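/- Fix an integer l > 5. Let F_n denote the set of simple graphs with vertex set {1,…,n} that are C_{2l}-free, and let G_n ⊆ F_n be the set of those graphs G whose vertex set can be partitioned into l-1 sets X_1,…,X_{l-2}, T such that each X_j is a clique of G and the complement of the induced subgraph G[T] is a disjoint union of stars and triangles. Then |G_n|/|F_n| tends to 1 as n tends to infinity. -/

import Mathlib

open SimpleGraph Filter

/-- `G` contains no induced copy of `H`. -/
def IndFree {W V : Type*} (H : SimpleGraph W) (G : SimpleGraph V) : Prop :=
  ¬ Nonempty (H ↪g G)

/-- `H` is a star: some center vertex is adjacent to all other vertices, and there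
are no further edges.  One- and two-vertex stars are allowed. -/
def IsStarGraph {V : Type*} (H : SimpleGraph V) : Prop :=
  ∃ c : V, ∀ a b : V, H.Adj a b ↔ a ≠ b ∧ (a = c ∨ b = c)

/-- `H` is a triangle `K₃`. -/
def IsTriangleGraph {V : Type*} (H : SimpleGraph V) : Prop :=
  Nonempty (H ≃g (⊤ : SimpleGraph (Fin 3)))

/-- Every connected component of `H` is a star or a triangle. -/
def StarsAndTriangles {V : Type*} (H : SimpleGraph V) : Prop :=
  ∀ c : H.ConnectedComponent,
    IsStarGraph (H.induce c.supp) ∨ IsTriangleGraph (H.induce c.supp)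

namespace CF

def okc (g : Fin 3) (a b : Bool) : Bool :=
  match g with
  | 0 => !a || b
  | 1 => a || !b
  | 2 => true

def cnt6 (g01 g02 g03 g12 g13 g23 : Fin 3) : ℕ :=
  ∑ f : Bool × Bool × Bool × Bool, 
    (if okc g01 f.1 f.2.1 && okc g02 f.1 f.2.2.1 && okc g03 f.1 f.2.2.2 && okc g12 f.2.1 f.2.2.1 &&
      okc g13 f.2.1 f.2.2.2 && okc g23 f.2.2.1 f.2.2.2 then 1 else 0)

def two (g : Fin 3) : ℕ := if g = 2 then 1 else 0

set_option maxRecDepth 100000 in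
lemma cnt6_le : ∀ g01 g02 g03 g12 g13 g23 : Fin 3, (cnt6 g01 g02 g03 g12 g13 g23) ^ 10 ≤ 
    2 ^ (24 + 3 * (two g01 + two g02 + two g03 + two g12 + two g13 + two g23)) := by
  decide +kernel

noncomputable section
open scoped Classical
open Finset (range mem_coe mem_univ mem_filter add_sum_erase univ sum_le_card_nsmul
  ne_of_mem_erase card_sigma card_nsmul_le_sum sum_le_sum card_powerset card_univ mem_powerset
  coe_filter card_product mem_insert mem_image mem_product prod_nonneg prod_ite prod_const
  sum_const card_le_card prod_mul_distrib card_compl card_filter sum_congr sum_add_distrib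
  card_pos mem_of_mem_erase card_biUnion_le_card_mul card_erase_of_mem mem_erase mem_of_mem_filter
  mem_biUnion card_insert_le card_image_le mem_compl mem_singleton mul_sum mem_union card_union_le
  sum_comm card_le_univ univ_inter filter_subset prod_ite_mem card_biUnion_le mem_inter prod_congr
  inter_subset_right mem_union_left mem_union_right)
open Real (rpow_natCast rpow_le_rpow_of_exponent_le rpow_add rpow_sub logb rpow_mul rpow_neg log
  log_pow log_mul)
open Function (Injective update update_of_ne update_self invFun)
open Set (mem_ofPred_eq toFinite ncard_le_ncard ncard_univ ncard_coe_finset)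
variable {n r : ℕ}

/-- Adjacency of positions in a cycle of length `L`. -/
def cyc (L p q : ℕ) : Prop :=
  p + 1 = q ∨ q + 1 = p ∨ (p = 0 ∧ q + 1 = L) ∨ (q = 0 ∧ p + 1 = L)

/-- `H` contains an induced complement of the cycle of length `2r+2`. -/
def HasC (r : ℕ) {V : Type*} (H : SimpleGraph V) : Prop :=
  ∃ φ : ℕ → V, ∀ p q, p < 2 * r + 2 → q < 2 * r + 2 → p ≠ q →
    φ p ≠ φ q ∧ (H.Adj (φ p) (φ q) ↔ ¬ cyc (2 * r + 2) p q)

/-- No path on four vertices inside `S`. -/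
def NoP4 {V : Type*} (H : SimpleGraph V) (S : V → Prop) : Prop :=
  ∀ a b d e, S a → S b → S d → S e → a ≠ d → a ≠ e → b ≠ e →
    H.Adj a b → H.Adj b d → H.Adj d e → False

def Tmpl (r : ℕ) {V : Type*} (H : SimpleGraph V) : Prop :=
  ∃ c : V → Fin r, ∃ i0, (∀ x y, c x = c y → c x ≠ i0 → ¬ H.Adj x y) ∧
    NoP4 H (fun x => c x = i0)

def FF (r n : ℕ) : Set (SimpleGraph (Fin n)) := {H | ¬ HasC r H}
def TT (r n : ℕ) : Set (SimpleGraph (Fin n)) := {H | Tmpl r H}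
def fN (r n : ℕ) : ℕ := (FF r n).ncard
def TN (r n : ℕ) : ℕ := (TT r n).ncard
def badN (r n : ℕ) : ℕ := (FF r n \ TT r n).ncard

lemma cyc_comm {L p q : ℕ} : cyc L p q ↔ cyc L q p := by
  unfold cyc; omega

lemma hasC_iff (r : ℕ) {V : Type*} (G : SimpleGraph V) :
    HasC r Gᶜ ↔ ¬ IndFree (cycleGraph (2 * (r + 1))) G := by
  unfold IndFree
  rw [not_not]
  have key : ∀ p q : Fin (2 * (r+1)), (cycleGraph (2 * (r+1))).Adj p q ↔
      cyc (2 * r + 2) p q ∧ p ≠ q := by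
    intro p q
    have h2 : 2 * (r + 1) = 2 * r + 2 := by ring
    rw [cycleGraph_adj']
    have hp := p.2
    have hq := q.2
    unfold cyc
    rw [Fin.val_sub, Fin.val_sub]
    have e : p ≠ q ↔ (p : ℕ) ≠ q := by
      rw [ne_eq, Fin.ext_iff]
    rw [e]
    have h1 : (2 * (r + 1) - (q:ℕ) + p) % (2 * (r+1)) = 1 ↔ ((q:ℕ) + 1 = p ∨ (p = (0:ℕ) ∧ (q:ℕ) + 1 = 2 * r + 2 )) := by
      rcases lt_or_ge (2 * (r + 1) - (q:ℕ) + p) (2 * (r+1)) with h | h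
      · rw [Nat.mod_eq_of_lt h]; omega
      · rw [Nat.mod_eq_sub_mod h, Nat.mod_eq_of_lt (by omega)]; omega
    have h3 : (2 * (r + 1) - (p:ℕ) + q) % (2 * (r+1)) = 1 ↔ ((p:ℕ) + 1 = q ∨ (q = (0:ℕ) ∧ (p:ℕ) + 1 = 2 * r + 2 )) := by
      rcases lt_or_ge (2 * (r + 1) - (p:ℕ) + q) (2 * (r+1)) with h | h
      · rw [Nat.mod_eq_of_lt h]; omega
      · rw [Nat.mod_eq_sub_mod h, Nat.mod_eq_of_lt (by omega)]; omega
    rw [h1, h3]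
    omega
  constructor
  · rintro ⟨φ, hφ⟩
    refine ⟨⟨⟨fun p => φ p, ?_⟩, ?_⟩⟩
    · intro p q hpq
      by_contra hne
      exact (hφ p q (by omega) (by omega) (by rwa [ne_eq, ← Fin.ext_iff])).1 hpq
    · intro p q
      by_cases hne : p = q
      · subst hne; simp
      · have := hφ p q (by omega) (by omega) (by rwa [ne_eq, ← Fin.ext_iff])
        rw [key]
        simp only [compl_adj] at this
        change G.Adj (φ p) (φ q) ↔ _
        by_cases h1 : G.Adj (φ p) (φ q) <;> by_cases h2 : cyc (2 * r + 2) p q <;>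
          simp_all
  · rintro ⟨e⟩
    refine ⟨fun p => e (Fin.ofNat (2 * (r+1)) p), ?_⟩
    intro p q hp hq hpq
    have hv : ∀ p, p < 2 * r + 2 → ((Fin.ofNat (2 * (r+1)) p : Fin (2 * (r+1))) : ℕ) = p := by
      intro p hp; simp only [Fin.ofNat]; exact Nat.mod_eq_of_lt (by omega)
    have hne : (Fin.ofNat (2 * (r+1)) p : Fin (2 * (r+1))) ≠ Fin.ofNat (2 * (r+1)) q := by
      rw [ne_eq, Fin.ext_iff, hv p hp, hv q hq]; exact hpq
    refine ⟨fun h => hne (e.injective h), ?_⟩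
    rw [compl_adj, e.map_adj_iff, key, hv p hp, hv q hq]
    have := e.injective.ne hne
    tauto

lemma tmpl_not_hasC (hr : 2 ≤ r) {V : Type*} {H : SimpleGraph V} (hT : Tmpl r H) :
    ¬ HasC r H := by
  rintro ⟨φ, hφ⟩
  obtain ⟨c, i0, hind, hno⟩ := hT
  set S := range (2 * r + 2) with hS
  have hcard : S.card = ∑ j : Fin r, (S.filter (fun p => c (φ p) = j)).card :=
    Finset.card_eq_sum_card_fiberwise (fun _ _ => mem_coe.2 (mem_univ _))
  have h2 : ∀ j, j ≠ i0 → (S.filter (fun p => c (φ p) = j)).card ≤ 2 := by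
    intro j hj
    by_contra hlt
    push Not at hlt
    obtain ⟨p, q, s, hp, hq, hs, hpq, hps, hqs⟩ := Finset.two_lt_card_iff.1 hlt
    simp only [hS, mem_filter, Finset.mem_range] at hp hq hs
    have e : ∀ p q, p < 2 * r + 2 → q < 2 * r + 2 → p ≠ q → c (φ p) = j → c (φ q) = j →
        cyc (2 * r + 2) p q := by
      intro p q hp hq hpq h1 h2
      by_contra hc
      exact hind _ _ (h1.trans h2.symm) (h1 ▸ hj) ((hφ p q hp hq hpq).2.2 hc)
    have e1 := e p q hp.1 hq.1 hpq hp.2 hq.2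
    have e2 := e p s hp.1 hs.1 hps hp.2 hs.2
    have e3 := e q s hq.1 hs.1 hqs hq.2 hs.2
    unfold cyc at e1 e2 e3
    omega
  have h4 : 4 ≤ (S.filter (fun p => c (φ p) = i0)).card := by
    rw [← add_sum_erase _ _ (mem_univ i0)] at hcard
    have : ∑ j ∈ univ.erase i0, (S.filter (fun p => c (φ p) = j)).card ≤ (r - 1) * 2 := by
      refine (sum_le_card_nsmul _ _ 2 ?_).trans ?_
      · intro j hj; exact h2 j (ne_of_mem_erase hj)
      · simp
    have hcs : S.card = 2 * r + 2 := by rw [hS, Finset.card_range]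
    omega
  obtain ⟨A, hA, hA4⟩ := Finset.exists_subset_card_eq h4
  obtain ⟨p1, p2, p3, p4, m1, m2, m3, m4, l1, l2, l3⟩ : ∃ p1 p2 p3 p4, p1 ∈ A ∧ p2 ∈ A ∧ p3 ∈ A ∧
      p4 ∈ A ∧ p1 < p2 ∧ p2 < p3 ∧ p3 < p4 :=
    ⟨_, _, _, _, A.orderEmbOfFin_mem hA4 0, A.orderEmbOfFin_mem hA4 1, A.orderEmbOfFin_mem hA4 2,
      A.orderEmbOfFin_mem hA4 3, (A.orderEmbOfFin hA4).strictMono (by decide),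
      (A.orderEmbOfFin hA4).strictMono (by decide), (A.orderEmbOfFin hA4).strictMono (by decide)⟩
  have hm : ∀ p ∈ A, p < 2 * r + 2 ∧ c (φ p) = i0 := by
    intro p hp
    simpa [hS] using hA hp
  obtain ⟨b1, c1⟩ := hm _ m1
  obtain ⟨b2, c2⟩ := hm _ m2
  obtain ⟨b3, c3⟩ := hm _ m3
  obtain ⟨b4, c4⟩ := hm _ m4
  have adj : ∀ p q, p < 2 * r + 2 → q < 2 * r + 2 → p ≠ q → ¬ cyc (2 * r + 2) p q →
      H.Adj (φ p) (φ q) := fun p q hp hq hpq hc => (hφ p q hp hq hpq).2.2 hc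
  have a13 := adj p1 p3 b1 b3 (by omega) (by unfold cyc; omega)
  have a24 := adj p2 p4 b2 b4 (by omega) (by unfold cyc; omega)
  have ne : ∀ p q, p < 2 * r + 2 → q < 2 * r + 2 → p ≠ q → φ p ≠ φ q :=
    fun p q hp hq hpq => (hφ p q hp hq hpq).1
  have n12 := ne p1 p2 b1 b2 (by omega)
  have n14 := ne p1 p4 b1 b4 (by omega)
  have n32 := ne p3 p2 b3 b2 (by omega)
  have n34 := ne p3 p4 b3 b4 (by omega)
  have hcase : ¬ cyc (2 * r + 2) p1 p2 ∨ ¬ cyc (2 * r + 2) p1 p4 ∨ ¬ cyc (2 * r + 2) p3 p2 ∨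
      ¬ cyc (2 * r + 2) p3 p4 := by
    unfold cyc; omega
  rcases hcase with h | h | h | h
  · exact hno _ _ _ _ c3 c1 c2 c4 n32 n34 n14 a13.symm (adj _ _ b1 b2 (by omega) h) a24
  · exact hno _ _ _ _ c3 c1 c4 c2 n34 n32 n12 a13.symm (adj _ _ b1 b4 (by omega) h) a24.symm
  · exact hno _ _ _ _ c1 c3 c2 c4 n12 n14 n34 a13 (adj _ _ b3 b2 (by omega) h) a24
  · exact hno _ _ _ _ c1 c3 c4 c2 n14 n12 n32 a13 (adj _ _ b3 b4 (by omega) h) a24.symm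

lemma reach_closed {V : Type*} {H : SimpleGraph V} {P : V → Prop}
    (h : ∀ x y, P x → H.Adj x y → P y) {v w : V} (hv : P v) (hw : H.Reachable v w) : P w := by
  obtain ⟨p⟩ := hw
  induction p with
  | nil => exact hv
  | cons hadj p ih => exact ih (h _ _ hv hadj)

lemma starsAndTriangles_of_noP4 {V : Type*} {H : SimpleGraph V} (h : NoP4 H (fun _ => True)) :
    StarsAndTriangles H := by
  intro C
  obtain ⟨v0, hv0⟩ := C.exists_rep
  have hreach : ∀ x ∈ C.supp, ∀ y ∈ C.supp, H.Reachable x y := by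
    intro x hx y hy
    exact ConnectedComponent.exact (hx.trans hy.symm)
  have hmem : ∀ x ∈ C.supp, ∀ y, H.Adj x y → y ∈ C.supp := by
    intro x hx y hxy
    have : H.connectedComponentMk y = H.connectedComponentMk x :=
      ConnectedComponent.sound hxy.symm.reachable
    exact this.trans hx
  by_cases htri : ∃ a b d, a ∈ C.supp ∧ H.Adj a b ∧ H.Adj b d ∧ H.Adj a d
  · right
    obtain ⟨a, b, d, ha, hab, hbd, had⟩ := htri
    have hb := hmem a ha b hab
    have hd := hmem a ha d had
    have hall : ∀ x ∈ C.supp, x = a ∨ x = b ∨ x = d := by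
      intro x hx
      refine reach_closed (P := fun x => x = a ∨ x = b ∨ x = d) ?_ (Or.inl rfl) (hreach a ha x hx)
      intro x y hx hxy
      by_contra hne
      push Not at hne
      obtain ⟨n1, n2, n3⟩ := hne
      rcases hx with rfl | rfl | rfl
      · exact h y x b d trivial trivial trivial trivial n2 n3 had.ne hxy.symm hab hbd
      · exact h y x d a trivial trivial trivial trivial n3 n1 hab.ne' hxy.symm hbd had.symm
      · exact h y x a b trivial trivial trivial trivial n1 n2 hbd.ne' hxy.symm had.symm hab
    let e : C.supp ≃ Fin 3 :=
      { toFun := fun x => if x.1 = a then 0 else if x.1 = b then 1 else 2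
        invFun := ![⟨a, ha⟩, ⟨b, hb⟩, ⟨d, hd⟩]
        left_inv := by
          rintro ⟨x, hx⟩
          rcases hall x hx with rfl | rfl | rfl
          · simp
          · simp [hab.ne']
          · simp [had.ne', hbd.ne']
        right_inv := by
          intro i
          fin_cases i
          · simp
          · simp [hab.ne']
          · simp [had.ne', hbd.ne'] }
    refine ⟨⟨e, ?_⟩⟩
    rintro ⟨x, hx⟩ ⟨y, hy⟩
    simp only [top_adj, ne_eq, EmbeddingLike.apply_eq_iff_eq, Subtype.mk.injEq, induce_adj]
    constructor
    · intro hne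
      rcases hall x hx with rfl | rfl | rfl <;> rcases hall y hy with rfl | rfl | rfl <;>
        first | exact absurd rfl hne | assumption | (apply SimpleGraph.Adj.symm; assumption)
    · intro hadj; exact hadj.ne
  · left
    have hc : ∃ v ∈ C.supp, (∃ x y, x ≠ y ∧ H.Adj v x ∧ H.Adj v y) ∨
        ∀ u ∈ C.supp, ¬ ∃ x y, x ≠ y ∧ H.Adj u x ∧ H.Adj u y := by
      by_cases hh : ∃ v ∈ C.supp, ∃ x y, x ≠ y ∧ H.Adj v x ∧ H.Adj v y
      · obtain ⟨v, hv, h'⟩ := hh; exact ⟨v, hv, Or.inl h'⟩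
      · push Not at hh
        refine ⟨v0, hv0, Or.inr ?_⟩
        rintro u hu ⟨x, y, h1, h2, h3⟩
        exact hh u hu x y h1 h2 h3
    obtain ⟨v, hv, hv2⟩ := hc
    have hcl : ∀ x z, H.Adj v x → H.Adj x z → z = v := by
      intro x z hvx hxz
      by_contra hzv
      rcases hv2 with ⟨s, t, hst, hs, ht⟩ | hno
      · obtain ⟨y, hy, hyx⟩ : ∃ y, H.Adj v y ∧ y ≠ x := by
          by_cases hsx : s = x
          · exact ⟨t, ht, fun h => hst (hsx.trans h.symm)⟩
          · exact ⟨s, hs, hsx⟩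
        by_cases hzy : z = y
        · subst hzy
          exact htri ⟨v, x, z, hv, hvx, hxz, hy⟩
        · exact h z x v y trivial trivial trivial trivial hzv hzy hyx.symm hxz.symm hvx.symm hy
      · exact hno x (hmem v hv x hvx) ⟨z, v, hzv, hxz, hvx.symm⟩
    have hall : ∀ x ∈ C.supp, x = v ∨ H.Adj v x := by
      intro x hx
      refine reach_closed (P := fun x => x = v ∨ H.Adj v x) ?_ (Or.inl rfl) (hreach v hv x hx)
      rintro x y (rfl | hx) hxy
      · exact Or.inr hxy
      · exact Or.inl (hcl x y hx hxy)
    refine ⟨⟨v, hv⟩, ?_⟩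
    rintro ⟨x, hx⟩ ⟨y, hy⟩
    simp only [induce_adj, ne_eq, Subtype.mk.injEq]
    constructor
    · intro hadj
      refine ⟨hadj.ne, ?_⟩
      rcases hall x hx with rfl | hx'
      · exact Or.inl rfl
      · exact Or.inr (hcl x y hx' hadj)
    · rintro ⟨hne, rfl | rfl⟩
      · rcases hall y hy with rfl | h'
        · exact absurd rfl hne
        · exact h'
      · rcases hall x hx with rfl | h'
        · exact absurd rfl hne
        · exact h'.symm

lemma tmpl_to_statement {m : ℕ} {G : SimpleGraph (Fin n)} (h : Tmpl (m + 1) Gᶜ) :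
    ∃ f : Fin n → Option (Fin m), (∀ i : Fin m, G.IsClique {v | f v = some i}) ∧
      StarsAndTriangles (G.induce {v | f v = none})ᶜ := by
  obtain ⟨c, i0, hind, hno⟩ := h
  have hnone : ∀ j, finSuccEquiv' i0 j = none ↔ j = i0 := by
    intro j
    rw [← finSuccEquiv'_at i0, EmbeddingLike.apply_eq_iff_eq]
  refine ⟨fun v => finSuccEquiv' i0 (c v), ?_, ?_⟩
  · intro i x hx y hy hxy
    simp only [mem_ofPred_eq] at hx hy
    by_contra hadj
    refine hind x y ((finSuccEquiv' i0).injective (hx.trans hy.symm)) ?_ ?_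
    · intro hc; rw [(hnone _).2 hc] at hx; simp at hx
    · rw [compl_adj]; exact ⟨hxy, hadj⟩
  · apply starsAndTriangles_of_noP4
    rintro ⟨a, ha⟩ ⟨b, hb⟩ ⟨d, hd⟩ ⟨e, he⟩ - - - - n1 n2 n3 h1 h2 h3
    simp only [mem_ofPred_eq, hnone] at ha hb hd he
    simp only [compl_adj, induce_adj, ne_eq, Subtype.mk.injEq] at h1 h2 h3 n1 n2 n3
    exact hno a b d e ha hb hd he n1 n2 n3 (by rw [compl_adj]; exact h1)
      (by rw [compl_adj]; exact h2) (by rw [compl_adj]; exact h3)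

lemma reduction {m : ℕ}
    (h : Tendsto (fun n => (badN (m + 1) n : ℝ) / fN (m + 1) n) atTop (nhds 0)) (hm : 3 < m) :
    Tendsto
      (fun n : ℕ =>
        (({G : SimpleGraph (Fin n) |
              IndFree (cycleGraph (2 * (m + 2))) G ∧
              ∃ f : Fin n → Option (Fin m),
                (∀ i : Fin m, G.IsClique {v | f v = some i}) ∧
                StarsAndTriangles (G.induce {v | f v = none})ᶜ}.ncard : ℝ) /
          ({G : SimpleGraph (Fin n) | IndFree (cycleGraph (2 * (m + 2))) G}.ncard : ℝ)))
      atTop (nhds 1) := by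
  have hcompl : ∀ n, Injective (fun G : SimpleGraph (Fin n) => Gᶜ) :=
    fun n => compl_injective
  have hfr : ∀ n, ∀ G : SimpleGraph (Fin n), IndFree (cycleGraph (2 * (m + 2))) G ↔ ¬ HasC (m + 1) Gᶜ := by
    intro n G
    rw [hasC_iff, not_not]
  have hF : ∀ n, ({G : SimpleGraph (Fin n) | IndFree (cycleGraph (2 * (m + 2))) G}).ncard = fN (m + 1) n := by
    intro n
    rw [fN, ← Set.ncard_image_of_injective _ (hcompl n)]
    congr 1
    ext G
    simp only [Set.mem_image, mem_ofPred_eq, hfr, FF]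
    constructor
    · rintro ⟨G', h1, rfl⟩; exact h1
    · intro h1; exact ⟨Gᶜ, by rwa [compl_compl], compl_compl _⟩
  have hpos : ∀ n, 0 < fN (m + 1) n := by
    intro n
    rw [fN, Set.ncard_pos (toFinite _)]
    refine ⟨⊥, ?_⟩
    rintro ⟨φ, hφ⟩
    have := (hφ 0 2 (by omega) (by omega) (by omega)).2.2 (by unfold cyc; omega)
    simp at this
  simp only [hF]
  have hlow : ∀ n, (1 : ℝ) - (badN (m + 1) n : ℝ) / fN (m + 1) n ≤
      (({G : SimpleGraph (Fin n) |
              IndFree (cycleGraph (2 * (m + 2))) G ∧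
              ∃ f : Fin n → Option (Fin m),
                (∀ i : Fin m, G.IsClique {v | f v = some i}) ∧
                StarsAndTriangles (G.induce {v | f v = none})ᶜ}.ncard : ℝ) / fN (m + 1) n) := by
    intro n
    have hp : (0 : ℝ) < fN (m + 1) n := by exact_mod_cast hpos n
    rw [sub_le_iff_le_add, ← add_div, one_le_div hp, ← hF n]
    set S := {G : SimpleGraph (Fin n) |
              IndFree (cycleGraph (2 * (m + 2))) G ∧
              ∃ f : Fin n → Option (Fin m),
                (∀ i : Fin m, G.IsClique {v | f v = some i}) ∧
                StarsAndTriangles (G.induce {v | f v = none})ᶜ} with hS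
    have hsub : {G : SimpleGraph (Fin n) | IndFree (cycleGraph (2 * (m + 2))) G} ⊆
        S ∪ (fun G : SimpleGraph (Fin n) => Gᶜ) ⁻¹' (FF (m + 1) n \ TT (m + 1) n) := by
      intro G hG
      by_cases hT : Tmpl (m + 1) Gᶜ
      · exact Or.inl ⟨hG, tmpl_to_statement hT⟩
      · exact Or.inr ⟨(hfr n G).1 hG, hT⟩
    have h1 := ncard_le_ncard hsub (toFinite _)
    have h2 := h1.trans (Set.ncard_union_le _ _)
    have h3 : ((fun G : SimpleGraph (Fin n) => Gᶜ) ⁻¹' (FF (m + 1) n \ TT (m + 1) n)).ncard ≤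
        badN (m + 1) n := by
      rw [badN, ← Set.ncard_image_of_injective _ (hcompl n)]
      exact ncard_le_ncard (Set.image_preimage_subset _ _) (toFinite _)
    exact_mod_cast h2.trans (Nat.add_le_add_left h3 _)
  have hup : ∀ n, (({G : SimpleGraph (Fin n) |
              IndFree (cycleGraph (2 * (m + 2))) G ∧
              ∃ f : Fin n → Option (Fin m),
                (∀ i : Fin m, G.IsClique {v | f v = some i}) ∧
                StarsAndTriangles (G.induce {v | f v = none})ᶜ}.ncard : ℝ) / fN (m + 1) n) ≤ 1 := by
    intro n
    have hp : (0 : ℝ) < fN (m + 1) n := by exact_mod_cast hpos n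
    rw [div_le_one hp, ← hF n]
    refine Nat.cast_le.2 (ncard_le_ncard ?_ (toFinite _))
    intro G hG
    exact hG.1
  have ht : Tendsto (fun n => (1 : ℝ) - (badN (m + 1) n : ℝ) / fN (m + 1) n) atTop (nhds 1) := by
    have := h.const_sub (1 : ℝ)
    simpa using this
  exact tendsto_of_tendsto_of_tendsto_of_le_of_le ht tendsto_const_nhds hlow hup

/-! ### Small families -/

abbrev Fam := ∀ n : ℕ, Set (SimpleGraph (Fin n))

def Small (r : ℕ) (A : Fam) : Prop :=
  ∃ δ : ℕ → ℝ, Tendsto δ atTop (nhds 0) ∧ ∀ᶠ n in atTop, ∀ C : ℝ, 1 ≤ C →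
    (∀ m < n, (fN r m : ℝ) ≤ C * TN r m) → ((A n).ncard : ℝ) ≤ δ n * C * TN r n

lemma Small.mono {A B : Fam} (hB : Small r B) (h : ∀ᶠ n in atTop, A n ⊆ B n) :
    Small r A := by
  obtain ⟨δ, hδ, hb⟩ := hB
  refine ⟨δ, hδ, ?_⟩
  filter_upwards [hb, h] with n hn hs C hC hf
  exact le_trans (by exact_mod_cast ncard_le_ncard hs (toFinite _)) (hn C hC hf)

lemma Small.union {A B : Fam} (hA : Small r A) (hB : Small r B) :
    Small r (fun n => A n ∪ B n) := by
  obtain ⟨δ, hδ, ha⟩ := hA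
  obtain ⟨δ', hδ', hb⟩ := hB
  refine ⟨fun n => δ n + δ' n, by simpa using hδ.add hδ', ?_⟩
  filter_upwards [ha, hb] with n h1 h2 C hC hf
  have h3 := h1 C hC hf
  have h4 := h2 C hC hf
  have h5 : ((A n ∪ B n).ncard : ℝ) ≤ (A n).ncard + (B n).ncard := by
    exact_mod_cast Set.ncard_union_le _ _
  linarith

lemma TN_le_fN (hr : 2 ≤ r) (n : ℕ) : TN r n ≤ fN r n :=
  ncard_le_ncard (fun _ hH => tmpl_not_hasC hr hH) (toFinite _)

lemma TN_pos (hr : 2 ≤ r) (n : ℕ) : 0 < TN r n := by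
  rw [TN, Set.ncard_pos (toFinite _)]
  refine ⟨⊥, fun _ => ⟨0, by omega⟩, ⟨0, by omega⟩, ?_, ?_⟩
  · intro x y _ _ h; simp at h
  · intro a b d e _ _ _ _ _ _ _ h; simp at h

lemma small_main (hr : 2 ≤ r) (h : Small r (fun n => FF r n \ TT r n)) :
    Tendsto (fun n => (badN r n : ℝ) / fN r n) atTop (nhds 0) := by
  obtain ⟨δ, hδ, hb⟩ := h
  have hδ2 : ∀ᶠ n in atTop, δ n ≤ 1 / 2 := (hδ.eventually (gt_mem_nhds (by norm_num : (0:ℝ) < 1/2))).mono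
    fun n hn => le_of_lt hn
  obtain ⟨n0, hn0⟩ := eventually_atTop.1 (hb.and hδ2)
  set C : ℝ := 2 + ∑ m ∈ range n0, (fN r m : ℝ) with hC
  have hC2 : 2 ≤ C := by
    have : 0 ≤ ∑ m ∈ range n0, (fN r m : ℝ) := Finset.sum_nonneg fun _ _ => Nat.cast_nonneg _
    linarith
  have hTpos : ∀ n, (1 : ℝ) ≤ TN r n := fun n => by exact_mod_cast TN_pos hr n
  have hfn : ∀ n, (fN r n : ℝ) ≤ TN r n + badN r n := by
    intro n
    have : FF r n ⊆ TT r n ∪ (FF r n \ TT r n) := by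
      intro H hH; by_cases hT : H ∈ TT r n
      · exact Or.inl hT
      · exact Or.inr ⟨hH, hT⟩
    exact_mod_cast (ncard_le_ncard this (toFinite _)).trans (Set.ncard_union_le _ _)
  have hall : ∀ n, (fN r n : ℝ) ≤ C * TN r n := by
    intro n
    induction n using Nat.strong_induction_on with
    | _ n ih =>
      rcases lt_or_ge n n0 with hlt | hge
      · have h1 : (fN r n : ℝ) ≤ C := by
          have := Finset.single_le_sum (f := fun m => (fN r m : ℝ)) (fun _ _ => Nat.cast_nonneg _)
            (Finset.mem_range.2 hlt)
          linarith
        nlinarith [hTpos n]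
      · obtain ⟨h1, h2⟩ := hn0 n hge
        have h3 : (badN r n : ℝ) ≤ δ n * C * TN r n := h1 C (by linarith) ih
        have h4 : δ n * C * TN r n ≤ 1/2 * C * TN r n := by
          gcongr
        have := hfn n
        nlinarith [hTpos n]
  have hup : ∀ᶠ n in atTop, (badN r n : ℝ) / fN r n ≤ |δ n| * C := by
    filter_upwards [eventually_ge_atTop n0] with n hn
    have hT : (TN r n : ℝ) ≤ fN r n := by exact_mod_cast TN_le_fN hr n
    have hfp : (0 : ℝ) < fN r n := by linarith [hTpos n]
    rw [div_le_iff₀ hfp]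
    have h3 : (badN r n : ℝ) ≤ δ n * C * TN r n := (hn0 n hn).1 C (by linarith) fun m _ => hall m
    have h4 : δ n * C * TN r n ≤ |δ n| * C * TN r n := by
      gcongr; exact le_abs_self _
    have h5 : |δ n| * C * TN r n ≤ |δ n| * C * fN r n := by gcongr
    linarith
  have ht : Tendsto (fun n => |δ n| * C) atTop (nhds 0) := by
    have := (hδ.abs).mul_const C
    simpa using this
  exact squeeze_zero' (Eventually.of_forall fun n => by positivity) hup ht

/-! ### One-vertex extensions and the lower bound -/

/-- add a new last vertex with neighbourhood `S`. -/
def ext1 (H : SimpleGraph (Fin n)) (S : Finset (Fin n)) : SimpleGraph (Fin (n + 1)) :=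
  SimpleGraph.fromRel (fun x y =>
    (∃ a b : Fin n, x = a.castSucc ∧ y = b.castSucc ∧ H.Adj a b) ∨
    (∃ a : Fin n, x = Fin.last n ∧ y = a.castSucc ∧ a ∈ S))

lemma ext1_cast (H : SimpleGraph (Fin n)) (S : Finset (Fin n)) (a b : Fin n) :
    (ext1 H S).Adj a.castSucc b.castSucc ↔ H.Adj a b := by
  simp only [ext1, fromRel_adj]
  constructor
  · rintro ⟨hne, (⟨a', b', h1, h2, h3⟩ | ⟨a', h1, h2, h3⟩) | (⟨a', b', h1, h2, h3⟩ | ⟨a', h1, h2, h3⟩)⟩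
    · rw [Fin.castSucc_inj.1 h1, Fin.castSucc_inj.1 h2]; exact h3
    · exact absurd h1 (Fin.castSucc_lt_last a).ne
    · rw [Fin.castSucc_inj.1 h1, Fin.castSucc_inj.1 h2]; exact h3.symm
    · exact absurd h1 (Fin.castSucc_lt_last b).ne
  · intro h
    exact ⟨fun e => h.ne (Fin.castSucc_inj.1 e), Or.inl (Or.inl ⟨a, b, rfl, rfl, h⟩)⟩

lemma ext1_last (H : SimpleGraph (Fin n)) (S : Finset (Fin n)) (b : Fin n) :
    (ext1 H S).Adj (Fin.last n) b.castSucc ↔ b ∈ S := by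
  simp only [ext1, fromRel_adj]
  constructor
  · rintro ⟨hne, (⟨a', b', h1, h2, h3⟩ | ⟨a', h1, h2, h3⟩) | (⟨a', b', h1, h2, h3⟩ | ⟨a', h1, h2, h3⟩)⟩
    · exact absurd h1.symm (Fin.castSucc_lt_last a').ne
    · rw [Fin.castSucc_inj.1 h2]; exact h3
    · exact absurd h2.symm (Fin.castSucc_lt_last b').ne
    · exact absurd h1 (Fin.castSucc_lt_last b).ne
  · intro h
    exact ⟨(Fin.castSucc_lt_last b).ne', Or.inl (Or.inr ⟨b, trivial, rfl, h⟩)⟩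

lemma ext1_inj {H H' : SimpleGraph (Fin n)} {S S' : Finset (Fin n)}
    (h : ext1 H S = ext1 H' S') : H = H' ∧ S = S' := by
  constructor
  · ext a b; rw [← ext1_cast H S, h, ext1_cast]
  · ext b; rw [← ext1_last H S, h, ext1_last]

lemma ext_count {A : Set (SimpleGraph (Fin n))} {B : Set (SimpleGraph (Fin (n + 1)))}
    (N : ℕ) (h : ∀ H ∈ A, ∃ 𝒮 : Finset (Finset (Fin n)), N ≤ 𝒮.card ∧ ∀ S ∈ 𝒮, ext1 H S ∈ B) :
    A.ncard * N ≤ B.ncard := by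
  choose! 𝒮 h1 h2 using h
  set A' := (toFinite A).toFinset with hA'
  have hmem : ∀ H, H ∈ A' ↔ H ∈ A := by simp [hA']
  have hc : A.ncard * N ≤ (A'.sigma 𝒮).card := by
    rw [card_sigma, Set.ncard_eq_toFinset_card A (toFinite A), ← smul_eq_mul]
    exact card_nsmul_le_sum _ _ _ fun H hH => h1 H ((hmem H).1 hH)
  refine hc.trans ?_
  rw [Set.ncard_eq_toFinset_card B (toFinite B)]
  refine Finset.card_le_card_of_injOn (fun p => ext1 p.1 p.2) ?_ ?_
  · rintro ⟨H, S⟩ hp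
    rw [mem_coe, Finset.mem_sigma] at hp
    simpa using h2 H ((hmem H).1 hp.1) S hp.2
  · rintro ⟨H, S⟩ - ⟨H', S'⟩ - he
    obtain ⟨rfl, rfl⟩ := ext1_inj he
    rfl

lemma exists_small_part (hr : 0 < r) (c : Fin n → Fin r) :
    ∃ j, (univ.filter (fun x => c x = j)).card ≤ n / r := by
  by_contra hcon
  push Not at hcon
  have hcard : (univ : Finset (Fin n)).card =
      ∑ j : Fin r, (univ.filter (fun x => c x = j)).card :=
    Finset.card_eq_sum_card_fiberwise (fun _ _ => mem_coe.2 (mem_univ _))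
  have h2 : ∑ j : Fin r, (n / r + 1) ≤ ∑ j : Fin r, (univ.filter (fun x => c x = j)).card :=
    sum_le_sum fun j _ => hcon j
  rw [← hcard] at h2
  simp at h2
  have := Nat.lt_mul_div_succ n hr
  omega

lemma TN_succ (hr : 2 ≤ r) (n : ℕ) : TN r n * 2 ^ (n - n / r) ≤ TN r (n + 1) := by
  refine ext_count _ ?_
  rintro H ⟨c, i0, hind, hno⟩
  obtain ⟨j, hj⟩ := exists_small_part (by omega) c
  refine ⟨(univ.filter (fun x => c x ≠ j)).powerset, ?_, ?_⟩
  · rw [card_powerset]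
    refine Nat.pow_le_pow_right (by norm_num) ?_
    have := Finset.card_filter_add_card_filter_not (s := (univ : Finset (Fin n))) (fun x => c x = j)
    simp only [card_univ, Fintype.card_fin] at this
    simp only [ne_eq]
    omega
  · intro S hS
    have hS' : ∀ b ∈ S, c b ≠ j := by
      intro b hb
      have := mem_powerset.1 hS hb
      simpa using this
    have e1 : ∀ b : Fin n, Fin.snoc (α := fun _ => Fin r) c j b.castSucc = c b := fun b => by simp
    have e2 : Fin.snoc (α := fun _ => Fin r) c j (Fin.last n) = j := by simp
    have hl : ∀ x, Fin.snoc (α := fun _ => Fin r) c j x = j → ¬ (ext1 H S).Adj (Fin.last n) x := by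
      intro x
      refine Fin.lastCases ?_ (fun b => ?_) x
      · intro _ h; exact h.ne rfl
      · rw [e1, ext1_last]; intro h1 h2; exact hS' b h2 h1
    refine ⟨Fin.snoc (α := fun _ => Fin r) c j, i0, ?_, ?_⟩
    · intro x y
      refine Fin.lastCases ?_ (fun a => ?_) x
      · intro h _; rw [e2] at h; exact hl y h.symm
      · refine Fin.lastCases ?_ (fun b => ?_) y
        · intro h _ h'; rw [e2] at h; exact hl _ h h'.symm
        · rw [e1, e1, ext1_cast]; exact hind a b
    · have hcs : ∀ x y, Fin.snoc (α := fun _ => Fin r) c j x = i0 →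
          Fin.snoc (α := fun _ => Fin r) c j y = i0 → (ext1 H S).Adj x y →
          ∃ a b : Fin n, x = a.castSucc ∧ y = b.castSucc ∧ H.Adj a b := by
        intro x y
        refine Fin.lastCases ?_ (fun a => ?_) x
        · intro h1 h2 h3; rw [e2] at h1; exact absurd h3 (hl y (h2.trans h1.symm))
        · refine Fin.lastCases ?_ (fun b => ?_) y
          · intro h1 h2 h3; rw [e2] at h2; exact absurd h3.symm (hl _ (h1.trans h2.symm))
          · intro _ _ h3; exact ⟨a, b, rfl, rfl, (ext1_cast ..).1 h3⟩
      intro x y z w hx hy hz hw n1 n2 n3 a1 a2 a3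
      obtain ⟨x, y, rfl, rfl, b1⟩ := hcs _ _ hx hy a1
      obtain ⟨z, w, rfl, rfl, b3⟩ := hcs _ _ hz hw a3
      rw [ext1_cast] at a2
      rw [e1] at hx hy hz hw
      refine hno x y z w hx hy hz hw ?_ ?_ ?_ b1 a2 b3
      · exact fun h => n1 (by rw [h])
      · exact fun h => n2 (by rw [h])
      · exact fun h => n3 (by rw [h])

/-- the Turan coefficient -/
def al (r : ℕ) : ℝ := 1 - 1 / (r : ℝ)

lemma al_nonneg (hr : 2 ≤ r) : 0 ≤ al r := by
  unfold al
  have : (2:ℝ) ≤ r := by exact_mod_cast hr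
  have : 1 / (r:ℝ) ≤ 1 := by rw [div_le_one (by linarith)]; linarith
  linarith

lemma al_le (r : ℕ) : al r ≤ 1 := by
  unfold al
  have : 0 ≤ 1 / (r:ℝ) := by positivity
  linarith

lemma two_pow_al_le : (2:ℝ) ^ (al r * n) ≤ ((2 ^ (n - n / r) : ℕ) : ℝ) := by
  rw [Nat.cast_pow, Nat.cast_ofNat, ← rpow_natCast]
  refine rpow_le_rpow_of_exponent_le (by norm_num) ?_
  rw [Nat.cast_sub (Nat.div_le_self n r)]
  have : ((n / r : ℕ) : ℝ) ≤ n / r := Nat.cast_div_le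
  unfold al
  have e : (1 - 1 / (r:ℝ)) * n = n - n / r := by ring
  linarith

lemma TN_succ' (hr : 2 ≤ r) (n : ℕ) :
    (TN r n : ℝ) * 2 ^ (al r * n) ≤ TN r (n + 1) := by
  have h := TN_succ hr n
  have h1 : ((TN r n * 2 ^ (n - n / r) : ℕ) : ℝ) ≤ TN r (n + 1) := by exact_mod_cast h
  refine le_trans ?_ h1
  rw [Nat.cast_mul]
  gcongr
  exact two_pow_al_le

lemma TN_add (hr : 2 ≤ r) (m s : ℕ) :
    (TN r m : ℝ) * 2 ^ (s * al r * m) ≤ TN r (m + s) := by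
  induction s with
  | zero => simp
  | succ s ih =>
    refine le_trans ?_ (TN_succ' hr (m + s))
    have e : ((s + 1 : ℕ) : ℝ) * al r * m = s * al r * m + al r * m := by push_cast; ring
    rw [e, rpow_add (by norm_num), ← mul_assoc]
    have h2 : (2:ℝ) ^ (al r * m) ≤ 2 ^ (al r * ((m + s : ℕ) : ℝ)) := by
      refine rpow_le_rpow_of_exponent_le (by norm_num) ?_
      have := al_nonneg hr
      gcongr; simp
    gcongr

lemma small_of_removal (hr : 2 ≤ r) {A : Fam} (s : ℕ) (hs : 1 ≤ s) (Y : ℕ → ℝ)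
    (hY0 : ∀ n, 0 ≤ Y n)
    (hY : Tendsto (fun n : ℕ => Y n / 2 ^ (s * al r * n)) atTop (nhds 0))
    (h : ∀ᶠ n in atTop, ((A n).ncard : ℝ) ≤ Y n * fN r (n - s)) : Small r A := by
  refine ⟨fun n => Y n / 2 ^ (s * al r * n) * 2 ^ (s * al r * s), ?_, ?_⟩
  · simpa using hY.mul_const ((2:ℝ) ^ (s * al r * s))
  · filter_upwards [h, eventually_ge_atTop s] with n hn hns C hC hf
    have h1 := hf (n - s) (by omega)
    have h2 := TN_add hr (n - s) s
    rw [Nat.sub_add_cancel hns, Nat.cast_sub hns] at h2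
    have e : (s:ℝ) * al r * ((n:ℝ) - s) = s * al r * n - s * al r * s := by ring
    rw [e, rpow_sub (by norm_num)] at h2
    set p : ℝ := 2 ^ (s * al r * n)
    set q : ℝ := 2 ^ (s * al r * s)
    have hp : 0 < p := by positivity
    have hq : 0 < q := by positivity
    have h3 : (TN r (n - s) : ℝ) ≤ TN r n * (q / p) := by
      have : (TN r (n - s) : ℝ) = TN r (n - s) * (p / q) * (q / p) := by field_simp
      rw [this]; gcongr
    calc ((A n).ncard : ℝ) ≤ Y n * fN r (n - s) := hn
      _ ≤ Y n * (C * (TN r n * (q / p))) := by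
        have := hY0 n
        gcongr
        refine h1.trans ?_
        gcongr
      _ = Y n / p * q * C * TN r n := by ring

lemma small_of_direct {A : Fam} (δ : ℕ → ℝ) (hδ : Tendsto δ atTop (nhds 0))
    (h0 : ∀ n, 0 ≤ δ n)
    (h : ∀ᶠ n in atTop, ((A n).ncard : ℝ) ≤ δ n * TN r n) : Small r A := by
  refine ⟨δ, hδ, ?_⟩
  filter_upwards [h] with n hn C hC hf
  have := h0 n
  calc ((A n).ncard : ℝ) ≤ δ n * TN r n := hn
    _ = δ n * 1 * TN r n := by ring
    _ ≤ δ n * C * TN r n := by gcongr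

/-! ### Lower bound with stars -/

def UU (r K n : ℕ) : Set (SimpleGraph (Fin n)) :=
  {H | (∀ x y : Fin n, H.Adj x y → (x:ℕ) % r = y % r → (x:ℕ) % r = 0 ∧
      (((x:ℕ) < r * K ∧ r * K ≤ y) ∨ ((y:ℕ) < r * K ∧ r * K ≤ x))) ∧
    ∀ y x x' : Fin n, r * K ≤ y → (y:ℕ) % r = 0 → (x:ℕ) % r = 0 → (x':ℕ) % r = 0 →
      H.Adj y x → H.Adj y x' → x = x'}

lemma UU_sub (hr : 2 ≤ r) (K n : ℕ) : UU r K n ⊆ TT r n := by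
  rintro H ⟨h1, h2⟩
  refine ⟨fun x => ⟨(x:ℕ) % r, Nat.mod_lt _ (by omega)⟩, ⟨0, by omega⟩, ?_, ?_⟩
  · intro x y hxy h0 hadj
    simp only [Fin.mk.injEq, ne_eq] at hxy h0
    exact h0 (h1 x y hadj hxy).1
  · intro a b d e ha hb hd he n1 n2 n3 ab bd de
    simp only [Fin.mk.injEq] at ha hb hd he
    rcases (h1 b d bd (hb.trans hd.symm)).2 with ⟨_, h⟩ | ⟨_, h⟩
    · exact n3 (h2 d b e h hd hb he bd.symm de)
    · exact n1 (h2 b a d h hb ha hd ab.symm bd)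

lemma count_mod (hr : 2 ≤ r) (n : ℕ) :
    (univ.filter (fun x : Fin n => (x:ℕ) % r = n % r)).card ≤ n / r := by
  rw [← Finset.card_range (n / r)]
  have hdm := Nat.div_add_mod n r
  refine Finset.card_le_card_of_injOn (fun x => (x:ℕ) / r) ?_ ?_
  · intro x hx
    simp only [coe_filter, mem_univ, true_and, mem_ofPred_eq] at hx
    simp only [Finset.coe_range, Set.mem_Iio]
    have := Nat.div_add_mod (x:ℕ) r
    have hx2 := x.2
    by_contra hlt
    push Not at hlt
    have : r * (n / r) ≤ r * ((x:ℕ) / r) := Nat.mul_le_mul_left _ hlt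
    omega
  · intro x hx y hy hxy
    simp only [coe_filter, mem_univ, true_and, mem_ofPred_eq] at hx hy hxy
    have h1 := Nat.div_add_mod (x:ℕ) r
    have h2 := Nat.div_add_mod (y:ℕ) r
    rw [hxy] at h1
    apply Fin.ext
    omega

lemma UU_succ (hr : 2 ≤ r) (K n : ℕ) :
    (UU r K n).ncard * (2 ^ (n - n / r) * (if n % r = 0 ∧ r * K ≤ n then K else 1)) ≤
      (UU r K (n + 1)).ncard := by
  refine ext_count _ ?_
  rintro H ⟨h1, h2⟩
  set P := (univ.filter (fun x : Fin n => (x:ℕ) % r ≠ n % r)).powerset with hP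
  have hPc : 2 ^ (n - n / r) ≤ P.card := by
    rw [hP, card_powerset]
    refine Nat.pow_le_pow_right (by norm_num) ?_
    have := Finset.card_filter_add_card_filter_not (s := (univ : Finset (Fin n)))
      (fun x => (x:ℕ) % r = n % r)
    simp only [card_univ, Fintype.card_fin] at this
    have h3 := count_mod hr n
    simp only [ne_eq]
    omega
  -- general criterion for membership
  have crit : ∀ S : Finset (Fin n),
      (∀ x ∈ S, (x:ℕ) % r = n % r → n % r = 0 ∧ (x:ℕ) < r * K ∧ r * K ≤ n) →
      (∀ x ∈ S, ∀ x' ∈ S, n % r = 0 → r * K ≤ n → (x:ℕ) % r = 0 → (x':ℕ) % r = 0 → x = x') →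
      ext1 H S ∈ UU r K (n + 1) := by
    intro S hS1 hS2
    constructor
    · intro x y
      refine Fin.lastCases ?_ (fun a => ?_) x
      · refine Fin.lastCases ?_ (fun b => ?_) y
        · intro h; exact absurd rfl h.ne
        · rw [ext1_last]
          intro h hm
          simp only [Fin.val_last, Fin.val_castSucc] at hm ⊢
          have := hS1 b h hm.symm
          omega
      · refine Fin.lastCases ?_ (fun b => ?_) y
        · rw [SimpleGraph.adj_comm, ext1_last]
          intro h hm
          simp only [Fin.val_last, Fin.val_castSucc] at hm ⊢
          have := hS1 a h hm
          omega
        · rw [ext1_cast]; exact h1 a b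
    · intro y x x'
      refine Fin.lastCases ?_ (fun b => ?_) y
      · refine Fin.lastCases ?_ (fun a => ?_) x
        · intro _ _ _ _ h; exact absurd rfl h.ne
        · refine Fin.lastCases ?_ (fun a' => ?_) x'
          · intro _ _ _ _ _ h; exact absurd rfl h.ne
          · rw [ext1_last, ext1_last]
            intro a1 a2 a3 a4 a5 a6
            rw [hS2 a a5 a' a6 a2 a1 a3 a4]
      · refine Fin.lastCases ?_ (fun a => ?_) x
        · intro a1 a2 a3 a4 a5
          rw [SimpleGraph.adj_comm, ext1_last] at a5
          simp only [Fin.val_last, Fin.val_castSucc] at a1 a2 a3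
          have := hS1 b a5 (by omega)
          omega
        · refine Fin.lastCases ?_ (fun a' => ?_) x'
          · intro a1 a2 a3 a4 _ a5
            rw [SimpleGraph.adj_comm, ext1_last] at a5
            simp only [Fin.val_last, Fin.val_castSucc] at a1 a2 a4
            have := hS1 b a5 (by omega)
            omega
          · rw [ext1_cast, ext1_cast]
            intro a1 a2 a3 a4 a5 a6
            rw [h2 b a a' a1 a2 a3 a4 a5 a6]
  have hPm : ∀ S ∈ P, ∀ x ∈ S, (x:ℕ) % r ≠ n % r := by
    intro S hS x hx
    have := mem_powerset.1 hS hx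
    simpa using this
  by_cases hc : n % r = 0 ∧ r * K ≤ n
  · rw [if_pos hc]
    have hlt : ∀ k : Fin K, r * (k:ℕ) < n := fun k =>
      lt_of_lt_of_le (Nat.mul_lt_mul_of_pos_left k.2 (by omega)) hc.2
    set ins : (Finset (Fin n)) × Fin K → Finset (Fin n) := fun p => insert ⟨r * (p.2:ℕ), hlt p.2⟩ p.1
    refine ⟨(P ×ˢ (univ : Finset (Fin K))).image ins, ?_, ?_⟩
    · rw [Finset.card_image_of_injOn, card_product]
      · simp only [card_univ, Fintype.card_fin]
        gcongr
      · rintro ⟨S, k⟩ hS ⟨S', k'⟩ hS' he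
        simp only [Finset.coe_product, Set.mem_prod, mem_coe] at hS hS'
        have hS1 := hPm S hS.1
        have hS2 := hPm S' hS'.1
        have hk : ∀ k : Fin K, ((⟨r * (k:ℕ), hlt k⟩ : Fin n) : ℕ) % r = n % r := by
          intro k; simp [hc.1]
        have hkk : k = k' := by
          have : (⟨r * (k:ℕ), hlt k⟩ : Fin n) ∈ ins (S', k') := by
            rw [← he]; exact Finset.mem_insert_self _ _
          rcases mem_insert.1 this with h | h
          · simp only [Fin.mk.injEq] at h
            exact Fin.ext (Nat.eq_of_mul_eq_mul_left (by omega) h)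
          · exact absurd (hk k) (hS2 _ h)
        subst hkk
        have : S = S' := by
          rw [← Finset.erase_insert (fun h => hS1 _ h (hk k)),
            ← Finset.erase_insert (s := S') (fun h => hS2 _ h (hk k))]
          exact congrArg (fun T => Finset.erase T _) he
        rw [this]
    · intro S hS
      obtain ⟨⟨S', k⟩, hS', rfl⟩ := mem_image.1 hS
      have hS1 := hPm S' (mem_product.1 hS').1
      refine crit _ ?_ ?_
      · intro x hx hm
        rcases mem_insert.1 hx with rfl | h
        · refine ⟨hc.1, ?_, hc.2⟩
          exact Nat.mul_lt_mul_of_pos_left k.2 (by omega)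
        · exact absurd hm (hS1 x h)
      · intro x hx x' hx' h0 _ hm hm'
        rcases mem_insert.1 hx with rfl | h
        · rcases mem_insert.1 hx' with rfl | h'
          · rfl
          · exact absurd (hm'.trans h0.symm) (hS1 x' h')
        · exact absurd (hm.trans h0.symm) (hS1 x h)
  · rw [if_neg hc, mul_one]
    refine ⟨P, hPc, fun S hS => crit S ?_ ?_⟩
    · intro x hx hm; exact absurd hm (hPm S hS x hx)
    · intro x hx x' hx' h0 _ hm _; exact absurd (hm.trans h0.symm) (hPm S hS x hx)

lemma UU_lower (hr : 2 ≤ r) {K : ℕ} (hK : 1 ≤ K) (n : ℕ) :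
    (2:ℝ) ^ (al r * (n * (n - 1) / 2)) * (K:ℝ) ^ ((n + r - 1) / r - K) ≤ (UU r K n).ncard := by
  induction n with
  | zero =>
    have : (0 + r - 1) / r = 0 := Nat.div_eq_of_lt (by omega)
    rw [this]
    simp only [CharP.cast_eq_zero, zero_mul, zero_div, mul_zero, Real.rpow_zero, Nat.zero_sub,
      pow_zero, mul_one, Nat.one_le_cast, Nat.succ_le_iff]
    rw [Set.ncard_pos (toFinite _)]
    exact ⟨⊥, fun x => x.elim0, fun x => x.elim0⟩
  | succ n ih =>
    have h := UU_succ hr K n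
    have h' : (((UU r K n).ncard * (2 ^ (n - n / r) * (if n % r = 0 ∧ r * K ≤ n then K else 1)) : ℕ) : ℝ)
        ≤ ((UU r K (n + 1)).ncard : ℝ) := by exact_mod_cast h
    refine le_trans ?_ h'
    rw [Nat.cast_mul, Nat.cast_mul]
    have e : al r * (((n + 1 : ℕ):ℝ) * (((n + 1 : ℕ) : ℝ) - 1) / 2) =
        al r * (n * (n - 1) / 2) + al r * n := by push_cast; ring
    rw [e, rpow_add (by norm_num)]
    have hK1 : (1:ℝ) ≤ K := by exact_mod_cast hK
    have hkey : (K:ℝ) ^ ((n + 1 + r - 1) / r - K) ≤ (K:ℝ) ^ ((n + r - 1) / r - K) *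
        ((if n % r = 0 ∧ r * K ≤ n then K else 1 : ℕ) : ℝ) := by
      have hdm := Nat.div_add_mod n r
      have ha : (n + 1 + r - 1) / r = n / r + 1 := by
        rw [show n + 1 + r - 1 = n + r by omega, Nat.add_div_right _ (by omega)]
      rw [ha]
      by_cases h0 : n % r = 0
      · have hb : (n + r - 1) / r = n / r := by
          rw [Nat.div_eq_iff (by omega)]
          have : n / r * r = r * (n / r) := Nat.mul_comm _ _
          omega
        rw [hb]
        by_cases hKn : r * K ≤ n
        · rw [if_pos ⟨h0, hKn⟩, ← pow_succ]
          refine pow_le_pow_right₀ hK1 ?_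
          omega
        · rw [if_neg (fun h => hKn h.2)]
          have : n / r < K := by
            by_contra hh; push Not at hh
            have := Nat.mul_le_mul_left r hh
            omega
          rw [show n / r + 1 - K = 0 by omega]
          simp
          exact one_le_pow₀ hK1
      · have hb : (n + r - 1) / r = n / r + 1 := by
          rw [Nat.div_eq_iff (by omega)]
          have : (n / r + 1) * r = r * (n / r) + r := by ring
          have := Nat.mod_lt n (show 0 < r by omega)
          omega
        rw [hb, if_neg (fun h => h0 h.1)]
        simp
    calc (2:ℝ) ^ (al r * (n * (n - 1) / 2)) * 2 ^ (al r * n) * (K:ℝ) ^ ((n + 1 + r - 1) / r - K)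
        ≤ (2:ℝ) ^ (al r * (n * (n - 1) / 2)) * 2 ^ (al r * n) * ((K:ℝ) ^ ((n + r - 1) / r - K) *
        ((if n % r = 0 ∧ r * K ≤ n then K else 1 : ℕ) : ℝ)) := by gcongr
      _ = ((2:ℝ) ^ (al r * (n * (n - 1) / 2)) * (K:ℝ) ^ ((n + r - 1) / r - K)) * (2 ^ (al r * n) *
        ((if n % r = 0 ∧ r * K ≤ n then K else 1 : ℕ) : ℝ)) := by ring
      _ ≤ _ := by
        gcongr
        exact two_pow_al_le

lemma TN_lower_star (hr : 2 ≤ r) {K : ℕ} (hK : 1 ≤ K) (n : ℕ) :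
    (2:ℝ) ^ (al r * (n * (n - 1) / 2)) * (K:ℝ) ^ (n / r - K) ≤ TN r n := by
  have h1 := UU_lower hr hK n
  have h2 : ((UU r K n).ncard : ℝ) ≤ TN r n := by
    exact_mod_cast ncard_le_ncard (UU_sub hr K n) (toFinite _)
  refine le_trans ?_ (h1.trans h2)
  have hK1 : (1:ℝ) ≤ K := by exact_mod_cast hK
  gcongr
  omega

lemma TN_lower (hr : 2 ≤ r) (n : ℕ) :
    (2:ℝ) ^ (al r * (n * (n - 1) / 2)) ≤ TN r n := by
  simpa using TN_lower_star hr (le_refl 1) n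

/-! ### Entropy bounds -/

lemma master {ι α : Type*} [Fintype ι] [Fintype α] (A : Finset (ι → α)) (w : ι → α → ℝ)
    (hw : ∀ p a, 0 ≤ w p a) (θ : ℝ) (h : ∀ f ∈ A, θ ≤ ∏ p, w p (f p)) :
    (A.card : ℝ) * θ ≤ ∏ p, ∑ a, w p a := by
  rw [Finset.prod_univ_sum, ← nsmul_eq_mul]
  refine (card_nsmul_le_sum A _ θ h).trans ?_
  refine Finset.sum_le_sum_of_subset_of_nonneg ?_ ?_
  · intro f _; simp
  · intro f _ _; exact prod_nonneg fun p _ => hw p _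

lemma entropy (m : ℕ) {γ : ℝ} (hγ : 0 < γ) : ∃ ζ : ℝ, 0 < ζ ∧ ∀ {ι α : Type} [Fintype ι] [Fintype α]
    (T : ι → Set α) (a : ι → ℝ) (N : ℝ) (A : Set (ι → α)), Fintype.card α ≤ m →
    (Fintype.card ι : ℝ) ≤ N → (∀ x, 1 ≤ a x) → (∀ x, ((T x).ncard : ℝ) ≤ a x) →
    (∀ f ∈ A, ((univ.filter (fun x => f x ∉ T x)).card : ℝ) ≤ ζ * N) →
    (A.ncard : ℝ) ≤ 2 ^ (γ * N) * ∏ x, a x := by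
  have h1 : (1:ℝ) < 2 ^ (γ / 2) := Real.one_lt_rpow (by norm_num) (by positivity)
  set lam : ℝ := min (1/2) ((2 ^ (γ / 2) - 1) / (m + 1)) with hlam
  have hl0 : 0 < lam := by
    refine lt_min (by norm_num) ?_
    have : (0:ℝ) < 2 ^ (γ / 2) - 1 := by linarith
    positivity
  have hl1 : lam < 1 := lt_of_le_of_lt (min_le_left _ _) (by norm_num)
  have hlm : 1 + lam * m ≤ 2 ^ (γ / 2) := by
    have h2 : lam ≤ (2 ^ (γ / 2) - 1) / (m + 1) := min_le_right _ _
    rw [le_div_iff₀ (by positivity)] at h2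
    nlinarith
  have hlog : logb 2 lam < 0 := Real.logb_neg (by norm_num) hl0 hl1
  refine ⟨(γ / 2) / (- logb 2 lam), by apply div_pos <;> linarith, ?_⟩
  intro ι α _ _ T a N A hα hι ha hT hA
  have hN : 0 ≤ N := le_trans (Nat.cast_nonneg _) hι
  have hθ : lam ^ ((γ / 2) / (- logb 2 lam) * N) = 2 ^ (-(γ / 2 * N)) := by
    have e : lam = 2 ^ logb 2 lam := by rw [Real.rpow_logb] <;> norm_num; exact hl0
    conv_lhs => rw [e]
    rw [Real.logb_rpow (by norm_num) (by norm_num), ← rpow_mul (by norm_num)]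
    congr 1
    have := hlog.ne
    field_simp
  have hm := master (toFinite A).toFinset (fun x b => if b ∈ T x then 1 else lam)
    (fun p b => by split_ifs <;> linarith)
    (2 ^ (-(γ / 2 * N))) (by
      intro f hf
      rw [prod_ite, Finset.prod_const_one, one_mul, prod_const, ← hθ, ← rpow_natCast]
      refine Real.rpow_le_rpow_of_exponent_ge hl0 hl1.le ?_
      exact hA f (by simpa using hf))
  rw [← Set.ncard_eq_toFinset_card] at hm
  have hs : ∏ x, ∑ b, (if b ∈ T x then (1:ℝ) else lam) ≤ (∏ x, a x) * 2 ^ (γ / 2 * N) := by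
    have h3 : ∀ x, ∑ b, (if b ∈ T x then (1:ℝ) else lam) ≤ a x * 2 ^ (γ / 2) := by
      intro x
      rw [Finset.sum_ite, sum_const, sum_const, nsmul_eq_mul, nsmul_eq_mul, mul_one]
      have e1 : ((univ.filter (fun b => b ∈ T x)).card : ℝ) ≤ a x := by
        refine le_trans ?_ (hT x)
        rw [Set.ncard_eq_toFinset_card']
        exact_mod_cast card_le_card (by intro b hb; simpa using hb)
      have e2 : ((univ.filter (fun b => b ∉ T x)).card : ℝ) ≤ m := by
        exact_mod_cast (Finset.card_filter_le _ _).trans hα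
      have := ha x
      calc _ ≤ a x + m * lam := by gcongr
        _ ≤ a x * (1 + lam * m) := by nlinarith [mul_nonneg hl0.le (Nat.cast_nonneg (α := ℝ) m)]
        _ ≤ _ := by gcongr
    refine (Finset.prod_le_prod (fun x _ => Finset.sum_nonneg fun b _ => by split_ifs <;> linarith)
      fun x _ => h3 x).trans ?_
    rw [prod_mul_distrib, prod_const, card_univ, ← rpow_natCast,
      ← rpow_mul (by norm_num)]
    have : 0 ≤ ∏ x, a x := prod_nonneg fun x _ => by linarith [ha x]
    gcongr
    norm_num
  have h5 := hm.trans hs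
  have e3 : (2:ℝ) ^ (γ * N) = 2 ^ (γ / 2 * N) * 2 ^ (γ / 2 * N) := by
    rw [← rpow_add (by norm_num)]; congr 1; ring
  rw [rpow_neg (by norm_num), ← div_eq_mul_inv, div_le_iff₀ (by positivity)] at h5
  rw [e3]
  linarith

/-! ### covering -/

lemma cover_card {K α : Type*} [Finite α] [Finite K] (S : Set K) (B : K → Set α) {A : Set α} {X : ℝ}
    (hA : ∀ a ∈ A, ∃ k ∈ S, a ∈ B k) (hB : ∀ k ∈ S, ((B k).ncard : ℝ) ≤ X) :
    (A.ncard : ℝ) ≤ S.ncard * X := by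
  have hsub : A ⊆ ⋃ k ∈ (toFinite S).toFinset, B k := by
    intro a ha
    obtain ⟨k, hk, h⟩ := hA a ha
    simp only [Set.Finite.mem_toFinset, Set.mem_iUnion]
    exact ⟨k, hk, h⟩
  have h1 := ncard_le_ncard hsub (toFinite _)
  have h2 := h1.trans (Finset.set_ncard_biUnion_le _ _)
  have h3 : ((∑ k ∈ (toFinite S).toFinset, (B k).ncard : ℕ) : ℝ) ≤ S.ncard * X := by
    rw [Nat.cast_sum, Set.ncard_eq_toFinset_card S, ← nsmul_eq_mul]
    exact sum_le_card_nsmul _ _ _ fun k hk => hB k (by simpa using hk)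
  exact le_trans (by exact_mod_cast h2) h3

lemma cover_card_univ {K α : Type*} [Finite α] [Fintype K] (B : K → Set α) {A : Set α} {X : ℝ}
    (hA : ∀ a ∈ A, ∃ k, a ∈ B k) (hB : ∀ k, ((B k).ncard : ℝ) ≤ X) :
    (A.ncard : ℝ) ≤ Fintype.card K * X := by
  have := cover_card (Set.univ : Set K) B (A := A) (X := X)
    (fun a ha => by obtain ⟨k, hk⟩ := hA a ha; exact ⟨k, trivial, hk⟩) fun k _ => hB k
  rwa [ncard_univ, Nat.card_eq_fintype_card] at this

/-! ### Removal -/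

def AgreeOff {s : ℕ} (q : Fin s → Fin n) (H H' : SimpleGraph (Fin n)) : Prop :=
  ∀ x y, (∀ i, q i ≠ x) → (∀ i, q i ≠ y) → (H.Adj x y ↔ H'.Adj x y)

def rows {s : ℕ} (q : Fin s → Fin n) (H : SimpleGraph (Fin n)) : Fin n → Fin s → Bool :=
  fun x i => decide (H.Adj x (q i))

lemma rows_eq {s : ℕ} {q : Fin s → Fin n} {H H' : SimpleGraph (Fin n)}
    (h : AgreeOff q H H') (hr : rows q H = rows q H') : H = H' := by
  have hq : ∀ x i, H.Adj x (q i) ↔ H'.Adj x (q i) := by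
    intro x i
    have := congrFun (congrFun hr x) i
    simpa [rows] using this
  ext x y
  by_cases hx : ∃ i, q i = x
  · obtain ⟨i, rfl⟩ := hx
    rw [H.adj_comm, H'.adj_comm]; exact hq y i
  · by_cases hy : ∃ i, q i = y
    · obtain ⟨i, rfl⟩ := hy; exact hq x i
    · push Not at hx hy; exact h x y hx hy

lemma rows_count {s : ℕ} (q : Fin s → Fin n) (H0 : SimpleGraph (Fin n))
    (R : Set (Fin n → Fin s → Bool)) :
    {H | AgreeOff q H0 H ∧ rows q H ∈ R}.ncard ≤ R.ncard := by
  refine Set.ncard_le_ncard_of_injOn (rows q) (fun H hH => hH.2) ?_ (toFinite _)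
  intro H hH H' hH' he
  refine rows_eq (q := q) ?_ he
  intro x y hx hy
  rw [← hH.1 x y hx hy, hH'.1 x y hx hy]

lemma hasC_comap {V W : Type*} {H : SimpleGraph V} (e : W ↪ V)
    (h : HasC r (H.comap e)) : HasC r H := by
  obtain ⟨φ, hφ⟩ := h
  refine ⟨fun p => e (φ p), fun p q hp hq hpq => ?_⟩
  obtain ⟨h1, h2⟩ := hφ p q hp hq hpq
  exact ⟨fun h => h1 (e.injective h), by simpa using h2⟩

lemma removal_one {s : ℕ} {q : Fin s → Fin n} (hq : Injective q)
    (B : Set (SimpleGraph (Fin n))) (Y : ℝ) (hY0 : 0 ≤ Y) (hF : ∀ H ∈ B, ¬ HasC r H)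
    (hY : ∀ H0 ∈ B, ({H | H ∈ B ∧ AgreeOff q H0 H}.ncard : ℝ) ≤ Y) :
    (B.ncard : ℝ) ≤ fN r (n - s) * Y := by
  set I : Finset (Fin n) := (univ.image q)ᶜ with hI
  have hIc : I.card = n - s := by
    rw [hI, card_compl, Finset.card_image_of_injective _ hq]; simp
  set e : Fin (n - s) ↪ Fin n := (I.orderEmbOfFin hIc).toEmbedding with he
  have hrange : ∀ x, (∀ i, q i ≠ x) → ∃ k, e k = x := by
    intro x hx
    have : x ∈ Set.range (I.orderEmbOfFin hIc) := by
      rw [Finset.range_orderEmbOfFin]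
      simp [hI, hx]
    obtain ⟨k, hk⟩ := this
    exact ⟨k, hk⟩
  set M : Set (SimpleGraph (Fin (n - s))) := (fun H => H.comap e) '' B with hM
  have hMF : (M.ncard : ℝ) ≤ fN r (n - s) := by
    refine Nat.cast_le.2 (ncard_le_ncard ?_ (toFinite _))
    rintro _ ⟨H, hH, rfl⟩
    exact fun h => hF H hH (hasC_comap e h)
  have hc := cover_card M (fun R => {H | H ∈ B ∧ H.comap e = R}) (A := B) (X := Y)
    (fun H hH => ⟨_, ⟨H, hH, rfl⟩, hH, rfl⟩) (by
      rintro _ ⟨H0, hH0, rfl⟩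
      refine le_trans (Nat.cast_le.2 (ncard_le_ncard ?_ (toFinite _))) (hY H0 hH0)
      rintro H ⟨hH, hHe⟩
      refine ⟨hH, ?_⟩
      intro x y hx hy
      obtain ⟨k, rfl⟩ := hrange x hx
      obtain ⟨k', rfl⟩ := hrange y hy
      have : (H.comap e).Adj k k' ↔ (H0.comap e).Adj k k' := by rw [hHe]
      simpa using this.symm)
  refine hc.trans ?_
  gcongr

lemma removal {s : ℕ} (A : Set (SimpleGraph (Fin n))) (P : (Fin s → Fin n) → SimpleGraph (Fin n) → Prop)
    (Y : ℝ) (hY0 : 0 ≤ Y)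
    (hA : ∀ H ∈ A, ¬ HasC r H ∧ ∃ q, Injective q ∧ P q H)
    (hY : ∀ q, Injective q → ∀ H0, P q H0 → ¬ HasC r H0 →
      ({H | P q H ∧ ¬ HasC r H ∧ AgreeOff q H0 H}.ncard : ℝ) ≤ Y) :
    (A.ncard : ℝ) ≤ n ^ s * Y * fN r (n - s) := by
  have h := cover_card {q : Fin s → Fin n | Injective q}
    (fun q => {H | ¬ HasC r H ∧ P q H}) (A := A) (X := fN r (n - s) * Y)
    (fun H hH => by
      obtain ⟨h1, q, hq, h2⟩ := hA H hH
      exact ⟨q, hq, h1, h2⟩)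
    (by
      intro q hq
      refine removal_one hq _ Y hY0 (fun H hH => hH.1) ?_
      rintro H0 ⟨h1, h2⟩
      refine le_trans (Nat.cast_le.2 (ncard_le_ncard ?_ (toFinite _))) (hY q hq H0 h2 h1)
      rintro H ⟨⟨h3, h4⟩, h5⟩
      exact ⟨h4, h3, h5⟩)
  refine h.trans ?_
  have h2 : ({q : Fin s → Fin n | Injective q}.ncard : ℝ) ≤ n ^ s := by
    have := Set.ncard_le_card {q : Fin s → Fin n | Injective q}
    rw [Nat.card_eq_fintype_card, Fintype.card_fun, Fintype.card_fin, Fintype.card_fin] at this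
    exact_mod_cast this
  calc _ ≤ (n:ℝ) ^ s * (fN r (n - s) * Y) := by gcongr
    _ = _ := by ring

lemma close_count (r : ℕ) {γ : ℝ} (hγ : 0 < γ) : ∃ ζ : ℝ, 0 < ζ ∧ ∀ (n : ℕ) (c0 : Fin n → Fin r),
    ({c : Fin n → Fin r | ∃ σ : Equiv.Perm (Fin r),
      ((univ.filter (fun v => c v ≠ σ (c0 v))).card : ℝ) ≤ ζ * n}.ncard : ℝ) ≤
      r.factorial * 2 ^ (γ * n) := by
  obtain ⟨ζ, hζ, h⟩ := entropy r hγ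
  refine ⟨ζ, hζ, fun n c0 => ?_⟩
  have hc := cover_card_univ (K := Equiv.Perm (Fin r)) (fun σ => {c : Fin n → Fin r |
      ((univ.filter (fun v => c v ≠ σ (c0 v))).card : ℝ) ≤ ζ * n})
      (A := {c : Fin n → Fin r | ∃ σ : Equiv.Perm (Fin r),
      ((univ.filter (fun v => c v ≠ σ (c0 v))).card : ℝ) ≤ ζ * n}) (X := 2 ^ (γ * n))
      (fun c hc => hc) (by
        intro σ
        have := h (fun v => {σ (c0 v)}) (fun _ => 1) n {c : Fin n → Fin r |
          ((univ.filter (fun v => c v ≠ σ (c0 v))).card : ℝ) ≤ ζ * n} (by simp) (by simp)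
          (fun _ => le_refl _) (fun _ => by simp) (by intro f hf; simpa using hf)
        simpa using this)
  rwa [Fintype.card_perm, Fintype.card_fin] at hc

lemma poly_exp_zero (k : ℕ) (C : ℝ) {γ : ℝ} (hγ : 0 < γ) :
    Tendsto (fun n : ℕ => (n:ℝ) ^ k * C * 2 ^ (-(γ * n))) atTop (nhds 0) := by
  have h1 : |(2:ℝ) ^ (-γ)| < 1 := by
    rw [abs_of_pos (by positivity)]
    exact Real.rpow_lt_one_of_one_lt_of_neg (by norm_num) (by linarith)
  have h := (tendsto_pow_const_mul_const_pow_of_abs_lt_one k h1).mul_const C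
  rw [zero_mul] at h
  refine h.congr fun n => ?_
  rw [← rpow_natCast ((2:ℝ) ^ (-γ)), ← rpow_mul (by norm_num)]
  rw [show -γ * (n:ℝ) = -(γ * n) by ring]
  ring

/-- The generic gain lemma: families in which `s` vertices have rows with exponentially few choices. -/
lemma gain_small (hr : 2 ≤ r) (s : ℕ) (hs : 1 ≤ s) {γ : ℝ} (hγ : 0 < γ) :
    ∃ ζ : ℝ, 0 < ζ ∧ ∀ (A : Fam) (col : ∀ n, SimpleGraph (Fin n) → Fin n → Fin r),
      (∀ᶠ n in atTop, ∃ P : (Fin s → Fin n) → SimpleGraph (Fin n) → Prop,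
        (∀ H ∈ A n, ¬ HasC r H ∧ ∃ q, Injective q ∧ P q H) ∧
        (∀ q, Injective q → ∀ H0 H, P q H0 → P q H → AgreeOff q H0 H →
          ∃ σ : Equiv.Perm (Fin r),
          ((univ.filter (fun v => col n H v ≠ σ (col n H0 v))).card : ℝ) ≤ ζ * n) ∧
        (∀ q, Injective q → ∀ H0, P q H0 → ∀ c : Fin n → Fin r,
          ∃ (D : Type) (_ : Fintype D) (T : D → Fin n → Set (Fin s → Bool)) (a : D → Fin n → ℝ),
          (∀ d x, 1 ≤ a d x) ∧ (∀ d x, ((T d x).ncard : ℝ) ≤ a d x) ∧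
          (∀ d, Fintype.card D * ∏ x, a d x ≤ 2 ^ ((s * al r - γ) * n)) ∧
          ∀ H, P q H → AgreeOff q H0 H → col n H = c →
            ∃ d, ((univ.filter (fun x => rows q H x ∉ T d x)).card : ℝ) ≤ ζ * n)) →
      Small r A := by
  obtain ⟨ζ1, hζ1, hent⟩ := entropy (2 ^ s) (γ := γ / 4) (by positivity)
  obtain ⟨ζ2, hζ2, hcl⟩ := close_count r (γ := γ / 4) (by positivity)
  refine ⟨min ζ1 ζ2, lt_min hζ1 hζ2, ?_⟩
  intro A col hev
  refine small_of_removal hr s hs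
    (fun n => n ^ s * (r.factorial * 2 ^ (γ / 4 * n) * (2 ^ (γ / 4 * n) * 2 ^ ((s * al r - γ) * n))))
    (fun n => by positivity) ?_ ?_
  · have := poly_exp_zero s (r.factorial : ℝ) (γ := γ / 2) (by positivity)
    refine this.congr fun n => ?_
    rw [eq_div_iff (by positivity)]
    have e : (2:ℝ) ^ (-(γ / 2 * n)) * 2 ^ (s * al r * n) =
        2 ^ (γ / 4 * n) * (2 ^ (γ / 4 * n) * 2 ^ ((s * al r - γ) * n)) := by
      rw [← rpow_add (by norm_num), ← rpow_add (by norm_num), ← rpow_add (by norm_num)]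
      congr 1; ring
    linear_combination ((n:ℝ) ^ s * r.factorial) * e
  · filter_upwards [hev] with n hn
    obtain ⟨P, hA, hclose, hrow⟩ := hn
    refine removal (A n) P _ (by positivity) hA ?_
    intro q hq H0 hP0 _
    have hζm1 : min ζ1 ζ2 * (n:ℝ) ≤ ζ1 * n := by gcongr; exact min_le_left _ _
    have hζm2 : min ζ1 ζ2 * (n:ℝ) ≤ ζ2 * n := by gcongr; exact min_le_right _ _
    have h1 := cover_card {c : Fin n → Fin r | ∃ σ : Equiv.Perm (Fin r),
      ((univ.filter (fun v => c v ≠ σ (col n H0 v))).card : ℝ) ≤ ζ2 * n}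
      (fun c => {H | P q H ∧ AgreeOff q H0 H ∧ col n H = c})
      (A := {H | P q H ∧ ¬ HasC r H ∧ AgreeOff q H0 H})
      (X := 2 ^ (γ / 4 * n) * 2 ^ ((s * al r - γ) * n))
      (by
        rintro H ⟨h1, h2, h3⟩
        obtain ⟨σ, hσ⟩ := hclose q hq H0 H hP0 h1 h3
        exact ⟨col n H, ⟨σ, hσ.trans hζm2⟩, h1, h3, rfl⟩)
      (by
        intro c _
        obtain ⟨D, _, T, a, ha1, haT, hprod, hH⟩ := hrow q hq H0 hP0 c
        rcases isEmpty_or_nonempty D with hD | ⟨⟨d0⟩⟩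
        · have : {H | P q H ∧ AgreeOff q H0 H ∧ col n H = c} = ∅ := by
            rw [Set.eq_empty_iff_forall_notMem]
            rintro H ⟨h1, h2, h3⟩
            obtain ⟨d, _⟩ := hH H h1 h2 h3
            exact hD.elim d
          rw [this]
          simp only [Set.ncard_empty, CharP.cast_eq_zero]
          positivity
        · have hDpos : (0:ℝ) < Fintype.card D := by exact_mod_cast Fintype.card_pos_iff.2 ⟨d0⟩
          have h2 := cover_card_univ (K := D)
            (fun d => {H | AgreeOff q H0 H ∧ rows q H ∈ {f : Fin n → Fin s → Bool |
              ((univ.filter (fun x => f x ∉ T d x)).card : ℝ) ≤ ζ1 * n}})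
            (A := {H | P q H ∧ AgreeOff q H0 H ∧ col n H = c})
            (X := 2 ^ (γ / 4 * n) * (2 ^ ((s * al r - γ) * n) / Fintype.card D))
            (by
              rintro H ⟨h1, h2, h3⟩
              obtain ⟨d, hd⟩ := hH H h1 h2 h3
              exact ⟨d, h2, hd.trans hζm1⟩)
            (by
              intro d
              refine le_trans (Nat.cast_le.2 (rows_count q H0 _)) ?_
              refine le_trans (hent (T d) (a d) n _ (by simp) (by simp) (ha1 d) (haT d)
                (fun f hf => hf)) ?_
              gcongr
              rw [le_div_iff₀ hDpos, mul_comm]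
              exact hprod d)
          refine h2.trans (le_of_eq ?_)
          field_simp)
    refine h1.trans ?_
    have h3 := hcl n (col n H0)
    gcongr

/-! ### Colourings -/

/-- Neighbours of `v` in part `j`. -/
def nbs (H : SimpleGraph (Fin n)) (c : Fin n → Fin r) (v : Fin n) (j : Fin r) :
    Finset (Fin n) := univ.filter (fun w => c w = j ∧ H.Adj v w)

/-- Non-neighbours of `v` in part `j`. -/
def gbs (H : SimpleGraph (Fin n)) (c : Fin n → Fin r) (v : Fin n) (j : Fin r) :
    Finset (Fin n) := univ.filter (fun w => c w = j ∧ ¬ H.Adj v w)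

def part (c : Fin n → Fin r) (j : Fin r) : Finset (Fin n) :=
  univ.filter (fun w => c w = j)

/-- Number of ordered adjacent pairs inside the parts. -/
def inner (H : SimpleGraph (Fin n)) (c : Fin n → Fin r) : ℕ :=
  ∑ v, (nbs H c v (c v)).card

def IsOpt (H : SimpleGraph (Fin n)) (c : Fin n → Fin r) : Prop :=
  ∀ c' : Fin n → Fin r, inner H c ≤ inner H c'

lemma exists_opt (hr : 0 < r) (H : SimpleGraph (Fin n)) :
    ∃ c : Fin n → Fin r, IsOpt H c := by
  have : Nonempty (Fin r) := ⟨⟨0, hr⟩⟩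
  obtain ⟨c, hc⟩ := Finite.exists_min (fun c : Fin n → Fin r => inner H c)
  exact ⟨c, hc⟩

lemma inner_split (H : SimpleGraph (Fin n)) (c : Fin n → Fin r) (v : Fin n) :
    inner H c = 2 * (nbs H c v (c v)).card +
      ∑ x ∈ univ.erase v, ∑ y ∈ univ.erase v,
        if c y = c x ∧ H.Adj x y then 1 else 0 := by
  have e : ∀ x, (nbs H c x (c x)).card = ∑ y, if c y = c x ∧ H.Adj x y then 1 else 0 := by
    intro x; rw [nbs, card_filter]
  unfold inner
  rw [← add_sum_erase _ _ (mem_univ v)]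
  have h2 : ∑ x ∈ univ.erase v, (nbs H c x (c x)).card =
      ∑ x ∈ univ.erase v, ((if c v = c x ∧ H.Adj x v then 1 else 0) +
        ∑ y ∈ univ.erase v, if c y = c x ∧ H.Adj x y then 1 else 0) := by
    refine sum_congr rfl fun x _ => ?_
    rw [e, ← add_sum_erase _ _ (mem_univ v)]
  rw [h2, sum_add_distrib]
  have h3 : ∑ x ∈ univ.erase v, (if c v = c x ∧ H.Adj x v then 1 else 0) =
      (nbs H c v (c v)).card := by
    rw [e v, ← add_sum_erase _ _ (mem_univ v)]
    simp only [SimpleGraph.irrefl, and_false, if_false, zero_add]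
    refine sum_congr rfl fun x _ => ?_
    simp only [H.adj_comm x v, eq_comm (a := c v) (b := c x)]
  omega

lemma IsOpt.nb_le {H : SimpleGraph (Fin n)} {c : Fin n → Fin r} (h : IsOpt H c)
    (v : Fin n) (j : Fin r) : (nbs H c v (c v)).card ≤ (nbs H c v j).card := by
  have h1 := h (update c v j)
  rw [inner_split H c v, inner_split H (update c v j) v] at h1
  have e1 : ∑ x ∈ univ.erase v, ∑ y ∈ univ.erase v,
        (if update c v j y = update c v j x ∧ H.Adj x y then 1 else 0) =
      ∑ x ∈ univ.erase v, ∑ y ∈ univ.erase v,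
        if c y = c x ∧ H.Adj x y then 1 else 0 := by
    refine sum_congr rfl fun x hx => sum_congr rfl fun y hy => ?_
    rw [update_of_ne (ne_of_mem_erase hx), update_of_ne (ne_of_mem_erase hy)]
  have e2 : nbs H (update c v j) v (update c v j v) = nbs H c v j := by
    unfold nbs
    ext w
    simp only [mem_filter, mem_univ, true_and, update_self]
    by_cases hw : w = v
    · subst hw; simp
    · rw [update_of_ne hw]
  rw [e1, e2] at h1
  omega

def opt (hr : 0 < r) (H : SimpleGraph (Fin n)) : Fin n → Fin r :=
  Classical.choose (exists_opt hr H)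

lemma opt_isOpt (hr : 0 < r) (H : SimpleGraph (Fin n)) : IsOpt H (opt hr H) :=
  Classical.choose_spec (exists_opt hr H)

/-- Genericity. -/
def Gen (H : SimpleGraph (Fin n)) (c : Fin n → Fin r) (K : ℕ) : Prop :=
  ∀ j, ∀ B : Finset (Fin n), (∀ b ∈ B, c b = j) → K ≤ B.card →
    (univ.filter (fun v => c v ≠ j ∧ 4 * (B.filter (fun b => H.Adj v b)).card < B.card)).card < K ∧
    (univ.filter (fun v => 4 * (B.filter (fun b => ¬ H.Adj v b)).card < B.card)).card < K

/-- Embedding lemma. -/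
lemma embed {K W0 : ℕ} {H : SimpleGraph (Fin n)} {c : Fin n → Fin r} (hg : Gen H c K)
    (hW : (2 * r + 2) * K + 20 ≤ W0) (hWK : K ≤ W0) (col : ℕ → Fin r) :
    ∀ (m : ℕ) (P : Finset ℕ) (φ : ℕ → Fin n) (X : ℕ → Finset (Fin n)),
    P.card = m → P ⊆ range (2 * r + 2) →
    (∀ p q, p < 2 * r + 2 → q < 2 * r + 2 → p ∉ P → q ∉ P → p ≠ q →
      φ p ≠ φ q ∧ (H.Adj (φ p) (φ q) ↔ ¬ cyc (2 * r + 2) p q)) →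
    (∀ q ∈ P, ∀ x ∈ X q, c x = col q) →
    (∀ q ∈ P, ∀ x ∈ X q, ∀ b, b < 2 * r + 2 → b ∉ P → x ≠ φ b ∧ (H.Adj x (φ b) ↔ ¬ cyc (2 * r + 2) q b)) →
    (∀ q ∈ P, ∀ q' ∈ P, q ≠ q' → col q = col q' → cyc (2 * r + 2) q q') →
    (∀ q ∈ P, 5 ^ m * W0 ≤ (X q).card) → HasC r H := by
  intro m
  induction m with
  | zero =>
    intro P φ X hP _ hb _ _ _ _
    rw [Finset.card_eq_zero] at hP
    subst hP
    exact ⟨φ, fun p q hp hq hpq => hb p q hp hq (by simp) (by simp) hpq⟩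
  | succ m ih =>
    intro P φ X hP hPr hb hX hXb hcol hcard
    obtain ⟨q, hq⟩ : P.Nonempty := by rw [← card_pos]; omega
    have hq0 : q < 2 * r + 2 := by simpa using hPr hq
    -- bad vertices
    set bad : ℕ → Finset (Fin n) := fun q' => if cyc (2 * r + 2) q q' then
        univ.filter (fun v => 4 * ((X q').filter (fun b => ¬ H.Adj v b)).card < (X q').card)
      else univ.filter (fun v => c v ≠ col q' ∧ 4 * ((X q').filter (fun b => H.Adj v b)).card < (X q').card)
      with hbad
    have h5 : 1 ≤ 5 ^ m := Nat.one_le_pow _ _ (by norm_num)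
    have hbig : ∀ q' ∈ P, 5 * (5 ^ m * W0) ≤ (X q').card := by
      intro q' hq'; have := hcard q' hq'; rw [pow_succ] at this; linarith
    have hbig2 : W0 ≤ 5 ^ m * W0 := Nat.le_mul_of_pos_left _ h5
    have hbadK : ∀ q' ∈ P.erase q, (bad q').card ≤ K := by
      intro q' hq'
      have hq'P := mem_of_mem_erase hq'
      have := hg (col q') (X q') (hX q' hq'P) (by have := hbig q' hq'P; omega)
      simp only [hbad]
      split_ifs
      · exact this.2.le
      · exact this.1.le
    have hU : ((P.erase q).biUnion bad).card ≤ (2 * r + 2) * K := by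
      refine (card_biUnion_le_card_mul _ _ K hbadK).trans ?_
      refine Nat.mul_le_mul_right _ ?_
      have := card_le_card ((Finset.erase_subset q P).trans hPr)
      simpa using this
    obtain ⟨v, hvX, hvb⟩ : ∃ v ∈ X q, v ∉ (P.erase q).biUnion bad := by
      by_contra hcon
      push Not at hcon
      have := card_le_card (show X q ⊆ (P.erase q).biUnion bad from hcon)
      have := hbig q hq
      omega
    have hvc := hX q hq v hvX
    refine ih (P.erase q) (update φ q v) (fun q' => ((X q').filter (fun x => x ≠ v ∧ (H.Adj v x ↔ ¬ cyc (2 * r + 2) q q')))) ?_ ?_ ?_ ?_ ?_ ?_ ?_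
    · rw [card_erase_of_mem hq]; omega
    · exact (Finset.erase_subset q P).trans hPr
    · intro p p' hp hp' hpP hp'P hne
      by_cases e : p = q
      · subst e
        have hne' : p' ≠ p := hne.symm
        rw [update_self, update_of_ne hne']
        exact hXb p hq v hvX p' hp' (fun h => hp'P (mem_erase.2 ⟨hne', h⟩))
      · have hpP' : p ∉ P := fun h => hpP (mem_erase.2 ⟨e, h⟩)
        by_cases e' : p' = q
        · subst e'
          rw [update_self, update_of_ne hne]
          have := hXb p' hq v hvX p hp hpP'
          rw [H.adj_comm, cyc_comm]
          exact ⟨this.1.symm, this.2⟩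
        · rw [update_of_ne e, update_of_ne e']
          exact hb p p' hp hp' hpP' (fun h => hp'P (mem_erase.2 ⟨e', h⟩)) hne
    · intro q' hq' x hx
      exact hX q' (mem_of_mem_erase hq') x (mem_of_mem_filter _ hx)
    · intro q' hq' x hx b hb hbP
      rw [mem_filter] at hx
      by_cases e : b = q
      · subst e
        rw [update_self, H.adj_comm, cyc_comm]
        exact hx.2
      · rw [update_of_ne e]
        exact hXb q' (mem_of_mem_erase hq') x hx.1 b hb (fun h => hbP (mem_erase.2 ⟨e, h⟩))
    · intro q' hq' q'' hq''
      exact hcol q' (mem_of_mem_erase hq') q'' (mem_of_mem_erase hq'')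
    · intro q' hq'
      have hq'P := mem_of_mem_erase hq'
      have hne := ne_of_mem_erase hq'
      have hB := hbig q' hq'P
      have hvq : v ∉ bad q' := fun h => hvb (mem_biUnion.2 ⟨q', hq', h⟩)
      have e1 : (X q').card ≤ 4 * ((X q').filter (fun x => (H.Adj v x ↔ ¬ cyc (2 * r + 2) q q'))).card := by
        simp only [hbad] at hvq
        split_ifs at hvq with h
        · simp only [h, not_true, iff_false]
          simpa using hvq
        · simp only [h, not_false_iff, iff_true]
          have hcc : c v ≠ col q' := by
            rw [hvc]; exact fun hc => h (hcol q hq q' hq'P hne.symm hc)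
          simpa [hcc] using hvq
      have e2 : ((X q').filter (fun x => (H.Adj v x ↔ ¬ cyc (2 * r + 2) q q'))).card ≤
        ((X q').filter (fun x => x ≠ v ∧ (H.Adj v x ↔ ¬ cyc (2 * r + 2) q q'))).card + 1 := by
        have : (X q').filter (fun x => (H.Adj v x ↔ ¬ cyc (2 * r + 2) q q')) ⊆
          insert v ((X q').filter (fun x => x ≠ v ∧ (H.Adj v x ↔ ¬ cyc (2 * r + 2) q q'))) := by
          intro x hx
          rw [mem_filter] at hx
          by_cases e : x = v
          · simp [e]
          · rw [mem_insert, mem_filter]; exact Or.inr ⟨hx.1, e, hx.2⟩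
        exact (card_le_card this).trans (card_insert_le _ _)
      omega

/-- size needed in embeddings -/
def WW (r K : ℕ) : ℕ := 5 ^ (2 * r + 2) * ((2 * r + 2) * K + 20) + (2 * r + 2)

lemma embed_pat {K : ℕ} {H : SimpleGraph (Fin n)} {c : Fin n → Fin r} (hg : Gen H c K)
    (col : ℕ → Fin r) (Bs : Finset ℕ) (hBs : Bs ⊆ range (2 * r + 2)) (φ : ℕ → Fin n)
    (hb : ∀ p ∈ Bs, ∀ q ∈ Bs, p ≠ q → φ p ≠ φ q ∧ (H.Adj (φ p) (φ q) ↔ ¬ cyc (2 * r + 2) p q))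
    (hcol : ∀ q q', q < 2 * r + 2 → q' < 2 * r + 2 → q ∉ Bs → q' ∉ Bs → q ≠ q' → col q = col q' →
      cyc (2 * r + 2) q q')
    (hX : ∀ q, q < 2 * r + 2 → q ∉ Bs → WW r K ≤ (univ.filter (fun x => c x = col q ∧
      ∀ b ∈ Bs, (H.Adj x (φ b) ↔ ¬ cyc (2 * r + 2) q b))).card) : HasC r H := by
  set P := range (2 * r + 2) \ Bs with hP
  have hPm : ∀ p, p < 2 * r + 2 → p ∉ P → p ∈ Bs := by
    intro p hp h
    by_contra h'
    exact h (by simp [hP, hp, h'])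
  have hPm' : ∀ p ∈ P, p < 2 * r + 2 ∧ p ∉ Bs := by
    intro p hp; simpa [hP] using hp
  have hPc : P.card ≤ 2 * r + 2 := by
    have := card_le_card (Finset.sdiff_subset : P ⊆ range (2 * r + 2)); simpa using this
  refine embed hg (W0 := (2 * r + 2) * K + 20) le_rfl (by nlinarith) col P.card P φ
    (fun q => (univ.filter (fun x => c x = col q ∧
      ∀ b ∈ Bs, (H.Adj x (φ b) ↔ ¬ cyc (2 * r + 2) q b))) \ Bs.image φ) rfl Finset.sdiff_subset ?_ ?_ ?_ ?_ ?_
  · intro p q hp hq hpP hqP hne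
    exact hb p (hPm p hp hpP) q (hPm q hq hqP) hne
  · intro q hq x hx
    simp only [Finset.mem_sdiff, mem_filter] at hx
    exact hx.1.2.1
  · intro q hq x hx b hb' hbP
    simp only [Finset.mem_sdiff, mem_filter] at hx
    have hbB := hPm b hb' hbP
    exact ⟨fun h => hx.2 (mem_image.2 ⟨b, hbB, h.symm⟩), hx.1.2.2 b hbB⟩
  · intro q hq q' hq'
    exact hcol q q' (hPm' q hq).1 (hPm' q' hq').1 (hPm' q hq).2 (hPm' q' hq').2
  · intro q hq
    have h1 := hX q (hPm' q hq).1 (hPm' q hq).2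
    have h2 := Finset.le_card_sdiff (Bs.image φ) (univ.filter (fun x => c x = col q ∧
      ∀ b ∈ Bs, (H.Adj x (φ b) ↔ ¬ cyc (2 * r + 2) q b)))
    have h3 : (Bs.image φ).card ≤ 2 * r + 2 := by
      refine card_image_le.trans ?_
      have := card_le_card hBs; simpa using this
    have h4 : 5 ^ P.card * ((2 * r + 2) * K + 20) ≤ 5 ^ (2 * r + 2) * ((2 * r + 2) * K + 20) :=
      Nat.mul_le_mul_right _ (Nat.pow_le_pow_right (by norm_num) hPc)
    unfold WW at h1
    omega

lemma enum3 {g0 g1 g2 : ℕ} (h0 : g0 < r) (h1 : g1 < r) (h2 : g2 < r) (h01 : g0 ≠ g1)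
    (h02 : g0 ≠ g2) (h12 : g1 ≠ g2) {f0 f1 f2 : Fin r} (k01 : f0 ≠ f1) (k02 : f0 ≠ f2) (k12 : f1 ≠ f2) :
    ∃ e : ℕ → Fin r, (∀ x y, x < r → y < r → e x = e y → x = y) ∧ e g0 = f0 ∧ e g1 = f1 ∧ e g2 = f2 := by
  obtain ⟨e, he0, he1, he2⟩ : ∃ e : Equiv.Perm (Fin r), e ⟨g0, h0⟩ = f0 ∧ e ⟨g1, h1⟩ = f1 ∧ e ⟨g2, h2⟩ = f2 := by
    obtain ⟨e, he0⟩ : ∃ e : Equiv.Perm (Fin r), e ⟨g0, h0⟩ = f0 := ⟨Equiv.swap ⟨g0, h0⟩ f0, by simp⟩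
    obtain ⟨e', he0', he1'⟩ : ∃ e : Equiv.Perm (Fin r), e ⟨g0, h0⟩ = f0 ∧ e ⟨g1, h1⟩ = f1 := by
      refine ⟨e.trans (Equiv.swap (e ⟨g1, h1⟩) f1), ?_, by simp⟩
      rw [Equiv.trans_apply, he0, Equiv.swap_apply_of_ne_of_ne _ k01]
      rw [← he0]; intro h; have := e.injective h; simp at this; omega
    refine ⟨e'.trans (Equiv.swap (e' ⟨g2, h2⟩) f2), ?_, ?_, by simp⟩
    · rw [Equiv.trans_apply, he0', Equiv.swap_apply_of_ne_of_ne _ k02]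
      rw [← he0']; intro h; have := e'.injective h; simp at this; omega
    · rw [Equiv.trans_apply, he1', Equiv.swap_apply_of_ne_of_ne _ k12]
      rw [← he1']; intro h; have := e'.injective h; simp at this; omega
  refine ⟨fun x => if h : x < r then e ⟨x, h⟩ else f0, ?_, by simp [h0, he0], by simp [h1, he1], by simp [h2, he2]⟩
  intro x y hx hy h
  simp only [hx, hy, dif_pos] at h
  have := e.injective h
  simpa using this

def low (H : SimpleGraph (Fin n)) (c : Fin n → Fin r) (E : ℕ) (v : Fin n) : Prop :=
  (nbs H c v (c v)).card < E

/-- All quadruples of vertices satisfying `lw` are rich. -/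
def RichP (H : SimpleGraph (Fin n)) (c : Fin n → Fin r) (lw : Fin n → Prop) (W : ℕ) : Prop :=
  ∀ Q : Fin 4 → Fin n, Injective Q → (∀ k, lw (Q k)) → ∀ j, ∀ s : Fin 4 → Prop,
    (∀ k, c (Q k) = j → ¬ s k) →
    W ≤ (univ.filter (fun x => c x = j ∧ ∀ k, (H.Adj x (Q k) ↔ s k))).card

abbrev RichAll {n r : ℕ} (H : SimpleGraph (Fin n)) (c : Fin n → Fin r) (E W : ℕ) : Prop := RichP H c (low H c E) W

lemma embed4 {K W : ℕ} {H : SimpleGraph (Fin n)} {c : Fin n → Fin r} (hg : Gen H c K)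
    {lw : Fin n → Prop} (hrich : RichP H c lw W) (hW : WW r K ≤ W) (col : ℕ → Fin r) (Q : Fin 4 → Fin n)
    (hQ : Injective Q) (hlow : ∀ k, lw (Q k)) (pos : Fin 4 → ℕ)
    (hpos : Injective pos) (hpl : ∀ k, pos k < 2 * r + 2)
    (hadj : ∀ k k', k < k' → (H.Adj (Q k) (Q k') ↔ ¬ cyc (2 * r + 2) (pos k) (pos k')))
    (hcol : ∀ q q', q < q' → q' < 2 * r + 2 → (∀ k, q ≠ pos k) → (∀ k, q' ≠ pos k) → col q = col q' →
      cyc (2 * r + 2) q q')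
    (hcb : ∀ q, q < 2 * r + 2 → (∀ k, q ≠ pos k) → ∀ k, c (Q k) = col q → cyc (2 * r + 2) q (pos k)) :
    HasC r H := by
  have hinv : ∀ k, invFun pos (pos k) = k := Function.leftInverse_invFun hpos
  have hmem : ∀ q, q ∉ univ.image pos → ∀ k, q ≠ pos k := by
    intro q hq k h; exact hq (by simp [h])
  refine embed_pat hg col (univ.image pos) ?_ (fun p => Q (invFun pos p)) ?_ ?_ ?_
  · intro p hp
    obtain ⟨k, -, rfl⟩ := mem_image.1 hp
    simpa using hpl k
  · intro p hp q hq hpq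
    obtain ⟨k, -, rfl⟩ := mem_image.1 hp
    obtain ⟨k', -, rfl⟩ := mem_image.1 hq
    simp only [hinv]
    have hne : k ≠ k' := fun h => hpq (by rw [h])
    refine ⟨fun h => hne (hQ h), ?_⟩
    rcases lt_or_gt_of_ne hne with h | h
    · exact hadj k k' h
    · rw [H.adj_comm, cyc_comm]; exact hadj k' k h
  · intro q q' hq hq' hqB hqB' hne h
    rcases lt_or_gt_of_ne hne with hl | hl
    · exact hcol q q' hl hq' (hmem q hqB) (hmem q' hqB') h
    · rw [cyc_comm]; exact hcol q' q hl hq (hmem q' hqB') (hmem q hqB) h.symm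
  · intro q hq hqB
    refine hW.trans ((hrich Q hQ hlow (col q) (fun k => ¬ cyc (2 * r + 2) q (pos k)) ?_).trans ?_)
    · intro k hk
      rw [not_not]; exact hcb q hq (hmem q hqB) k hk
    · refine card_le_card ?_
      intro x hx
      simp only [mem_filter, mem_univ, true_and] at hx ⊢
      refine ⟨hx.1, ?_⟩
      intro b hb
      obtain ⟨k, -, rfl⟩ := mem_image.1 hb
      simp only [hinv]
      exact hx.2 k

/-- all base vertices in a part `i`. -/
lemma embed4_part {K W : ℕ} (hr : 5 ≤ r) {H : SimpleGraph (Fin n)} {c : Fin n → Fin r} (hg : Gen H c K)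
    {lw : Fin n → Prop} (hrich : RichP H c lw W) (hW : WW r K ≤ W) (i : Fin r) {w0 w1 w2 w3 : Fin n}
    (h01 : w0 ≠ w1) (h02 : w0 ≠ w2) (h03 : w0 ≠ w3) (h12 : w1 ≠ w2) (h13 : w1 ≠ w3) (h23 : w2 ≠ w3)
    (l0 : lw w0) (l1 : lw w1) (l2 : lw w2) (l3 : lw w3)
    (c0 : c w0 = i) (c1 : c w1 = i) (c2 : c w2 = i) (c3 : c w3 = i)
    (p1 p2 p3 : ℕ) (q01 : 0 < p1) (q12 : p1 < p2) (q23 : p2 < p3) (q3 : p3 < 12)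
    (e1 : p1 % 2 = 1) (e2 : p2 % 2 = 0) (e3 : p3 % 2 = 1)
    (a01 : H.Adj w0 w1 ↔ p1 ≠ 1) (a02 : H.Adj w0 w2) (a03 : H.Adj w0 w3 ↔ p3 ≠ 11 ∨ 5 < r)
    (a12 : H.Adj w1 w2 ↔ p1 + 1 ≠ p2) (a13 : H.Adj w1 w3) (a23 : H.Adj w2 w3 ↔ p2 + 1 ≠ p3) : HasC r H := by
  have hi : ∃ i1 : Fin r, ∃ i2 : Fin r, i ≠ i1 ∧ i ≠ i2 ∧ i1 ≠ i2 := by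
    have := i.2
    by_cases h0 : (i : ℕ) = 0
    · exact ⟨⟨1, by omega⟩, ⟨2, by omega⟩, by simp [Fin.ext_iff, h0], by simp [Fin.ext_iff, h0], by simp⟩
    · by_cases h1 : (i : ℕ) = 1
      · exact ⟨⟨0, by omega⟩, ⟨2, by omega⟩, by simp [Fin.ext_iff, h1], by simp [Fin.ext_iff, h1], by simp⟩
      · exact ⟨⟨0, by omega⟩, ⟨1, by omega⟩, by simp [Fin.ext_iff, h0], by simp [Fin.ext_iff, h1], by simp⟩
  obtain ⟨i1, i2, hi1, hi2, hi12⟩ := hi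
  obtain ⟨e, he, he0, -, -⟩ := enum3 (r := r) (g0 := r - 1) (g1 := 0) (g2 := 1) (by omega) (by omega) (by omega)
    (by omega) (by omega) (by omega) hi1 hi2 hi12
  have hposn : ∀ q, (∀ k, q ≠ (![0, p1, p2, p3] : Fin 4 → ℕ) k) → q ≠ 0 ∧ q ≠ p1 ∧ q ≠ p2 ∧ q ≠ p3 := by
    intro q h
    exact ⟨h 0, h 1, h 2, h 3⟩
  set idx : ℕ → ℕ := fun q => (q - (1 + (if p1 < q then 1 else 0) + (if p2 < q then 1 else 0) +
    (if p3 < q then 1 else 0))) / 2 with hidx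
  have hidxlt : ∀ q, q < 2 * r + 2 → q ≠ 0 → q ≠ p1 → q ≠ p2 → q ≠ p3 → idx q < r - 1 := by
    intro q hq _ _ _ _
    simp only [hidx]
    split_ifs <;> omega
  have hidxeq : ∀ q q', q < q' → q' < 2 * r + 2 → q ≠ 0 → q ≠ p1 → q ≠ p2 → q ≠ p3 →
      q' ≠ 0 → q' ≠ p1 → q' ≠ p2 → q' ≠ p3 → idx q = idx q' → q + 1 = q' := by
    intro q q' hq _ _ _ _ _ _ _ _ _ h
    simp only [hidx] at h
    split_ifs at h <;> omega
  refine embed4 hg hrich hW (fun q => e (idx q)) ![w0, w1, w2, w3] ?_ ?_ ![0, p1, p2, p3] ?_ ?_ ?_ ?_ ?_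
  · intro a b; fin_cases a <;> fin_cases b <;> simp [*, Ne.symm] <;> tauto
  · intro k; fin_cases k <;> simpa
  · intro a b; fin_cases a <;> fin_cases b <;> simp <;> omega
  · intro k; fin_cases k <;> simp <;> omega
  · intro k k' h
    have b01 : H.Adj w0 w1 ↔ ¬ cyc (2 * r + 2) 0 p1 := by rw [a01]; unfold cyc; omega
    have b02 : H.Adj w0 w2 ↔ ¬ cyc (2 * r + 2) 0 p2 := by unfold cyc; simp only [a02, true_iff]; omega
    have b03 : H.Adj w0 w3 ↔ ¬ cyc (2 * r + 2) 0 p3 := by rw [a03]; unfold cyc; omega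
    have b12 : H.Adj w1 w2 ↔ ¬ cyc (2 * r + 2) p1 p2 := by rw [a12]; unfold cyc; omega
    have b13 : H.Adj w1 w3 ↔ ¬ cyc (2 * r + 2) p1 p3 := by unfold cyc; simp only [a13, true_iff]; omega
    have b23 : H.Adj w2 w3 ↔ ¬ cyc (2 * r + 2) p2 p3 := by rw [a23]; unfold cyc; omega
    fin_cases k <;> fin_cases k' <;> first | exact b01 | exact b02 | exact b03 | exact b12 | exact b13 | exact b23 | (exfalso; revert h; decide)
  · intro q q' hqq hq' h1 h2 h
    obtain ⟨x0, x1, x2, x3⟩ := hposn q h1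
    obtain ⟨y0, y1, y2, y3⟩ := hposn q' h2
    have z := hidxlt q (by omega) x0 x1 x2 x3
    have z' := hidxlt q' (by omega) y0 y1 y2 y3
    have := hidxeq q q' hqq hq' x0 x1 x2 x3 y0 y1 y2 y3 (he _ _ (by omega) (by omega) h)
    exact Or.inl this
  · intro q hq h1 k hk
    exfalso
    obtain ⟨x0, x1, x2, x3⟩ := hposn q h1
    have z := hidxlt q (by omega) x0 x1 x2 x3
    have hk' : c ((![w0, w1, w2, w3] : Fin 4 → Fin n) k) = i := by fin_cases k <;> simpa
    rw [hk', ← he0] at hk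
    have := he _ _ (by omega) (by omega) hk
    omega

/-- E1 -/
lemma noP4_P {K W : ℕ} (hr : 5 ≤ r) {H : SimpleGraph (Fin n)} {c : Fin n → Fin r} (hg : Gen H c K)
    {lw : Fin n → Prop} (hrich : RichP H c lw W) (hW : WW r K ≤ W) (hC : ¬ HasC r H) (i : Fin r) :
    NoP4 H (fun x => c x = i ∧ lw x) := by
  rintro a b d e ⟨ca, la⟩ ⟨cb, lb⟩ ⟨cd, ld⟩ ⟨ce, le⟩ had hae hbe ab bd de
  have hab := ab.ne
  have hbd := bd.ne
  have hde := de.ne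
  apply hC
  have ba := ab.symm
  have db := bd.symm
  have ed := de.symm
  by_cases x1 : H.Adj a d <;> by_cases x2 : H.Adj b e <;> by_cases x3 : H.Adj a e
  -- plan names: a b c d = a b d e
  · exact embed4_part hr hg hrich hW i (w0 := a) (w1 := b) (w2 := d) (w3 := e) hab had hae hbd hbe hde
      la lb ld le ca cb cd ce 3 6 9 (by omega) (by omega) (by omega) (by omega) rfl rfl rfl
      (by simp [ab]) x1 (by simp [x3]) (by simp [bd]) x2 (by simp [de])
  · -- ac + bd : a0 d1 b4 c7
    exact embed4_part hr hg hrich hW i (w0 := a) (w1 := e) (w2 := b) (w3 := d) hae hab had hbe.symm hde.symm hbd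
      la le lb ld ca ce cb cd 1 4 7 (by omega) (by omega) (by omega) (by omega) rfl rfl rfl
      (by simp [x3]) ab (by simp [x1]) (by simp [x2.symm]) ed (by simp [bd])
  · -- ac + ad : b0 d1 a4 c7
    exact embed4_part hr hg hrich hW i (w0 := b) (w1 := e) (w2 := a) (w3 := d) hbe hab.symm hbd hae.symm hde.symm had
      lb le la ld cb ce ca cd 1 4 7 (by omega) (by omega) (by omega) (by omega) rfl rfl rfl
      (by simp [x2]) ba (by simp [bd]) (by simp [x3.symm]) ed (by simp [x1])
  · -- ac : a0 d1 b2 c5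
    exact embed4_part hr hg hrich hW i (w0 := a) (w1 := e) (w2 := b) (w3 := d) hae hab had hbe.symm hde.symm hbd
      la le lb ld ca ce cb cd 1 2 5 (by omega) (by omega) (by omega) (by omega) rfl rfl rfl
      (by simp [x3]) ab (by simp [x1]) (by simp [H.adj_comm e b, x2]) ed (by simp [bd])
  · -- bd + ad : a0 c1 b4 d7
    exact embed4_part hr hg hrich hW i (w0 := a) (w1 := d) (w2 := b) (w3 := e) had hab hae hbd.symm hde hbe
      la ld lb le ca cd cb ce 1 4 7 (by omega) (by omega) (by omega) (by omega) rfl rfl rfl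
      (by simp [x1]) ab (by simp [x3]) (by simp [db]) de (by simp [x2])
  · -- bd : c0 a1 d2 b5
    exact embed4_part hr hg hrich hW i (w0 := d) (w1 := a) (w2 := e) (w3 := b) had.symm hde hbd.symm hae hab hbe.symm
      ld la le lb cd ca ce cb 1 2 5 (by omega) (by omega) (by omega) (by omega) rfl rfl rfl
      (by simp [H.adj_comm d a, x1]) de (by simp [db]) (by simp [x3]) ab (by simp [x2.symm])
  · -- ad : c0 a1 b4 d5
    exact embed4_part hr hg hrich hW i (w0 := d) (w1 := a) (w2 := b) (w3 := e) had.symm hbd.symm hde hab hae hbe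
      ld la lb le cd ca cb ce 1 4 5 (by omega) (by omega) (by omega) (by omega) rfl rfl rfl
      (by simp [H.adj_comm d a, x1]) db (by simp [de]) (by simp [ab]) x3 (by simp [x2])
  · -- none : c0 a1 d2 b3
    exact embed4_part hr hg hrich hW i (w0 := d) (w1 := a) (w2 := e) (w3 := b) had.symm hde hbd.symm hae hab hbe.symm
      ld la le lb cd ca ce cb 1 2 3 (by omega) (by omega) (by omega) (by omega) rfl rfl rfl
      (by simp [H.adj_comm d a, x1]) de (by simp [db]) (by simp [x3]) ab (by simp [H.adj_comm e b, x2])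

lemma noP4_low {K E W : ℕ} (hr : 5 ≤ r) {H : SimpleGraph (Fin n)} {c : Fin n → Fin r} (hg : Gen H c K)
    (hrich : RichAll H c E W) (hW : WW r K ≤ W) (hC : ¬ HasC r H) (i : Fin r) :
    NoP4 H (fun x => c x = i ∧ low H c E x) := noP4_P hr hg hrich hW hC i

lemma exists_third (hr : 5 ≤ r) (i i' : Fin r) : ∃ i2 : Fin r, i ≠ i2 ∧ i' ≠ i2 := by
  have hc : (({i, i'} : Finset (Fin r))ᶜ).Nonempty := by
    rw [← card_pos, card_compl, Fintype.card_fin]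
    have := Finset.card_le_two (a := i) (b := i')
    omega
  obtain ⟨x, hx⟩ := hc
  simp only [mem_compl, mem_insert, mem_singleton, not_or] at hx
  exact ⟨x, Ne.symm hx.1, Ne.symm hx.2⟩

/-- E2 -/
lemma embed_two_edges {K E W : ℕ} (hr : 5 ≤ r) {H : SimpleGraph (Fin n)} {c : Fin n → Fin r} (hg : Gen H c K)
    (hrich : RichAll H c E W) (hW : WW r K ≤ W) {i i' : Fin r} (hii : i ≠ i') {u v u' v' : Fin n}
    (lu : low H c E u) (lv : low H c E v) (lu' : low H c E u') (lv' : low H c E v')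
    (cu : c u = i) (cv : c v = i) (cu' : c u' = i') (cv' : c v' = i')
    (huv : H.Adj u v) (huv' : H.Adj u' v') (h1 : H.Adj u u') (h2 : H.Adj u v') (h3 : H.Adj v v') : HasC r H := by
  obtain ⟨i2, hi2, hi2'⟩ := exists_third hr i i'
  obtain ⟨e, he, he0, he1, -⟩ := enum3 (r := r) (g0 := 0) (g1 := 1) (g2 := 2) (by omega) (by omega) (by omega)
    (by omega) (by omega) (by omega) hii hi2 hi2'
  have hvu' : v ≠ u' := fun h => hii (by rw [← cv, ← cu', h])
  have hinj : Injective ![u, v, u', v'] := by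
    intro a b
    have := huv.ne
    have := huv'.ne
    have := h1.ne
    have := h2.ne
    have := h3.ne
    fin_cases a <;> fin_cases b <;> simp [*, Ne.symm]
  have hlow : ∀ k, low H c E (![u, v, u', v'] k) := by intro k; fin_cases k <;> simpa
  by_cases h4 : H.Adj v u'
  · set idx : ℕ → ℕ := fun q => if q = 1 then 0 else if q = 6 then 1 else if q < 5 then 2 else (q - 8) / 2 + 3 with hidx
    refine embed4 hg hrich hW (fun q => e (idx q)) ![u, v, u', v'] hinj hlow ![0, 2, 5, 7] (by decide) ?_ ?_ ?_ ?_
    · intro k; fin_cases k <;> simp <;> omega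
    · intro k k' h
      have b01 : H.Adj u v ↔ ¬ cyc (2 * r + 2) 0 2 := by simp only [huv, true_iff]; unfold cyc; omega
      have b02 : H.Adj u u' ↔ ¬ cyc (2 * r + 2) 0 5 := by simp only [h1, true_iff]; unfold cyc; omega
      have b03 : H.Adj u v' ↔ ¬ cyc (2 * r + 2) 0 7 := by simp only [h2, true_iff]; unfold cyc; omega
      have b12 : H.Adj v u' ↔ ¬ cyc (2 * r + 2) 2 5 := by simp only [h4, true_iff]; unfold cyc; omega
      have b13 : H.Adj v v' ↔ ¬ cyc (2 * r + 2) 2 7 := by simp only [h3, true_iff]; unfold cyc; omega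
      have b23 : H.Adj u' v' ↔ ¬ cyc (2 * r + 2) 5 7 := by simp only [huv', true_iff]; unfold cyc; omega
      fin_cases k <;> fin_cases k' <;> first | exact b01 | exact b02 | exact b03 | exact b12 | exact b13 | exact b23 | (exfalso; revert h; decide)
    · intro q q' hqq hq' h1 h2 h
      have x0 := h1 0
      have x1 := h1 1
      have x2 := h1 2
      have x3 := h1 3
      have y0 := h2 0
      have y1 := h2 1
      have y2 := h2 2
      have y3 := h2 3
      simp only [Matrix.cons_val] at x0 x1 x2 x3 y0 y1 y2 y3
      have hx : idx q = idx q' := he _ _ (by simp only [hidx]; split_ifs <;> omega) (by simp only [hidx]; split_ifs <;> omega) h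
      refine Or.inl ?_
      simp only [hidx] at hx
      split_ifs at hx <;> omega
    · intro q hq h1 k hk
      have x0 := h1 0
      have x1 := h1 1
      have x2 := h1 2
      have x3 := h1 3
      simp only [Matrix.cons_val] at x0 x1 x2 x3
      have hlt : idx q < r := by simp only [hidx]; split_ifs <;> omega
      have k0 : i = e (idx q) → q = 1 := by
        intro h; rw [← he0] at h
        have := he _ _ (by omega) hlt h
        simp only [hidx] at this; split_ifs at this <;> omega
      have k1 : i' = e (idx q) → q = 6 := by
        intro h; rw [← he1] at h
        have := he _ _ (by omega) hlt h
        simp only [hidx] at this; split_ifs at this <;> omega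
      fin_cases k <;> simp [cu, cv, cu', cv'] at hk ⊢ <;> first | (have := k0 hk; subst this; unfold cyc; omega) | (have := k1 hk; subst this; unfold cyc; omega)
  · set idx : ℕ → ℕ := fun q => if q = 1 then 0 else if q = 4 then 1 else (q - 6) / 2 + 2 with hidx
    refine embed4 hg hrich hW (fun q => e (idx q)) ![u, v, u', v'] hinj hlow ![0, 2, 3, 5] (by decide) ?_ ?_ ?_ ?_
    · intro k; fin_cases k <;> simp <;> omega
    · intro k k' h
      have b01 : H.Adj u v ↔ ¬ cyc (2 * r + 2) 0 2 := by simp only [huv, true_iff]; unfold cyc; omega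
      have b02 : H.Adj u u' ↔ ¬ cyc (2 * r + 2) 0 3 := by simp only [h1, true_iff]; unfold cyc; omega
      have b03 : H.Adj u v' ↔ ¬ cyc (2 * r + 2) 0 5 := by simp only [h2, true_iff]; unfold cyc; omega
      have b12 : H.Adj v u' ↔ ¬ cyc (2 * r + 2) 2 3 := by simp only [h4, false_iff]; unfold cyc; omega
      have b13 : H.Adj v v' ↔ ¬ cyc (2 * r + 2) 2 5 := by simp only [h3, true_iff]; unfold cyc; omega
      have b23 : H.Adj u' v' ↔ ¬ cyc (2 * r + 2) 3 5 := by simp only [huv', true_iff]; unfold cyc; omega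
      fin_cases k <;> fin_cases k' <;> first | exact b01 | exact b02 | exact b03 | exact b12 | exact b13 | exact b23 | (exfalso; revert h; decide)
    · intro q q' hqq hq' h1 h2 h
      have x0 := h1 0
      have x1 := h1 1
      have x2 := h1 2
      have x3 := h1 3
      have y0 := h2 0
      have y1 := h2 1
      have y2 := h2 2
      have y3 := h2 3
      simp only [Matrix.cons_val] at x0 x1 x2 x3 y0 y1 y2 y3
      have hx : idx q = idx q' := he _ _ (by simp only [hidx]; split_ifs <;> omega) (by simp only [hidx]; split_ifs <;> omega) h
      refine Or.inl ?_
      simp only [hidx] at hx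
      split_ifs at hx <;> omega
    · intro q hq h1 k hk
      have x0 := h1 0
      have x1 := h1 1
      have x2 := h1 2
      have x3 := h1 3
      simp only [Matrix.cons_val] at x0 x1 x2 x3
      have hlt : idx q < r := by simp only [hidx]; split_ifs <;> omega
      have k0 : i = e (idx q) → q = 1 := by
        intro h; rw [← he0] at h
        have := he _ _ (by omega) hlt h
        simp only [hidx] at this; split_ifs at this <;> omega
      have k1 : i' = e (idx q) → q = 4 := by
        intro h; rw [← he1] at h
        have := he _ _ (by omega) hlt h
        simp only [hidx] at this; split_ifs at this <;> omega
      fin_cases k <;> simp [cu, cv, cu', cv'] at hk ⊢ <;> first | (have := k0 hk; subst this; unfold cyc; omega) | (have := k1 hk; subst this; unfold cyc; omega)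

/-- class of two vertices -/
def cls2 (H : SimpleGraph (Fin n)) (c : Fin n → Fin r) (v v' : Fin n) (j : Fin r) (s s' : Prop) : ℕ :=
  (univ.filter (fun x => c x = j ∧ (H.Adj x v ↔ s) ∧ (H.Adj x v' ↔ s'))).card

def cls3 (H : SimpleGraph (Fin n)) (c : Fin n → Fin r) (v x y : Fin n) (j : Fin r) (s s' s'' : Prop) : ℕ :=
  (univ.filter (fun z => c z = j ∧ (H.Adj z v ↔ s) ∧ (H.Adj z x ↔ s') ∧ (H.Adj z y ↔ s''))).card

lemma embed_pair {K W : ℕ} (hr : 5 ≤ r) {H : SimpleGraph (Fin n)} {c : Fin n → Fin r} (hg : Gen H c K)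
    (hW : WW r K ≤ W) {v v' : Fin n} (hne : v ≠ v') (h11 : ∀ j, W ≤ cls2 H c v v' j True True)
    {a b d : Fin r} (hab : a ≠ b) (had : a ≠ d) (hbd : b ≠ d)
    (h : ∀ j, j = a ∨ j = b ∨ j = d → W ≤ cls2 H c v v' j True False ∧ W ≤ cls2 H c v v' j False True) :
    HasC r H := by
  obtain ⟨e, he, he0, he1, he2⟩ := enum3 (r := r) (g0 := 0) (g1 := 1) (g2 := r - 1) (by omega) (by omega) (by omega)
    (by omega) (by omega) (by omega) hab had hbd
  by_cases hadj : H.Adj v v'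
  · set idx : ℕ → ℕ := fun q => if q < 3 then 0 else (q - 2) / 2 with hidx
    refine embed_pat hg (fun q => e (idx q)) {0, 3} ?_ (fun p => if p = 0 then v else v') ?_ ?_ ?_
    · intro p; simp; omega
    · have h1 : ¬ cyc (2 * r + 2) 0 3 := by unfold cyc; omega
      have h2 : ¬ cyc (2 * r + 2) 3 0 := by unfold cyc; omega
      intro p hp q hq hpq
      simp only [mem_insert, mem_singleton] at hp hq
      rcases hp with rfl | rfl <;> rcases hq with rfl | rfl <;> simp [hne, hne.symm, hadj, hadj.symm, h1, h2] at hpq ⊢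
    · intro q q' hq hq' hqB hqB' hqq hc
      simp only [mem_insert, mem_singleton] at hqB hqB'
      have hx : idx q = idx q' := he _ _ (by simp only [hidx]; split_ifs <;> omega) (by simp only [hidx]; split_ifs <;> omega) hc
      simp only [hidx] at hx
      unfold cyc
      split_ifs at hx <;> omega
    · intro q hq hqB
      simp only [mem_insert, mem_singleton] at hqB
      have key : W ≤ cls2 H c v v' (e (idx q)) (¬ cyc (2 * r + 2) q 0) (¬ cyc (2 * r + 2) q 3) := by
        by_cases q1 : q = 1
        · subst q1
          have e1 : cyc (2 * r + 2) 1 0 := by unfold cyc; omega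
          have e2 : ¬ cyc (2 * r + 2) 1 3 := by unfold cyc; omega
          have := (h a (by simp)).2
          simpa [e1, e2, hidx, he0] using this
        by_cases q2 : q = 2
        · subst q2
          have e1 : ¬ cyc (2 * r + 2) 2 0 := by unfold cyc; omega
          have e2 : cyc (2 * r + 2) 2 3 := by unfold cyc; omega
          have := (h a (by simp)).1
          simpa [e1, e2, hidx, he0] using this
        by_cases q4 : q = 4
        · subst q4
          have e1 : ¬ cyc (2 * r + 2) 4 0 := by unfold cyc; omega
          have e2 : cyc (2 * r + 2) 4 3 := by unfold cyc; omega
          have := (h b (by simp)).1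
          simpa [e1, e2, hidx, he1] using this
        by_cases ql : q = 2 * r + 1
        · have e1 : cyc (2 * r + 2) q 0 := by unfold cyc; omega
          have e2 : ¬ cyc (2 * r + 2) q 3 := by unfold cyc; omega
          have := (h d (by simp)).2
          have e3 : idx q = r - 1 := by simp only [hidx]; split_ifs <;> omega
          simpa [e1, e2, e3, he2] using this
        · have e1 : ¬ cyc (2 * r + 2) q 0 := by unfold cyc; omega
          have e2 : ¬ cyc (2 * r + 2) q 3 := by unfold cyc; omega
          simpa [e1, e2] using h11 (e (idx q))
      refine hW.trans (key.trans (le_of_eq ?_))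
      unfold cls2
      congr 1
      ext x
      simp
  · set idx : ℕ → ℕ := fun q => (q - 2) / 2 with hidx
    have hadj' : ¬ H.Adj v' v := fun h => hadj h.symm
    refine embed_pat hg (fun q => e (idx q)) {0, 1} ?_ (fun p => if p = 0 then v else v') ?_ ?_ ?_
    · intro p; simp; omega
    · have h1 : cyc (2 * r + 2) 0 1 := by unfold cyc; omega
      have h2 : cyc (2 * r + 2) 1 0 := by unfold cyc; omega
      intro p hp q hq hpq
      simp only [mem_insert, mem_singleton] at hp hq
      rcases hp with rfl | rfl <;> rcases hq with rfl | rfl <;> simp [hne, hne.symm, hadj, hadj', h1, h2] at hpq ⊢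
    · intro q q' hq hq' hqB hqB' hqq hc
      simp only [mem_insert, mem_singleton] at hqB hqB'
      have hx : idx q = idx q' := he _ _ (by simp only [hidx]; omega) (by simp only [hidx]; omega) hc
      simp only [hidx] at hx
      unfold cyc
      omega
    · intro q hq hqB
      simp only [mem_insert, mem_singleton] at hqB
      have key : W ≤ cls2 H c v v' (e (idx q)) (¬ cyc (2 * r + 2) q 0) (¬ cyc (2 * r + 2) q 1) := by
        by_cases q2 : q = 2
        · subst q2
          have e1 : ¬ cyc (2 * r + 2) 2 0 := by unfold cyc; omega
          have e2 : cyc (2 * r + 2) 2 1 := by unfold cyc; omega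
          have := (h a (by simp)).1
          simpa [e1, e2, hidx, he0] using this
        by_cases ql : q = 2 * r + 1
        · have e1 : cyc (2 * r + 2) q 0 := by unfold cyc; omega
          have e2 : ¬ cyc (2 * r + 2) q 1 := by unfold cyc; omega
          have := (h d (by simp)).2
          have e3 : idx q = r - 1 := by simp only [hidx]; omega
          simpa [e1, e2, e3, he2] using this
        · have e1 : ¬ cyc (2 * r + 2) q 0 := by unfold cyc; omega
          have e2 : ¬ cyc (2 * r + 2) q 1 := by unfold cyc; omega
          simpa [e1, e2] using h11 (e (idx q))
      refine hW.trans (key.trans (le_of_eq ?_))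
      unfold cls2
      congr 1
      ext x
      simp

set_option maxHeartbeats 1000000 in
/-- E4 -/
lemma embed_triple {K W : ℕ} (hr : 5 ≤ r) {H : SimpleGraph (Fin n)} {c : Fin n → Fin r} (hg : Gen H c K)
    (hW : WW r K ≤ W) {v x y : Fin n} (hvx : H.Adj v x) (hxy : H.Adj x y) (hvy : v ≠ y) {i b1 b2 : Fin r}
    (h1 : i ≠ b1) (h2 : i ≠ b2) (h12 : b1 ≠ b2)
    (hw : W ≤ cls3 H c v x y i True False False)
    (hpos : ∀ j, j ≠ i → ∀ s s', W ≤ cls3 H c v x y j True s s')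
    (hneg : ∀ j, j = b1 ∨ j = b2 → ∀ s s', W ≤ cls3 H c v x y j False s s') : HasC r H := by
  by_cases hadj : H.Adj v y
  · obtain ⟨e, he, he0, he1, he2⟩ := enum3 (r := r) (g0 := 0) (g1 := 1) (g2 := r - 1) (f0 := b1) (f1 := b2) (f2 := i) (by omega) (by omega) (by omega)
      (by omega) (by omega) (by omega) h12 h1.symm h2.symm
    set idx : ℕ → ℕ := fun q => if q = 1 then r - 1 else if q < 5 then 0 else (q - 4) / 2 with hidx
    refine embed_pat hg (fun q => e (idx q)) {0, 2, 5} ?_ (fun p => if p = 0 then x else if p = 2 then y else v) ?_ ?_ ?_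
    · intro p; simp; omega
    · have k1 : ¬ cyc (2 * r + 2) 0 2 := by unfold cyc; omega
      have k2 : ¬ cyc (2 * r + 2) 0 5 := by unfold cyc; omega
      have k3 : ¬ cyc (2 * r + 2) 2 5 := by unfold cyc; omega
      have k1' : ¬ cyc (2 * r + 2) 2 0 := by unfold cyc; omega
      have k2' : ¬ cyc (2 * r + 2) 5 0 := by unfold cyc; omega
      have k3' : ¬ cyc (2 * r + 2) 5 2 := by unfold cyc; omega
      have := hvx.ne
      have := hxy.ne
      have := hvx.ne.symm
      have := hxy.ne.symm
      have := hvx.symm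
      have := hxy.symm
      have := hadj.symm
      have := hvy.symm
      intro p hp q hq hpq
      simp only [mem_insert, mem_singleton] at hp hq
      rcases hp with rfl | rfl | rfl <;> rcases hq with rfl | rfl | rfl <;> simp [*] at hpq ⊢
    · intro q q' hq hq' hqB hqB' hqq hc
      simp only [mem_insert, mem_singleton] at hqB hqB'
      have hx : idx q = idx q' := he _ _ (by simp only [hidx]; split_ifs <;> omega) (by simp only [hidx]; split_ifs <;> omega) hc
      simp only [hidx] at hx
      unfold cyc
      split_ifs at hx <;> omega
    · intro q hq hqB
      simp only [mem_insert, mem_singleton] at hqB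
      have key : W ≤ cls3 H c v x y (e (idx q)) (¬ cyc (2 * r + 2) q 5) (¬ cyc (2 * r + 2) q 0) (¬ cyc (2 * r + 2) q 2) := by
        by_cases q1 : q = 1
        · subst q1
          have e1 : cyc (2 * r + 2) 1 0 := by unfold cyc; omega
          have e2 : cyc (2 * r + 2) 1 2 := by unfold cyc; omega
          have e3 : ¬ cyc (2 * r + 2) 1 5 := by unfold cyc; omega
          simpa [e1, e2, e3, hidx, he2] using hw
        by_cases q4 : q = 4
        · subst q4
          have e3 : cyc (2 * r + 2) 4 5 := by unfold cyc; omega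
          simpa [e3, hidx, he0] using hneg b1 (by simp) (¬ cyc (2 * r + 2) 4 0) (¬ cyc (2 * r + 2) 4 2)
        by_cases q6 : q = 6
        · subst q6
          have e3 : cyc (2 * r + 2) 6 5 := by unfold cyc; omega
          simpa [e3, hidx, he1] using hneg b2 (by simp) (¬ cyc (2 * r + 2) 6 0) (¬ cyc (2 * r + 2) 6 2)
        · have e3 : ¬ cyc (2 * r + 2) q 5 := by unfold cyc; omega
          have := hpos (e (idx q)) (by
            intro hh; rw [← he2] at hh
            have := he _ _ (by simp only [hidx]; split_ifs <;> omega) (by omega) hh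
            simp only [hidx] at this; split_ifs at this <;> omega) (¬ cyc (2 * r + 2) q 0) (¬ cyc (2 * r + 2) q 2)
          simpa [e3] using this
      refine hW.trans (key.trans (le_of_eq ?_))
      unfold cls3
      congr 1
      ext z
      simp
      tauto
  · obtain ⟨e, he, he0, he1, he2⟩ := enum3 (r := r) (g0 := r - 2) (g1 := 1) (g2 := r - 1) (f0 := b1) (f1 := b2) (f2 := i) (by omega) (by omega) (by omega)
      (by omega) (by omega) (by omega) h12 h1.symm h2.symm
    set idx : ℕ → ℕ := fun q => if q = 2 then r - 1 else (q - 4) / 2 with hidx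
    have hadj' : ¬ H.Adj y v := fun h => hadj h.symm
    refine embed_pat hg (fun q => e (idx q)) {0, 1, 3} ?_ (fun p => if p = 0 then v else if p = 1 then y else x) ?_ ?_ ?_
    · intro p; simp; omega
    · have k1 : cyc (2 * r + 2) 0 1 := by unfold cyc; omega
      have k2 : ¬ cyc (2 * r + 2) 0 3 := by unfold cyc; omega
      have k3 : ¬ cyc (2 * r + 2) 1 3 := by unfold cyc; omega
      have k1' : cyc (2 * r + 2) 1 0 := by unfold cyc; omega
      have k2' : ¬ cyc (2 * r + 2) 3 0 := by unfold cyc; omega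
      have k3' : ¬ cyc (2 * r + 2) 3 1 := by unfold cyc; omega
      have := hvx.ne
      have := hxy.ne
      have := hvx.ne.symm
      have := hxy.ne.symm
      have := hvx.symm
      have := hxy.symm
      have := hvy.symm
      intro p hp q hq hpq
      simp only [mem_insert, mem_singleton] at hp hq
      rcases hp with rfl | rfl | rfl <;> rcases hq with rfl | rfl | rfl <;> simp [*] at hpq ⊢
    · intro q q' hq hq' hqB hqB' hqq hc
      simp only [mem_insert, mem_singleton] at hqB hqB'
      have hx : idx q = idx q' := he _ _ (by simp only [hidx]; split_ifs <;> omega) (by simp only [hidx]; split_ifs <;> omega) hc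
      simp only [hidx] at hx
      unfold cyc
      split_ifs at hx <;> omega
    · intro q hq hqB
      simp only [mem_insert, mem_singleton] at hqB
      have key : W ≤ cls3 H c v x y (e (idx q)) (¬ cyc (2 * r + 2) q 0) (¬ cyc (2 * r + 2) q 3) (¬ cyc (2 * r + 2) q 1) := by
        by_cases q1 : q = 2
        · subst q1
          have e1 : ¬ cyc (2 * r + 2) 2 0 := by unfold cyc; omega
          have e2 : cyc (2 * r + 2) 2 1 := by unfold cyc; omega
          have e3 : cyc (2 * r + 2) 2 3 := by unfold cyc; omega
          simpa [e1, e2, e3, hidx, he2] using hw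
        by_cases q4 : q = 2 * r + 1
        · have e3 : cyc (2 * r + 2) q 0 := by unfold cyc; omega
          have e4 : idx q = r - 2 := by simp only [hidx]; split_ifs <;> omega
          simpa [e3, e4, he0] using hneg b1 (by simp) (¬ cyc (2 * r + 2) q 3) (¬ cyc (2 * r + 2) q 1)
        · have e3 : ¬ cyc (2 * r + 2) q 0 := by unfold cyc; omega
          have := hpos (e (idx q)) (by
            intro hh; rw [← he2] at hh
            have := he _ _ (by simp only [hidx]; split_ifs <;> omega) (by omega) hh
            simp only [hidx] at this; split_ifs at this <;> omega) (¬ cyc (2 * r + 2) q 3) (¬ cyc (2 * r + 2) q 1)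
          simpa [e3] using this
      refine hW.trans (key.trans (le_of_eq ?_))
      unfold cls3
      congr 1
      ext z
      simp
      tauto

lemma close_aux {s K L : ℕ} {H1 H2 : SimpleGraph (Fin n)} {c1 c2 : Fin n → Fin r} {q : Fin s → Fin n}
    (hag : AgreeOff q H1 H2) (g2 : Gen H2 c2 K) (i1 : inner H1 c1 ≤ L) (hK : 2 * L < K * K)
    {i j j' : Fin r} (hj : j ≠ j')
    (hb : 2 * K ≤ (univ.filter (fun v => (∀ k, q k ≠ v) ∧ c1 v = i ∧ c2 v = j)).card)
    (hb' : 2 * K ≤ (univ.filter (fun v => (∀ k, q k ≠ v) ∧ c1 v = i ∧ c2 v = j')).card) : False := by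
  set B := univ.filter (fun v => (∀ k, q k ≠ v) ∧ c1 v = i ∧ c2 v = j) with hB
  set D := univ.filter (fun v => (∀ k, q k ≠ v) ∧ c1 v = i ∧ c2 v = j') with hD
  have h1 := (g2 j B (by intro b hb; simp [hB] at hb; exact hb.2.2) (by omega)).1
  set X := univ.filter (fun v => c2 v ≠ j ∧ 4 * (B.filter (fun b => H2.Adj v b)).card < B.card) with hX
  have h2 := Finset.le_card_sdiff X D
  have h3 : ∑ v ∈ D \ X, K ≤ 2 * inner H1 c1 := by
    unfold inner
    rw [mul_sum]
    refine (sum_le_sum (fun v hv => ?_)).trans (Finset.sum_le_sum_of_subset (Finset.subset_univ (D \ X)))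
    rw [Finset.mem_sdiff] at hv
    obtain ⟨hvD, hvX⟩ := hv
    simp only [hD, mem_filter, mem_univ, true_and] at hvD
    simp only [hX, mem_filter, mem_univ, true_and, not_and, not_lt] at hvX
    have h4 := hvX (by rw [hvD.2.2]; exact hj.symm)
    have h5 : (B.filter (fun b => H2.Adj v b)).card ≤ (nbs H1 c1 v (c1 v)).card := by
      refine card_le_card ?_
      intro w hw
      simp only [hB, mem_filter, mem_univ, true_and] at hw
      simp only [nbs, mem_filter, mem_univ, true_and]
      refine ⟨by rw [hw.1.2.1, hvD.2.1], (hag v w hvD.1 hw.1.1).2 hw.2⟩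
    omega
  rw [sum_const, smul_eq_mul] at h3
  have : K * K ≤ (D \ X).card * K := Nat.mul_le_mul_right _ (by omega)
  omega

lemma AgreeOff.symm {s : ℕ} {q : Fin s → Fin n} {H H' : SimpleGraph (Fin n)} (h : AgreeOff q H H') :
    AgreeOff q H' H := fun x y hx hy => (h x y hx hy).symm

lemma closeness {s K L : ℕ} {H1 H2 : SimpleGraph (Fin n)} {c1 c2 : Fin n → Fin r} {q : Fin s → Fin n}
    (hag : AgreeOff q H1 H2) (g1 : Gen H1 c1 K) (g2 : Gen H2 c2 K) (i1 : inner H1 c1 ≤ L) (i2 : inner H2 c2 ≤ L)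
    (hK : 2 * L < K * K) : ∃ σ : Equiv.Perm (Fin r),
      (univ.filter (fun v => c2 v ≠ σ (c1 v))).card ≤ r * r * (2 * K) + s := by
  set N : Fin r → Fin r → Finset (Fin n) := fun i j =>
    univ.filter (fun v => (∀ k, q k ≠ v) ∧ c1 v = i ∧ c2 v = j) with hN
  set big : Fin r → Fin r → Prop := fun i j => 2 * K ≤ (N i j).card with hbig
  have u1 : ∀ i j j', big i j → big i j' → j = j' := by
    intro i j j' h h'
    by_contra hne
    exact close_aux hag g2 i1 hK hne h h'
  have u2 : ∀ i i' j, big i j → big i' j → i = i' := by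
    intro i i' j h h'
    by_contra hne
    refine close_aux hag.symm g1 i2 hK (i := j) hne ?_ ?_
    · simp only [hbig, hN] at h
      convert h using 4; tauto
    · simp only [hbig, hN] at h'
      convert h' using 4; tauto
  obtain ⟨σ, hσ⟩ : ∃ σ : Equiv.Perm (Fin r), ∀ i j, big i j → σ i = j := by
    set f : Fin r → Fin r := fun i => if h : ∃ j, big i j then h.choose else i with hf
    have hf' : ∀ i j, big i j → f i = j := by
      intro i j h
      have hex : ∃ j, big i j := ⟨j, h⟩
      simp only [hf, hex, dif_pos]
      exact u1 i _ _ hex.choose_spec h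
    obtain ⟨g, hg⟩ := Finset.exists_equiv_extend_of_card_eq (α := Fin r) (t := (univ : Finset (Fin r)))
      (by simp) (s := univ.filter (fun i => ∃ j, big i j)) (f := f) (Finset.subset_univ _) (by
        intro a ha b hb hab
        simp only [coe_filter, mem_univ, true_and, mem_ofPred_eq] at ha hb
        obtain ⟨j, hj⟩ := ha
        obtain ⟨j', hj'⟩ := hb
        rw [hf' a j hj, hf' b j' hj'] at hab
        subst hab
        exact u2 a b j hj hj')
    refine ⟨g.trans (Equiv.subtypeUnivEquiv (by simp)), ?_⟩
    intro i j h
    have := hg i (by simp; exact ⟨j, h⟩)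
    rw [hf' i j h] at this
    exact this
  refine ⟨σ, ?_⟩
  have hsub : (univ.filter (fun v => c2 v ≠ σ (c1 v))) ⊆
      ((univ : Finset (Fin r × Fin r)).biUnion (fun p => if big p.1 p.2 then ∅ else N p.1 p.2)) ∪
        univ.image q := by
    intro v hv
    simp only [mem_filter, mem_univ, true_and] at hv
    rw [mem_union]
    by_cases hq : ∃ k, q k = v
    · right; simpa using hq
    · left
      push Not at hq
      rw [mem_biUnion]
      refine ⟨(c1 v, c2 v), mem_univ _, ?_⟩
      rw [if_neg]
      · simp only [hN, mem_filter, mem_univ, true_and, and_true]; exact hq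
      · intro h; exact hv (hσ _ _ h).symm
  refine (card_le_card hsub).trans ((card_union_le _ _).trans (add_le_add ?_ ?_))
  · refine (card_biUnion_le_card_mul _ _ (2 * K) ?_).trans ?_
    · intro p _
      split_ifs with h
      · simp
      · simp only [hbig, not_le] at h; exact h.le
    · simp
  · refine card_image_le.trans ?_
    simp

def Near (hr : 0 < r) (ν η : ℝ) {n : ℕ} (H : SimpleGraph (Fin n)) : Prop :=
  (inner H (opt hr H) : ℝ) ≤ η * n ^ 2 ∧ Gen H (opt hr H) ⌈ν * n⌉₊ ∧
    ∀ j, |((part (opt hr H) j).card : ℝ) - n / r| ≤ ν * n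

lemma near_close (hr : 0 < r) {ν η : ℝ} (hν : 0 < ν) (hη : 2 * η < ν ^ 2) {n s : ℕ} (hn : 0 < n)
    {H1 H2 : SimpleGraph (Fin n)} {q : Fin s → Fin n} (hag : AgreeOff q H1 H2)
    (h1 : Near hr ν η H1) (h2 : Near hr ν η H2) : ∃ σ : Equiv.Perm (Fin r),
      ((univ.filter (fun v => opt hr H2 v ≠ σ (opt hr H1 v))).card : ℝ) ≤ r * r * (2 * (ν * n + 1)) + s := by
  obtain ⟨σ, hσ⟩ := closeness hag h1.2.1 h2.2.1 (L := max (inner H1 (opt hr H1)) (inner H2 (opt hr H2)))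
    (le_max_left _ _) (le_max_right _ _) (by
      have a1 := h1.1
      have a2 := h2.1
      have hn' : (0:ℝ) < n := by exact_mod_cast hn
      have : ((max (inner H1 (opt hr H1)) (inner H2 (opt hr H2)) : ℕ) : ℝ) ≤ η * n ^ 2 := by
        push_cast; exact max_le a1 a2
      have hc := Nat.le_ceil (ν * n)
      have : (2:ℝ) * (max (inner H1 (opt hr H1)) (inner H2 (opt hr H2)) : ℕ) < ⌈ν * n⌉₊ * ⌈ν * n⌉₊ := by
        have : ν * n * (ν * n) ≤ (⌈ν * n⌉₊ : ℝ) * ⌈ν * n⌉₊ := by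
          apply mul_le_mul hc hc (by positivity) (by positivity)
        nlinarith [sq_nonneg (n:ℝ), pow_pos hn' 2]
      exact_mod_cast this)
  refine ⟨σ, ?_⟩
  have hc := (Nat.ceil_lt_add_one (show 0 ≤ ν * n by positivity)).le
  calc ((univ.filter (fun v => opt hr H2 v ≠ σ (opt hr H1 v))).card : ℝ)
      ≤ ((r * r * (2 * ⌈ν * n⌉₊) + s : ℕ) : ℝ) := by exact_mod_cast hσ
    _ ≤ _ := by push_cast; gcongr

lemma gain_near (hr : 2 ≤ r) (hr0 : 0 < r) (s : ℕ) (hs : 1 ≤ s) {γ : ℝ} (hγ : 0 < γ) :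
    ∃ ζ : ℝ, 0 < ζ ∧ ∃ ζ0 : ℝ, 0 < ζ0 ∧ ∀ ν η : ℝ, 0 < ν → ν ≤ ζ0 → 2 * η < ν ^ 2 → ∀ A : Fam,
      (∀ᶠ n in atTop, ∃ P : (Fin s → Fin n) → SimpleGraph (Fin n) → Prop,
        (∀ H ∈ A n, ¬ HasC r H ∧ Near hr0 ν η H ∧ ∃ q, Injective q ∧ P q H) ∧
        (∀ q, Injective q → ∀ H1, P q H1 → Near hr0 ν η H1 →
          ∃ (D : Type) (_ : Fintype D) (T : D → Fin n → Set (Fin s → Bool)) (a : D → Fin n → ℝ),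
          (∀ d x, 1 ≤ a d x) ∧ (∀ d x, ((T d x).ncard : ℝ) ≤ a d x) ∧
          (∀ d, Fintype.card D * ∏ x, a d x ≤ 2 ^ ((s * al r - γ) * n)) ∧
          ∀ H, P q H → Near hr0 ν η H → ¬ HasC r H → AgreeOff q H1 H → opt hr0 H = opt hr0 H1 →
            ∃ d, ((univ.filter (fun x => rows q H x ∉ T d x)).card : ℝ) ≤ ζ * n)) →
      Small r A := by
  obtain ⟨ζ, hζ, h⟩ := gain_small hr s hs hγ
  refine ⟨ζ, hζ, ζ / (4 * r * r), by positivity, ?_⟩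
  intro ν η hν hνζ hη A hev
  refine h A (fun n H => opt hr0 H) ?_
  have hlarge : ∀ᶠ n : ℕ in atTop, (r * r * 2 + s : ℝ) ≤ ζ / 2 * n := by
    have : Tendsto (fun n : ℕ => ζ / 2 * (n:ℝ)) atTop atTop :=
      Tendsto.const_mul_atTop (by positivity) tendsto_natCast_atTop_atTop
    exact this.eventually_ge_atTop _
  filter_upwards [hev, hlarge, eventually_gt_atTop 0] with n hn hl hn0
  obtain ⟨P, hA, hP⟩ := hn
  refine ⟨fun q H => P q H ∧ Near hr0 ν η H ∧ ¬ HasC r H, ?_, ?_, ?_⟩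
  · intro H hH
    obtain ⟨a1, a2, q, hq, a3⟩ := hA H hH
    exact ⟨a1, q, hq, a3, a2, a1⟩
  · intro q hq H0 H h0 h1 hag
    obtain ⟨σ, hσ⟩ := near_close hr0 hν hη hn0 hag h0.2.1 h1.2.1
    refine ⟨σ, hσ.trans ?_⟩
    rw [le_div_iff₀ (by positivity)] at hνζ
    have : ν * (4 * r * r) * n ≤ ζ * n := by gcongr
    nlinarith
  · intro q hq H0 h0 c
    by_cases hex : ∃ H1, (P q H1 ∧ Near hr0 ν η H1 ∧ ¬ HasC r H1) ∧ AgreeOff q H0 H1 ∧ opt hr0 H1 = c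
    · obtain ⟨H1, b1, b2, b3⟩ := hex
      obtain ⟨D, fD, T, a, e1, e2, e3, e4⟩ := hP q hq H1 b1.1 b1.2.1
      refine ⟨D, fD, T, a, e1, e2, e3, ?_⟩
      intro H hH hag hc
      refine e4 H hH.1 hH.2.1 hH.2.2 ?_ (by rw [hc, b3])
      intro x y hx hy
      rw [← b2 x y hx hy, hag x y hx hy]
    · refine ⟨Empty, inferInstance, fun d => d.elim, fun d => d.elim, fun d => d.elim, fun d => d.elim,
        fun d => d.elim, ?_⟩
      intro H hH hag hc
      exact absurd ⟨H, hH, hag, hc⟩ hex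

lemma prod_bal {ν : ℝ} (c : Fin n → Fin r)
    (hbal : ∀ j, |((part c j).card : ℝ) - n / r| ≤ ν * n) (b : Fin r → ℝ) :
    ∏ x, (2:ℝ) ^ (b (c x)) ≤ 2 ^ ((∑ j, b j) * (n / r) + ν * n * ∑ j, |b j|) := by
  rw [← Real.rpow_sum_of_pos (by norm_num)]
  apply rpow_le_rpow_of_exponent_le (by norm_num)
  have : ∑ x, b (c x) = ∑ j, ((part c j).card : ℝ) * b j := by
    rw [← Finset.sum_fiberwise (s := univ) (g := c)]
    refine sum_congr rfl fun j _ => ?_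
    rw [sum_congr rfl (g := fun _ => b j)]
    · simp [part]
    · intro x hx; simp at hx; rw [hx]
  rw [this, Finset.sum_mul, mul_sum, ← sum_add_distrib]
  refine sum_le_sum fun j _ => ?_
  have h1 := hbal j
  have h2 : (((part c j).card : ℝ) - n / r) * b j ≤ |((part c j).card : ℝ) - n / r| * |b j| := by
    rw [← abs_mul]; exact le_abs_self _
  have h3 : |((part c j).card : ℝ) - n / r| * |b j| ≤ ν * n * |b j| := by gcongr
  linarith

lemma ev_const_le {γ : ℝ} (hγ : 0 < γ) (M : ℝ) : ∀ᶠ n : ℕ in atTop, M ≤ 2 ^ (γ * (n:ℝ)) := by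
  have h1 : Tendsto (fun n : ℕ => γ * (n:ℝ)) atTop atTop :=
    Tendsto.const_mul_atTop hγ tendsto_natCast_atTop_atTop
  exact ((tendsto_rpow_atTop_of_base_gt_one 2 (by norm_num)).comp h1).eventually_ge_atTop M

lemma ev_lin_ge {γ : ℝ} (hγ : 0 < γ) (M : ℝ) : ∀ᶠ n : ℕ in atTop, M ≤ γ * (n:ℝ) :=
  (Tendsto.const_mul_atTop hγ tendsto_natCast_atTop_atTop).eventually_ge_atTop M

lemma gain_col (hr : 2 ≤ r) (hr0 : 0 < r) (s : ℕ) (hs : 1 ≤ s) (M : ℕ) {κ : ℝ} (hκ : 0 < κ) :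
    ∃ ζ : ℝ, 0 < ζ ∧ ∃ ζ0 : ℝ, 0 < ζ0 ∧ ∀ ν η : ℝ, 0 < ν → ν ≤ ζ0 → 2 * η < ν ^ 2 → ∀ A : Fam,
      (∀ᶠ n in atTop, ∃ P : (Fin s → Fin n) → SimpleGraph (Fin n) → Prop,
        (∀ H ∈ A n, ¬ HasC r H ∧ Near hr0 ν η H ∧ ∃ q, Injective q ∧ P q H) ∧
        (∀ q, Injective q → ∀ H1, P q H1 → Near hr0 ν η H1 →
          ∃ (D : Type) (_ : Fintype D) (T : D → Fin r → Set (Fin s → Bool)) (b : D → Fin r → ℝ),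
          Fintype.card D ≤ M ∧ (∀ d j, 0 ≤ b d j) ∧ (∀ d j, b d j ≤ s) ∧
          (∀ d j, ((T d j).ncard : ℝ) ≤ 2 ^ (b d j)) ∧
          (∀ d, ∑ j, b d j ≤ s * (r - 1) - κ) ∧
          ∀ H, P q H → Near hr0 ν η H → ¬ HasC r H → AgreeOff q H1 H → opt hr0 H = opt hr0 H1 →
            ∃ d, ((univ.filter (fun x => rows q H x ∉ T d (opt hr0 H1 x))).card : ℝ) ≤ ζ * n)) →
      Small r A := by
  have hrp : (0:ℝ) < r := by exact_mod_cast hr0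
  have hsp : (0:ℝ) < s := by exact_mod_cast hs
  set γ := κ / (4 * r) with hγd
  have hγ : 0 < γ := by positivity
  obtain ⟨ζ, hζ, ζ0, hζ0, h⟩ := gain_near hr hr0 s hs hγ
  refine ⟨ζ, hζ, min ζ0 (κ / (2 * r * r * s)), by positivity, ?_⟩
  intro ν η hν hν0 hη A hev
  refine h ν η hν (hν0.trans (min_le_left _ _)) hη A ?_
  have hν1 := hν0.trans (min_le_right _ _)
  filter_upwards [hev, ev_const_le hγ M] with n hn hM
  obtain ⟨P, hA, hP⟩ := hn
  refine ⟨P, hA, ?_⟩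
  intro q hq H1 hP1 hN1
  obtain ⟨D, fD, T, b, hD, hb0, hbs, hT, hsum, hH⟩ := hP q hq H1 hP1 hN1
  refine ⟨D, fD, fun d x => T d (opt hr0 H1 x), fun d x => 2 ^ (b d (opt hr0 H1 x)), ?_, ?_, ?_, hH⟩
  · intro d x; exact Real.one_le_rpow (by norm_num) (hb0 d _)
  · intro d x; exact hT d _
  · intro d
    have h1 := prod_bal (opt hr0 H1) hN1.2.2 (b d)
    have h2 : ∑ j, |b d j| ≤ r * s := by
      calc ∑ j, |b d j| ≤ ∑ j : Fin r, (s:ℝ) := sum_le_sum fun j _ => by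
            rw [abs_of_nonneg (hb0 d j)]; exact hbs d j
        _ = _ := by simp
    have hD' : (Fintype.card D : ℝ) ≤ 2 ^ (γ * n) := le_trans (by exact_mod_cast hD) hM
    calc (Fintype.card D : ℝ) * ∏ x, (2:ℝ) ^ (b d (opt hr0 H1 x))
        ≤ 2 ^ (γ * n) * 2 ^ ((∑ j, b d j) * (n / r) + ν * n * ∑ j, |b d j|) := by gcongr
      _ = 2 ^ (γ * n + ((∑ j, b d j) * (n / r) + ν * n * ∑ j, |b d j|)) := by
          rw [rpow_add (by norm_num) (γ * n)]
      _ ≤ 2 ^ ((s * al r - γ) * n) := by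
          apply rpow_le_rpow_of_exponent_le (by norm_num)
          have e1 : (∑ j, b d j) * (n / r) ≤ (s * (r - 1) - κ) * (n / r) := by
            gcongr; exact hsum d
          have e2 : ν * n * ∑ j, |b d j| ≤ κ / (2 * r * r * s) * n * (r * s) := by gcongr
          have e3 : (s * (r - 1) - κ) * ((n:ℝ) / r) = s * al r * n - 4 * γ * n := by
            rw [hγd]; unfold al; field_simp; try ring
          have e4 : κ / (2 * r * r * s) * n * (r * s) = 2 * γ * n := by
            rw [hγd]; field_simp; try ring
          nlinarith

/-- count of boolean patterns supported outside a set -/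
lemma ncard_pat {s : ℕ} (p : Fin s → Prop) :
    ({f : Fin s → Bool | ∀ k, p k → f k = false} : Set (Fin s → Bool)).ncard =
      2 ^ (univ.filter (fun k => ¬ p k)).card := by
  have : ({f : Fin s → Bool | ∀ k, p k → f k = false} : Set (Fin s → Bool)) =
      ↑(Fintype.piFinset (fun k => if p k then ({false} : Finset Bool) else univ)) := by
    ext f
    simp only [mem_ofPred_eq, mem_coe, Fintype.mem_piFinset]
    refine forall_congr' fun k => ?_
    split_ifs with h <;> simp [h]
  rw [this, ncard_coe_finset, Fintype.card_piFinset]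
  have : ∀ k, (if p k then ({false} : Finset Bool) else univ).card = if ¬ p k then 2 else 1 := by
    intro k; split_ifs <;> simp_all
  simp only [this]
  rw [prod_ite]; simp

lemma sum_out {s : ℕ} (f : Fin s → Fin r) :
    ∑ j : Fin r, ((univ.filter (fun k => ¬ f k = j)).card : ℝ) = s * (r - 1) := by
  have : ∀ j : Fin r, ((univ.filter (fun k => ¬ f k = j)).card : ℝ) = ∑ k : Fin s, if f k = j then (0:ℝ) else 1 := by
    intro j; rw [card_filter]; push_cast
    refine sum_congr rfl fun k _ => ?_
    split_ifs <;> simp_all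
  simp only [this]
  rw [sum_comm]
  have : ∀ k : Fin s, ∑ j : Fin r, (if f k = j then (0:ℝ) else 1) = r - 1 := by
    intro k
    have : ∀ j : Fin r, (if f k = j then (0:ℝ) else 1) = 1 - if f k = j then 1 else 0 := by
      intro j; split_ifs <;> simp
    simp only [this, Finset.sum_sub_distrib]; simp
  simp only [this]; simp [mul_sub]

/-- low vertices: few inner neighbours -/
lemma low_exc {s E : ℕ} {H : SimpleGraph (Fin n)} {c : Fin n → Fin r} {q : Fin s → Fin n}
    (hq : ∀ k, low H c E (q k)) :
    (univ.filter (fun x => ∃ k, c (q k) = c x ∧ H.Adj x (q k))).card ≤ s * E := by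
  have : univ.filter (fun x => ∃ k, c (q k) = c x ∧ H.Adj x (q k)) ⊆
      (univ : Finset (Fin s)).biUnion (fun k => nbs H c (q k) (c (q k))) := by
    intro x hx
    simp only [mem_filter, mem_univ, true_and] at hx
    obtain ⟨k, h1, h2⟩ := hx
    rw [mem_biUnion]
    exact ⟨k, mem_univ _, by simp [nbs, h1, h2.symm]⟩
  refine (card_le_card this).trans ((card_biUnion_le_card_mul _ _ E (fun k _ => (hq k).le)).trans ?_)
  simp

lemma A2 (hr : 2 ≤ r) (hr0 : 0 < r) : ∃ ζ : ℝ, 0 < ζ ∧ ∀ ε μ : ℝ, 0 < ε → ε ≤ ζ → 0 < μ → μ ≤ ζ →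
    ∃ ζ0 : ℝ, 0 < ζ0 ∧ ∀ ν η : ℝ, 0 < ν → ν ≤ ζ0 → 2 * η < ν ^ 2 →
      Small r (fun n => {H | ¬ HasC r H ∧ Near hr0 ν η H ∧ ¬ RichAll H (opt hr0 H) ⌈ε * n⌉₊ ⌈μ * n⌉₊}) := by
  set κ : ℝ := logb 2 (16 / 15) with hκd
  have hκ : 0 < κ := Real.logb_pos (by norm_num) (by norm_num)
  have hrp : (2:ℝ) ≤ r := by exact_mod_cast hr
  obtain ⟨ζ, hζ, ζ0, hζ0, h⟩ := gain_col hr hr0 4 (by norm_num) (r * 2 ^ 4) hκ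
  refine ⟨min (ζ / 20) (1 / (40 * r)), by positivity, ?_⟩
  intro ε μ hε hεζ' hμ hμζ'
  have hεζ := hεζ'.trans (min_le_left _ _)
  have hμζ := hμζ'.trans (min_le_left _ _)
  have hεr := hεζ'.trans (min_le_right _ _)
  have hμr := hμζ'.trans (min_le_right _ _)
  refine ⟨min ζ0 (1 / (4 * r)), by positivity, ?_⟩
  intro ν η hν hν0 hη
  have hν1 := hν0.trans (min_le_right _ _)
  refine h ν η hν (hν0.trans (min_le_left _ _)) hη _ ?_
  filter_upwards [ev_lin_ge (γ := ζ / 2) (by positivity) 5, ev_lin_ge (γ := 1 / (4 * r)) (by positivity) 5,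
    eventually_gt_atTop 0] with n hn5 hn1 hn0
  have hnp : (0:ℝ) < n := by exact_mod_cast hn0
  have hcE := (Nat.ceil_lt_add_one (show 0 ≤ ε * n by positivity)).le
  have hcM := (Nat.ceil_lt_add_one (show 0 ≤ μ * n by positivity)).le
  set E := ⌈ε * n⌉₊ with hE
  set W := ⌈μ * n⌉₊ with hW
  have hEn : ε * n ≤ ζ / 20 * n := by gcongr
  have hMn : μ * n ≤ ζ / 20 * n := by gcongr
  have hexc : (4 * E + W : ℝ) ≤ ζ * n := by linarith
  refine ⟨fun q H => (∀ k, low H (opt hr0 H) E (q k)) ∧ ∃ j : Fin r, ∃ s : Fin 4 → Bool,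
    (∀ k, opt hr0 H (q k) = j → s k = false) ∧
    (univ.filter (fun x => opt hr0 H x = j ∧ ∀ k, (H.Adj x (q k) ↔ s k = true))).card < W, ?_, ?_⟩
  · intro H hH
    obtain ⟨h1, h2, h3⟩ := hH
    refine ⟨h1, h2, ?_⟩
    unfold RichAll RichP at h3
    push Not at h3
    obtain ⟨Q, hQ, hlow, j, s, hs, hlt⟩ := h3
    refine ⟨Q, hQ, hlow, j, fun k => decide (s k), ?_, ?_⟩
    · intro k hk; simpa using hs k hk
    · simpa using hlt
  · intro q hq H1 hP1 hN1
    set c := opt hr0 H1 with hc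
    set m : Fin r → ℕ := fun j => (univ.filter (fun k => ¬ c (q k) = j)).card with hm
    have hm4 : ∀ j, m j ≤ 4 := fun j => (card_le_univ _).trans (by simp)
    -- base sets
    set S : Fin r → Set (Fin 4 → Bool) := fun j => {f | ∀ k, c (q k) = j → f k = false} with hS
    have hSc : ∀ j, (S j).ncard = 2 ^ (m j) := fun j => by
      simp only [hS, hm]; convert ncard_pat (fun k => c (q k) = j)
    refine ⟨{p : Fin r × (Fin 4 → Bool) // 1 ≤ m p.1 ∧ p.2 ∈ S p.1}, inferInstance,
      fun d j => if j = d.1.1 then S j \ {d.1.2} else S j,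
      fun d j => if j = d.1.1 then logb 2 (2 ^ m j - 1) else m j, ?_, ?_, ?_, ?_, ?_, ?_⟩
    · refine (Fintype.card_subtype_le _).trans ?_
      simp
    · intro d j
      have hd := d.2.1
      simp only
      split_ifs with hj
      · subst hj
        apply Real.logb_nonneg (by norm_num)
        have : (2:ℝ) ^ 1 ≤ 2 ^ m d.1.1 := pow_le_pow_right₀ (by norm_num) hd
        linarith
      · positivity
    · intro d j
      simp only
      have hmj : (m j : ℝ) ≤ 4 := by exact_mod_cast hm4 j
      split_ifs with hj
      · subst hj
        have : (2:ℝ) ^ 1 ≤ 2 ^ m d.1.1 := pow_le_pow_right₀ (by norm_num) d.2.1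
        have h2 : logb 2 (2 ^ m d.1.1 - 1) ≤ logb 2 (2 ^ m d.1.1) :=
          Real.logb_le_logb_of_le (by norm_num) (by linarith) (by linarith)
        rw [Real.logb_pow, Real.logb_self_eq_one (by norm_num)] at h2
        push_cast; linarith
      · exact_mod_cast hmj
    · intro d j
      simp only
      split_ifs with hj
      · subst hj
        have : (2:ℝ) ^ 1 ≤ 2 ^ m d.1.1 := pow_le_pow_right₀ (by norm_num) d.2.1
        rw [Real.rpow_logb (by norm_num) (by norm_num) (by linarith)]
        rw [Set.ncard_sdiff_singleton_of_mem d.2.2, hSc]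
        rw [Nat.cast_sub Nat.one_le_two_pow]
        push_cast; rfl
      · rw [hSc, rpow_natCast]; push_cast; rfl
    · intro d
      have h1 : ∀ j, (if j = d.1.1 then logb 2 (2 ^ m j - 1) else (m j : ℝ)) ≤ m j - if j = d.1.1 then κ else 0 := by
        intro j
        split_ifs with hj
        · subst hj
          have h2 : (2:ℝ) ^ 1 ≤ 2 ^ m d.1.1 := pow_le_pow_right₀ (by norm_num) d.2.1
          have h3 : (2:ℝ) ^ m d.1.1 ≤ 2 ^ 4 := pow_le_pow_right₀ (by norm_num) (hm4 _)
          have h4 : logb 2 (2 ^ m d.1.1 - 1) + κ ≤ logb 2 (2 ^ m d.1.1) := by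
            rw [hκd, ← Real.logb_mul (by linarith) (by norm_num)]
            apply Real.logb_le_logb_of_le (by norm_num)
            · nlinarith
            · nlinarith
          rw [Real.logb_pow, Real.logb_self_eq_one (by norm_num)] at h4
          linarith
        · simp
      refine (sum_le_sum fun j _ => h1 j).trans ?_
      rw [Finset.sum_sub_distrib, sum_out (fun k => c (q k))]
      simp
    · intro H hP hN hC hag hopt
      obtain ⟨hlow, j, s, hs, hlt⟩ := hP
      rw [hopt] at hlow hs hlt
      have hmj : 1 ≤ m j := by
        by_contra hm0
        have hm0' : m j = 0 := by omega
        simp only [hm, Finset.card_eq_zero, Finset.filter_eq_empty_iff, mem_univ, true_implies, not_not] at hm0'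
        have h1 : part c j ⊆ (univ.filter (fun x => c x = j ∧ ∀ k, (H.Adj x (q k) ↔ s k = true))) ∪
            univ.filter (fun x => ∃ k, c (q k) = c x ∧ H.Adj x (q k)) := by
          intro x hx
          simp only [part, mem_filter, mem_univ, true_and] at hx
          rw [mem_union]
          by_cases hx' : ∃ k, c (q k) = c x ∧ H.Adj x (q k)
          · right; simpa using hx'
          · left
            push Not at hx'
            simp only [mem_filter, mem_univ, true_and]
            refine ⟨hx, fun k => ?_⟩
            have a1 := hs k (hm0' (x := k))
            have a2 := hx' k ((hm0' (x := k)).trans hx.symm)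
            simp [a1, a2]
        have h2 := (card_le_card h1).trans (card_union_le _ _)
        have h3 := low_exc hlow
        have h4 : ((part c j).card : ℝ) ≤ 4 * E + W := by
          have : (part c j).card ≤ 4 * E + W := by omega
          exact_mod_cast this
        have h5 := (abs_le.1 (hN1.2.2 j)).1
        have h6 : ε * n ≤ 1 / (40 * r) * n := by gcongr
        have h7 : μ * n ≤ 1 / (40 * r) * n := by gcongr
        have h8 : ν * n ≤ 1 / (4 * r) * n := by gcongr
        have h9 : 1 / (4 * r) * (n:ℝ) = n / r / 4 := by field_simp
        have h10 : 1 / (40 * r) * (n:ℝ) = n / r / 40 := by field_simp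
        rw [h9] at hn1 h8
        rw [h10] at h6 h7
        linarith
      refine ⟨⟨(j, s), hmj, ?_⟩, ?_⟩
      · simpa [hS] using hs
      · refine le_trans ?_ hexc
        have h1 : univ.filter (fun x => rows q H x ∉ if c x = j then S (c x) \ {s} else S (c x)) ⊆
            (univ.filter (fun x => c x = j ∧ ∀ k, (H.Adj x (q k) ↔ s k = true))) ∪
            univ.filter (fun x => ∃ k, c (q k) = c x ∧ H.Adj x (q k)) := by
          intro x hx
          simp only [mem_filter, mem_univ, true_and] at hx
          rw [mem_union]
          by_cases hx' : ∃ k, c (q k) = c x ∧ H.Adj x (q k)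
          · right; simpa using hx'
          · left
            push Not at hx'
            have hxS : rows q H x ∈ S (c x) := by
              simp only [hS, mem_ofPred_eq, rows]
              intro k hk; simpa using hx' k hk
            split_ifs at hx with hj
            · simp only [mem_filter, mem_univ, true_and]
              refine ⟨hj, ?_⟩
              have : rows q H x = s := by
                by_contra hne; exact hx ⟨hxS, hne⟩
              intro k
              rw [← this]; simp [rows]
            · exact absurd hxS hx
        have h2 := (card_le_card h1).trans (card_union_le _ _)
        have h3 := low_exc hlow
        have : (univ.filter (fun x => rows q H x ∉ if c x = j then S (c x) \ {s} else S (c x))).card ≤ 4 * E + W := by omega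
        exact_mod_cast this

lemma A3a (hr5 : 5 ≤ r) (hr : 2 ≤ r) (hr0 : 0 < r) : ∃ ζ : ℝ, 0 < ζ ∧ ∀ ε : ℝ, 0 < ε → ε ≤ ζ →
    ∃ ζ0 : ℝ, 0 < ζ0 ∧ ∀ ν η : ℝ, 0 < ν → ν ≤ ζ0 → 2 * η < ν ^ 2 →
      Small r (fun n => {H | ¬ HasC r H ∧ Near hr0 ν η H ∧
        ∃ v, (univ.filter (fun j => ⌈ε * n⌉₊ ≤ (gbs H (opt hr0 H) v j).card)).card ≤ 3}) := by
  have hrp : (5:ℝ) ≤ r := by exact_mod_cast hr5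
  obtain ⟨ζ, hζ, ζ0, hζ0, h⟩ := gain_col hr hr0 1 (by norm_num) (2 ^ r) (κ := 1) one_pos
  refine ⟨ζ / (2 * r), by positivity, ?_⟩
  intro ε hε hεζ
  refine ⟨ζ0, by positivity, ?_⟩
  intro ν η hν hν0 hη
  refine h ν η hν hν0 hη _ ?_
  filter_upwards [ev_lin_ge (γ := ζ / 2) (by positivity) r, eventually_gt_atTop 0] with n hn5 hn0
  have hnp : (0:ℝ) < n := by exact_mod_cast hn0
  have hcE := (Nat.ceil_lt_add_one (show 0 ≤ ε * n by positivity)).le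
  set E := ⌈ε * n⌉₊ with hE
  have hexc : (r * E : ℝ) ≤ ζ * n := by
    have : ε * n ≤ ζ / (2 * r) * n := by gcongr
    have h2 : ζ / (2 * r) * n * r = ζ / 2 * n := by field_simp
    nlinarith
  refine ⟨fun q H => (univ.filter (fun j => E ≤ (gbs H (opt hr0 H) (q 0) j).card)).card ≤ 3, ?_, ?_⟩
  · rintro H ⟨h1, h2, v, hv⟩
    exact ⟨h1, h2, fun _ => v, Function.injective_of_subsingleton _, hv⟩
  · intro q hq H1 hP1 hN1
    set c := opt hr0 H1 with hc
    refine ⟨{J : Finset (Fin r) // J.card ≤ 3}, inferInstance,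
      fun J j => if j ∈ J.1 then Set.univ else {fun _ => true},
      fun J j => if j ∈ J.1 then 1 else 0, ?_, ?_, ?_, ?_, ?_, ?_⟩
    · refine (Fintype.card_subtype_le _).trans ?_
      simp
    · intro d j; simp only; split_ifs <;> norm_num
    · intro d j; simp only; split_ifs <;> norm_num
    · intro d j
      simp only
      split_ifs
      · simp [ncard_univ]
      · simp
    · intro d
      have : ((d.1.card : ℕ) : ℝ) ≤ 3 := by exact_mod_cast d.2
      simp only [Finset.sum_ite_mem, univ_inter, sum_const, nsmul_eq_mul, mul_one]
      push_cast; linarith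
    · intro H hP hN hC hag hopt
      rw [hopt] at hP
      refine ⟨⟨_, hP⟩, le_trans ?_ hexc⟩
      have h1 : univ.filter (fun x => rows q H x ∉ if c x ∈ (univ.filter (fun j => E ≤ (gbs H c (q 0) j).card)) then Set.univ else {fun _ => true}) ⊆
        (univ.filter (fun j => ¬ E ≤ (gbs H c (q 0) j).card)).biUnion (fun j => gbs H c (q 0) j) := by
        intro x hx
        rw [mem_biUnion]
        simp only [mem_filter, mem_univ, true_and] at hx
        split_ifs at hx with hj
        · simp at hx
        · refine ⟨c x, by simpa using hj, ?_⟩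
          simp only [gbs, mem_filter, mem_univ, true_and]
          intro hadj
          apply hx
          simp only [Set.mem_singleton_iff]
          funext k
          have : k = 0 := Subsingleton.elim _ _
          subst this
          simpa [rows] using hadj.symm
      have h2 := (card_le_card h1).trans (card_biUnion_le_card_mul _ _ E (fun j hj => by
        simp only [mem_filter, mem_univ, true_and] at hj; omega))
      have h3 : (univ.filter (fun j : Fin r => ¬ E ≤ (gbs H c (q 0) j).card)).card ≤ r :=
        (card_le_univ _).trans (by simp)
      have : (univ.filter (fun x => rows q H x ∉ if c x ∈ (univ.filter (fun j => E ≤ (gbs H c (q 0) j).card)) then Set.univ else {fun _ => true})).card ≤ r * E :=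
        h2.trans (Nat.mul_le_mul_right _ h3)
      exact_mod_cast this

def okP (g : Fin 4 → Fin 4 → Fin 3) : Set (Fin 4 → Bool) := {f | ∀ k k', k < k' → okc (g k k') (f k) (f k') = true}

lemma okP_card (g : Fin 4 → Fin 4 → Fin 3) : (okP g).ncard ≤ cnt6 (g 0 1) (g 0 2) (g 0 3) (g 1 2) (g 1 3) (g 2 3) := by
  have : okP g ⊆ ↑((univ.filter (fun f : Bool × Bool × Bool × Bool => (okc (g 0 1) f.1 f.2.1 && okc (g 0 2) f.1 f.2.2.1 && okc (g 0 3) f.1 f.2.2.2 && okc (g 1 2) f.2.1 f.2.2.1 &&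
      okc (g 1 3) f.2.1 f.2.2.2 && okc (g 2 3) f.2.2.1 f.2.2.2) = true)).image (fun f => ![f.1, f.2.1, f.2.2.1, f.2.2.2])) := by
    intro f hf
    simp only [okP, mem_ofPred_eq] at hf
    simp only [Finset.coe_image, Set.mem_image, coe_filter, mem_univ, true_and, mem_ofPred_eq, Bool.and_eq_true]
    refine ⟨(f 0, f 1, f 2, f 3), ⟨⟨⟨⟨⟨?_, ?_⟩, ?_⟩, ?_⟩, ?_⟩, ?_⟩, ?_⟩
    · exact hf 0 1 (by decide)
    · exact hf 0 2 (by decide)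
    · exact hf 0 3 (by decide)
    · exact hf 1 2 (by decide)
    · exact hf 1 3 (by decide)
    · exact hf 2 3 (by decide)
    · funext k; fin_cases k <;> rfl
  refine (ncard_le_ncard this (Finset.finite_toSet _)).trans ?_
  rw [ncard_coe_finset]
  refine card_image_le.trans ?_
  rw [card_filter]
  rfl

def xx (g : Fin 4 → Fin 4 → Fin 3) : ℕ := two (g 0 1) + two (g 0 2) + two (g 0 3) + two (g 1 2) + two (g 1 3) + two (g 2 3)

lemma okP_bound (g : Fin 4 → Fin 4 → Fin 3) : ((okP g).ncard : ℝ) ≤ 2 ^ (min 4 ((24 + 3 * (xx g : ℝ)) / 10)) := by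
  have h1 : (okP g).ncard ≤ 16 := by
    refine (ncard_le_ncard (Set.subset_univ _) Set.finite_univ).trans ?_
    simp [ncard_univ]
  have h2 : ((okP g).ncard) ^ 10 ≤ 2 ^ (24 + 3 * xx g) := (Nat.pow_le_pow_left (okP_card g) 10).trans (cnt6_le _ _ _ _ _ _)
  rcases min_cases (4:ℝ) ((24 + 3 * (xx g : ℝ)) / 10) with h | h
  · rw [h.1]
    have : (2:ℝ) ^ (4:ℝ) = 16 := by norm_num
    rw [this]; exact_mod_cast h1
  · rw [h.1]
    have h3 : ((okP g).ncard : ℝ) ^ 10 ≤ ((2:ℝ) ^ ((24 + 3 * (xx g : ℝ)) / 10)) ^ 10 := by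
      rw [← rpow_natCast (2 ^ _), ← rpow_mul (by norm_num)]
      have : (24 + 3 * (xx g : ℝ)) / 10 * ((10:ℕ):ℝ) = ((24 + 3 * xx g : ℕ) : ℝ) := by push_cast; ring
      rw [this, rpow_natCast]
      exact_mod_cast h2
    exact le_of_pow_le_pow_left₀ (by norm_num) (by positivity) h3

/-- Each pair among the four vertices has at most two incomparable parts. -/
def Comp4 (H : SimpleGraph (Fin n)) (c : Fin n → Fin r) (M : ℕ) (q : Fin 4 → Fin n) : Prop :=
  ∀ k k', k < k' → (univ.filter (fun j => M ≤ cls2 H c (q k) (q k') j True False ∧ M ≤ cls2 H c (q k) (q k') j False True)).card ≤ 2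

lemma A3b (hr5 : 5 ≤ r) (hr : 2 ≤ r) (hr0 : 0 < r) : ∃ ζ : ℝ, 0 < ζ ∧ ∀ ε : ℝ, 0 < ε → ε ≤ ζ →
    ∃ ζ0 : ℝ, 0 < ζ0 ∧ ∀ ν η : ℝ, 0 < ν → ν ≤ ζ0 → 2 * η < ν ^ 2 →
      Small r (fun n => {H | ¬ HasC r H ∧ Near hr0 ν η H ∧
        ∃ q : Fin 4 → Fin n, Injective q ∧ Comp4 H (opt hr0 H) ⌈ε * n⌉₊ q}) := by
  have hrp : (5:ℝ) ≤ r := by exact_mod_cast hr5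
  obtain ⟨ζ, hζ, ζ0, hζ0, h⟩ := gain_col hr hr0 4 (by norm_num) (Fintype.card (Fin 4 → Fin 4 → Fin r → Fin 3)) (κ := 4/10) (by norm_num)
  refine ⟨ζ / (64 * r), by positivity, ?_⟩
  intro ε hε hεζ
  refine ⟨ζ0, by positivity, ?_⟩
  intro ν η hν hν0 hη
  refine h ν η hν hν0 hη _ ?_
  filter_upwards [ev_lin_ge (γ := ζ / 2) (by positivity) (32 * r), eventually_gt_atTop 0] with n hn5 hn0
  have hnp : (0:ℝ) < n := by exact_mod_cast hn0
  have hcE := (Nat.ceil_lt_add_one (show 0 ≤ ε * n by positivity)).le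
  set E := ⌈ε * n⌉₊ with hE
  have hexc : (32 * r * E : ℝ) ≤ ζ * n := by
    have : ε * n ≤ ζ / (64 * r) * n := by gcongr
    have h2 : ζ / (64 * r) * n * (32 * r) = ζ / 2 * n := by field_simp; norm_num
    nlinarith
  refine ⟨fun q H => Comp4 H (opt hr0 H) E q, ?_, ?_⟩
  · rintro H ⟨h1, h2, v, hv⟩
    exact ⟨h1, h2, v, hv⟩
  · clear_value E
    intro q hq H1 hP1 hN1
    set c := opt hr0 H1 with hc
    refine ⟨{g : Fin 4 → Fin 4 → Fin r → Fin 3 // ∀ k k', k < k' → (univ.filter (fun j => g k k' j = 2)).card ≤ 2}, inferInstance,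
      fun g j => okP (fun k k' => g.1 k k' j),
      fun g j => min 4 ((24 + 3 * (xx (fun k k' => g.1 k k' j) : ℝ)) / 10), ?_, ?_, ?_, ?_, ?_, ?_⟩
    · exact Fintype.card_subtype_le _
    · intro d j; simp only; positivity
    · intro d j; simp only; push_cast; exact min_le_left _ _
    · intro d j
      exact okP_bound _
    · intro d
      have h2 : ∀ k k', k < k' → ∑ j, two (d.1 k k' j) ≤ 2 := by
        intro k k' hk
        have := d.2 k k' hk
        rw [card_filter] at this
        exact this
      have h3 : ∑ j, xx (fun k k' => d.1 k k' j) ≤ 12 := by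
        simp only [xx, sum_add_distrib]
        have a1 := h2 0 1 (by decide)
        have a2 := h2 0 2 (by decide)
        have a3 := h2 0 3 (by decide)
        have a4 := h2 1 2 (by decide)
        have a5 := h2 1 3 (by decide)
        have a6 := h2 2 3 (by decide)
        omega
      have h4 : (∑ j, (xx (fun k k' => d.1 k k' j) : ℝ)) ≤ 12 := by exact_mod_cast h3
      calc _ ≤ ∑ j : Fin r, ((24 + 3 * (xx (fun k k' => d.1 k k' j) : ℝ)) / 10) := sum_le_sum fun j _ => min_le_right _ _
        _ = (24 * r + 3 * ∑ j, (xx (fun k k' => d.1 k k' j) : ℝ)) / 10 := by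
            rw [← Finset.sum_div, sum_add_distrib, ← mul_sum]; simp; ring
        _ ≤ _ := by push_cast; linarith
    · intro H hP hN hC hag hopt
      rw [hopt] at hP
      set g : Fin 4 → Fin 4 → Fin r → Fin 3 := fun k k' j =>
        if E ≤ cls2 H c (q k) (q k') j True False then (if E ≤ cls2 H c (q k) (q k') j False True then 2 else 1) else 0 with hg
      have hg2 : ∀ k k' j, g k k' j = 2 ↔ (E ≤ cls2 H c (q k) (q k') j True False ∧ E ≤ cls2 H c (q k) (q k') j False True) := by
        intro k k' j
        simp only [hg]; split_ifs with a1 a2 <;> simp_all only [and_self, and_false, false_and] <;> decide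
      refine ⟨⟨g, ?_⟩, le_trans ?_ hexc⟩
      · intro k k' hk
        simp only [hg2]
        exact hP k k' hk
      set Z : Fin 4 × Fin 4 × Fin r × Bool → Finset (Fin n) := fun p =>
        univ.filter (fun x => c x = p.2.2.1 ∧ (H.Adj x (q p.1) ↔ p.2.2.2 = true) ∧ (H.Adj x (q p.2.1) ↔ p.2.2.2 = false)) with hZ
      have h1 : univ.filter (fun x => rows q H x ∉ okP (fun k k' => g k k' (c x))) ⊆
        (univ.filter (fun p => (Z p).card ≤ E)).biUnion Z := by
        intro x hx
        rw [mem_biUnion]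
        replace hx := (mem_filter.1 hx).2
        simp only [okP, mem_ofPred_eq] at hx
        push Not at hx
        obtain ⟨k, k', hk, hx⟩ := hx
        have hz1 : ∀ j, cls2 H c (q k) (q k') j True False = (Z (k, k', j, true)).card := by
          intro j; simp [cls2, hZ]
        have hz2 : ∀ j, cls2 H c (q k) (q k') j False True = (Z (k, k', j, false)).card := by
          intro j; simp [cls2, hZ]
        simp only [hg] at hx
        split_ifs at hx with a1 a2
        · simp [okc] at hx
        · refine ⟨(k, k', c x, false), ?_, ?_⟩
          · rw [hz2] at a2; simp; omega
          · simp [okc, rows] at hx; simp [hZ]; tauto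
        · refine ⟨(k, k', c x, true), ?_, ?_⟩
          · rw [hz1] at a1; simp; omega
          · simp [okc, rows] at hx; simp [hZ]; tauto
      have h2 := (card_le_card h1).trans (card_biUnion_le_card_mul _ _ E (fun j hj => by
        simpa using hj))
      have h3 : (univ.filter (fun p => (Z p).card ≤ E)).card ≤ 32 * r :=
        (card_le_univ _).trans (by simp; omega)
      have : (univ.filter (fun x => rows q H x ∉ okP (fun k k' => g k k' (c x)))).card ≤ 32 * r * E :=
        h2.trans (Nat.mul_le_mul_right _ h3)
      exact_mod_cast this

def cnb (H : SimpleGraph (Fin n)) (c : Fin n → Fin r) (Q : Finset (Fin n)) (j : Fin r) : Finset (Fin n) :=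
  univ.filter (fun x => c x = j ∧ ∀ v ∈ Q, H.Adj v x)

lemma four_common {b E : ℕ} (hr : 0 < r) (hn : 0 < n) {H : SimpleGraph (Fin n)} {c : Fin n → Fin r} {B : Finset (Fin n)} (hB : B.card = b)
    (hE : ∀ v ∈ B, ∀ j, E ≤ (nbs H c v j).card) (hb : 4 * n ^ r ≤ b * E ^ r) :
    ∃ Q ⊆ B, Q.card = 4 ∧ ∀ j, n ≤ b * 2 ^ b * (cnb H c Q j).card := by
  set S : Fin n → Finset (Fin r → Fin n) := fun v => Fintype.piFinset (fun j => nbs H c v j) with hS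
  set SQ : Finset (Fin n) → Finset (Fin r → Fin n) := fun Q => Fintype.piFinset (fun j => cnb H c Q j) with hSQ
  have h1 : b * E ^ r ≤ ∑ v ∈ B, (S v).card := by
    rw [← hB, ← smul_eq_mul]
    refine card_nsmul_le_sum _ _ _ fun v hv => ?_
    simp only [hS, Fintype.card_piFinset]
    calc E ^ r = ∏ j : Fin r, E := by simp
      _ ≤ _ := Finset.prod_le_prod' fun j _ => hE v hv j
  have h2 : ∑ v ∈ B, (S v).card = ∑ ω : Fin r → Fin n, (B.filter (fun v => ω ∈ S v)).card := by
    simp only [card_filter]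
    rw [sum_comm]
    refine sum_congr rfl fun v _ => ?_
    rw [← card_filter]
    congr 1; ext; simp
  have h3 : ∀ ω : Fin r → Fin n, (B.filter (fun v => ω ∈ S v)).card ≤
      3 + ∑ Q ∈ B.powersetCard 4, if ω ∈ SQ Q then b else 0 := by
    intro ω
    by_cases h : (B.filter (fun v => ω ∈ S v)).card ≤ 3
    · omega
    · obtain ⟨Q, hQ, hQ4⟩ := Finset.exists_subset_card_eq (show 4 ≤ (B.filter (fun v => ω ∈ S v)).card by omega)
      have hQB : Q ∈ B.powersetCard 4 := by
        rw [Finset.mem_powersetCard]; exact ⟨hQ.trans (filter_subset _ _), hQ4⟩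
      have hω : ω ∈ SQ Q := by
        simp only [hSQ, Fintype.mem_piFinset, cnb, mem_filter, mem_univ, true_and]
        intro j
        have : ∀ v ∈ Q, c (ω j) = j ∧ H.Adj v (ω j) := by
          intro v hv
          have := (mem_filter.1 (hQ hv)).2
          simp only [hS, Fintype.mem_piFinset, nbs, mem_filter, mem_univ, true_and] at this
          exact this j
        obtain ⟨v, hv⟩ : Q.Nonempty := by rw [← card_pos]; omega
        exact ⟨(this v hv).1, fun v hv => (this v hv).2⟩
      have h5 : b ≤ ∑ Q ∈ B.powersetCard 4, if ω ∈ SQ Q then b else 0 := by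
        refine le_trans ?_ (Finset.single_le_sum (fun _ _ => Nat.zero_le _) hQB)
        simp [hω]
      have h6 : (B.filter (fun v => ω ∈ S v)).card ≤ b := hB ▸ card_le_card (filter_subset _ _)
      omega
  have h4 : n ^ r ≤ ∑ Q ∈ B.powersetCard 4, b * (SQ Q).card := by
    have h5 := sum_le_sum (s := univ) fun ω _ => h3 ω
    rw [sum_add_distrib, sum_comm] at h5
    have h6 : ∑ Q ∈ B.powersetCard 4, ∑ ω : Fin r → Fin n, (if ω ∈ SQ Q then b else 0) = ∑ Q ∈ B.powersetCard 4, b * (SQ Q).card := by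
      refine sum_congr rfl fun Q _ => ?_
      rw [Finset.sum_ite_mem]; simp [mul_comm]
    rw [h6] at h5
    simp only [sum_const, card_univ, Fintype.card_pi, prod_const, Fintype.card_fin, smul_eq_mul] at h5
    omega
  have h7 : ∃ Q ∈ B.powersetCard 4, n ^ r ≤ b * 2 ^ b * (SQ Q).card := by
    by_contra hcon
    push Not at hcon
    have hpc : (B.powersetCard 4).card ≤ 2 ^ b := by
      rw [Finset.card_powersetCard, hB]; exact Nat.choose_le_two_pow _ _
    have hne : (B.powersetCard 4).Nonempty := by
      by_contra h
      rw [Finset.not_nonempty_iff_eq_empty] at h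
      rw [h] at h4; simp at h4; omega
    have : ∑ Q ∈ B.powersetCard 4, 2 ^ b * (b * (SQ Q).card) < ∑ Q ∈ B.powersetCard 4, n ^ r := by
      refine Finset.sum_lt_sum_of_nonempty hne fun Q hQ => ?_
      have := hcon Q hQ
      calc _ = b * 2 ^ b * (SQ Q).card := by ring
        _ < _ := this
    rw [← mul_sum, sum_const, smul_eq_mul] at this
    have h8 : (B.powersetCard 4).card * n ^ r ≤ 2 ^ b * n ^ r := Nat.mul_le_mul_right _ hpc
    have h9 : 2 ^ b * n ^ r ≤ 2 ^ b * ∑ Q ∈ B.powersetCard 4, b * (SQ Q).card := Nat.mul_le_mul_left _ h4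
    omega
  obtain ⟨Q, hQ, h8⟩ := h7
  rw [Finset.mem_powersetCard] at hQ
  refine ⟨Q, hQ.1, hQ.2, fun j => ?_⟩
  have h9 : (SQ Q).card ≤ (cnb H c Q j).card * n ^ (r - 1) := by
    simp only [hSQ, Fintype.card_piFinset]
    rw [← Finset.mul_prod_erase _ _ (mem_univ j)]
    refine Nat.mul_le_mul_left _ ?_
    calc _ ≤ ∏ _x ∈ univ.erase j, n := Finset.prod_le_prod' fun i _ => (card_le_univ _).trans (by simp)
      _ = _ := by simp
  have h10 : n ^ r = n * n ^ (r - 1) := by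
    rw [← pow_succ']; congr 1; omega
  have h11 : n * n ^ (r - 1) ≤ (b * 2 ^ b * (cnb H c Q j).card) * n ^ (r - 1) := by
    rw [← h10]; refine h8.trans ?_
    rw [mul_assoc _ _ (n ^ (r-1))]
    exact Nat.mul_le_mul_left _ h9
  exact Nat.le_of_mul_le_mul_right h11 (by positivity)

/-- exceptional vertices -/
def BB (H : SimpleGraph (Fin n)) (c : Fin n → Fin r) (E : ℕ) : Finset (Fin n) :=
  univ.filter (fun v => ¬ low H c E v)

lemma BB_bounded {b E K M : ℕ} (hr5 : 5 ≤ r) (hr0 : 0 < r) (hn : 0 < n) {H : SimpleGraph (Fin n)}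
    (hC : ¬ HasC r H) (hg : Gen H (opt hr0 H) K) (hM : WW r K ≤ M) (hMn : b * 2 ^ b * WW r K < n)
    (hb : 4 * n ^ r ≤ b * E ^ r)
    (hcomp : ∀ q : Fin 4 → Fin n, Injective q → ¬ Comp4 H (opt hr0 H) M q) :
    (BB H (opt hr0 H) E).card < b := by
  by_contra hcon
  push Not at hcon
  obtain ⟨B, hBB, hBc⟩ := Finset.exists_subset_card_eq hcon
  set c := opt hr0 H with hc
  obtain ⟨Q, hQB, hQ4, hQ⟩ := four_common hr0 hn (H := H) (c := c) hBc (E := E) (by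
    intro v hv j
    have := (mem_filter.1 (hBB hv)).2
    have h2 := (opt_isOpt hr0 H).nb_le v j
    unfold low at this
    push Not at this
    exact this.trans h2) hb
  set q : Fin 4 → Fin n := fun k => Q.orderEmbOfFin hQ4 k with hq
  have hqi : Injective q := (Q.orderEmbOfFin hQ4).injective
  have hqm : ∀ k, q k ∈ Q := fun k => Finset.orderEmbOfFin_mem _ _ _
  have := hcomp q hqi
  unfold Comp4 at this
  push Not at this
  obtain ⟨k, k', hk, h3⟩ := this
  obtain ⟨a, b', d, ha, hb', hd, hab, had, hbd⟩ := Finset.two_lt_card.1 h3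
  apply hC
  refine embed_pair hr5 hg (W := WW r K) le_rfl (v := q k) (v' := q k') (hqi.ne hk.ne) ?_ hab had hbd ?_
  · intro j
    have h4 := hQ j
    have h5 : cnb H c Q j ⊆ univ.filter (fun x => c x = j ∧ (H.Adj x (q k) ↔ True) ∧ (H.Adj x (q k') ↔ True)) := by
      intro x hx
      simp only [cnb, mem_filter, mem_univ, true_and] at hx
      simp only [mem_filter, mem_univ, true_and, iff_true]
      exact ⟨hx.1, (hx.2 _ (hqm k)).symm, (hx.2 _ (hqm k')).symm⟩
    have h6 : (cnb H c Q j).card ≤ cls2 H c (q k) (q k') j True True := by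
      unfold cls2; convert card_le_card h5
    refine le_trans ?_ h6
    by_contra h7
    push Not at h7
    have : b * 2 ^ b * (cnb H c Q j).card ≤ b * 2 ^ b * WW r K := Nat.mul_le_mul_left _ h7.le
    omega
  · intro j hj
    have : j ∈ univ.filter (fun j => M ≤ cls2 H c (q k) (q k') j True False ∧ M ≤ cls2 H c (q k) (q k') j False True) := by
      rcases hj with rfl | rfl | rfl <;> assumption
    have := (mem_filter.1 this).2
    exact ⟨hM.trans this.1, hM.trans this.2⟩

/-- inner graph on the low vertices -/
def DD (H : SimpleGraph (Fin n)) (c : Fin n → Fin r) (E : ℕ) : SimpleGraph (Fin n) where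
  Adj x y := c x = c y ∧ H.Adj x y ∧ low H c E x ∧ low H c E y
  symm := ⟨fun _ _ h => ⟨h.1.symm, h.2.1.symm, h.2.2.2, h.2.2.1⟩⟩
  loopless := ⟨fun _ h => h.2.1.ne rfl⟩

def NP (D : SimpleGraph (Fin n)) : Prop := NoP4 D (fun _ => True)

lemma NP_DD {K E W : ℕ} (hr : 5 ≤ r) {H : SimpleGraph (Fin n)} {c : Fin n → Fin r} (hg : Gen H c K)
    (hrich : RichAll H c E W) (hW : WW r K ≤ W) (hC : ¬ HasC r H) : NP (DD H c E) := by
  intro a b d e _ _ _ _ had hae hbe ab bd de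
  refine noP4_low hr hg hrich hW hC (c a) a b d e ?_ ?_ ?_ ?_ had hae hbe ab.2.1 bd.2.1 de.2.1
  · exact ⟨rfl, ab.2.2.1⟩
  · exact ⟨ab.1.symm, bd.2.2.1⟩
  · exact ⟨bd.1.symm.trans ab.1.symm, de.2.2.1⟩
  · exact ⟨de.1.symm.trans (bd.1.symm.trans ab.1.symm), de.2.2.2⟩

lemma exists_gfun {D : SimpleGraph (Fin n)} (h : NP D) : ∃ g : Fin n → Fin n,
    (∀ x, g x = x ∨ D.Adj x (g x)) ∧ (∀ x y, D.Adj x y ↔ x ≠ y ∧ (g x = y ∨ g y = x)) := by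
  have hex : ∀ x, ∃ z, (x < z ∧ D.Adj x z ∧ ∀ w, x < w → D.Adj x w → z ≤ w) ∨
      ((∀ w, x < w → ¬ D.Adj x w) ∧ D.Adj x z ∧ ∀ w, D.Adj x w → z ≤ w) ∨ ((∀ w, ¬ D.Adj x w) ∧ z = x) := by
    intro x
    by_cases h1 : (univ.filter (fun w => x < w ∧ D.Adj x w)).Nonempty
    · obtain ⟨z, hz, hmin⟩ := Finset.exists_min_image _ id h1
      simp only [mem_filter, mem_univ, true_and, id] at hz hmin
      exact ⟨z, Or.inl ⟨hz.1, hz.2, fun w a b => hmin w ⟨a, b⟩⟩⟩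
    · rw [Finset.not_nonempty_iff_eq_empty, Finset.filter_eq_empty_iff] at h1
      have h1' : ∀ w, x < w → ¬ D.Adj x w := fun w hw ha => h1 (mem_univ w) ⟨hw, ha⟩
      by_cases h2 : (univ.filter (fun w => D.Adj x w)).Nonempty
      · obtain ⟨z, hz, hmin⟩ := Finset.exists_min_image _ id h2
        simp only [mem_filter, mem_univ, true_and, id] at hz hmin
        exact ⟨z, Or.inr (Or.inl ⟨h1', hz, hmin⟩)⟩
      · rw [Finset.not_nonempty_iff_eq_empty, Finset.filter_eq_empty_iff] at h2
        exact ⟨x, Or.inr (Or.inr ⟨fun w hw => h2 (mem_univ w) hw, rfl⟩)⟩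
  choose g hg using hex
  have h1 : ∀ x, g x = x ∨ D.Adj x (g x) := by
    intro x
    rcases hg x with h | h | h
    · exact Or.inr h.2.1
    · exact Or.inr h.2.1
    · exact Or.inl h.2
  have key : ∀ x y, x < y → D.Adj x y → g x = y ∨ g y = x := by
    intro x y hxy ha
    by_contra hcon
    push Not at hcon
    obtain ⟨hx, hy⟩ := hcon
    have hxz : x < g x ∧ D.Adj x (g x) ∧ g x < y := by
      rcases hg x with h | h | h
      · exact ⟨h.1, h.2.1, lt_of_le_of_ne (h.2.2 y hxy ha) hx⟩
      · exact absurd ha (h.1 y hxy)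
      · exact absurd ha (h.1 y)
    have hyw : D.Adj y (g y) ∧ g y ≠ g x := by
      rcases hg y with h | h | h
      · exact ⟨h.2.1, ne_of_gt (hxz.2.2.trans h.1)⟩
      · have := h.2.2 x ha.symm
        have h2 : g y < x := lt_of_le_of_ne this hy
        exact ⟨h.2.1, ne_of_lt (h2.trans hxz.1)⟩
      · exact absurd ha.symm (h.1 x)
    exact h (g y) y x (g x) trivial trivial trivial trivial hy hyw.2 (ne_of_gt hxz.2.2) hyw.1.symm ha.symm hxz.2.1
  refine ⟨g, h1, fun x y => ⟨fun ha => ⟨ha.ne, ?_⟩, ?_⟩⟩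
  · rcases lt_trichotomy x y with hxy | hxy | hxy
    · exact key x y hxy ha
    · exact absurd hxy ha.ne
    · exact (key y x hxy ha.symm).symm
  · rintro ⟨hne, h | h⟩
    · subst h
      rcases h1 x with h | h
      · exact absurd h.symm hne
      · exact h
    · subst h
      rcases h1 y with h | h
      · exact absurd h hne
      · exact h.symm

/-- an endpoint of an edge has degree at most two -/
lemma NP_small_end {D : SimpleGraph (Fin n)} (h : NP D) {u v : Fin n} (huv : D.Adj u v) :
    (univ.filter (fun x => D.Adj u x)).card ≤ 2 ∨ (univ.filter (fun x => D.Adj v x)).card ≤ 2 := by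
  by_contra hcon
  push Not at hcon
  obtain ⟨h1, h2⟩ := hcon
  obtain ⟨a, ha, hav⟩ : ∃ a ∈ univ.filter (fun x => D.Adj u x), a ≠ v := by
    by_contra hc; push Not at hc
    have : univ.filter (fun x => D.Adj u x) ⊆ {v} := fun x hx => by simpa using hc x hx
    have := card_le_card this; simp at this; omega
  obtain ⟨b, hb, hbn⟩ : ∃ b ∈ univ.filter (fun x => D.Adj v x), b ∉ ({u, a} : Finset (Fin n)) := by
    by_contra hc; push Not at hc
    have := card_le_card hc
    have := Finset.card_le_two (a := u) (b := a); omega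
  simp only [mem_filter, mem_univ, true_and, mem_insert, mem_singleton, not_or] at ha hb hbn
  exact h a u v b trivial trivial trivial trivial hav (Ne.symm hbn.2) (Ne.symm hbn.1) ha.symm huv hb

/-! ### counting graphs as pair functions -/

def prs (F : Fin n → Fin n → Prop) : Finset (Fin n × Fin n) :=
  univ.filter (fun p => p.1 < p.2 ∧ F p.1 p.2)

lemma pair_count (F : Fin n → Fin n → Prop) (D : Fin n → Fin n → Prop) :
    {H : SimpleGraph (Fin n) | ∀ x y, x < y → ¬ F x y → (H.Adj x y ↔ D x y)}.ncard ≤ 2 ^ (prs F).card := by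
  have h1 : {H : SimpleGraph (Fin n) | ∀ x y, x < y → ¬ F x y → (H.Adj x y ↔ D x y)}.ncard ≤
      ((prs F).powerset : Set (Finset (Fin n × Fin n))).ncard := by
    refine Set.ncard_le_ncard_of_injOn (fun H => (prs F).filter (fun p => H.Adj p.1 p.2)) ?_ ?_ (toFinite _)
    · intro H _
      rw [mem_coe, mem_powerset]
      exact filter_subset _ _
    · intro H hH H' hH' he
      simp only [mem_ofPred_eq] at hH hH'
      have key : ∀ x y, x < y → (H.Adj x y ↔ H'.Adj x y) := by
        intro x y hxy
        by_cases hF : F x y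
        · have := Finset.ext_iff.1 he (x, y)
          simpa [prs, hxy, hF] using this
        · rw [hH x y hxy hF, hH' x y hxy hF]
      ext x y
      rcases lt_trichotomy x y with hxy | hxy | hxy
      · exact key x y hxy
      · subst hxy; simp
      · rw [H.adj_comm, H'.adj_comm]; exact key y x hxy
  rw [ncard_coe_finset, card_powerset] at h1
  exact h1

lemma cross_sum (c : Fin n → Fin r) : (n:ℝ) ^ 2 ≤ r * ∑ j, ((part c j).card : ℝ) ^ 2 := by
  have h := sq_sum_le_card_mul_sum_sq (s := (univ : Finset (Fin r))) (f := fun j => ((part c j).card : ℝ))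
  have h2 : ∑ j, ((part c j).card : ℝ) = n := by
    have := Finset.card_eq_sum_card_fiberwise (s := (univ : Finset (Fin n))) (t := (univ : Finset (Fin r))) (f := c) (by simp [Set.MapsTo])
    simp only [card_univ, Fintype.card_fin] at this
    have h3 : (n:ℝ) = ((∑ b : Fin r, (univ.filter (fun a => c a = b)).card : ℕ) : ℝ) := by exact_mod_cast this
    rw [h3]; push_cast; rfl
  rw [h2] at h
  simpa using h

lemma cross_eq (c : Fin n → Fin r) :
    2 * ((prs (fun x y => c x ≠ c y)).card : ℝ) = n ^ 2 - ∑ j, ((part c j).card : ℝ) ^ 2 := by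
  have h1 : (univ.filter (fun p : Fin n × Fin n => c p.1 ≠ c p.2)).card = 2 * (prs (fun x y => c x ≠ c y)).card := by
    have : univ.filter (fun p : Fin n × Fin n => c p.1 ≠ c p.2) = prs (fun x y => c x ≠ c y) ∪
        (prs (fun x y => c x ≠ c y)).map ⟨Prod.swap, Prod.swap_injective⟩ := by
      ext ⟨x, y⟩
      simp only [prs, mem_filter, mem_univ, true_and, mem_union, Finset.mem_map, Function.Embedding.coeFn_mk, Prod.exists, Prod.swap_prod_mk, Prod.mk.injEq]
      constructor
      · intro h
        rcases lt_trichotomy x y with hxy | hxy | hxy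
        · exact Or.inl ⟨hxy, h⟩
        · exact absurd (congrArg c hxy) h
        · exact Or.inr ⟨y, x, ⟨hxy, Ne.symm h⟩, rfl, rfl⟩
      · rintro (⟨_, h⟩ | ⟨a, b, ⟨_, h⟩, rfl, rfl⟩)
        · exact h
        · exact Ne.symm h
    rw [this, Finset.card_union_of_disjoint, Finset.card_map]
    · ring
    · rw [Finset.disjoint_left]
      rintro ⟨x, y⟩ hp hq
      simp only [prs, mem_filter, mem_univ, true_and, Finset.mem_map, Function.Embedding.coeFn_mk, Prod.exists, Prod.swap_prod_mk, Prod.mk.injEq] at hp hq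
      obtain ⟨a, b, ⟨h, _⟩, rfl, rfl⟩ := hq
      exact lt_asymm h hp.1
  have h2 : (univ.filter (fun p : Fin n × Fin n => c p.1 = c p.2)).card = ∑ j, (part c j).card ^ 2 := by
    rw [Finset.card_eq_sum_card_fiberwise (f := fun p : Fin n × Fin n => c p.1) (t := (univ : Finset (Fin r))) (by simp [Set.MapsTo])]
    refine sum_congr rfl fun j _ => ?_
    rw [sq, ← card_product]
    congr 1
    ext ⟨x, y⟩
    simp only [mem_filter, mem_univ, true_and, mem_product, part]
    constructor
    · rintro ⟨h, h'⟩; exact ⟨h', h ▸ h'⟩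
    · rintro ⟨h, h'⟩; exact ⟨h.trans h'.symm, h⟩
  have h3 := Finset.card_filter_add_card_filter_not (s := (univ : Finset (Fin n × Fin n))) (fun p => c p.1 = c p.2)
  rw [h2] at h3
  simp only [card_univ, Fintype.card_prod, Fintype.card_fin] at h3
  have h4 : (univ.filter (fun p : Fin n × Fin n => ¬ c p.1 = c p.2)).card = 2 * (prs (fun x y => c x ≠ c y)).card := h1
  rw [h4] at h3
  have h5 : ((∑ j, (part c j).card ^ 2 + 2 * (prs (fun x y => c x ≠ c y)).card : ℕ) : ℝ) = ((n * n : ℕ) : ℝ) := by exact_mod_cast h3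
  push_cast at h5
  linarith

lemma cross_le (hr : 0 < r) (c : Fin n → Fin r) :
    ((prs (fun x y => c x ≠ c y)).card : ℝ) ≤ al r * n ^ 2 / 2 := by
  have h1 := cross_sum c
  have h2 := cross_eq c
  have hr' : (0:ℝ) < r := by exact_mod_cast hr
  unfold al
  have : (n:ℝ) ^ 2 / r ≤ ∑ j, ((part c j).card : ℝ) ^ 2 := by
    rw [div_le_iff₀ hr']; linarith
  have e : (1 - 1 / (r:ℝ)) * n ^ 2 / 2 = (n ^ 2 - n ^ 2 / r) / 2 := by ring
  rw [e]; linarith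

/-- vertices still having a neighbour after deleting `C` -/
def Us (D : SimpleGraph (Fin n)) (C : Finset (Fin n)) : Finset (Fin n) :=
  univ.filter (fun x => x ∉ C ∧ ∃ y, y ∉ C ∧ D.Adj x y)

def FewU (r b t K n : ℕ) : Set (SimpleGraph (Fin n)) :=
  {H | ∃ c : Fin n → Fin r, ∃ D : SimpleGraph (Fin n), NP D ∧ ∃ B : Finset (Fin n), B.card ≤ b ∧
    (∀ x y, c x = c y → x ∉ B → y ∉ B → (H.Adj x y ↔ D.Adj x y)) ∧ ∃ C : Finset (Fin n), C.card ≤ t ∧ (Us D C).card ≤ K}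

lemma prs_B (B : Finset (Fin n)) (F : Fin n → Fin n → Prop) :
    (prs (fun x y => F x y ∨ x ∈ B ∨ y ∈ B)).card ≤ (prs F).card + 2 * (B.card * n) := by
  have : prs (fun x y => F x y ∨ x ∈ B ∨ y ∈ B) ⊆ prs F ∪ (B ×ˢ univ ∪ univ ×ˢ B) := by
    intro p hp
    simp only [prs, mem_filter, mem_univ, true_and, mem_union, mem_product, and_true] at hp ⊢
    tauto
  refine (card_le_card this).trans ((card_union_le _ _).trans ?_)
  refine Nat.add_le_add_left ((card_union_le _ _).trans ?_) _
  simp only [card_product, card_univ, Fintype.card_fin]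
  rw [mul_comm n]; omega

lemma FewU_count {b t K : ℕ} (hr : 0 < r) (hn : 0 < n) : ((FewU r b t K n).ncard : ℝ) ≤
    r ^ n * 8 ^ n * ((n:ℝ) ^ (t + K) * (t + 1) ^ n * (2 ^ (al r * n ^ 2 / 2) * 2 ^ (2 * (b * n)))) := by
  set S : Set ((Fin n → Fin r) × Finset (Fin n) × Finset (Fin n) × Finset (Fin n)) :=
    {k | k.2.1.card ≤ b ∧ k.2.2.1.card ≤ t ∧ k.2.2.2.card ≤ K} with hS
  have h1 := cover_card (A := FewU r b t K n) S (fun k => {H | ∃ g : Fin n → Fin n,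
      (∀ x, x ∉ k.2.2.1 → x ∉ k.2.2.2 → g x ∈ insert x k.2.2.1) ∧
      ∀ x y, k.1 x = k.1 y → x ∉ k.2.1 → y ∉ k.2.1 → (H.Adj x y ↔ x ≠ y ∧ (g x = y ∨ g y = x))})
      (X := ((n:ℝ) ^ (t + K) * (t + 1) ^ n * (2 ^ (al r * n ^ 2 / 2) * 2 ^ (2 * (b * n))))) ?_ ?_
  · refine h1.trans ?_
    gcongr
    have h2 : S.ncard ≤ r ^ n * 8 ^ n := by
      refine (ncard_le_ncard (Set.subset_univ S) Set.finite_univ).trans ?_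
      rw [ncard_univ, Nat.card_eq_fintype_card]
      simp only [Fintype.card_prod, Fintype.card_finset, Fintype.card_fin, Fintype.card_pi, prod_const, card_univ]
      rw [show (8:ℕ) = 2 * (2 * 2) by norm_num, mul_pow, mul_pow]
    exact_mod_cast h2
  · rintro H ⟨c, D, hD, B, hB, hH, C, hC, hU⟩
    obtain ⟨g, hg1, hg2⟩ := exists_gfun hD
    refine ⟨(c, B, C, Us D C), ⟨hB, hC, hU⟩, g, ?_, ?_⟩
    · intro x hx hx'
      simp only [Us, mem_filter, mem_univ, true_and, not_and, not_exists] at hx'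
      rw [mem_insert]
      rcases hg1 x with h | h
      · exact Or.inl h
      · right
        by_contra hc
        exact hx' hx _ hc h
    · intro x y hxy hx hy
      rw [hH x y hxy hx hy, hg2]
  · rintro ⟨c, B, C, X⟩ ⟨hB, hC, hX⟩
    simp only at hB hC hX ⊢
    set G : Finset (Fin n → Fin n) := Fintype.piFinset (fun x => if x ∈ C ∪ X then univ else insert x C) with hG
    have h2 := cover_card (A := {H : SimpleGraph (Fin n) | ∃ g : Fin n → Fin n,
      (∀ x, x ∉ C → x ∉ X → g x ∈ insert x C) ∧
      ∀ x y, c x = c y → x ∉ B → y ∉ B → (H.Adj x y ↔ x ≠ y ∧ (g x = y ∨ g y = x))}) (↑G : Set (Fin n → Fin n))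
      (fun g => {H | ∀ x y, x < y → ¬ (c x ≠ c y ∨ x ∈ B ∨ y ∈ B) → (H.Adj x y ↔ x ≠ y ∧ (g x = y ∨ g y = x))})
      (X := (2 ^ (al r * n ^ 2 / 2) * 2 ^ (2 * (b * n)))) ?_ ?_
    · refine h2.trans ?_
      gcongr
      rw [ncard_coe_finset, hG, Fintype.card_piFinset]
      have h3 : ∀ x, (if x ∈ C ∪ X then (univ : Finset (Fin n)) else insert x C).card ≤ (if x ∈ C ∪ X then n else 1) * (t + 1) := by
        intro x
        split_ifs
        · simp only [card_univ, Fintype.card_fin]; nlinarith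
        · have := card_insert_le x C; omega
      have h4 := Finset.prod_le_prod' (s := univ) fun x _ => h3 x
      rw [prod_mul_distrib] at h4
      have h5 : ∏ x : Fin n, (if x ∈ C ∪ X then n else 1) ≤ n ^ (t + K) := by
        rw [prod_ite_mem, prod_const]
        apply Nat.pow_le_pow_right hn
        rw [univ_inter]
        have := card_union_le C X; omega
      simp only [prod_const, card_univ, Fintype.card_fin] at h4
      have := h4.trans (Nat.mul_le_mul_right _ h5)
      exact_mod_cast this
    · rintro H ⟨g, hg1, hg2⟩
      refine ⟨g, ?_, ?_⟩
      · rw [hG, mem_coe, Fintype.mem_piFinset]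
        intro x
        split_ifs with h
        · simp
        · rw [mem_union, not_or] at h
          exact hg1 x h.1 h.2
      · intro x y _ h
        push Not at h
        exact hg2 x y h.1 h.2.1 h.2.2
    · intro g _
      have h6 := pair_count (fun x y => c x ≠ c y ∨ x ∈ B ∨ y ∈ B) (fun x y => x ≠ y ∧ (g x = y ∨ g y = x))
      have h7 := prs_B B (fun x y => c x ≠ c y)
      have h8 := cross_le hr c
      calc _ ≤ ((2 ^ (prs (fun x y => c x ≠ c y ∨ x ∈ B ∨ y ∈ B)).card : ℕ) : ℝ) := by exact_mod_cast h6
        _ ≤ ((2 ^ ((prs (fun x y => c x ≠ c y)).card + 2 * (B.card * n)) : ℕ) : ℝ) := by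
            exact_mod_cast Nat.pow_le_pow_right (by norm_num) h7
        _ = 2 ^ ((prs (fun x y => c x ≠ c y)).card : ℝ) * 2 ^ (2 * (B.card * n)) := by
            rw [rpow_natCast]; push_cast; rw [pow_add]
        _ ≤ _ := by
            gcongr <;> norm_num

/-- binary logarithm -/
abbrev lg (n : ℕ) : ℕ := Nat.log 2 n

lemma lg_le (n : ℕ) : (lg n : ℝ) ≤ 2 * log n := by
  by_cases h : n = 0
  · subst h; simp
  have h1 : 2 ^ lg n ≤ n := Nat.pow_log_le_self 2 h
  have h2 : ((2:ℝ) ^ lg n) ≤ n := by exact_mod_cast h1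
  have h3 := Real.log_le_log (by positivity) h2
  rw [log_pow] at h3
  have h4 := Real.log_two_gt_d9
  have : (0:ℝ) ≤ lg n := by positivity
  nlinarith

lemma lg_pow (k : ℕ) {θ : ℝ} (hθ : 0 < θ) : ∀ᶠ n : ℕ in atTop, ((lg n : ℝ)) ^ k + 1 ≤ (n:ℝ) ^ θ := by
  have h1 := (isLittleO_log_rpow_rpow_atTop (k:ℝ) hθ).comp_tendsto (tendsto_natCast_atTop_atTop (R := ℝ))
  have h2 := h1.bound (c := 1 / (2 * 2 ^ k)) (by positivity)
  have h3 : ∀ᶠ n : ℕ in atTop, (2:ℝ) ≤ (n:ℝ) ^ θ :=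
    ((tendsto_rpow_atTop hθ).comp tendsto_natCast_atTop_atTop).eventually_ge_atTop 2
  filter_upwards [h2, h3, eventually_ge_atTop 1] with n h2 h3 h4
  simp only [Function.comp, rpow_natCast, Real.norm_eq_abs] at h2
  rw [abs_of_nonneg (a := (n:ℝ) ^ θ) (by positivity)] at h2
  have h5 := (le_abs_self _).trans h2
  have h6 : (lg n : ℝ) ^ k ≤ (2 * log n) ^ k := by gcongr; exact lg_le n
  rw [mul_pow] at h6
  have h7 : (2:ℝ) ^ k * (log n) ^ k ≤ 2 ^ k * (1 / (2 * 2 ^ k) * (n:ℝ) ^ θ) := by gcongr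
  have h8 : (2:ℝ) ^ k * (1 / (2 * 2 ^ k) * (n:ℝ) ^ θ) = (n:ℝ) ^ θ / 2 := by field_simp
  linarith

lemma lg_lin (k : ℕ) {θ : ℝ} (hθ : 0 < θ) : ∀ᶠ n : ℕ in atTop, ((lg n : ℝ)) ^ k + 1 ≤ θ * n := by
  have h3 : ∀ᶠ n : ℕ in atTop, 1 / θ ≤ (n:ℝ) ^ (1/2 : ℝ) :=
    ((tendsto_rpow_atTop (by norm_num)).comp tendsto_natCast_atTop_atTop).eventually_ge_atTop _
  filter_upwards [lg_pow k (θ := 1/2) (by norm_num), h3, eventually_ge_atTop 1] with n h1 h2 h4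
  refine h1.trans ?_
  have : (n:ℝ) = (n:ℝ) ^ (1/2:ℝ) * (n:ℝ) ^ (1/2:ℝ) := by
    rw [← rpow_add (by exact_mod_cast h4)]; norm_num
  rw [div_le_iff₀ hθ] at h2
  have h5 : (0:ℝ) ≤ (n:ℝ) ^ (1/2:ℝ) := by positivity
  calc (n:ℝ) ^ (1/2:ℝ) ≤ (n:ℝ) ^ (1/2:ℝ) * ((n:ℝ) ^ (1/2:ℝ) * θ) := le_mul_of_one_le_right h5 h2
    _ = θ * ((n:ℝ) ^ (1/2:ℝ) * (n:ℝ) ^ (1/2:ℝ)) := by ring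
    _ = θ * n := by rw [← this]

set_option maxHeartbeats 800000 in
lemma A6 (hr : 2 ≤ r) (b k : ℕ) {ε : ℝ} (hε : 0 < ε) (hε1 : ε ≤ 1 / r) :
    Small r (fun n => FewU r b (lg n ^ k) ⌊(1 / r - ε) * n⌋₊ n) := by
  obtain ⟨m, hm⟩ := exists_nat_gt (8 / ε)
  have hmpos : (0:ℝ) < m := lt_of_le_of_lt (by positivity) hm
  have hm0 : 0 < m := by exact_mod_cast hmpos
  have hm1 : 1 / (m:ℝ) ≤ ε / 8 := by
    rw [div_lt_iff₀ hε] at hm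
    rw [div_le_iff₀ hmpos]; linarith
  refine small_of_direct (fun n => Real.exp (-n)) ?_ (fun n => (Real.exp_pos _).le) ?_
  · exact Real.tendsto_exp_neg_atTop_nhds_zero.comp tendsto_natCast_atTop_atTop
  set C : ℝ := log r + log 8 + 2 * b * log 2 + log 2 + log (2 * m) + 1 with hCdef
  have hlog : ∀ᶠ n : ℕ in atTop, C ≤ ε / 8 * log n :=
    (Tendsto.const_mul_atTop (by positivity) (Real.tendsto_log_atTop.comp tendsto_natCast_atTop_atTop)).eventually_ge_atTop C
  filter_upwards [lg_pow k (θ := ε/8) (by positivity), lg_lin k (θ := ε / 8) (by positivity), hlog, eventually_ge_atTop (r * m + 1),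
    ev_lin_ge (γ := ε / 8) (by positivity) 1] with n h1 h2 h3 hn hlin
  have hr0 : (0:ℝ) < r := by exact_mod_cast (by omega : 0 < r)
  have hnm : m ≤ n := by nlinarith
  have hn1 : (1:ℝ) ≤ n := by exact_mod_cast (by nlinarith : 1 ≤ n)
  have hn0 : (0:ℝ) < n := by linarith
  have hK0 : 1 ≤ n / m := (Nat.one_le_div_iff hm0).2 hnm
  have hcount := FewU_count (r := r) (b := b) (t := lg n ^ k) (K := ⌊(1 / r - ε) * n⌋₊) (n := n) (by omega) (by omega)
  have hTN := TN_lower_star hr hK0 n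
  set K0 := n / m
  have hK0u : (K0:ℝ) ≤ ε / 8 * n := by
    calc (K0:ℝ) ≤ (n:ℝ) / m := Nat.cast_div_le
      _ = 1 / m * n := by ring
      _ ≤ _ := by gcongr
  have hK0l : (n:ℝ) / (2 * m) ≤ K0 := by
    have : n < (K0 + 1) * m := by
      have h := Nat.div_add_mod n m
      have h' := Nat.mod_lt n hm0
      simp only [K0]; nlinarith
    have : (n:ℝ) < (K0 + 1) * m := by exact_mod_cast this
    have h1 : (1:ℝ) ≤ K0 := by exact_mod_cast hK0
    rw [div_le_iff₀ (by positivity)]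
    nlinarith
  refine hcount.trans (le_trans ?_ (mul_le_mul_of_nonneg_left hTN (Real.exp_pos _).le))
  set t := lg n ^ k with ht
  have htr : ((t:ℕ):ℝ) = (lg n : ℝ) ^ k := by rw [ht]; push_cast; rfl
  rw [← htr] at h1 h2
  set K := ⌊(1 / (r:ℝ) - ε) * n⌋₊ with hK
  set e := n / r - K0 with he
  have hel : (n:ℝ) / r - 1 - K0 ≤ e := by
    have h1 : (n:ℝ) / r - 1 ≤ ((n / r : ℕ) : ℝ) := by
      have := Nat.lt_floor_add_one ((n:ℝ) / r)
      rw [Nat.floor_div_natCast, Nat.floor_natCast] at this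
      linarith
    have h2 : ((n / r : ℕ) : ℝ) ≤ e + K0 := by exact_mod_cast (by omega : n / r ≤ e + K0)
    linarith
  have hL : 0 ≤ log n := Real.log_nonneg hn1
  have hKr : (K:ℝ) * log n ≤ max ((1 / (r:ℝ) - ε) * n) 0 * log n := by
    refine mul_le_mul_of_nonneg_right ?_ hL
    rcases le_total 0 ((1 / (r:ℝ) - ε) * n) with h | h
    · exact (Nat.floor_le h).trans (le_max_left _ _)
    · rw [hK, Nat.floor_of_nonpos h]; simp
  have hlt : log (t + 1) ≤ ε / 8 * log n := by
    rw [← Real.log_rpow hn0]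
    exact Real.log_le_log (by positivity) h1
  have hlK : log n - log (2 * m) ≤ log K0 := by
    rw [← Real.log_div (by positivity) (by positivity)]
    exact Real.log_le_log (by positivity) hK0l
  have hK0p : (0:ℝ) < K0 := by exact_mod_cast hK0
  rw [← Real.log_le_log_iff (by positivity) (by positivity)]
  have hal := al_le r
  have hal0 := al_nonneg hr
  have l2 : 0 < log 2 := Real.log_pos (by norm_num)
  have l2m : 0 ≤ log (2 * m) := Real.log_nonneg (by have : (1:ℝ) ≤ m := by { exact_mod_cast hm0 }; linarith)
  have e1 : log (r ^ n * 8 ^ n * ((n:ℝ) ^ (t + K) * (t + 1) ^ n * (2 ^ (al r * n ^ 2 / 2) * 2 ^ (2 * (b * n)))))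
      = n * log r + n * log 8 + ((t + K) * log n + n * log (t + 1) +
        (al r * n ^ 2 / 2 * log 2 + 2 * (b * n) * log 2)) := by
    rw [log_mul (by positivity) (by positivity), log_mul (by positivity) (by positivity),
      log_mul (by positivity) (by positivity), log_mul (by positivity) (by positivity),
      log_mul (by positivity) (by positivity)]
    simp only [log_pow, Real.log_rpow (show (0:ℝ) < 2 by norm_num)]
    push_cast; ring
  have e2 : log (Real.exp (-n) * (2 ^ (al r * (n * (n - 1) / 2)) * (K0:ℝ) ^ e)) =
      -n + (al r * (n * (n - 1) / 2) * log 2 + e * log K0) := by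
    rw [log_mul (by positivity) (by positivity), log_mul (by positivity) (by positivity), Real.log_exp,
      log_pow, Real.log_rpow (by norm_num)]
  rw [e1, e2]
  -- e * log K0 ≥ (n/r -1-K0)^+ (log n - log 2m)
  have hen : (e:ℝ) ≤ n := by
    have := Nat.div_le_self n r
    exact_mod_cast (by omega : e ≤ n)
  have h5 : ((n:ℝ) / r - 1 - K0) * log n - n * log (2 * m) ≤ e * log K0 := by
    have a1 : (e:ℝ) * (log n - log (2*m)) ≤ e * log K0 := by gcongr
    have a2 : ((n:ℝ) / r - 1 - K0) * log n ≤ e * log n := by gcongr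
    have a3 : (e:ℝ) * log (2*m) ≤ n * log (2*m) := by gcongr
    linarith
  have h6 : ((K:ℝ) + ε / 8 * n * 4 ) * log n ≤ (max ((1 / (r:ℝ) - ε) * n) 0 + ε / 2 * n) * log n := by
    linarith
  have h7 : (al r * n ^ 2 / 2 * log 2) ≤ al r * (n * (n - 1) / 2) * log 2 + n * log 2 := by
    have : al r * n * log 2 ≤ 1 * n * log 2 := by gcongr
    nlinarith [mul_nonneg (mul_nonneg hal0 hn0.le) l2.le]
  have hCn : n * C ≤ n * (ε / 8 * log n) := by gcongr
  have hCe : n * C = n * log r + n * log 8 + 2 * (b * n) * log 2 + n * log 2 + n * log (2 * m) + n := by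
    rw [hCdef]; ring
  have h8 : (t:ℝ) * log n ≤ ε / 8 * n * log n := by gcongr; linarith
  have h9 : (n:ℝ) * log (t+1) ≤ n * (ε / 8 * log n) := by gcongr
  have h10 : (1 + (K0:ℝ)) * log n ≤ (ε / 8 * n + ε / 8 * n) * log n := by gcongr
  have hs : 0 ≤ (1 / (r:ℝ) - ε) * n := mul_nonneg (by linarith) hn0.le
  rw [max_eq_left hs] at hKr
  have h11 : 0 ≤ ε * n * log n := by positivity
  have e3 : (1 / (r:ℝ) - ε) * n * log n = n / r * log n - ε * n * log n := by ring
  rw [e3] at hKr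
  have e4 : ε / 8 * n * log n = ε * n * log n / 8 := by ring
  have e5 : n * (ε / 8 * log n) = ε * n * log n / 8 := by ring
  have e6 : (ε / 8 * n + ε / 8 * n) * log n = ε * n * log n / 4 := by ring
  have e7 : ((n:ℝ) / r - 1 - K0) * log n = n / r * log n - (1 + K0) * log n := by ring
  have e8 : ((t:ℝ) + K) * log n = t * log n + K * log n := by ring
  rw [e4] at h8
  rw [e5] at h9 hCn
  rw [e6] at h10
  rw [e7] at h5
  rw [e8]
  clear_value C e K t K0
  clear hm hm1 h1 h2 h3 hcount hTN hK0u hK0l hel hlt hlK e1 e2 h6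
  linarith

structure Nice {r : ℕ} (hr : 0 < r) (ν η : ℝ) (E W b : ℕ) {n : ℕ} (H : SimpleGraph (Fin n)) : Prop where
  noC : ¬ HasC r H
  near : Near hr ν η H
  rich : RichAll H (opt hr H) E W
  bb : (BB H (opt hr H) E).card < b
  four : ∀ v, 4 ≤ (univ.filter (fun j => E ≤ (gbs H (opt hr H) v j).card)).card

lemma rich_one {E W b : ℕ} {H : SimpleGraph (Fin n)} {c : Fin n → Fin r} (hr : RichAll H c E W)
    (hb : (BB H c E).card < b) (hn : b + 4 ≤ n) {x : Fin n} (hx : low H c E x) {j : Fin r} (hj : c x ≠ j) :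
    W ≤ (nbs H c x j).card := by
  have h1 : (BB H c E)ᶜ.card = n - (BB H c E).card := by rw [card_compl, Fintype.card_fin]
  have h2 : 3 ≤ ((BB H c E)ᶜ.erase x).card := by
    have := Finset.pred_card_le_card_erase (s := (BB H c E)ᶜ) (a := x)
    omega
  obtain ⟨S, hS, hS3⟩ := Finset.exists_subset_card_eq h2
  obtain ⟨y, z, w, hyz, hyw, hzw, rfl⟩ := Finset.card_eq_three.1 hS3
  have hm : ∀ u ∈ ({y, z, w} : Finset (Fin n)), u ≠ x ∧ low H c E u := by
    intro u hu
    have := hS hu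
    simpa [BB] using this
  have hy := hm y (by simp)
  have hz := hm z (by simp)
  have hw := hm w (by simp)
  have := hr ![x, y, z, w] (by
    intro a b
    have := hy.1; have := hz.1; have := hw.1
    fin_cases a <;> fin_cases b <;> simp <;> tauto) (by
    intro k; fin_cases k
    · exact hx
    · exact hy.2
    · exact hz.2
    · exact hw.2) j ![True, False, False, False] (by
    intro k; fin_cases k <;> simp; tauto)
  refine this.trans (card_le_card ?_)
  intro u hu
  simp only [mem_filter, mem_univ, true_and, nbs] at hu ⊢
  refine ⟨hu.1, ?_⟩
  have := hu.2 0
  simp at this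
  exact this.symm

/-- Uniqueness of the optimal partition up to few vertices. -/
lemma uniq {E W b : ℕ} {hr : 0 < r} {ν η : ℝ} (hν : 0 < ν) (hη : 2 * η < ν ^ 2) (hn : b + 4 ≤ n)
    (hEW : r * r * (2 * (ν * n + 1)) + 2 + E ≤ W)
    {H1 H2 : SimpleGraph (Fin n)} {q : Fin 1 → Fin n} (hag : AgreeOff q H1 H2)
    (h1 : Nice hr ν η E W b H1) (h2 : Nice hr ν η E W b H2) : ∃ σ : Equiv.Perm (Fin r),
      ∀ x, x ∉ BB H1 (opt hr H1) E → x ∉ BB H2 (opt hr H2) E → x ≠ q 0 → opt hr H2 x = σ (opt hr H1 x) := by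
  obtain ⟨σ, hσ⟩ := near_close hr hν hη (by omega) hag h1.near h2.near
  refine ⟨σ, ?_⟩
  intro x hx1 hx2 hxq
  have l1 : low H1 (opt hr H1) E x := by simpa [BB] using hx1
  have l2 : low H2 (opt hr H2) E x := by simpa [BB] using hx2
  by_contra hne
  set c1 := opt hr H1
  set c2 := opt hr H2
  have h3 : W ≤ (nbs H1 c1 x (σ.symm (c2 x))).card := rich_one h1.rich h1.bb hn l1 (j := σ.symm (c2 x)) (by
    intro h; apply hne; change c1 x = _ at h; rw [h]; simp)
  set X := univ.filter (fun v => c2 v ≠ σ (c1 v))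
  have h4 : nbs H1 c1 x (σ.symm (c2 x)) ⊆ nbs H2 c2 x (c2 x) ∪ insert (q 0) X := by
    intro z hz
    simp only [nbs, X, mem_filter, mem_univ, true_and, mem_union, mem_insert] at hz ⊢
    by_cases hzq : z = q 0
    · exact Or.inr (Or.inl hzq)
    by_cases hzX : c2 z = σ (c1 z)
    · left
      refine ⟨?_, ?_⟩
      · rw [hzX, hz.1]; simp
      · refine (hag x z ?_ ?_).1 hz.2
        · intro i; rw [Subsingleton.elim i 0]; exact fun h => hxq h.symm
        · intro i; rw [Subsingleton.elim i 0]; exact fun h => hzq h.symm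
    · exact Or.inr (Or.inr hzX)
  have h5 := (card_le_card h4).trans (card_union_le _ _)
  have h6 := card_insert_le (q 0) X
  unfold low at l2
  have h7 : W + 1 ≤ E + (X.card + 1) := by omega
  have h8 : (W:ℝ) + 1 ≤ E + (X.card + 1) := by exact_mod_cast h7
  push_cast at hσ
  linarith

lemma index_count {m : ℕ} (c1 : Fin n → Fin r) :
    {p : (Fin n → Fin r) × Finset (Fin n) | p.2.Nonempty ∧ p.2.card ≤ m ∧
      ∃ σ : Fin r → Fin r, ∀ x, x ∉ p.2 → p.1 x = σ (c1 x)}.ncard ≤ r ^ r * (n ^ m * r ^ m) := by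
  set F : (Fin r → Fin r) × (Fin m → Fin n) × (Fin m → Fin r) → (Fin n → Fin r) × Finset (Fin n) := fun d =>
    (fun x => if h : ∃ k, d.2.1 k = x then d.2.2 h.choose else d.1 (c1 x), univ.image d.2.1) with hF
  have hsub : {p : (Fin n → Fin r) × Finset (Fin n) | p.2.Nonempty ∧ p.2.card ≤ m ∧
      ∃ σ : Fin r → Fin r, ∀ x, x ∉ p.2 → p.1 x = σ (c1 x)} ⊆ F '' Set.univ := by
    rintro ⟨c, L⟩ ⟨⟨x0, hx0⟩, hm, σ, hσ⟩
    simp only at hx0 hm hσ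
    set e : Fin m → Fin n := fun k => if h : (k:ℕ) < L.card then (L.equivFin.symm ⟨k, h⟩ : Fin n) else x0 with he
    have he1 : ∀ k, e k ∈ L := by
      intro k
      simp only [he]
      split_ifs
      · exact Subtype.coe_prop _
      · exact hx0
    have he2 : ∀ x ∈ L, ∃ k, e k = x := by
      intro x hx
      refine ⟨⟨L.equivFin ⟨x, hx⟩, lt_of_lt_of_le (Fin.is_lt _) hm⟩, ?_⟩
      simp [he]
    refine ⟨(σ, e, fun k => c (e k)), Set.mem_univ _, ?_⟩
    simp only [hF, Prod.mk.injEq]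
    constructor
    · funext x
      split_ifs with h
      · rw [h.choose_spec]
      · rw [hσ x]
        intro hx; exact h (he2 x hx)
    · ext x
      simp only [mem_image, mem_univ, true_and]
      constructor
      · rintro ⟨k, rfl⟩; exact he1 k
      · exact he2 x
  refine (ncard_le_ncard hsub (toFinite _)).trans ((Set.ncard_image_le Set.finite_univ).trans ?_)
  rw [ncard_univ, Nat.card_eq_fintype_card]
  simp

lemma lg_tendsto : Tendsto lg atTop atTop := by
  refine tendsto_atTop.2 fun k => ?_
  filter_upwards [eventually_ge_atTop (2 ^ k)] with n hn
  exact Nat.le_log_of_pow_le (by norm_num) hn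

lemma small_poly (hr : 2 ≤ r) {A : Fam} (C : ℝ) (hC : 0 ≤ C) (m : ℕ)
    (P : ∀ n, Fin n → SimpleGraph (Fin n) → Prop)
    (hA : ∀ᶠ n in atTop, (∀ H ∈ A n, ¬ HasC r H ∧ ∃ v, P n v H) ∧ ∀ v, ∀ H0, P n v H0 →
      ({H | P n v H ∧ AgreeOff ![v] H0 H}.ncard : ℝ) ≤ C * n ^ m * 2 ^ (al r * n - (lg n : ℝ) ^ 2)) : Small r A := by
  refine small_of_removal hr 1 le_rfl (fun n => n ^ 1 * (C * n ^ m * 2 ^ (al r * n - (lg n : ℝ) ^ 2)))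
    (fun n => by positivity) ?_ ?_
  · have h1 : ∀ᶠ n : ℕ in atTop, ((n:ℝ) ^ 1 * (C * n ^ m * 2 ^ (al r * n - (lg n : ℝ) ^ 2))) / 2 ^ ((1:ℕ) * al r * n) ≤
        C * (2:ℝ) ^ (-(lg n : ℝ)) := by
      filter_upwards [lg_tendsto.eventually_ge_atTop (2 * (m + 1) + 1)] with n hn
      have h2 : n < 2 ^ (lg n + 1) := Nat.lt_pow_succ_log_self (by norm_num) n
      have h3 : (n:ℝ) ≤ 2 ^ ((lg n:ℝ) + 1) := by
        have : (n:ℝ) ≤ 2 ^ (lg n + 1) := by exact_mod_cast h2.le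
        calc (n:ℝ) ≤ 2 ^ (lg n + 1) := this
          _ = 2 ^ ((lg n:ℝ) + 1) := by rw [← rpow_natCast]; push_cast; rfl
      rw [div_le_iff₀ (by positivity)]
      calc (n:ℝ) ^ 1 * (C * n ^ m * 2 ^ (al r * n - (lg n : ℝ) ^ 2))
          = C * ((n:ℝ) ^ (m + 1) * 2 ^ (al r * n - (lg n : ℝ) ^ 2)) := by ring
        _ ≤ C * ((2 ^ ((lg n:ℝ) + 1)) ^ (m + 1) * 2 ^ (al r * n - (lg n : ℝ) ^ 2)) := by gcongr
        _ = C * 2 ^ (((lg n:ℝ) + 1) * (m + 1) + (al r * n - (lg n : ℝ) ^ 2)) := by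
            rw [rpow_add (by norm_num) (((lg n:ℝ) + 1) * (m + 1)), rpow_mul (by norm_num) ((lg n:ℝ) + 1),
              show ((m:ℝ) + 1) = ((m + 1 : ℕ) : ℝ) by push_cast; rfl, rpow_natCast]
        _ ≤ C * 2 ^ (-(lg n:ℝ) + (1:ℕ) * al r * n) := by
            refine mul_le_mul_of_nonneg_left (rpow_le_rpow_of_exponent_le (by norm_num) ?_) hC
            have : (2 * (m + 1) + 1 : ℝ) ≤ lg n := by exact_mod_cast hn
            push_cast
            nlinarith [sq_nonneg ((lg n:ℝ) - 1)]
        _ = _ := by rw [rpow_add (by norm_num)]; ring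
    have h4 : Tendsto (fun n : ℕ => C * (2:ℝ) ^ (-(lg n : ℝ))) atTop (nhds 0) := by
      rw [show (0:ℝ) = C * 0 by simp]
      refine Tendsto.const_mul _ ?_
      have := (tendsto_pow_atTop_nhds_zero_of_lt_one (r := (1/2:ℝ)) (by norm_num) (by norm_num)).comp lg_tendsto
      refine this.congr fun n => ?_
      simp [rpow_neg, rpow_natCast]
    exact squeeze_zero' (Eventually.of_forall fun n => by positivity) h1 h4
  · filter_upwards [hA] with n hn
    have := removal (r := r) (A n) (fun q H => q = ![q 0] ∧ P n (q 0) H) (C * n ^ m * 2 ^ (al r * n - (lg n : ℝ) ^ 2)) (by positivity) ?_ ?_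
    · exact this
    · intro H hH
      obtain ⟨a, v, hv⟩ := hn.1 H hH
      exact ⟨a, ![v], Function.injective_of_subsingleton _, by simp, hv⟩
    · intro q _ H0 hP _
      refine le_trans ?_ (hn.2 (q 0) H0 hP.2)
      norm_cast
      refine ncard_le_ncard ?_ (toFinite _)
      intro H hH
      refine ⟨hH.1.2, ?_⟩
      rw [← hP.1]; exact hH.2.2

lemma small_uniq (hr : 2 ≤ r) (hr0 : 0 < r) {ν η ε μ : ℝ} (hν : 0 < ν) (hη : 2 * η < ν ^ 2) (hε : 0 < ε)
    (hμ : 4 * r * r * ν + 2 * ε ≤ μ) (b : ℕ) {A : Fam} (C : ℝ) (hC : 0 ≤ C)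
    (P : ∀ n, Fin n → SimpleGraph (Fin n) → Prop)
    (hP : ∀ n v H, P n v H → Nice hr0 ν η ⌈ε * n⌉₊ ⌈μ * n⌉₊ b H ∧ low H (opt hr0 H) ⌈ε * n⌉₊ v ∧
      (univ.filter (fun x => (DD H (opt hr0 H) ⌈ε * n⌉₊).Adj v x)).card ≤ 2)
    (hA : ∀ᶠ n in atTop, (∀ H ∈ A n, ∃ v, P n v H) ∧ ∀ v, ∀ H0, P n v H0 → ∀ c L, L.card ≤ 2 * b + 3 → v ∈ L → BB H0 (opt hr0 H0) ⌈ε * n⌉₊ ⊆ L →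
      ({H | P n v H ∧ AgreeOff ![v] H0 H ∧ opt hr0 H = c ∧ BB H c ⌈ε * n⌉₊ ⊆ L ∧ ∀ y, (DD H c ⌈ε * n⌉₊).Adj v y → y ∈ L}.ncard : ℝ)
        ≤ C * 2 ^ (al r * n - (lg n : ℝ) ^ 2)) : Small r A := by
  refine small_poly hr (C * r ^ r * r ^ (2 * b + 3)) (by positivity) (2 * b + 3) P ?_
  filter_upwards [hA, eventually_ge_atTop (b + 4), ev_lin_ge (γ := ε) hε (2 * r * r + 3)] with n hn hnb hlin
  refine ⟨fun H hH => ?_, ?_⟩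
  · obtain ⟨v, hv⟩ := hn.1 H hH
    exact ⟨(hP _ _ _ hv).1.noC, v, hv⟩
  intro v H0 h0
  have hn0 : (0:ℝ) ≤ n := by positivity
  have hEW : r * r * (2 * (ν * n + 1)) + 2 + (⌈ε * n⌉₊:ℝ) ≤ (⌈μ * n⌉₊:ℝ) := by
    have h1 := Nat.ceil_lt_add_one (a := ε * n) (by positivity)
    have h2 := Nat.le_ceil (μ * n)
    have h3 : (4 * r * r * ν + 2 * ε) * n ≤ μ * n := by gcongr
    have h4 : 0 ≤ (r:ℝ) * r * (ν * n) := by positivity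
    nlinarith
  set E := ⌈ε * n⌉₊
  set W := ⌈μ * n⌉₊
  have hcov := cover_card (A := {H | P n v H ∧ AgreeOff ![v] H0 H})
    ({p : (Fin n → Fin r) × Finset (Fin n) | (p.2.Nonempty ∧ p.2.card ≤ 2 * b + 3 ∧
      ∃ σ : Fin r → Fin r, ∀ x, x ∉ p.2 → p.1 x = σ (opt hr0 H0 x)) ∧ v ∈ p.2 ∧ BB H0 (opt hr0 H0) E ⊆ p.2})
    (fun p => {H | P n v H ∧ AgreeOff ![v] H0 H ∧ opt hr0 H = p.1 ∧ BB H p.1 E ⊆ p.2 ∧ ∀ y, (DD H p.1 E).Adj v y → y ∈ p.2})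
    (X := C * 2 ^ (al r * n - (lg n : ℝ) ^ 2)) ?_ ?_
  · refine hcov.trans ?_
    have h1 := (ncard_le_ncard (fun p (hp : p ∈ {p : (Fin n → Fin r) × Finset (Fin n) | (p.2.Nonempty ∧ p.2.card ≤ 2 * b + 3 ∧
      ∃ σ : Fin r → Fin r, ∀ x, x ∉ p.2 → p.1 x = σ (opt hr0 H0 x)) ∧ v ∈ p.2 ∧ BB H0 (opt hr0 H0) E ⊆ p.2}) => hp.1) (toFinite _)).trans
      (index_count (m := 2 * b + 3) (opt hr0 H0))
    have h2 := (Nat.cast_le (α := ℝ)).2 h1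
    refine (mul_le_mul_of_nonneg_right h2 (by positivity)).trans (le_of_eq ?_)
    push_cast; ring
  · rintro H ⟨hH, hag⟩
    obtain ⟨N0, l0, d0⟩ := hP _ _ _ h0
    obtain ⟨N1, l1, d1⟩ := hP _ _ _ hH
    obtain ⟨σ, hσ⟩ := uniq hν hη hnb hEW hag N0 N1
    set Nb := univ.filter (fun x => (DD H (opt hr0 H) E).Adj v x) with hNb
    set L := insert v (BB H0 (opt hr0 H0) E ∪ BB H (opt hr0 H) E ∪ Nb) with hL
    refine ⟨(opt hr0 H, L), ⟨⟨⟨v, by simp [hL]⟩, ?_, σ, ?_⟩, by simp [hL], ?_⟩, hH, hag, rfl, ?_, ?_⟩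
    · have a1 : (BB H0 (opt hr0 H0) E).card < b := N0.bb
      have a2 : (BB H (opt hr0 H) E).card < b := N1.bb
      have a3 := card_insert_le v (BB H0 (opt hr0 H0) E ∪ BB H (opt hr0 H) E ∪ Nb)
      have a4 := card_union_le (BB H0 (opt hr0 H0) E ∪ BB H (opt hr0 H) E) Nb
      have a5 := card_union_le (BB H0 (opt hr0 H0) E) (BB H (opt hr0 H) E)
      change L.card ≤ _
      rw [← hL] at a3
      omega
    · intro x hx
      simp only [hL, mem_insert, mem_union, not_or] at hx
      exact hσ x hx.2.1.1 hx.2.1.2 hx.1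
    · intro x hx
      simp only [hL, mem_insert, mem_union]; tauto
    · intro x hx
      simp only [hL, mem_insert, mem_union]
      simp only at hx
      tauto
    · intro y hy
      simp only [hL, mem_insert, mem_union]
      right; right
      simpa [hNb] using hy
  · rintro ⟨c, L⟩ ⟨⟨_, h2, _⟩, h3, h4⟩
    exact hn.2 v H0 h0 c L h2 h3 h4

lemma row_count {t : ℕ} (F : Finset (Fin n)) (p : Fin t × Fin 2 → Fin n) (hp : Injective p) (hpF : ∀ k, p k ∈ F) :
    ({ρ : Fin n → Fin 1 → Bool | (∀ x, x ∉ F → ρ x 0 = false) ∧ ∀ k, ¬ (ρ (p (k, 0)) 0 = true ∧ ρ (p (k, 1)) 0 = true)}.ncard : ℝ)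
      ≤ 2 ^ F.card * (3 / 4) ^ t := by
  set R := {ρ : Fin n → Fin 1 → Bool | (∀ x, x ∉ F → ρ x 0 = false) ∧ ∀ k, ¬ (ρ (p (k, 0)) 0 = true ∧ ρ (p (k, 1)) 0 = true)} with hR
  set F' := F \ univ.image p with hF'
  have hsubF : univ.image p ⊆ F := by
    intro x hx
    obtain ⟨k, _, rfl⟩ := mem_image.1 hx
    exact hpF k
  have hcard : F'.card + 2 * t = F.card := by
    rw [hF', Finset.card_sdiff_of_subset, Finset.card_image_of_injective _ hp]
    · simp only [card_univ, Fintype.card_prod, Fintype.card_fin]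
      have : (univ.image p).card ≤ F.card := card_le_card hsubF
      rw [Finset.card_image_of_injective _ hp] at this
      simp only [card_univ, Fintype.card_prod, Fintype.card_fin] at this
      omega
    · exact hsubF
  have h1 : R.ncard ≤ (F'.powerset ×ˢ (Fintype.piFinset (fun _ : Fin t => (univ.filter (fun z : Bool × Bool => ¬ (z.1 = true ∧ z.2 = true))))) : Finset (Finset (Fin n) × (Fin t → Bool × Bool))).card := by
    rw [← ncard_coe_finset]
    refine Set.ncard_le_ncard_of_injOn (fun ρ => (F'.filter (fun x => ρ x 0 = true), fun k => (ρ (p (k, 0)) 0, ρ (p (k,1)) 0))) ?_ ?_ (toFinite _)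
    · intro ρ hρ
      simp only [Finset.coe_product, Set.mem_prod, mem_coe, mem_powerset, Fintype.mem_piFinset, mem_filter, mem_univ, true_and]
      exact ⟨filter_subset _ _, hρ.2⟩
    · intro ρ hρ ρ' hρ' he
      simp only [Prod.mk.injEq] at he
      funext x i
      rw [Subsingleton.elim i 0]
      by_cases hx : x ∈ F
      · by_cases hx' : x ∈ F'
        · have := Finset.ext_iff.1 he.1 x
          simp only [mem_filter, hx', true_and] at this
          exact Bool.eq_iff_iff.2 this
        · have : ∃ k, p k = x := by
            by_contra hno
            exact hx' (Finset.mem_sdiff.2 ⟨hx, fun hi => hno (by obtain ⟨k, _, hk⟩ := mem_image.1 hi; exact ⟨k, hk⟩)⟩)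
          obtain ⟨⟨k, j⟩, rfl⟩ := this
          have h := congrFun he.2 k
          simp only [Prod.mk.injEq] at h
          fin_cases j
          · exact h.1
          · exact h.2
      · rw [hρ.1 x hx, hρ'.1 x hx]
  have h3 : (univ.filter (fun z : Bool × Bool => ¬ (z.1 = true ∧ z.2 = true))).card = 3 := by decide
  rw [card_product, card_powerset, Fintype.card_piFinset] at h1
  simp only [h3, prod_const, card_univ, Fintype.card_fin] at h1
  rw [← hcard, pow_add, pow_mul]
  calc (R.ncard : ℝ) ≤ 2 ^ F'.card * 3 ^ t := by exact_mod_cast h1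
    _ = 2 ^ F'.card * (2 ^ 2) ^ t * (3 / 4) ^ t := by
      rw [mul_assoc, ← mul_pow]; norm_num

/-- The rows at `v` allowed by a colouring and a list of exceptions. -/
lemma fibre_rows {E : ℕ} {H : SimpleGraph (Fin n)} {c : Fin n → Fin r} {L : Finset (Fin n)} {v : Fin n}
    (hB : BB H c E ⊆ L) (hv : low H c E v) (hD : ∀ y, (DD H c E).Adj v y → y ∈ L) :
    ∀ x, x ∉ (part c (c v))ᶜ ∪ L → rows ![v] H x 0 = false := by
  intro x hx
  simp only [mem_union, mem_compl, part, mem_filter, mem_univ, true_and, not_or, not_not] at hx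
  simp only [rows, decide_eq_false_iff_not]
  intro hadj
  change H.Adj x v at hadj
  refine hx.2 (hD x ⟨hx.1.symm, hadj.symm, hv, ?_⟩)
  by_contra hl
  exact hx.2 (hB (by simpa [BB] using hl))

lemma fibre_card {m : ℕ} (c : Fin n → Fin r) (i : Fin r) (L : Finset (Fin n)) (hL : L.card ≤ m) :
    (((part c i)ᶜ ∪ L).card : ℝ) ≤ n - (part c i).card + m := by
  have h1 := card_union_le (part c i)ᶜ L
  have h2 : (part c i)ᶜ.card + (part c i).card = n := by
    rw [Finset.card_compl_add_card, Fintype.card_fin]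
  have h3 : ((part c i)ᶜ ∪ L).card + (part c i).card ≤ n + m := by omega
  have : (((part c i)ᶜ ∪ L).card : ℝ) + (part c i).card ≤ n + m := by exact_mod_cast h3
  linarith

lemma A35 (hr5 : 5 ≤ r) (hr0 : 0 < r) {ν η ε μ : ℝ} (hν : 0 < ν) (hη : 2 * η < ν ^ 2) (hε : 0 < ε)
    (hμ : 4 * r * r * ν + 2 * ε ≤ μ) (hWW : ∀ᶠ n : ℕ in atTop, WW r ⌈ν * n⌉₊ ≤ ⌈μ * n⌉₊) (b : ℕ) :
    Small r (fun n => {H | Nice hr0 ν η ⌈ε * n⌉₊ ⌈μ * n⌉₊ b H ∧ ∃ i, (n:ℝ) / r + (lg n:ℝ) ^ 2 ≤ (part (opt hr0 H) i).card}) := by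
  refine small_uniq (by omega) hr0 hν hη hε hμ b (2 ^ (2 * b + 3)) (by positivity)
    (fun n v H => (Nice hr0 ν η ⌈ε * n⌉₊ ⌈μ * n⌉₊ b H ∧ low H (opt hr0 H) ⌈ε * n⌉₊ v ∧
      (univ.filter (fun x => (DD H (opt hr0 H) ⌈ε * n⌉₊).Adj v x)).card ≤ 2) ∧
      (n:ℝ) / r + (lg n:ℝ) ^ 2 ≤ (part (opt hr0 H) (opt hr0 H v)).card) (fun n v H h => h.1) ?_
  have hrp : (0:ℝ) < r := by exact_mod_cast hr0
  filter_upwards [hWW, ev_lin_ge (γ := 1 / r) (by positivity) (b + 1)] with n hW hlin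
  constructor
  · rintro H ⟨hN, i, hi⟩
    have hnp := NP_DD hr5 hN.near.2.1 hN.rich hW hN.noC
    set c := opt hr0 H with hc
    set E := ⌈ε * n⌉₊
    have h1 : (BB H c E).card < (part c i).card := by
      have h2 := hN.bb
      have h3 : (b:ℝ) < (part c i).card := by
        have : (0:ℝ) ≤ (lg n:ℝ) ^ 2 := by positivity
        have e : (n:ℝ) / r = 1 / r * n := by ring
        rw [e] at hi; linarith
      have h4 : b < (part c i).card := by exact_mod_cast h3
      change (BB H c E).card < b at h2
      omega
    obtain ⟨v, hv, hvB⟩ := Finset.exists_mem_notMem_of_card_lt_card h1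
    have hcv : c v = i := by simpa [part] using hv
    have hlow : low H c E v := by simpa [BB] using hvB
    by_cases hd : (univ.filter (fun x => (DD H c E).Adj v x)).card ≤ 2
    · exact ⟨v, ⟨hN, hlow, hd⟩, by rw [hcv]; exact hi⟩
    · push Not at hd
      obtain ⟨y, hy⟩ := card_pos.1 (by omega : 0 < (univ.filter (fun x => (DD H c E).Adj v x)).card)
      have hy : (DD H c E).Adj v y := by simpa using hy
      rcases NP_small_end hnp hy with h | h
      · change (univ.filter (fun x => (DD H c E).Adj v x)).card ≤ 2 at h
        omega
      · exact ⟨y, ⟨hN, hy.2.2.2, h⟩, by rw [← hy.1, hcv]; exact hi⟩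
  · intro v H0 h0 c L hL hvL hBL
    by_cases hsz : (n:ℝ) / r + (lg n:ℝ) ^ 2 ≤ (part c (c v)).card
    · set F := (part c (c v))ᶜ ∪ L with hF
      have h1 := rows_count ![v] H0 {ρ : Fin n → Fin 1 → Bool | (∀ x, x ∉ F → ρ x 0 = false) ∧
        ∀ k : Fin 0, ¬ (ρ ((fun z : Fin 0 × Fin 2 => z.1.elim0) (k, 0)) 0 = true ∧ ρ ((fun z : Fin 0 × Fin 2 => z.1.elim0) (k, 1)) 0 = true)}
      have h2 := row_count (t := 0) F (fun z => z.1.elim0) (fun z => z.1.elim0) (fun z => z.1.elim0)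
      have h3 := (Nat.cast_le (α := ℝ)).2 h1
      have h4 := h3.trans h2
      rw [pow_zero, mul_one] at h4
      refine le_trans ?_ (h4.trans ?_)
      · norm_cast
        refine ncard_le_ncard ?_ (toFinite _)
        rintro H ⟨⟨⟨hN, hl, hd⟩, hs⟩, hag, rfl, hB, hD⟩
        exact ⟨hag, fibre_rows hB hl hD, fun k => k.elim0⟩
      · have h5 := fibre_card c (c v) L hL
        rw [← hF] at h5
        rw [← rpow_natCast, ← rpow_natCast, ← rpow_add (by norm_num)]
        refine rpow_le_rpow_of_exponent_le (by norm_num) ?_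
        unfold al
        have e : (1 - 1 / (r:ℝ)) * n = n - n / r := by ring
        push_cast at h5 ⊢
        linarith
    · have : {H | ((Nice hr0 ν η ⌈ε * n⌉₊ ⌈μ * n⌉₊ b H ∧ low H (opt hr0 H) ⌈ε * n⌉₊ v ∧
      (univ.filter (fun x => (DD H (opt hr0 H) ⌈ε * n⌉₊).Adj v x)).card ≤ 2) ∧
      (n:ℝ) / r + (lg n:ℝ) ^ 2 ≤ (part (opt hr0 H) (opt hr0 H v)).card) ∧ AgreeOff ![v] H0 H ∧ opt hr0 H = c ∧ BB H c ⌈ε * n⌉₊ ⊆ L ∧ ∀ y, (DD H c ⌈ε * n⌉₊).Adj v y → y ∈ L} = ∅ := by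
        rw [Set.eq_empty_iff_forall_notMem]
        rintro H ⟨⟨_, hs⟩, hag, rfl, hB, hD⟩
        exact hsz hs
      rw [this]
      simp only [Set.ncard_empty, Nat.cast_zero]
      positivity

def finOf {k : ℕ} (e : Fin k → Option (Fin n)) : Finset (Fin n) := univ.filter (fun x => ∃ j, e j = some x)

lemma exists_finOf {k : ℕ} {S : Finset (Fin n)} (h : S.card ≤ k) : ∃ e : Fin k → Option (Fin n), finOf e = S := by
  refine ⟨fun j => if h : (j:ℕ) < S.card then some (S.equivFin.symm ⟨j, h⟩ : Fin n) else none, ?_⟩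
  ext x
  simp only [finOf, mem_filter, mem_univ, true_and]
  constructor
  · rintro ⟨j, hj⟩
    split_ifs at hj with h1
    rw [Option.some.injEq] at hj
    rw [← hj]; exact Subtype.coe_prop _
  · intro hx
    refine ⟨⟨S.equivFin ⟨x, hx⟩, lt_of_lt_of_le (Fin.is_lt _) h⟩, ?_⟩
    simp

lemma card_polylog (b k : ℕ) (C : ℝ) {γ : ℝ} (hγ : 0 < γ) : ∀ᶠ n : ℕ in atTop, C * ((n:ℝ) + 1) ^ (b + lg n ^ k) ≤ 2 ^ (γ * n) := by
  filter_upwards [lg_lin (k + 2) (θ := γ / 2) (by positivity), lg_tendsto.eventually_ge_atTop (b + 3), ev_const_le (γ := γ / 2) (by positivity) C] with n h1 h2 h3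
  have h4 : n + 1 ≤ 2 ^ (lg n + 1) := Nat.lt_pow_succ_log_self (by norm_num) n
  have h5 : (n + 1) ^ (b + lg n ^ k) ≤ 2 ^ (lg n ^ (k + 2)) := by
    refine (Nat.pow_le_pow_left h4 _).trans ?_
    rw [← pow_mul]
    refine Nat.pow_le_pow_right (by norm_num) ?_
    have h6 : 1 ≤ lg n ^ k := Nat.one_le_pow _ _ (by omega)
    calc (lg n + 1) * (b + lg n ^ k) ≤ (lg n + 1) * (b * lg n ^ k + lg n ^ k) := by gcongr; nlinarith
      _ = ((lg n + 1) * (b + 1)) * lg n ^ k := by ring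
      _ ≤ (lg n * lg n) * lg n ^ k := by
          refine Nat.mul_le_mul_right _ ?_
          nlinarith
      _ = _ := by ring
  have h7 : ((n:ℝ) + 1) ^ (b + lg n ^ k) ≤ 2 ^ (γ / 2 * n) := by
    calc ((n:ℝ) + 1) ^ (b + lg n ^ k) ≤ (2:ℝ) ^ (lg n ^ (k+2)) := by exact_mod_cast h5
      _ = (2:ℝ) ^ ((lg n:ℝ) ^ (k+2)) := by rw [← rpow_natCast]; push_cast; rfl
      _ ≤ _ := rpow_le_rpow_of_exponent_le (by norm_num) (by linarith)
  calc C * ((n:ℝ) + 1) ^ (b + lg n ^ k) ≤ 2 ^ (γ / 2 * n) * 2 ^ (γ / 2 * n) := by gcongr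
    _ = _ := by rw [← rpow_add (by norm_num)]; ring_nf

def Ex4 (H : SimpleGraph (Fin n)) (c : Fin n → Fin r) (E : ℕ) (k : ℝ) (M : ℕ) (u : Fin n) : Prop :=
  low H c E u ∧ ∃ i, i ≠ c u ∧ ∃ C : Finset (Fin n), C.card ≤ M ∧
    k ≤ ((Us (DD H c E) C).filter (fun x => c x = i)).card ∧ ∀ x ∈ Us (DD H c E) C, c x = i → ¬ H.Adj u x

def Xd (H : SimpleGraph (Fin n)) (c : Fin n → Fin r) (i : Fin r) (B C : Finset (Fin n)) : Finset (Fin n) :=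
  univ.filter (fun x => x ∉ C ∧ c x = i ∧ x ∉ B ∧ ∃ y, y ∉ C ∧ c y = i ∧ y ∉ B ∧ H.Adj x y)

lemma mem_Us {D : SimpleGraph (Fin n)} {C : Finset (Fin n)} {x : Fin n} : x ∈ Us D C ↔ x ∉ C ∧ ∃ y, y ∉ C ∧ D.Adj x y := by
  simp [Us]

lemma Xd_eq {E : ℕ} (H : SimpleGraph (Fin n)) (c : Fin n → Fin r) (i : Fin r) (C : Finset (Fin n)) :
    Xd H c i (BB H c E) C = (Us (DD H c E) C).filter (fun x => c x = i) := by
  ext x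
  rw [mem_filter, mem_Us]
  simp only [Xd, BB, mem_filter, mem_univ, true_and, not_not]
  constructor
  · rintro ⟨h1, h2, h3, y, h4, h5, h6, h7⟩
    exact ⟨⟨h1, y, h4, h2.trans h5.symm, h7, h3, h6⟩, h2⟩
  · rintro ⟨⟨h1, y, h4, h5, h6, h7, h8⟩, h2⟩
    exact ⟨h1, h2, h7, y, h4, h5 ▸ h2, h8, h6⟩

lemma Xd_congr {H H' : SimpleGraph (Fin n)} {c : Fin n → Fin r} {i : Fin r} {B C : Finset (Fin n)} {q : Fin 1 → Fin n}
    (hag : AgreeOff q H H') (hi : i ≠ c (q 0)) : Xd H c i B C = Xd H' c i B C := by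
  ext x
  simp only [Xd, mem_filter, mem_univ, true_and]
  have : ∀ y, c x = i → c y = i → (H.Adj x y ↔ H'.Adj x y) := by
    intro y hx hy
    refine hag x y ?_ ?_
    · rintro j rfl; rw [Subsingleton.elim j 0] at hx; exact hi hx.symm
    · rintro j rfl; rw [Subsingleton.elim j 0] at hy; exact hi hy.symm
  constructor
  · rintro ⟨h1, h2, h3, y, h4, h5, h6, h7⟩
    exact ⟨h1, h2, h3, y, h4, h5, h6, (this y h2 h5).1 h7⟩
  · rintro ⟨h1, h2, h3, y, h4, h5, h6, h7⟩
    exact ⟨h1, h2, h3, y, h4, h5, h6, (this y h2 h5).2 h7⟩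

lemma A4a (hr : 2 ≤ r) (hr0 : 0 < r) {κ : ℝ} (hκ : 0 < κ) (m : ℕ) : ∃ ζ : ℝ, 0 < ζ ∧ ∀ ε : ℝ, 0 < ε → ε ≤ ζ →
    ∃ ζ0 : ℝ, 0 < ζ0 ∧ ∀ ν η : ℝ, 0 < ν → ν ≤ ζ0 → 2 * η < ν ^ 2 → ∀ b : ℕ,
      Small r (fun n => {H | ¬ HasC r H ∧ Near hr0 ν η H ∧ (BB H (opt hr0 H) ⌈ε * n⌉₊).card < b ∧
        ∃ u, Ex4 H (opt hr0 H) ⌈ε * n⌉₊ (κ * n) (lg n ^ m) u}) := by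
  obtain ⟨ζ, hζ, ζ0, hζ0, h⟩ := gain_near hr hr0 1 le_rfl (γ := κ / 2) (by positivity)
  refine ⟨ζ / 2, by positivity, ?_⟩
  intro ε hε hεζ
  refine ⟨min ζ0 (κ / 4), by positivity, ?_⟩
  intro ν η hν hν0 hη b
  have hνκ := hν0.trans (min_le_right _ _)
  refine h ν η hν (hν0.trans (min_le_left _ _)) hη _ ?_
  filter_upwards [ev_lin_ge (γ := ζ / 2) (by positivity) 1, eventually_gt_atTop 0, card_polylog b m r (γ := κ / 4) (by positivity)] with n hn5 hn0 hpl
  have hnp : (0:ℝ) < n := by exact_mod_cast hn0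
  have hE : (⌈ε * n⌉₊ : ℝ) ≤ ζ * n := by
    have := Nat.ceil_lt_add_one (a := ε * n) (by positivity)
    have : ε * n ≤ ζ / 2 * n := by gcongr
    linarith
  set E := ⌈ε * n⌉₊
  clear_value E
  set M := lg n ^ m
  refine ⟨fun q H => (BB H (opt hr0 H) E).card < b ∧ Ex4 H (opt hr0 H) E (κ * n) M (q 0), ?_, ?_⟩
  · rintro H ⟨h1, h2, h3, u, hu⟩
    exact ⟨h1, h2, ![u], Function.injective_of_subsingleton _, h3, hu⟩
  intro q _ H1 hP hN1
  set c := opt hr0 H1 with hc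
  set D := {d : Fin r × (Fin b → Option (Fin n)) × (Fin M → Option (Fin n)) // d.1 ≠ c (q 0) ∧ κ * n ≤ (Xd H1 c d.1 (finOf d.2.1) (finOf d.2.2)).card} with hD
  set Z : D → Finset (Fin n) := fun d => part c (c (q 0)) ∪ Xd H1 c d.1.1 (finOf d.1.2.1) (finOf d.1.2.2) with hZ
  refine ⟨D, inferInstance, fun d x => if x ∈ Z d then {fun _ => false} else Set.univ, fun d x => if x ∈ Z d then 1 else 2, ?_, ?_, ?_, ?_⟩
  · intro d x; beta_reduce; split_ifs <;> norm_num
  · intro d x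
    beta_reduce
    split_ifs
    · simp
    · rw [ncard_univ, Nat.card_eq_fintype_card]; simp
  · intro d
    have hcd : (Fintype.card D : ℝ) ≤ 2 ^ (κ / 4 * n) := by
      refine le_trans ?_ hpl
      have := Fintype.card_subtype_le (fun d : Fin r × (Fin b → Option (Fin n)) × (Fin M → Option (Fin n)) => d.1 ≠ c (q 0) ∧ κ * n ≤ (Xd H1 c d.1 (finOf d.2.1) (finOf d.2.2)).card)
      simp only [Fintype.card_prod, Fintype.card_fin, Fintype.card_pi, prod_const, card_univ, Fintype.card_option] at this
      rw [pow_add]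
      have h2 := (Nat.cast_le (α := ℝ)).2 this
      push_cast at h2
      convert h2 using 1
    have hprod : (∏ x, if x ∈ Z d then (1:ℝ) else 2) = 2 ^ ((Z d)ᶜ.card : ℝ) := by
      rw [rpow_natCast, prod_ite]
      simp only [prod_const, one_pow, one_mul]
      congr 2
      ext x; simp
    have hZc : (Z d).card = (part c (c (q 0))).card + (Xd H1 c d.1.1 (finOf d.1.2.1) (finOf d.1.2.2)).card := by
      refine Finset.card_union_of_disjoint ?_
      rw [Finset.disjoint_left]
      intro x h1 h2
      simp only [part, Xd, mem_filter, mem_univ, true_and] at h1 h2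
      exact d.2.1 (h2.2.1.symm.trans h1)
    have hcc : ((Z d)ᶜ.card : ℝ) = n - (Z d).card := by
      have := Finset.card_compl_add_card (Z d)
      rw [Fintype.card_fin] at this
      have : ((Z d)ᶜ.card : ℝ) + (Z d).card = n := by exact_mod_cast this
      linarith
    rw [hprod]
    calc _ ≤ (2:ℝ) ^ (κ / 4 * n) * 2 ^ ((Z d)ᶜ.card : ℝ) := by gcongr
      _ = 2 ^ (κ / 4 * n + (Z d)ᶜ.card) := by rw [rpow_add (by norm_num)]
      _ ≤ _ := by
        refine rpow_le_rpow_of_exponent_le (by norm_num) ?_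
        rw [hcc, hZc]
        have h1 := abs_le.1 (hN1.2.2 (c (q 0)))
        have h2 := d.2.2
        have h3 : ν * n ≤ κ / 4 * n := by gcongr
        push_cast
        unfold al
        have e : (1 * (1 - 1 / (r:ℝ)) - κ / 2) * n = n - n / r - κ / 2 * n := by ring
        rw [e]
        have := h1.1
        rw [← hc] at this
        linarith
  · intro H hPH hNH hHC hag hopt
    obtain ⟨hb, hlow, i, hi, C, hC, hk, hno⟩ := hPH
    rw [hopt] at hb hlow hi hk hno
    obtain ⟨e1, he1⟩ := exists_finOf (S := BB H c E) hb.le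
    obtain ⟨e2, he2⟩ := exists_finOf hC
    have hX : Xd H1 c i (finOf e1) (finOf e2) = (Us (DD H c E) C).filter (fun x => c x = i) := by
      rw [Xd_congr hag hi, he1, he2, Xd_eq]
    refine ⟨⟨(i, e1, e2), hi, by simp only; rw [hX]; exact hk⟩, ?_⟩
    refine le_trans ?_ hE
    norm_cast
    refine le_trans (card_le_card ?_) hlow.le
    intro x hx
    simp only [mem_filter, mem_univ, true_and] at hx
    split_ifs at hx with hz
    · have hadj : H.Adj x (q 0) := by
        by_contra hna
        apply hx
        rw [Set.mem_singleton_iff]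
        funext j
        rw [Subsingleton.elim j 0]
        simp [rows, hna]
      simp only [hZ, mem_union, part, mem_filter, mem_univ, true_and, hX] at hz
      simp only [nbs, mem_filter, mem_univ, true_and]
      rcases hz with hz | hz
      · exact ⟨hz, hadj.symm⟩
      · exact absurd hadj.symm (hno x hz.1 hz.2)
    · exact absurd (Set.mem_univ _) hx

lemma part_sum (c : Fin n → Fin r) : ∑ j, (part c j).card = n := by
  have := Finset.card_eq_sum_card_fiberwise (f := c) (s := univ) (t := univ) (fun _ _ => mem_coe.2 (mem_univ _))
  rw [card_univ, Fintype.card_fin] at this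
  exact this.symm

lemma part_lower (hr : 0 < r) (c : Fin n → Fin r) {x : ℝ} (h : ∀ i, ((part c i).card : ℝ) ≤ n / r + x) (j : Fin r) :
    (n:ℝ) / r - (r - 1) * x ≤ (part c j).card := by
  have h1 : ∑ j, ((part c j).card : ℝ) = n := by exact_mod_cast part_sum c
  rw [← add_sum_erase _ _ (mem_univ j)] at h1
  have h2 : ∑ i ∈ univ.erase j, ((part c i).card : ℝ) ≤ ∑ i ∈ univ.erase j, ((n:ℝ) / r + x) :=
    sum_le_sum fun i _ => h i
  rw [sum_const, card_erase_of_mem (mem_univ j), card_univ, Fintype.card_fin, nsmul_eq_mul, Nat.cast_sub (by omega)] at h2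
  have hrp : (0:ℝ) < r := by exact_mod_cast hr
  have e : (((r:ℝ) - (1:ℕ)) * (n / r + x)) = n - n / r + (r - 1) * x := by
    field_simp
    push_cast; ring
  linarith

def Many (H : SimpleGraph (Fin n)) (c : Fin n → Fin r) (E t m : ℕ) (u : Fin n) (i : Fin r) : Prop :=
  ∀ S : Finset (Fin n), S.card ≤ m → ∃ p : Fin t × Fin 2 → Fin n, Injective p ∧ (∀ k, p k ∉ S) ∧ (∀ k, c (p k) = i) ∧
    (∀ k, (DD H c E).Adj (p (k, 0)) (p (k, 1))) ∧ ∀ k, H.Adj u (p (k, 0))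

lemma A4b_fibre {E W b t K : ℕ} (hr5 : 5 ≤ r) (hW : WW r K ≤ W) (c : Fin n → Fin r) (L : Finset (Fin n)) (v : Fin n)
    (H0 : SimpleGraph (Fin n)) (u : Fin n) (i : Fin r) (hL : L.card ≤ b) (hvL : v ∈ L) (hi : i ≠ c v)
    (Z : Set (SimpleGraph (Fin n)))
    (hZ : ∀ H ∈ Z, AgreeOff ![v] H0 H ∧ ¬ HasC r H ∧ Gen H c K ∧ RichAll H c E W ∧ BB H c E ⊆ L ∧ (∀ y, (DD H c E).Adj v y → y ∈ L) ∧
      low H c E v ∧ (DD H c E).Adj v u ∧ Many H c E t b u i) :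
    (Z.ncard : ℝ) ≤ 2 ^ ((part c (c v))ᶜ ∪ L).card * (3 / 4) ^ t := by
  rcases Z.eq_empty_or_nonempty with rfl | ⟨H', hH'⟩
  · rw [Set.ncard_empty, Nat.cast_zero]; positivity
  · obtain ⟨hag', -, -, -, -, -, -, hvu', hm⟩ := hZ H' hH'
    obtain ⟨p, hp, hpL, hpi, hpD, hpu⟩ := hm L hL
    have hpv : ∀ k, p k ≠ v := fun k h => hi (by rw [← hpi k, h])
    have h2 := row_count ((part c (c v))ᶜ ∪ L) p hp (by
      intro k
      rw [mem_union, mem_compl]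
      left
      simp only [part, mem_filter, mem_univ, true_and, hpi k]
      exact hi)
    refine le_trans ?_ h2
    refine le_trans ?_ (Nat.cast_le.2 (rows_count ![v] H0 _))
    norm_cast
    refine ncard_le_ncard ?_ (toFinite _)
    intro H hH
    obtain ⟨hag, hC, hG, hR, hB, hD, hl, hvu, -⟩ := hZ H hH
    refine ⟨hag, fibre_rows hB hl hD, ?_⟩
    rintro k ⟨hk0, hk1⟩
    have tr : ∀ x y, x ≠ v → y ≠ v → H'.Adj x y → H.Adj x y := by
      intro x y hx hy h
      have a1 : ∀ j : Fin 1, (![v] : Fin 1 → Fin n) j ≠ x := fun j => by rw [Subsingleton.elim j 0]; exact hx.symm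
      have a2 : ∀ j : Fin 1, (![v] : Fin 1 → Fin n) j ≠ y := fun j => by rw [Subsingleton.elim j 0]; exact hy.symm
      exact (hag x y a1 a2).1 ((hag' x y a1 a2).2 h)
    have hlow : ∀ k, low H c E (p k) := by
      intro k
      by_contra h
      exact hpL k (hB (by simpa [BB] using h))
    simp only [rows, decide_eq_true_eq] at hk0 hk1
    change H.Adj _ v at hk0 hk1
    have huv : u ≠ v := hvu.2.1.ne'
    exact hC (embed_two_edges hr5 hG hR hW (i := i) (i' := c v) hi (hlow (k,0)) (hlow (k,1)) hvu.2.2.2 hvu.2.2.1 (hpi _) (hpi _) hvu.1.symm rfl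
      (tr _ _ (hpv _) (hpv _) (hpD k).2.1) hvu.2.1.symm (tr _ _ huv (hpv _) (hpu k)).symm hk0 hk1)

lemma A4b (hr5 : 5 ≤ r) (hr0 : 0 < r) {ν η ε μ : ℝ} (hν : 0 < ν) (hη : 2 * η < ν ^ 2) (hε : 0 < ε)
    (hμ : 4 * r * r * ν + 2 * ε ≤ μ) (hWW : ∀ᶠ n : ℕ in atTop, WW r ⌈ν * n⌉₊ ≤ ⌈μ * n⌉₊) (b : ℕ) :
    Small r (fun n => {H | Nice hr0 ν η ⌈ε * n⌉₊ ⌈μ * n⌉₊ b H ∧ (∀ i, ((part (opt hr0 H) i).card:ℝ) ≤ (n:ℝ) / r + (lg n:ℝ) ^ 2) ∧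
      ∃ v u i, (DD H (opt hr0 H) ⌈ε * n⌉₊).Adj v u ∧ i ≠ opt hr0 H v ∧
        (univ.filter (fun x => (DD H (opt hr0 H) ⌈ε * n⌉₊).Adj v x)).card ≤ 2 ∧
        Many H (opt hr0 H) ⌈ε * n⌉₊ (lg n ^ 3) (2 * b + 3) u i}) := by
  have hrp : (0:ℝ) < r := by exact_mod_cast hr0
  refine small_uniq (by omega) hr0 hν hη hε hμ b (2 * r * 2 ^ (2 * b + 3)) (by positivity)
    (fun n v H => (Nice hr0 ν η ⌈ε * n⌉₊ ⌈μ * n⌉₊ b H ∧ low H (opt hr0 H) ⌈ε * n⌉₊ v ∧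
      (univ.filter (fun x => (DD H (opt hr0 H) ⌈ε * n⌉₊).Adj v x)).card ≤ 2) ∧
      (∀ i, ((part (opt hr0 H) i).card:ℝ) ≤ (n:ℝ) / r + (lg n:ℝ) ^ 2) ∧ ∃ u i, (DD H (opt hr0 H) ⌈ε * n⌉₊).Adj v u ∧ i ≠ opt hr0 H v ∧
        Many H (opt hr0 H) ⌈ε * n⌉₊ (lg n ^ 3) (2 * b + 3) u i) (fun n v H h => h.1) ?_
  filter_upwards [hWW, lg_tendsto.eventually_ge_atTop (3 * (r + 2))] with n hW hlg
  constructor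
  · rintro H ⟨hN, hbal, v, u, i, hvu, hi, hd, hM⟩
    exact ⟨v, ⟨hN, hvu.2.2.1, hd⟩, hbal, u, i, hvu, hi, hM⟩
  intro v H0 h0 c L hL hvL hBL
  set Z := {H | ((Nice hr0 ν η ⌈ε * n⌉₊ ⌈μ * n⌉₊ b H ∧ low H (opt hr0 H) ⌈ε * n⌉₊ v ∧
      (univ.filter (fun x => (DD H (opt hr0 H) ⌈ε * n⌉₊).Adj v x)).card ≤ 2) ∧
      (∀ i, ((part (opt hr0 H) i).card:ℝ) ≤ (n:ℝ) / r + (lg n:ℝ) ^ 2) ∧ ∃ u i, (DD H (opt hr0 H) ⌈ε * n⌉₊).Adj v u ∧ i ≠ opt hr0 H v ∧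
        Many H (opt hr0 H) ⌈ε * n⌉₊ (lg n ^ 3) (2 * b + 3) u i) ∧ AgreeOff ![v] H0 H ∧ opt hr0 H = c ∧ BB H c ⌈ε * n⌉₊ ⊆ L ∧ ∀ y, (DD H c ⌈ε * n⌉₊).Adj v y → y ∈ L} with hZ
  rcases Z.eq_empty_or_nonempty with hZe | ⟨H', hH'⟩
  · rw [hZe]
    simp only [Set.ncard_empty, Nat.cast_zero]
    positivity
  have hpl : (n:ℝ) / r - (r - 1) * (lg n:ℝ) ^ 2 ≤ (part c (c v)).card := by
    obtain ⟨⟨_, h, _⟩, _, rfl, _⟩ := hH'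
    exact part_lower hr0 _ h _
  let Zui : Fin n × Fin r → Set (SimpleGraph (Fin n)) := fun z => {H | H ∈ Z ∧ (DD H c ⌈ε * n⌉₊).Adj v z.1 ∧ z.2 ≠ c v ∧ Many H c ⌈ε * n⌉₊ (lg n ^ 3) (2 * b + 3) z.1 z.2}
  have hcov : Z ⊆ ⋃ z ∈ (univ : Finset (Fin n × Fin r)), Zui z := by
    intro H hH
    obtain ⟨⟨_, _, u, i, h1, h2, h3⟩, _, hc, _⟩ := id hH
    rw [hc] at h1 h2 h3
    simp only [mem_univ, Set.iUnion_true, Set.mem_iUnion]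
    exact ⟨(u, i), hH, h1, h2, h3⟩
  have hF := fibre_card c (c v) L hL
  have hone : ∀ z, ((Zui z).ncard : ℝ) ≤ 2 ^ ((part c (c v))ᶜ ∪ L).card * (3 / 4) ^ (lg n ^ 3) := by
    intro z
    by_cases hz : z.2 ≠ c v
    · refine A4b_fibre (E := ⌈ε * n⌉₊) (K := ⌈ν * n⌉₊) hr5 hW c L v H0 z.1 z.2 hL hvL hz _ ?_
      rintro H ⟨⟨⟨⟨hN, hl, hd⟩, _, _⟩, hag, rfl, hB, hD⟩, h1, h2, h3⟩
      exact ⟨hag, hN.noC, hN.near.2.1, hN.rich, hB, hD, hl, h1, h3⟩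
    · have : Zui z = ∅ := by
        rw [Set.eq_empty_iff_forall_notMem]
        rintro H ⟨_, _, h, _⟩; exact hz h
      rw [this, Set.ncard_empty, Nat.cast_zero]; positivity
  have h1 : (Z.ncard : ℝ) ≤ ∑ z : Fin n × Fin r, ((Zui z).ncard : ℝ) := by
    have := (ncard_le_ncard hcov (toFinite _)).trans (Finset.set_ncard_biUnion_le _ _)
    exact_mod_cast this
  have h2 : (Z.ncard : ℝ) ≤ (n * r) * (2 ^ ((part c (c v))ᶜ ∪ L).card * (3 / 4) ^ (lg n ^ 3)) := by
    refine h1.trans ((sum_le_sum fun z _ => hone z).trans ?_)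
    simp
  refine h2.trans ?_
  set ℓ := lg n with hℓ
  have h4 : (n:ℝ) ≤ 2 * 2 ^ (ℓ:ℝ) := by
    have : n + 1 ≤ 2 ^ (ℓ + 1) := Nat.lt_pow_succ_log_self (by norm_num) n
    rw [rpow_natCast]
    have h : (n:ℝ) + 1 ≤ 2 ^ (ℓ + 1) := by exact_mod_cast this
    rw [pow_succ] at h; linarith
  have h5 : ((3:ℝ) / 4) ^ (ℓ ^ 3) ≤ 2 ^ (-((ℓ:ℝ) ^ 3 / 3)) := by
    have : ((3:ℝ) / 4) ≤ 2 ^ (-((1:ℝ) / 3)) := by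
      rw [rpow_neg (by norm_num), le_inv_comm₀ (by norm_num) (by positivity)]
      rw [one_div, Real.rpow_inv_le_iff_of_pos (by norm_num) (by norm_num) (by norm_num)]
      norm_num
    calc ((3:ℝ) / 4) ^ (ℓ ^ 3) ≤ (2 ^ (-((1:ℝ) / 3))) ^ (ℓ ^ 3) := by gcongr
      _ = _ := by
        rw [← rpow_natCast, ← rpow_mul (by norm_num)]
        push_cast
        congr 1; ring
  have h6 : ((2:ℝ)) ^ ((part c (c v))ᶜ ∪ L).card ≤ 2 ^ ((n:ℝ) - n / r + (r - 1) * (ℓ:ℝ)^2) * 2 ^ (2 * b + 3) := by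
    rw [← rpow_natCast, ← rpow_natCast 2 (2 * b + 3), ← rpow_add (by norm_num)]
    refine rpow_le_rpow_of_exponent_le (by norm_num) ?_
    push_cast at hF ⊢
    linarith
  have h7 : (2:ℝ) ^ (ℓ:ℝ) * (2 ^ ((n:ℝ) - n / r + (r - 1) * (ℓ:ℝ)^2) * 2 ^ (-((ℓ:ℝ) ^ 3 / 3))) ≤ 2 ^ (al r * n - (ℓ:ℝ) ^ 2) := by
    rw [← rpow_add (by norm_num), ← rpow_add (by norm_num)]
    refine rpow_le_rpow_of_exponent_le (by norm_num) ?_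
    unfold al
    have e : (1 - 1 / (r:ℝ)) * n = n - n / r := by ring
    rw [e]
    have h8 : (3 * ((r:ℝ) + 2)) ≤ ℓ := by exact_mod_cast hlg
    have h9 : 1 ≤ (ℓ:ℝ) := by linarith
    have h10 : (ℓ:ℝ) ≤ ℓ ^ 2 := by nlinarith
    have h11 : (3 * ((r:ℝ) + 2)) * ℓ ^ 2 ≤ ℓ ^ 3 := by
      have : (ℓ:ℝ) ^ 3 = ℓ * ℓ ^ 2 := by ring
      rw [this]; gcongr
    nlinarith
  calc ((n:ℝ) * r) * (2 ^ ((part c (c v))ᶜ ∪ L).card * (3 / 4) ^ (ℓ ^ 3))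
      ≤ ((2 * 2 ^ (ℓ:ℝ)) * r) * ((2 ^ ((n:ℝ) - n / r + (r - 1) * (ℓ:ℝ)^2) * 2 ^ (2 * b + 3)) * 2 ^ (-((ℓ:ℝ) ^ 3 / 3))) := by gcongr
    _ = 2 * r * 2 ^ (2 * b + 3) * ((2:ℝ) ^ (ℓ:ℝ) * (2 ^ ((n:ℝ) - n / r + (r - 1) * (ℓ:ℝ)^2) * 2 ^ (-((ℓ:ℝ) ^ 3 / 3)))) := by ring
    _ ≤ _ := by gcongr

/-- greedy choice of disjoint pairs avoiding a set -/
lemma greedy (R : Fin n → Fin n → Prop) (M : ℕ)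
    (h : ∀ C : Finset (Fin n), C.card ≤ M → ∃ x y, x ∉ C ∧ y ∉ C ∧ x ≠ y ∧ R x y) :
    ∀ t (S : Finset (Fin n)), S.card + 2 * t ≤ M → ∃ p : Fin t × Fin 2 → Fin n, Injective p ∧ (∀ k, p k ∉ S) ∧ ∀ k, R (p (k, 0)) (p (k, 1)) := by
  intro t
  induction t with
  | zero =>
    intro S _
    exact ⟨fun z => z.1.elim0, fun z => z.1.elim0, fun z => z.1.elim0, fun z => z.elim0⟩
  | succ t ih =>
    intro S hS
    obtain ⟨x, y, hx, hy, hxy, hR⟩ := h S (by omega)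
    obtain ⟨p, hp, hpS, hpR⟩ := ih (insert x (insert y S)) (by
      have := card_insert_le x (insert y S)
      have := card_insert_le y S
      omega)
    have hpx : ∀ k, p k ≠ x := fun k h => hpS k (by simp [h])
    have hpy : ∀ k, p k ≠ y := fun k h => hpS k (by simp [h])
    refine ⟨fun z => Fin.cases (motive := fun _ => Fin n) (if z.2 = 0 then x else y) (fun k => p (k, z.2)) z.1, ?_, ?_, ?_⟩
    · rintro ⟨a, a'⟩ ⟨b, b'⟩ hab
      induction a using Fin.cases with
      | zero =>
        induction b using Fin.cases with
        | zero =>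
          simp only [Fin.cases_zero] at hab
          fin_cases a' <;> fin_cases b' <;> simp_all
        | succ b =>
          simp only [Fin.cases_zero, Fin.cases_succ] at hab
          split_ifs at hab
          · exact absurd hab.symm (hpx _)
          · exact absurd hab.symm (hpy _)
      | succ a =>
        induction b using Fin.cases with
        | zero =>
          simp only [Fin.cases_zero, Fin.cases_succ] at hab
          split_ifs at hab
          · exact absurd hab (hpx _)
          · exact absurd hab (hpy _)
        | succ b =>
          simp only [Fin.cases_succ] at hab
          have := hp hab
          simp only [Prod.mk.injEq] at this
          simp [this.1, this.2]
    · rintro ⟨a, a'⟩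
      induction a using Fin.cases with
      | zero => simp only [Fin.cases_zero]; split_ifs <;> assumption
      | succ a =>
        simp only [Fin.cases_succ]
        exact fun h => hpS (a, a') (by simp [h])
    · intro k
      induction k using Fin.cases with
      | zero => simpa using hR
      | succ a => simpa using hpR a

lemma many_of_not_ex {E M t m : ℕ} {k : ℝ} {H : SimpleGraph (Fin n)} {c : Fin n → Fin r} {u : Fin n} (hu : low H c E u)
    (hex : ¬ Ex4 H c E k M u) {i : Fin r} (hi : i ≠ c u) (hk : ∀ C : Finset (Fin n), C.card ≤ M →
      k ≤ ((Us (DD H c E) C).filter (fun x => c x = i)).card) (hM : m + 2 * t ≤ M) : Many H c E t m u i := by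
  intro S hS
  obtain ⟨p, h1, h2, h3⟩ := greedy (fun x y => c x = i ∧ (DD H c E).Adj x y ∧ H.Adj u x) M (by
    intro C hC
    have : ∃ x ∈ Us (DD H c E) C, c x = i ∧ H.Adj u x := by
      by_contra hcon
      push Not at hcon
      exact hex ⟨hu, i, hi, C, hC, hk C hC, hcon⟩
    obtain ⟨x, hx, hxi, hux⟩ := this
    obtain ⟨hxC, y, hyC, hxy⟩ := mem_Us.1 hx
    exact ⟨x, y, hxC, hyC, hxy.ne, hxi, hxy, hux⟩) t S (by omega)
  refine ⟨p, h1, h2, ?_, fun k => (h3 k).2.1, fun k => (h3 k).2.2⟩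
  rintro ⟨k, e⟩
  fin_cases e
  · exact (h3 k).1
  · exact (h3 k).2.1.1.symm.trans (h3 k).1

lemma Us_mono (D : SimpleGraph (Fin n)) {C C' : Finset (Fin n)} (h : C ⊆ C') : Us D C' ⊆ Us D C := by
  intro x hx
  obtain ⟨h1, y, h2, h3⟩ := mem_Us.1 hx
  exact mem_Us.2 ⟨fun a => h1 (h a), y, fun a => h2 (h a), h3⟩

/-- If for every part there is a small set killing it, there is one small set killing all. -/
lemma exists_typ {t M K : ℕ} {k : ℝ} (D : SimpleGraph (Fin n)) (c : Fin n → Fin r) (hM : r * t ≤ M)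
    (hU : ∀ C : Finset (Fin n), C.card ≤ M → K < (Us D C).card) (hk : r * k ≤ K + 1) :
    ∃ i, ∀ C : Finset (Fin n), C.card ≤ t → k ≤ ((Us D C).filter (fun x => c x = i)).card := by
  by_contra hcon
  push Not at hcon
  choose C hC hlt using hcon
  have h1 := hU (univ.biUnion C) (by
    refine (card_biUnion_le).trans (le_trans ?_ hM)
    refine (sum_le_sum fun i _ => hC i).trans ?_
    simp)
  have h2 : ((Us D (univ.biUnion C)).card : ℝ) = ∑ i, (((Us D (univ.biUnion C)).filter (fun x => c x = i)).card : ℝ) := by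
    have := Finset.card_eq_sum_card_fiberwise (f := c) (s := Us D (univ.biUnion C)) (t := univ) (fun _ _ => mem_coe.2 (mem_univ _))
    exact_mod_cast this
  rcases Nat.eq_zero_or_pos r with rfl | hr
  · simp only [Finset.univ_eq_empty, Finset.sum_empty] at h2
    have : (Us D (univ.biUnion C)).card = 0 := by exact_mod_cast h2
    simp only [Finset.univ_eq_empty] at h1
    simp only [Finset.univ_eq_empty] at this
    omega
  have h3 : ∑ i, (((Us D (univ.biUnion C)).filter (fun x => c x = i)).card : ℝ) < ∑ i : Fin r, k := by
    haveI : Nonempty (Fin r) := ⟨⟨0, hr⟩⟩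
    refine Finset.sum_lt_sum_of_nonempty Finset.univ_nonempty fun i _ => lt_of_le_of_lt ?_ (hlt i)
    norm_cast
    exact card_le_card (Finset.filter_subset_filter _ (Us_mono D (Finset.subset_biUnion_of_mem C (mem_univ i))))
  rw [← h2] at h3
  simp only [sum_const, card_univ, Fintype.card_fin, nsmul_eq_mul] at h3
  have h4 : (K:ℝ) + 1 ≤ (Us D (univ.biUnion C)).card := by exact_mod_cast h1
  linarith

def cset3 (H : SimpleGraph (Fin n)) (c : Fin n → Fin r) (v x y : Fin n) (j : Fin r) (s s' s'' : Prop) : Finset (Fin n) :=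
  univ.filter (fun z => c z = j ∧ (H.Adj z v ↔ s) ∧ (H.Adj z x ↔ s') ∧ (H.Adj z y ↔ s''))

lemma cset3_card (H : SimpleGraph (Fin n)) (c : Fin n → Fin r) (v x y : Fin n) (j : Fin r) (s s' s'' : Prop) :
    (cset3 H c v x y j s s' s'').card = cls3 H c v x y j s s' s'' := by
  unfold cset3 cls3; rfl

lemma of_mem_filter' {α : Type*} {p : α → Prop} {inst : DecidablePred p} {s : Finset α} {x : α} (h : x ∈ @Finset.filter α p inst s) : p x :=
  (mem_filter.1 h).2

def Poor5 (H : SimpleGraph (Fin n)) (c : Fin n → Fin r) (E W : ℕ) (v x y : Fin n) (i : Fin r) : Prop :=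
  ∃ j, j ≠ i ∧ ∃ s : Bool × Bool × Bool, E ≤ (univ.filter (fun z => c z = j ∧ decide (H.Adj z v) = s.1)).card ∧
    cls3 H c v x y j (s.1 = true) (s.2.1 = true) (s.2.2 = true) < W

def Aset (i j cx : Fin r) (ρ : Bool) (s : Bool × Bool × Bool) : Finset (Bool × Bool) :=
  if cx = i then {(false, false)} else if cx = j ∧ ρ = s.1 then univ.erase s.2 else univ

lemma Aset_card {i j : Fin r} (hij : j ≠ i) (cx : Fin r) (ρ : Bool) (s : Bool × Bool × Bool) :
    ((Aset i j cx ρ s).card : ℝ) = (if cx = i then 1 else 4) * (if cx = j ∧ ρ = s.1 then 3 / 4 else 1) := by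
  unfold Aset
  split_ifs with h1 h2 h2
  · exact absurd (h2.1.symm.trans h1) hij
  · simp
  · rw [card_erase_of_mem (mem_univ _)]; simp; norm_num
  · simp

lemma pat_count {s t : ℕ} (e : Fin s ≃ Option (Fin t × Fin 2)) (ρ : Bool) (A : Fin t → Finset (Bool × Bool)) :
    ({f : Fin s → Bool | f (e.symm none) = ρ ∧ ∀ k, (f (e.symm (some (k, 0))), f (e.symm (some (k, 1)))) ∈ A k} : Set (Fin s → Bool)).ncard
      ≤ ∏ k, (A k).card := by
  rw [← Fintype.card_piFinset, ← ncard_coe_finset]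
  refine Set.ncard_le_ncard_of_injOn (fun f k => (f (e.symm (some (k, 0))), f (e.symm (some (k, 1))))) ?_ ?_ (toFinite _)
  · rintro f ⟨h1, h2⟩
    simp only [mem_coe, Fintype.mem_piFinset]
    exact h2
  · rintro f ⟨h1, h2⟩ g ⟨h3, h4⟩ hfg
    funext a
    obtain ⟨z, rfl⟩ := e.symm.surjective a
    rcases z with _ | ⟨k, b⟩
    · rw [h1, h3]
    · have := congrFun hfg k
      simp only [Prod.mk.injEq] at this
      fin_cases b
      · exact this.1
      · exact this.2

lemma prod_Aset {i j : Fin r} (hij : j ≠ i) (c : Fin n → Fin r) (ρ : Fin n → Bool) (s : Bool × Bool × Bool) {E : ℕ}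
    (hE : E ≤ (univ.filter (fun z => c z = j ∧ ρ z = s.1)).card) :
    ∏ x, ((Aset i j (c x) (ρ x) s).card : ℝ) ≤ 4 ^ (n - (part c i).card) * (3 / 4) ^ E := by
  simp only [Aset_card hij]
  rw [prod_mul_distrib]
  have h1 : ∏ x, (if c x = i then (1:ℝ) else 4) = 4 ^ (n - (part c i).card) := by
    rw [prod_ite, Finset.prod_const_one, one_mul, prod_const]
    congr 1
    have := Finset.card_filter_add_card_filter_not (s := (univ : Finset (Fin n))) (fun x => c x = i)
    rw [card_univ, Fintype.card_fin] at this
    have h : (part c i).card = (univ.filter (fun x => c x = i)).card := rfl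
    omega
  have h2 : ∏ x, (if c x = j ∧ ρ x = s.1 then (3 / 4 : ℝ) else 1) ≤ (3 / 4) ^ E := by
    rw [prod_ite, Finset.prod_const_one, mul_one, prod_const]
    exact pow_le_pow_of_le_one (by norm_num) (by norm_num) hE
  rw [h1]
  gcongr

set_option maxHeartbeats 1600000 in
lemma A5count (hr : 2 ≤ r) (hr0 : 0 < r) {ε : ℝ} (hε : 0 < ε) (t : ℕ) (ht : 10 / ε ≤ t) :
    ∃ ζ : ℝ, 0 < ζ ∧ ∀ ε3 μ5 : ℝ, 0 < ε3 → ε3 ≤ ζ → 0 < μ5 → μ5 ≤ ζ →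
    ∃ ζ0 : ℝ, 0 < ζ0 ∧ ∀ ν η : ℝ, 0 < ν → ν ≤ ζ0 → 2 * η < ν ^ 2 →
      Small r (fun n => {H | ¬ HasC r H ∧ Near hr0 ν η H ∧ ∃ v i, ∃ p : Fin t × Fin 2 → Fin n, Injective p ∧ (∀ k, p k ≠ v) ∧
        (∀ k, opt hr0 H (p k) = i ∧ low H (opt hr0 H) ⌈ε3 * n⌉₊ (p k)) ∧
        ∀ k, Poor5 H (opt hr0 H) ⌈ε * n⌉₊ ⌈μ5 * n⌉₊ v (p (k, 0)) (p (k, 1)) i}) := by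
  have hrp : (2:ℝ) ≤ r := by exact_mod_cast hr
  have htp : (0:ℝ) < t := lt_of_lt_of_le (by positivity) ht
  obtain ⟨ζ, hζ, ζ0, hζ0, h⟩ := gain_near hr hr0 (1 + 2 * t) (by omega) (γ := 1) (by norm_num)
  refine ⟨ζ / (8 * t), by positivity, ?_⟩
  intro ε3 μ5 hε3 hεζ hμ hμζ
  refine ⟨min ζ0 (1 / (4 * t)), by positivity, ?_⟩
  intro ν η hν hν0 hη
  have hν1 := hν0.trans (min_le_right _ _)
  refine h ν η hν (hν0.trans (min_le_left _ _)) hη _ ?_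
  have e : Fin (1 + 2 * t) ≃ Option (Fin t × Fin 2) := Fintype.equivOfCardEq (by simp; ring)
  filter_upwards [ev_lin_ge (γ := ζ / 2) (by positivity) (3 * t), ev_const_le (γ := 1 / 2) (by norm_num) (r * (r * 8) ^ t),
    eventually_gt_atTop 0] with n hn5 hn1 hn0
  have hnp : (0:ℝ) < n := by exact_mod_cast hn0
  have hcE := (Nat.ceil_lt_add_one (show 0 ≤ ε3 * n by positivity)).le
  have hcM := (Nat.ceil_lt_add_one (show 0 ≤ μ5 * n by positivity)).le
  have hEle := Nat.le_ceil (ε * n)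
  set E := ⌈ε * n⌉₊ with hE
  set E3 := ⌈ε3 * n⌉₊ with hE3
  set W := ⌈μ5 * n⌉₊ with hW
  clear_value E E3 W
  have hEn : ε3 * n ≤ ζ / (8 * t) * n := by gcongr
  have hMn : μ5 * n ≤ ζ / (8 * t) * n := by gcongr
  have hexc : (t * (2 * E3 + W) : ℝ) ≤ ζ * n := by
    have : (2 * E3 + W : ℝ) ≤ 3 * (ζ / (8 * t) * n) + 3 := by linarith
    calc (t * (2 * E3 + W) : ℝ) ≤ t * (3 * (ζ / (8 * t) * n) + 3) := by gcongr
      _ = 3 / 8 * ζ * n + 3 * t := by field_simp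
      _ ≤ _ := by nlinarith
  refine ⟨fun q H => ∃ i, (∀ k, opt hr0 H (q (e.symm (some k))) = i ∧ low H (opt hr0 H) E3 (q (e.symm (some k)))) ∧
    ∀ k, Poor5 H (opt hr0 H) E W (q (e.symm none)) (q (e.symm (some (k, 0)))) (q (e.symm (some (k, 1)))) i, ?_, ?_⟩
  · rintro H ⟨h1, h2, v, i, p, hp, hpv, hl, hpoor⟩
    refine ⟨h1, h2, fun a => (e a).elim v p, ?_, i, ?_, ?_⟩
    · intro a b hab
      simp only at hab
      apply e.injective
      cases ha : e a <;> cases hb : e b <;> rw [ha, hb] at hab <;> simp only [Option.elim] at hab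
      · exact absurd hab.symm (hpv _)
      · exact absurd hab (hpv _)
      · rw [hp hab]
    · intro k; simpa using hl k
    · intro k; simpa using hpoor k
  · intro q hq H1 hP1 hN1
    have hbal := hN1.2.2
    set c := opt hr0 H1 with hc
    refine ⟨{d : (Fin n → Bool) × Fin r × (Fin t → Fin r × (Bool × Bool × Bool)) // ∀ k, (d.2.2 k).1 ≠ d.2.1 ∧
      E ≤ (univ.filter (fun z => c z = (d.2.2 k).1 ∧ d.1 z = (d.2.2 k).2.1)).card}, inferInstance,
      fun d x => {f | f (e.symm none) = d.1.1 x ∧ ∀ k, (f (e.symm (some (k, 0))), f (e.symm (some (k, 1)))) ∈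
        Aset d.1.2.1 (d.1.2.2 k).1 (c x) (d.1.1 x) (d.1.2.2 k).2},
      fun d x => ∏ k, ((Aset d.1.2.1 (d.1.2.2 k).1 (c x) (d.1.1 x) (d.1.2.2 k).2).card : ℝ), ?_, ?_, ?_, ?_⟩
    · intro d x
      have : ∀ k, (1:ℝ) ≤ ((Aset d.1.2.1 (d.1.2.2 k).1 (c x) (d.1.1 x) (d.1.2.2 k).2).card : ℝ) := by
        intro k
        rw [Aset_card (d.2 k).1]
        split_ifs with h1 h2
        · exact absurd (h2.1.symm.trans h1) (d.2 k).1
        · norm_num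
        · norm_num
        · norm_num
      calc (1:ℝ) = ∏ k : Fin t, (1:ℝ) := by simp
        _ ≤ _ := Finset.prod_le_prod (fun _ _ => by norm_num) (fun k _ => this k)
    · intro d x
      beta_reduce
      have := pat_count e (d.1.1 x) (fun k => Aset d.1.2.1 (d.1.2.2 k).1 (c x) (d.1.1 x) (d.1.2.2 k).2)
      exact_mod_cast this
    · intro d
      beta_reduce
      rw [Finset.prod_comm]
      have h1 : ∏ k, ∏ x, ((Aset d.1.2.1 (d.1.2.2 k).1 (c x) (d.1.1 x) (d.1.2.2 k).2).card : ℝ) ≤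
          ∏ k : Fin t, ((4:ℝ) ^ (n - (part c d.1.2.1).card) * (3 / 4) ^ E) := by
        refine Finset.prod_le_prod (fun _ _ => prod_nonneg fun _ _ => Nat.cast_nonneg _) (fun k _ => prod_Aset (d.2 k).1 c d.1.1 (d.1.2.2 k).2 (d.2 k).2)
      rw [prod_const, card_univ, Fintype.card_fin] at h1
      have h2 : (Fintype.card {d : (Fin n → Bool) × Fin r × (Fin t → Fin r × (Bool × Bool × Bool)) // ∀ k, (d.2.2 k).1 ≠ d.2.1 ∧
          E ≤ (univ.filter (fun z => c z = (d.2.2 k).1 ∧ d.1 z = (d.2.2 k).2.1)).card} : ℝ) ≤ 2 ^ (n:ℝ) * 2 ^ ((1:ℝ) / 2 * n) := by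
        refine le_trans (b := (2:ℝ) ^ (n:ℝ) * (r * (r * 8) ^ t)) ?_ (by gcongr)
        rw [rpow_natCast]
        have := Fintype.card_subtype_le (fun d : (Fin n → Bool) × Fin r × (Fin t → Fin r × (Bool × Bool × Bool)) => ∀ k, (d.2.2 k).1 ≠ d.2.1 ∧
          E ≤ (univ.filter (fun z => c z = (d.2.2 k).1 ∧ d.1 z = (d.2.2 k).2.1)).card)
        refine (Nat.cast_le.2 this).trans ?_
        simp
      have h3 : ((4:ℝ) ^ (n - (part c d.1.2.1).card) * (3 / 4) ^ E) ≤ 2 ^ (2 * ((n:ℝ) - n / r + ν * n) - 2 / 5 * (ε * n)) := by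
        have hp : (part c d.1.2.1).card ≤ n := by
          have := card_le_univ (part c d.1.2.1); simpa using this
        have h4 : (4:ℝ) ^ (n - (part c d.1.2.1).card) ≤ 2 ^ (2 * ((n:ℝ) - n / r + ν * n)) := by
          have e4 : (4:ℝ) = 2 ^ (2:ℝ) := by norm_num
          rw [e4, ← rpow_natCast, ← rpow_mul (by norm_num)]
          refine rpow_le_rpow_of_exponent_le (by norm_num) ?_
          rw [Nat.cast_sub hp]
          have := (abs_le.1 (hbal d.1.2.1)).1
          linarith
        have h5 : ((3:ℝ) / 4) ^ E ≤ 2 ^ (-(2 / 5 * (ε * n))) := by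
          have : ((3:ℝ) / 4) ≤ 2 ^ (-((2:ℝ) / 5)) := by
            have e2 : (2:ℝ) ^ (-((2:ℝ) / 5)) = ((1/4 : ℝ)) ^ ((1:ℝ)/5) := by
              have : (1/4:ℝ) = 2 ^ (-(2:ℝ)) := by rw [rpow_neg (by norm_num)]; norm_num
              rw [this, ← rpow_mul (by norm_num)]; norm_num
            rw [e2, one_div (5:ℝ), Real.le_rpow_inv_iff_of_pos (by norm_num) (by norm_num) (by norm_num)]
            norm_num
          calc ((3:ℝ) / 4) ^ E ≤ (2 ^ (-((2:ℝ) / 5))) ^ E := by gcongr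
            _ = 2 ^ (-((2:ℝ) / 5) * E) := by
              rw [← rpow_natCast, ← rpow_mul (by norm_num)]
            _ ≤ _ := by
              refine rpow_le_rpow_of_exponent_le (by norm_num) ?_
              linarith
        calc _ ≤ (2:ℝ) ^ (2 * ((n:ℝ) - n / r + ν * n)) * 2 ^ (-(2 / 5 * (ε * n))) := by gcongr
          _ = _ := by rw [← rpow_add (by norm_num)]; ring_nf
      have h6 : ((4:ℝ) ^ (n - (part c d.1.2.1).card) * (3 / 4) ^ E) ^ t ≤ 2 ^ ((2 * ((n:ℝ) - n / r + ν * n) - 2 / 5 * (ε * n)) * t) := by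
        rw [rpow_mul (by norm_num), rpow_natCast]
        gcongr
      calc _ ≤ ((2:ℝ) ^ (n:ℝ) * 2 ^ ((1:ℝ) / 2 * n)) * 2 ^ ((2 * ((n:ℝ) - n / r + ν * n) - 2 / 5 * (ε * n)) * t) := by
            refine mul_le_mul h2 (h1.trans h6) (by positivity) (by positivity)
        _ = 2 ^ ((n:ℝ) + (1:ℝ) / 2 * n + (2 * ((n:ℝ) - n / r + ν * n) - 2 / 5 * (ε * n)) * t) := by
            rw [← rpow_add (by norm_num), ← rpow_add (by norm_num)]
        _ ≤ _ := by
            refine rpow_le_rpow_of_exponent_le (by norm_num) ?_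
            have k1 : 10 * (n:ℝ) ≤ ε * n * t := by
              rw [div_le_iff₀ hε] at ht
              nlinarith
            have k2 : ν * n * t ≤ 1 / 4 * n := by
              have : ν * t ≤ 1 / 4 := by
                rw [le_div_iff₀ (by positivity)] at hν1
                linarith
              nlinarith
            have k3 : (n:ℝ) / r ≤ n / 2 := by gcongr
            unfold al
            push_cast
            have e : ((1 + 2 * (t:ℝ)) * (1 - 1 / (r:ℝ)) - 1) * n = 2 * t * n - n / r - 2 * t * (n / r) := by ring
            rw [e]
            linarith
    · rintro H ⟨i, hi, hpoor⟩ hN hC hag hopt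
      rw [hopt] at hi hpoor
      choose j hj s hs1 hs2 using hpoor
      refine ⟨⟨(fun z => decide (H.Adj z (q (e.symm none))), i, fun k => (j k, s k)), fun k => ⟨hj k, hs1 k⟩⟩, ?_⟩
      refine le_trans ?_ hexc
      norm_cast
      refine (card_le_card (t := univ.biUnion (fun k : Fin t =>
          (nbs H c (q (e.symm (some (k, 0)))) i ∪ nbs H c (q (e.symm (some (k, 1)))) i) ∪
          cset3 H c (q (e.symm none)) (q (e.symm (some (k, 0)))) (q (e.symm (some (k, 1)))) (j k) ((s k).1 = true) ((s k).2.1 = true) ((s k).2.2 = true))) ?_).trans ?_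
      · intro x hx
        have hx := of_mem_filter' hx
        simp only [mem_ofPred_eq, rows, true_and, not_forall] at hx
        obtain ⟨k, hk⟩ := hx
        rw [mem_biUnion]
        refine ⟨k, mem_univ _, ?_⟩
        unfold Aset at hk
        simp only [mem_union, nbs, cset3, mem_filter, mem_univ, true_and]
        split_ifs at hk with h1 h2
        · left
          simp only [mem_singleton, Prod.mk.injEq, decide_eq_false_iff_not, not_and_or, not_not] at hk
          rcases hk with hk | hk
          · exact Or.inl ⟨h1, hk.symm⟩
          · exact Or.inr ⟨h1, hk.symm⟩
        · right
          simp only [mem_erase, mem_univ, and_true, not_not] at hk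
          refine ⟨h2.1, ?_, ?_, ?_⟩
          · rw [← h2.2]; simp
          · rw [← hk]; simp
          · rw [← hk]; simp
        · simp at hk
      refine (card_biUnion_le_card_mul _ _ (2 * E3 + W) ?_).trans (by simp)
      intro k _
      have a1 := (hi (k, 0)).2
      have a2 := (hi (k, 1)).2
      unfold low at a1 a2
      rw [(hi _).1] at a1 a2
      have a3 := hs2 k
      rw [← cset3_card] at a3
      refine (card_union_le _ _).trans ?_
      have a4 := card_union_le (nbs H c (q (e.symm (some (k, 0)))) i) (nbs H c (q (e.symm (some (k, 1)))) i)
      omega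

lemma A5comb {K E E3 W W5 M b t : ℕ} {ν η : ℝ} (hr5 : 5 ≤ r) (hr0 : 0 < r) {H : SimpleGraph (Fin n)} (hN : Nice hr0 ν η E W b H)
    (hg : Gen H (opt hr0 H) K) (hW5 : WW r K ≤ W5) (i : Fin r) (hD : ∀ x y, (DD H (opt hr0 H) E).Adj x y → opt hr0 H x = i)
    (hU : ∀ C : Finset (Fin n), C.card ≤ M → (part (opt hr0 H) i).card < (Us (DD H (opt hr0 H) E) C).card + E)
    (hM : (BB H (opt hr0 H) E3).card + 2 * t ≤ M) (hE3 : W5 + 2 * E3 ≤ E) {v : Fin n} (hv : v ∈ BB H (opt hr0 H) E) :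
    ∃ p : Fin t × Fin 2 → Fin n, Injective p ∧ (∀ k, p k ≠ v) ∧
        (∀ k, opt hr0 H (p k) = i ∧ low H (opt hr0 H) E3 (p k)) ∧
        ∀ k, Poor5 H (opt hr0 H) E W5 v (p (k, 0)) (p (k, 1)) i := by
  have hnb := fun j => (opt_isOpt hr0 H).nb_le v j
  have hfour := hN.four v
  have hC := hN.noC
  set c := opt hr0 H with hc
  have hvl : E ≤ (nbs H c v (c v)).card := by
    simp only [BB, mem_filter, mem_univ, true_and, low, not_lt] at hv
    exact hv
  obtain ⟨b1, hb1, b2, hb2, hb12⟩ := Finset.one_lt_card.1 (show 1 < ((univ.filter (fun j => E ≤ (gbs H c v j).card)).erase i).card by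
    have := Finset.pred_card_le_card_erase (s := univ.filter (fun j => E ≤ (gbs H c v j).card)) (a := i)
    omega)
  simp only [mem_erase, mem_filter, mem_univ, true_and] at hb1 hb2
  obtain ⟨p, h1, h2, h3⟩ := greedy (fun x y => (c x = i ∧ low H c E3 x) ∧ (c y = i ∧ low H c E3 y) ∧ Poor5 H c E W5 v x y i) (2 * t) (by
    intro C hCc
    have hU' := hU (C ∪ BB H c E3) (by
      have := card_union_le C (BB H c E3)
      omega)
    have hsub : Us (DD H c E) (C ∪ BB H c E3) ⊆ part c i := by
      intro x hx
      obtain ⟨_, y, _, hxy⟩ := mem_Us.1 hx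
      simp only [part, mem_filter, mem_univ, true_and]
      exact hD x y hxy
    have hsub2 : nbs H c v i ⊆ part c i := by
      intro x hx
      simp only [part, nbs, mem_filter, mem_univ, true_and] at hx ⊢
      exact hx.1
    have hnint : (Us (DD H c E) (C ∪ BB H c E3) ∩ nbs H c v i).Nonempty := by
      rw [← card_pos]
      have e1 := Finset.card_union_add_card_inter (Us (DD H c E) (C ∪ BB H c E3)) (nbs H c v i)
      have e2 := card_le_card (Finset.union_subset hsub hsub2)
      have := hnb i
      omega
    obtain ⟨x, hx⟩ := hnint
    rw [mem_inter] at hx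
    have hvx : H.Adj v x := by
      have := hx.2
      simp only [nbs, mem_filter, mem_univ, true_and] at this
      exact this.2
    obtain ⟨hxC, y, hyC, hxy⟩ := mem_Us.1 hx.1
    rw [mem_union, not_or] at hxC hyC
    have hlx : low H c E3 x := by
      by_contra h; exact hxC.2 (by simp [BB, h])
    have hly : low H c E3 y := by
      by_contra h; exact hyC.2 (by simp [BB, h])
    have hcx : c x = i := hD x y hxy
    have hcy : c y = i := hxy.1 ▸ hcx
    refine ⟨x, y, hxC.1, hyC.1, hxy.ne, ⟨hcx, hlx⟩, ⟨hcy, hly⟩, ?_⟩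
    by_contra hnp
    unfold Poor5 at hnp
    push Not at hnp
    have hvy : v ≠ y := by
      rintro rfl
      have : low H c E3 v := hly
      unfold low at this
      omega
    have key : ∀ j, j ≠ i → ∀ e : Bool, E ≤ (univ.filter (fun z => c z = j ∧ decide (H.Adj z v) = e)).card →
        ∀ s s' : Prop, W5 ≤ cls3 H c v x y j (e = true) s s' := by
      intro j hj e he s s'
      have := hnp j hj (e, decide s, decide s') he
      simpa using this
    refine hC (embed_triple hr5 hg hW5 hvx hxy.2.1 hvy (Ne.symm hb1.1) (Ne.symm hb2.1) hb12 ?_ ?_ ?_)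
    · rw [← cset3_card]
      have hs : nbs H c v i ⊆ cset3 H c v x y i True False False ∪ (nbs H c x i ∪ nbs H c y i) := by
        intro z hz
        simp only [nbs, cset3, mem_union, mem_filter, mem_univ, true_and] at hz ⊢
        by_cases k1 : H.Adj x z
        · exact Or.inr (Or.inl ⟨hz.1, k1⟩)
        by_cases k2 : H.Adj y z
        · exact Or.inr (Or.inr ⟨hz.1, k2⟩)
        left
        refine ⟨hz.1, ?_, ?_, ?_⟩
        · simpa using hz.2.symm
        · simpa using fun h => k1 h.symm
        · simpa using fun h => k2 h.symm
      have e1 := card_le_card hs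
      have e2 := card_union_le (cset3 H c v x y i True False False) (nbs H c x i ∪ nbs H c y i)
      have e3 := card_union_le (nbs H c x i) (nbs H c y i)
      unfold low at hlx hly
      rw [hcx] at hlx
      rw [hcy] at hly
      have := hnb i
      omega
    · intro j hj s s'
      have := key j hj true (by
        refine (hvl.trans (hnb j)).trans (card_le_card ?_)
        intro z hz
        simp only [nbs, mem_filter, mem_univ, true_and, decide_eq_true_eq] at hz ⊢
        exact ⟨hz.1, hz.2.symm⟩) s s'
      simpa using this
    · intro j hj s s'
      have hj' : j ≠ i ∧ E ≤ (gbs H c v j).card := by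
        rcases hj with rfl | rfl
        · exact hb1
        · exact hb2
      have := key j hj'.1 false (by
        refine hj'.2.trans (card_le_card ?_)
        intro z hz
        simp only [gbs, mem_filter, mem_univ, true_and, decide_eq_false_iff_not] at hz ⊢
        exact ⟨hz.1, fun h => hz.2 h.symm⟩) s s'
      simpa using this) t ∅ (by simp)
  have hp : ∀ k, c (p k) = i ∧ low H c E3 (p k) := by
    rintro ⟨k, e⟩
    fin_cases e
    · exact (h3 k).1
    · exact (h3 k).2.1
  refine ⟨p, h1, ?_, hp, fun k => (h3 k).2.2⟩
  intro k hk
  have := (hp k).2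
  rw [hk] at this
  unfold low at this
  omega

lemma WW_lin (r : ℕ) {γ : ℝ} (hγ : 0 < γ) : ∃ ν0 : ℝ, 0 < ν0 ∧ ∀ ν : ℝ, 0 < ν → ν ≤ ν0 → ∀ᶠ n : ℕ in atTop, (WW r ⌈ν * n⌉₊ : ℝ) < γ * n := by
  set A : ℝ := 5 ^ (2 * r + 2) * (2 * r + 2) with hA
  have hAp : 0 < A := by positivity
  refine ⟨γ / (2 * A), by positivity, ?_⟩
  intro ν hν hν0
  filter_upwards [ev_lin_ge (γ := γ / 2) (by positivity) (A + 5 ^ (2 * r + 2) * 20 + (2 * r + 2) + 1)] with n hn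
  have h1 := (Nat.ceil_lt_add_one (show 0 ≤ ν * n by positivity)).le
  unfold WW
  push_cast
  have h2 : ν * n ≤ γ / (2 * A) * n := by gcongr
  have h3 : A * (γ / (2 * A) * n) = γ / 2 * n := by field_simp
  have h4 : A * (⌈ν * n⌉₊:ℝ) ≤ A * (γ / (2 * A) * n + 1) := by gcongr; linarith
  have h5 : (5:ℝ) ^ (2 * r + 2) * ((2 * r + 2) * (⌈ν * n⌉₊:ℝ) + 20) + (2 * r + 2) = A * (⌈ν * n⌉₊:ℝ) + 5 ^ (2 * r + 2) * 20 + (2 * r + 2) := by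
    rw [hA]; ring
  rw [h5]
  linarith

/-- Deterministic end of the argument. -/
lemma final_det {E E3 W W5 b t : ℕ} {ν η κ : ℝ} (hr5 : 5 ≤ r) (hr0 : 0 < r) {H : SimpleGraph (Fin n)}
    (hN : Nice hr0 ν η E W b H) (hW : WW r ⌈ν * n⌉₊ ≤ W) (hW5 : WW r ⌈ν * n⌉₊ ≤ W5) (hE3 : W5 + 2 * E3 ≤ E)
    (hb3 : (BB H (opt hr0 H) E3).card < b) {K T : ℕ}
    (hFew : H ∉ FewU r b T K n) (hbal : ∀ i, ((part (opt hr0 H) i).card : ℝ) ≤ n / r + (lg n : ℝ) ^ 2)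
    (hKE : (n:ℝ) / r + (lg n : ℝ) ^ 2 < K + 1 + E) (hT : r * lg n ^ 4 ≤ T) (hT2 : b + 2 * t ≤ T) (hκ : r * κ ≤ K + 1)
    (hlg : 2 * b + 3 + 2 * lg n ^ 3 ≤ lg n ^ 4)
    (hEx : ∀ u, ¬ Ex4 H (opt hr0 H) E κ (lg n ^ 4) u)
    (hMany : ¬ ∃ v u i, (DD H (opt hr0 H) E).Adj v u ∧ i ≠ opt hr0 H v ∧
        (univ.filter (fun x => (DD H (opt hr0 H) E).Adj v x)).card ≤ 2 ∧
        Many H (opt hr0 H) E (lg n ^ 3) (2 * b + 3) u i)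
    (h5 : ¬ ∃ v i, ∃ p : Fin t × Fin 2 → Fin n, Injective p ∧ (∀ k, p k ≠ v) ∧
        (∀ k, opt hr0 H (p k) = i ∧ low H (opt hr0 H) E3 (p k)) ∧
        ∀ k, Poor5 H (opt hr0 H) E W5 v (p (k, 0)) (p (k, 1)) i) : Tmpl r H := by
  have hnp := NP_DD hr5 hN.near.2.1 hN.rich hW hN.noC
  have hU : ∀ C : Finset (Fin n), C.card ≤ T → K < (Us (DD H (opt hr0 H) E) C).card := by
    intro C hC
    by_contra hcon
    push Not at hcon
    refine hFew ⟨opt hr0 H, DD H (opt hr0 H) E, hnp, BB H (opt hr0 H) E, hN.bb.le, ?_, C, hC, hcon⟩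
    intro x y hxy hx hy
    simp only [BB, mem_filter, mem_univ, true_and, not_not] at hx hy
    exact ⟨fun h => ⟨hxy, h, hx, hy⟩, fun h => h.2.1⟩
  obtain ⟨i, hi⟩ := exists_typ (t := lg n ^ 4) (DD H (opt hr0 H) E) (opt hr0 H) hT hU hκ
  have hD : ∀ x y, (DD H (opt hr0 H) E).Adj x y → opt hr0 H x = i := by
    intro x y hxy
    by_contra hne
    rcases NP_small_end hnp hxy with h | h
    · refine hMany ⟨x, y, i, hxy, Ne.symm hne, h, ?_⟩
      exact many_of_not_ex hxy.2.2.2 (hEx y) (by rw [← hxy.1]; exact Ne.symm hne) hi hlg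
    · refine hMany ⟨y, x, i, hxy.symm, by rw [← hxy.1]; exact Ne.symm hne, h, ?_⟩
      exact many_of_not_ex hxy.2.2.1 (hEx x) (Ne.symm hne) hi hlg
  by_cases hB : (BB H (opt hr0 H) E).Nonempty
  · exfalso
    obtain ⟨v, hv⟩ := hB
    obtain ⟨p, hp⟩ := A5comb (t := t) (M := T) hr5 hr0 hN hN.near.2.1 hW5 i hD (by
      intro C hC
      have h1 := hU C hC
      have h2 : (K:ℝ) + 1 ≤ (Us (DD H (opt hr0 H) E) C).card := by exact_mod_cast h1
      have h3 := hbal i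
      have : ((part (opt hr0 H) i).card : ℝ) < (Us (DD H (opt hr0 H) E) C).card + E := by linarith
      exact_mod_cast this) (by omega) hE3 hv
    exact h5 ⟨v, i, p, hp⟩
  · rw [Finset.not_nonempty_iff_eq_empty] at hB
    have hlow : ∀ x, low H (opt hr0 H) E x := by
      intro x
      by_contra h
      have : x ∈ BB H (opt hr0 H) E := by simp [BB, h]
      rw [hB] at this
      simp at this
    refine ⟨opt hr0 H, i, ?_, ?_⟩
    · intro x y hxy hx hadj
      exact hx (hD x y ⟨hxy, hadj, hlow x, hlow y⟩)
    · intro a b d e ha hb hd he h1 h2 h3 ab bd de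
      exact hnp a b d e trivial trivial trivial trivial h1 h2 h3 ⟨ha.trans hb.symm, ab, hlow _, hlow _⟩
        ⟨hb.trans hd.symm, bd, hlow _, hlow _⟩ ⟨hd.trans he.symm, de, hlow _, hlow _⟩

set_option maxHeartbeats 1600000 in
lemma near_main (hr5 : 5 ≤ r) (hr0 : 0 < r) : ∃ ν0 : ℝ, 0 < ν0 ∧ ∀ ν η : ℝ, 0 < ν → ν ≤ ν0 → 2 * η < ν ^ 2 →
    Small r (fun n => {H | ¬ HasC r H ∧ Near hr0 ν η H ∧ ¬ Tmpl r H}) := by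
  have hr2 : 2 ≤ r := by omega
  have hrp : (5:ℝ) ≤ r := by exact_mod_cast hr5
  obtain ⟨ζ2, hζ2, H2⟩ := A2 hr2 hr0
  obtain ⟨ζ3, hζ3, H3⟩ := A3a hr5 hr2 hr0
  obtain ⟨ζb, hζb, H3b⟩ := A3b hr5 hr2 hr0
  obtain ⟨ζ4, hζ4, H4⟩ := A4a hr2 hr0 (κ := 1 / (2 * r ^ 2)) (by positivity) 4
  obtain ⟨ε, hε, e2, e3, e4, e5⟩ : ∃ ε : ℝ, 0 < ε ∧ ε ≤ ζ2 / 3 ∧ ε ≤ ζ3 ∧ ε ≤ ζ4 ∧ ε ≤ 1 / r :=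
    ⟨min (min (ζ2 / 3) ζ3) (min ζ4 (1 / r)), by positivity, (min_le_left _ _).trans (min_le_left _ _), (min_le_left _ _).trans (min_le_right _ _),
      (min_le_right _ _).trans (min_le_left _ _), (min_le_right _ _).trans (min_le_right _ _)⟩
  obtain ⟨t, ht⟩ := exists_nat_ge (10 / ε)
  obtain ⟨ζ5, hζ5, H5⟩ := A5count hr2 hr0 hε t ht
  obtain ⟨δ, hδ, d1, d2⟩ : ∃ δ : ℝ, 0 < δ ∧ δ ≤ ζ5 ∧ δ ≤ ε / 4 := ⟨min ζ5 (ε / 4), by positivity, min_le_left _ _, min_le_right _ _⟩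
  obtain ⟨b, hb⟩ := exists_nat_ge (4 / δ ^ r)
  obtain ⟨z2, hz2, H2⟩ := H2 ε (3 * ε) hε (by linarith) (by positivity) (by linarith)
  obtain ⟨z3, hz3, H3⟩ := H3 ε hε e3
  obtain ⟨zb, hzb, H3b⟩ := H3b ζb hζb le_rfl
  obtain ⟨z4, hz4, H4⟩ := H4 ε hε e4
  obtain ⟨z5, hz5, H5⟩ := H5 δ δ hδ d1 hδ d1
  obtain ⟨w1, hw1, W1⟩ := WW_lin r hδ
  obtain ⟨w2, hw2, W2⟩ := WW_lin r hζb
  obtain ⟨w3, hw3, W3⟩ := WW_lin r (γ := 1 / (b * 2 ^ b + 1)) (by positivity)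
  refine ⟨min (min (min z2 z3) (min zb z4)) (min (min z5 w1) (min (min w2 w3) (ε / (4 * r * r)))), by positivity, ?_⟩
  intro ν η hν hνm hη
  simp only [le_min_iff] at hνm
  obtain ⟨⟨⟨k1, k2⟩, k3, k4⟩, ⟨k5, k6⟩, ⟨k7, k8⟩, k9⟩ := hνm
  have hμ : 4 * r * r * ν + 2 * ε ≤ 3 * ε := by
    rw [le_div_iff₀ (by positivity)] at k9
    linarith
  have hWW : ∀ᶠ n : ℕ in atTop, WW r ⌈ν * n⌉₊ ≤ ⌈3 * ε * n⌉₊ := by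
    filter_upwards [W1 ν hν k6] with n h1
    have h2 := Nat.le_ceil (3 * ε * n)
    have : (WW r ⌈ν * n⌉₊ : ℝ) ≤ ⌈3 * ε * n⌉₊ := by
      refine h1.le.trans (le_trans ?_ h2)
      gcongr; linarith
    exact_mod_cast this
  have B2 := H2 ν η hν k1 hη
  have B3 := H3 ν η hν k2 hη
  have B3b := H3b ν η hν k3 hη
  have B4 := H4 ν η hν k4 hη b
  have B5 := H5 ν η hν k5 hη
  have B35 := A35 hr5 hr0 hν hη hε hμ hWW b
  have B4b := A4b hr5 hr0 hν hη hε hμ hWW b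
  have B6 := A6 hr2 b 5 (ε := ε / 4) (by positivity) (by linarith)
  refine (((B2.union B3).union (B3b.union B4)).union ((B5.union B35).union (B4b.union B6))).mono ?_
  filter_upwards [hWW, W1 ν hν k6, W2 ν hν k7, W3 ν hν k8, ev_lin_ge hε 20, eventually_gt_atTop 0,
    lg_lin 2 (θ := ε / 4) (by positivity), lg_tendsto.eventually_ge_atTop (r + 2 * b + 2 * t + 6), ev_lin_ge hδ 1] with n g1 g2 g3 g4 g5 hn0 g7 g8 g9
  have hnp : (0:ℝ) < n := by exact_mod_cast hn0
  intro H hH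
  obtain ⟨hC, hNear, hT⟩ := hH
  by_contra hcon
  simp only [Set.mem_union, not_or] at hcon
  obtain ⟨⟨⟨c2, c3⟩, c3b, c4⟩, ⟨c5, c35⟩, c4b, c6⟩ := hcon
  have hdc := (Nat.ceil_lt_add_one (show 0 ≤ δ * n by positivity)).le
  have hdc' := Nat.le_ceil (δ * n)
  have hec := Nat.le_ceil (ε * n)
  have hbc := Nat.le_ceil (ζb * n)
  have hbb : (BB H (opt hr0 H) ⌈δ * n⌉₊).card < b := by
    refine BB_bounded (K := ⌈ν * n⌉₊) (M := ⌈ζb * n⌉₊) hr5 hr0 hn0 hC hNear.2.1 ?_ ?_ ?_ ?_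
    · have : (WW r ⌈ν * n⌉₊ : ℝ) ≤ ⌈ζb * n⌉₊ := by linarith
      exact_mod_cast this
    · have : (b * 2 ^ b * WW r ⌈ν * n⌉₊ : ℝ) < n := by
        have p : (0:ℝ) < b * 2 ^ b + 1 := by positivity
        have h1 : (b * 2 ^ b + 1) * (WW r ⌈ν * n⌉₊ : ℝ) < (b * 2 ^ b + 1) * (1 / (b * 2 ^ b + 1) * n) := by gcongr
        have h2 : ((b:ℝ) * 2 ^ b + 1) * (1 / (b * 2 ^ b + 1) * n) = n := by field_simp
        have h3 : (0:ℝ) ≤ WW r ⌈ν * n⌉₊ := by positivity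
        nlinarith
      exact_mod_cast this
    · have : (4 * n ^ r : ℝ) ≤ b * ⌈δ * n⌉₊ ^ r := by
        calc (4 * n ^ r : ℝ) = 4 / δ ^ r * (δ * n) ^ r := by rw [mul_pow]; field_simp
          _ ≤ b * ⌈δ * n⌉₊ ^ r := by gcongr
      exact_mod_cast this
    · intro q hq hcomp
      exact c3b ⟨hC, hNear, q, hq, hcomp⟩
  have hde : ⌈δ * n⌉₊ + 2 * ⌈δ * n⌉₊ ≤ ⌈ε * n⌉₊ := by
    have : ((⌈δ * n⌉₊ + 2 * ⌈δ * n⌉₊ : ℕ) : ℝ) ≤ ⌈ε * n⌉₊ := by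
      have : δ * n ≤ ε / 4 * n := by gcongr
      push_cast; linarith
    exact_mod_cast this
  have hbbE : (BB H (opt hr0 H) ⌈ε * n⌉₊).card < b := by
    refine lt_of_le_of_lt (card_le_card ?_) hbb
    intro x hx
    simp only [BB, low, mem_filter, mem_univ, true_and, not_lt] at hx ⊢
    omega
  have hN : Nice hr0 ν η ⌈ε * n⌉₊ ⌈3 * ε * n⌉₊ b H := by
    refine ⟨hC, hNear, ?_, hbbE, ?_⟩
    · by_contra h; exact c2 ⟨hC, hNear, h⟩
    · intro v
      by_contra h
      exact c3 ⟨hC, hNear, v, by omega⟩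
  have hbal : ∀ i, ((part (opt hr0 H) i).card : ℝ) ≤ n / r + (lg n : ℝ) ^ 2 := by
    intro i
    by_contra h
    push Not at h
    exact c35 ⟨hN, i, h.le⟩
  have hfl := Nat.lt_floor_add_one ((1 / r - ε / 4) * n)
  have hdiv : (1 / (r:ℝ) - ε / 4) * n = n / r - ε / 4 * n := by ring
  rw [hdiv] at hfl
  refine hT (final_det (t := t) (κ := 1 / (2 * r ^ 2) * n) (W5 := ⌈δ * n⌉₊) hr5 hr0 hN g1 ?_ hde hbb (by exact c6) hbal ?_ ?_ ?_ ?_ ?_ ?_ ?_ ?_)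
  · have : (WW r ⌈ν * n⌉₊ : ℝ) ≤ ⌈δ * n⌉₊ := by linarith
    exact_mod_cast this
  · rw [hdiv]; linarith
  · rw [pow_succ' (lg n) 4]
    gcongr; omega
  · have : lg n ≤ lg n ^ 5 := Nat.le_self_pow (by norm_num) _
    omega
  · rw [hdiv]
    have e1 : (r:ℝ) * (1 / (2 * r ^ 2) * n) = n / r / 2 := by field_simp
    rw [e1]
    have : ε / 4 * n ≤ n / r / 4 := by
      calc ε / 4 * n ≤ (1 / r) / 4 * n := by gcongr
        _ = _ := by ring
    have : (0:ℝ) ≤ n / r := by positivity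
    linarith
  · have h1 : lg n ^ 4 = lg n * lg n ^ 3 := by ring
    have h2 : 1 ≤ lg n ^ 3 := Nat.one_le_pow _ _ (by omega)
    rw [h1]
    have h3 : (2 * b + 5) * lg n ^ 3 ≤ lg n * lg n ^ 3 := Nat.mul_le_mul_right _ (by omega)
    have h4 : (2 * b + 3) * 1 ≤ (2 * b + 3) * lg n ^ 3 := Nat.mul_le_mul_left _ h2
    have h5 : (2 * b + 5) * lg n ^ 3 = (2 * b + 3) * lg n ^ 3 + 2 * lg n ^ 3 := by ring
    omega
  · intro u hu
    exact c4 ⟨hC, hNear, hbbE, u, hu⟩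
  · intro h
    exact c4b ⟨hN, hbal, h⟩
  · intro h
    exact c5 ⟨hC, hNear, h⟩

/-! ### Cores -/

/-- Genericity across the colour classes. -/
def GenX {k : ℕ} (Q : SimpleGraph (Fin n)) (c : Fin n → Fin k) (K : ℕ) : Prop :=
  ∀ j, ∀ B : Finset (Fin n), (∀ b ∈ B, c b = j) → K ≤ B.card →
    (univ.filter (fun v => c v ≠ j ∧ 3 * (B.filter (fun b => Q.Adj v b)).card < B.card)).card < K ∧
    (univ.filter (fun v => c v ≠ j ∧ 3 * (B.filter (fun b => ¬ Q.Adj v b)).card < B.card)).card < K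

/-- Greedy embedding of a prescribed pattern. -/
lemma greedyG {k K M W0 : ℕ} {Q : SimpleGraph (Fin n)} {c : Fin n → Fin k} (hg : GenX Q c K)
    (hW : M * K + 20 ≤ W0) (hKW : K ≤ W0) (v0 : Fin n) {ι : Type} (d : ι → Fin k) (P : ι → ι → Prop) (hP : ∀ p p', P p p' ↔ P p' p) :
    ∀ (m : ℕ) (F : Finset ι) (X : ι → Finset (Fin n)), F.card = m → m ≤ M →
    (∀ p ∈ F, ∀ x ∈ X p, c x = d p) → (∀ p ∈ F, 5 ^ m * W0 ≤ (X p).card) →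
    ∃ g : ι → Fin n, (∀ p ∈ F, g p ∈ X p) ∧ (∀ p ∈ F, ∀ p' ∈ F, p ≠ p' → g p ≠ g p' ∧
      (d p ≠ d p' → (Q.Adj (g p) (g p') ↔ P p p'))) := by
  intro m
  induction m with
  | zero =>
    intro F X hF _ _ hX
    rw [Finset.card_eq_zero] at hF
    subst hF
    exact ⟨fun _ => v0, by simp, by simp⟩
  | succ m ih =>
    intro F X hF hM hX hcard
    obtain ⟨q, hq⟩ : F.Nonempty := by rw [← card_pos]; omega
    set bad : ι → Finset (Fin n) := fun q' => if P q q' then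
        univ.filter (fun v => c v ≠ d q' ∧ 3 * ((X q').filter (fun b => Q.Adj v b)).card < (X q').card)
      else univ.filter (fun v => c v ≠ d q' ∧ 3 * ((X q').filter (fun b => ¬ Q.Adj v b)).card < (X q').card)
      with hbad
    have h5 : 1 ≤ 5 ^ m := Nat.one_le_pow _ _ (by norm_num)
    have hbig : ∀ q' ∈ F, 5 * (5 ^ m * W0) ≤ (X q').card := by
      intro q' hq'; have := hcard q' hq'; rw [pow_succ] at this; linarith
    have hbig2 : W0 ≤ 5 ^ m * W0 := Nat.le_mul_of_pos_left _ h5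
    have hbadK : ∀ q' ∈ F.erase q, (bad q').card ≤ K := by
      intro q' hq'
      have hq'P := mem_of_mem_erase hq'
      have := hg (d q') (X q') (hX q' hq'P) (by have := hbig q' hq'P; omega)
      simp only [hbad]
      split_ifs
      · exact this.1.le
      · exact this.2.le
    have hU : ((F.erase q).biUnion bad).card ≤ M * K := by
      refine (card_biUnion_le_card_mul _ _ K hbadK).trans ?_
      refine Nat.mul_le_mul_right _ ?_
      rw [card_erase_of_mem hq]; omega
    obtain ⟨v, hvX, hvb⟩ : ∃ v ∈ X q, v ∉ (F.erase q).biUnion bad := by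
      by_contra hcon
      push Not at hcon
      have := card_le_card (show X q ⊆ (F.erase q).biUnion bad from hcon)
      have := hbig q hq
      omega
    have hvc := hX q hq v hvX
    obtain ⟨g, hg1, hg2⟩ := ih (F.erase q) (fun q' => ((X q').filter (fun x => x ≠ v ∧ (d q ≠ d q' → (Q.Adj v x ↔ P q q')))))
      (by rw [card_erase_of_mem hq]; omega) (by omega)
      (fun q' hq' x hx => hX q' (mem_of_mem_erase hq') x (mem_of_mem_filter _ hx)) (by
      intro q' hq'
      have hq'P := mem_of_mem_erase hq'
      have hne := ne_of_mem_erase hq'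
      have hB := hbig q' hq'P
      have hvq : v ∉ bad q' := fun h => hvb (mem_biUnion.2 ⟨q', hq', h⟩)
      have e1 : (X q').card ≤ 3 * ((X q').filter (fun x => (d q ≠ d q' → (Q.Adj v x ↔ P q q')))).card := by
        by_cases hd : d q = d q'
        · simp only [hd, ne_eq, not_true, false_imp_iff, Finset.filter_true]; omega
        · simp only [hbad] at hvq
          have hcc : c v ≠ d q' := by rwa [hvc]
          split_ifs at hvq with h
          · simpa [hcc, h, hd] using hvq
          · simpa [hcc, h, hd] using hvq
      have e2 : ((X q').filter (fun x => (d q ≠ d q' → (Q.Adj v x ↔ P q q')))).card ≤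
        ((X q').filter (fun x => x ≠ v ∧ (d q ≠ d q' → (Q.Adj v x ↔ P q q')))).card + 1 := by
        have : (X q').filter (fun x => (d q ≠ d q' → (Q.Adj v x ↔ P q q'))) ⊆
            insert v ((X q').filter (fun x => x ≠ v ∧ (d q ≠ d q' → (Q.Adj v x ↔ P q q')))) := by
          intro x hx
          rw [mem_filter] at hx
          by_cases e : x = v
          · simp [e]
          · exact Finset.mem_insert_of_mem (mem_filter.2 ⟨hx.1, e, hx.2⟩)
        exact (card_le_card this).trans (card_insert_le _ _)
      omega)
    refine ⟨update g q v, ?_, ?_⟩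
    · intro p hp
      by_cases e : p = q
      · subst e; rwa [update_self]
      · rw [update_of_ne e]
        exact mem_of_mem_filter _ (hg1 p (mem_erase.2 ⟨e, hp⟩))
    · have key : ∀ p ∈ F, p ≠ q → v ≠ g p ∧ (d q ≠ d p → (Q.Adj v (g p) ↔ P q p)) := by
        intro p hp e
        have := (mem_filter.1 (hg1 p (mem_erase.2 ⟨e, hp⟩))).2
        exact ⟨this.1.symm, this.2⟩
      intro p hp p' hp' hne
      by_cases e : p = q
      · subst e
        rw [update_self, update_of_ne hne.symm]
        exact key p' hp' hne.symm
      · by_cases e' : p' = q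
        · subst e'
          rw [update_self, update_of_ne hne, Q.adj_comm, hP]
          have := key p hp hne
          exact ⟨this.1.symm, fun h => this.2 h.symm⟩
        · rw [update_of_ne e, update_of_ne e']
          exact hg2 p (mem_erase.2 ⟨e, hp⟩) p' (mem_erase.2 ⟨e', hp'⟩) hne

lemma ramsey_aux {α : Type} (G : α → α → Prop) (hG : ∀ a b, G a b → G b a) : ∀ (m a b : ℕ) (S : Finset α), a + b = m →
    2 ^ m ≤ S.card → (∃ T ⊆ S, T.card = a ∧ ∀ x ∈ T, ∀ y ∈ T, x ≠ y → G x y) ∨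
      (∃ T ⊆ S, T.card = b ∧ ∀ x ∈ T, ∀ y ∈ T, x ≠ y → ¬ G x y) := by
  intro m
  induction m with
  | zero =>
    intro a b S hab _
    left
    exact ⟨∅, by simp, by simp; omega, by simp⟩
  | succ m ih =>
    intro a b S hab hS
    rcases a with _ | a
    · left; exact ⟨∅, by simp, by simp, by simp⟩
    rcases b with _ | b
    · right; exact ⟨∅, by simp, by simp, by simp⟩
    have hp : 1 ≤ 2 ^ m := Nat.one_le_pow _ _ (by norm_num)
    rw [pow_succ] at hS
    obtain ⟨v, hv⟩ : S.Nonempty := by rw [← card_pos]; omega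
    have h1 := Finset.card_filter_add_card_filter_not (s := S.erase v) (fun x => G v x)
    rw [card_erase_of_mem hv] at h1
    obtain ⟨R1, hR1⟩ : ∃ R, R = (S.erase v).filter (fun x => G v x) := ⟨_, rfl⟩
    obtain ⟨R2, hR2⟩ : ∃ R, R = (S.erase v).filter (fun x => ¬ G v x) := ⟨_, rfl⟩
    have hm1 : ∀ x ∈ R1, G v x := fun x hx => by rw [hR1, mem_filter] at hx; exact hx.2
    have hm2 : ∀ x ∈ R2, ¬ G v x := fun x hx => by rw [hR2, mem_filter] at hx; exact hx.2
    have hs1 : R1 ⊆ S.erase v := by rw [hR1]; exact filter_subset _ _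
    have hs2 : R2 ⊆ S.erase v := by rw [hR2]; exact filter_subset _ _
    have h1' : R1.card + R2.card = S.card - 1 := by rw [hR1, hR2, ← h1]
    have hE := Finset.erase_subset v S
    have hins : ∀ (Y : Finset α) (R : α → α → Prop), (∀ a b, R a b → R b a) → Y ⊆ S.erase v → (∀ x ∈ Y, R v x) →
        ∀ k, (∃ T ⊆ Y, T.card = k ∧ ∀ x ∈ T, ∀ y ∈ T, x ≠ y → R x y) →
        ∃ T ⊆ S, T.card = k + 1 ∧ ∀ x ∈ T, ∀ y ∈ T, x ≠ y → R x y := by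
      rintro Y R hR hY hpR k ⟨T, hT, hk, hT2⟩
      have hvT : v ∉ T := fun h => by have := hY (hT h); simp at this
      refine ⟨insert v T, Finset.insert_subset hv (hT.trans (hY.trans hE)), by rw [Finset.card_insert_of_notMem hvT, hk], ?_⟩
      intro x hx y hy hne
      rcases mem_insert.1 hx with ex | hx'
      · rcases mem_insert.1 hy with ey | hy'
        · exact absurd (ex.trans ey.symm) hne
        · rw [ex]; exact hpR y (hT hy')
      · rcases mem_insert.1 hy with ey | hy'
        · rw [ey]; exact hR _ _ (hpR x (hT hx'))
        · exact hT2 x hx' y hy' hne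
    by_cases hc : 2 ^ m ≤ R1.card
    · rcases ih a (b + 1) _ (by omega) hc with h | ⟨T, hT, h⟩
      · left; exact hins _ _ hG hs1 hm1 _ h
      · right; exact ⟨T, hT.trans (hs1.trans hE), h⟩
    · rcases ih (a + 1) b R2 (by omega) (by omega) with ⟨T, hT, h⟩ | h
      · left; exact ⟨T, hT.trans (hs2.trans hE), h⟩
      · right; exact hins _ (fun a b => ¬ G a b) (fun a b h h' => h (hG _ _ h')) hs2 hm2 _ h

def Rams (s N : ℕ) : Prop := ∀ G : Fin N → Fin N → Prop, (∀ a b, G a b → G b a) →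
  ∃ ι : Fin s → Fin N, Injective ι ∧ ∃ t : Bool, ∀ a b, a ≠ b → (G (ι a) (ι b) ↔ t = true)

lemma ramsey (s : ℕ) : Rams s (2 ^ (s + s)) := by
  intro G hG
  have key : ∀ T : Finset (Fin (2 ^ (s + s))), T.card = s → ∃ ι : Fin s → Fin (2 ^ (s + s)), Injective ι ∧ ∀ a, ι a ∈ T := by
    intro T hT
    refine ⟨fun a => T.orderEmbOfFin hT a, (T.orderEmbOfFin hT).injective, fun a => T.orderEmbOfFin_mem hT a⟩
  rcases ramsey_aux G hG (s + s) s s univ rfl (by simp) with ⟨T, -, hT, h⟩ | ⟨T, -, hT, h⟩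
  · obtain ⟨ι, h1, h2⟩ := key T hT
    exact ⟨ι, h1, true, fun a b hab => by simpa using h _ (h2 a) _ (h2 b) (h1.ne hab)⟩
  · obtain ⟨ι, h1, h2⟩ := key T hT
    exact ⟨ι, h1, false, fun a b hab => by simpa using h _ (h2 a) _ (h2 b) (h1.ne hab)⟩

/-- `q` is a copy of the coloured pattern `(c0, Q)`, with homogeneous parts of type `τ`. -/
def Core {s k : ℕ} (c0 : Fin s → Fin k) (Q : SimpleGraph (Fin s)) (H : SimpleGraph (Fin n)) (q : Fin s → Fin n)
    (τ : Fin k → Prop) : Prop :=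
  Injective q ∧ ∀ x y, x ≠ y → (H.Adj (q x) (q y) ↔ if c0 x = c0 y then τ (c0 x) else Q.Adj x y)

def trc {s : ℕ} (H : SimpleGraph (Fin n)) (q : Fin s → Fin n) (v : Fin n) : Finset (Fin s) :=
  univ.filter (fun x => H.Adj v (q x))

lemma mem_trc {s : ℕ} {H : SimpleGraph (Fin n)} {q : Fin s → Fin n} {v : Fin n} {x : Fin s} :
    x ∈ trc H q v ↔ H.Adj v (q x) := by simp [trc]

/-- The extraction lemma. -/
lemma extract {s s' k N K M W0 : ℕ} {Q : SimpleGraph (Fin s')} {c : Fin s' → Fin k} (hg : GenX Q c K)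
    {H : SimpleGraph (Fin n)} {q : Fin s' → Fin n} {τ : Fin k → Prop} (hc : Core c Q H q τ) (hN : Rams s N)
    (hM : M = 2 * (s * N ^ s) + N) (hW : M * K + 20 ≤ W0) (hKW : K ≤ W0)
    {S Y : Finset (Fin s')} {T : Finset (Finset (Fin s'))}
    (hT : ∀ A ∈ T, Y ⊆ A ∧ ∃ v, (∀ x, q x ≠ v) ∧ A = trc H q v) (hS : T.Shatters S)
    (c0 : Bool → Fin s → Option (Fin k)) (P : Bool → SimpleGraph (Fin s)) (Z : Fin k → Finset (Fin s'))
    (hZ : ∀ i, ∀ x ∈ Z i, c x = i) (hZc : ∀ i, 5 ^ M * W0 ≤ (Z i).card)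
    (hZS : ∀ i, Z i ⊆ S ∨ (Z i ⊆ Y ∧ ∀ t x b, c0 t x = some i → c0 t b = none → (P t).Adj x b))
    (i0 : Fin k) (hi0 : Z i0 ⊆ S) :
    ∃ t, ∃ q' : Fin s → Fin n, Injective q' ∧ ∀ x y, x ≠ y → (H.Adj (q' x) (q' y) ↔
      if c0 t x = c0 t y then Option.elim (c0 t x) (t = true) τ else (P t).Adj x y) := by
  obtain ⟨v0, -⟩ : (Z i0).Nonempty := by
    rw [← card_pos]
    have : 1 ≤ 5 ^ M := Nat.one_le_pow _ _ (by norm_num)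
    have h2 := hZc i0
    have : 1 * 20 ≤ 5 ^ M * W0 := Nat.mul_le_mul this (by omega)
    omega
  let d : ((Bool × Fin s × (Fin s → Fin N)) ⊕ Fin N) → Fin k := Sum.elim (fun p => (c0 p.1 p.2.1).getD i0) (fun _ => i0)
  obtain ⟨g, hg1, hg2⟩ := greedyG hg hW hKW v0 d
    (fun p p' => ∃ t x f x' f', p = Sum.inl (t, x, f) ∧ p' = Sum.inl (t, x', f') ∧ (P t).Adj x x') (by
      intro p p'
      constructor
      · rintro ⟨t, x, f, x', f', h1, h2, h3⟩; exact ⟨t, x', f', x, f, h2, h1, h3.symm⟩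
      · rintro ⟨t, x, f, x', f', h1, h2, h3⟩; exact ⟨t, x', f', x, f, h2, h1, h3.symm⟩)
    M (univ : Finset ((Bool × Fin s × (Fin s → Fin N)) ⊕ Fin N)) (fun p => Z (d p)) (by simp [hM]) le_rfl
    (fun p _ x hx => hZ _ x hx) (fun p _ => hZc _)
  have ginj : ∀ p p', g p = g p' → p = p' := by
    intro p p' h
    by_contra hne
    exact (hg2 p (mem_univ _) p' (mem_univ _) hne).1 h
  have hgr : ∀ i, g (Sum.inr i) ∈ S := fun i => hi0 (hg1 (Sum.inr i) (mem_univ _))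
  have hgl : ∀ t x f i, c0 t x = some i → g (Sum.inl (t, x, f)) ∈ Z i := by
    intro t x f i h
    have := hg1 (Sum.inl (t, x, f)) (mem_univ _)
    simpa [d, h] using this
  have hex : ∀ i : Fin N, ∃ v, (∀ x, q x ≠ v) ∧ Y ⊆ trc H q v ∧ ∀ y ∈ S, (H.Adj v (q y) ↔ (y = g (Sum.inr i) ∨
      ∃ t x f b, y = g (Sum.inl (t, x, f)) ∧ c0 t b = none ∧ f b = i ∧ (P t).Adj x b)) := by
    intro i
    obtain ⟨A, hA, hA2⟩ := hS (t := S.filter (fun y => y = g (Sum.inr i) ∨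
      ∃ t x f b, y = g (Sum.inl (t, x, f)) ∧ c0 t b = none ∧ f b = i ∧ (P t).Adj x b)) (filter_subset _ _)
    obtain ⟨hY, v, hv, rfl⟩ := hT A hA
    refine ⟨v, hv, hY, fun y hy => ?_⟩
    rw [← mem_trc]
    have := Finset.ext_iff.1 hA2 y
    rw [mem_inter, mem_filter] at this
    simpa only [hy, true_and] using this
  choose v hv hvY hvS using hex
  have vinj : ∀ i i', v i = v i' → i = i' := by
    intro i i' h
    have h1 := (hvS i _ (hgr i)).2 (Or.inl rfl)
    rw [h] at h1
    rcases (hvS i' _ (hgr i)).1 h1 with e | ⟨t, x, f, b, e, -⟩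
    · simpa using ginj _ _ e
    · simpa using ginj _ _ e
  obtain ⟨f, hf, t, ht⟩ := hN (fun i i' => H.Adj (v i) (v i')) (fun _ _ h => h.symm)
  have mixed : ∀ x b i, c0 t x = some i → c0 t b = none → (H.Adj (v (f b)) (q (g (Sum.inl (t, x, f)))) ↔ (P t).Adj x b) := by
    intro x b i hx hb
    have hm := hgl t x f i hx
    rcases hZS i with h | ⟨h, h'⟩
    · rw [hvS _ _ (h hm)]
      constructor
      · rintro (e | ⟨t', x', f', b', e, h1, h2, h3⟩)
        · simpa using ginj _ _ e
        · have := ginj _ _ e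
          simp only [Sum.inl.injEq, Prod.mk.injEq] at this
          obtain ⟨rfl, rfl, rfl⟩ := this
          rwa [hf h2] at h3
      · intro h3; exact Or.inr ⟨t, x, f, b, rfl, hb, rfl, h3⟩
    · have h1 := mem_trc.1 (hvY (f b) (h hm))
      simp only [h1, h' t x b hx hb]
  refine ⟨t, fun x => Option.elim (c0 t x) (v (f x)) (fun _ => q (g (Sum.inl (t, x, f)))), ?_, ?_⟩
  · intro x y h
    simp only at h
    rcases hx : c0 t x with _ | i <;> rcases hy : c0 t y with _ | j <;> simp only [hx, hy, Option.elim] at h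
    · exact hf (vinj _ _ h)
    · exact absurd h.symm (hv _ _)
    · exact absurd h (hv _ _)
    · have := ginj _ _ (hc.1 h)
      simpa using this
  · intro x y hxy
    rcases hx : c0 t x with _ | i <;> rcases hy : c0 t y with _ | j <;> simp only [hx, hy, Option.elim]
    · simpa using ht x y hxy
    · rw [mixed y x j hy hx, (P t).adj_comm]; simp
    · rw [H.adj_comm, mixed x y i hx hy]; simp
    · have hne : (Sum.inl (t, x, f) : ((Bool × Fin s × (Fin s → Fin N)) ⊕ Fin N)) ≠ Sum.inl (t, y, f) := by simp [hxy]
      have h2 := hg2 _ (mem_univ (Sum.inl (t, x, f))) _ (mem_univ (Sum.inl (t, y, f))) hne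
      rw [hc.2 _ _ h2.1, hZ _ _ (hgl t x f i hx), hZ _ _ (hgl t y f j hy)]
      by_cases hij : i = j
      · simp [hij]
      · rw [if_neg hij, if_neg (by simpa using hij), h2.2 (by simpa [d, hx, hy] using hij)]
        simp

/-- A cycle inside a core. -/
lemma core_hasC {s k K M W0 : ℕ} {Q : SimpleGraph (Fin s)} {c : Fin s → Fin k} (hg : GenX Q c K)
    {H : SimpleGraph (Fin n)} {q : Fin s → Fin n} {τ : Fin k → Prop} (hc : Core c Q H q τ)
    (hM : M = 2 * r + 2) (hW : M * K + 20 ≤ W0) (hKW : K ≤ W0) (v0 : Fin s)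
    (hZc : ∀ i, 5 ^ M * W0 ≤ (part c i).card) (d : Fin (2 * r + 2) → Fin k)
    (hd : ∀ x y, x ≠ y → d x = d y → (τ (d x) ↔ ¬ cyc (2 * r + 2) x y)) : HasC r H := by
  obtain ⟨g, hg1, hg2⟩ := greedyG hg hW hKW v0 d (fun p p' => ¬ cyc (2 * r + 2) p p')
    (by intro p p'; rw [cyc_comm]) M (univ : Finset (Fin (2 * r + 2))) (fun p => part c (d p)) (by simp [hM]) le_rfl
    (fun p _ x hx => by simpa [part] using hx) (fun p _ => hZc _)
  have hgc : ∀ p, c (g p) = d p := fun p => by simpa [part] using hg1 p (mem_univ _)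
  refine ⟨fun p => if h : p < 2 * r + 2 then q (g ⟨p, h⟩) else q v0, ?_⟩
  intro x y hx hy hxy
  simp only [hx, hy, dif_pos]
  have hne : (⟨x, hx⟩ : Fin (2 * r + 2)) ≠ ⟨y, hy⟩ := by simpa using hxy
  have h2 := hg2 _ (mem_univ ⟨x, hx⟩) _ (mem_univ ⟨y, hy⟩) hne
  refine ⟨hc.1.ne h2.1, ?_⟩
  rw [hc.2 _ _ h2.1, hgc, hgc]
  split_ifs with h
  · exact hd _ _ hne h
  · exact h2.2 h

lemma chern0 {ι : Type*} [Fintype ι] (A : Finset (Finset ι)) (w : ι → ℝ) (hw : ∀ p, 0 ≤ w p) (θ : ℝ)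
    (h : ∀ f ∈ A, θ ≤ ∏ p ∈ f, w p) : (A.card : ℝ) * θ ≤ ∏ p, (1 + w p) := by
  rw [Finset.prod_one_add, ← nsmul_eq_mul]
  refine (card_nsmul_le_sum A _ θ h).trans ?_
  refine Finset.sum_le_sum_of_subset_of_nonneg ?_ ?_
  · intro f _; simp
  · intro f _ _; exact prod_nonneg fun p _ => hw p

lemma half_gain (m : ℕ) : ((3:ℝ) / 4) ^ m * 2 ^ ((m:ℝ) / 3) ≤ 2 ^ (-((m:ℝ) / 20)) := by
  have h : (3:ℝ) / 4 ≤ 2 ^ (-(23 / 60) : ℝ) := by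
    have e : ((2:ℝ) ^ (-(23 / 60) : ℝ)) ^ 60 = 2 ^ (-23 : ℝ) := by
      rw [← rpow_natCast, ← rpow_mul (by norm_num)]; norm_num
    refine le_of_pow_le_pow_left₀ (n := 60) (by norm_num) (by positivity) ?_
    rw [e, rpow_neg (by norm_num)]
    norm_num
  calc ((3:ℝ) / 4) ^ m * 2 ^ ((m:ℝ) / 3) ≤ (2 ^ (-(23 / 60) : ℝ)) ^ m * 2 ^ ((m:ℝ) / 3) := by gcongr
    _ = 2 ^ (-((m:ℝ) / 20)) := by
      rw [← rpow_natCast, ← rpow_mul (by norm_num), ← rpow_add (by norm_num)]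
      congr 1; ring

/-- Chernoff bound with weights. -/
lemma chern {ι : Type*} [Fintype ι] [DecidableEq ι] (A : Finset (Finset ι)) (w : ι → ℝ) (hw : ∀ p, 0 ≤ w p) (θ : ℝ)
    (h : ∀ f ∈ A, θ ≤ ∏ p ∈ f, w p) (C : Finset ι) (hC : ∀ p ∈ C, w p = 1)
    (hA : (∀ f ∈ A, 3 * (C ∩ f).card ≤ C.card) ∨ (∀ f ∈ A, 3 * (C \ f).card ≤ C.card)) :
    (A.card : ℝ) * θ ≤ (∏ p, (1 + w p)) * 2 ^ (-((C.card : ℝ) / 20)) := by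
  obtain ⟨b, y, hb0, hby, hbA⟩ : ∃ b y : ℝ, 0 < b ∧ (1 + b) / 2 = 3 / 4 * 2 ^ y ∧ ∀ f ∈ A, 2 ^ (C.card * (y - 1 / 3)) ≤ b ^ ((C ∩ f).card) := by
    rcases hA with hA | hA
    · refine ⟨2 ^ (-1 : ℝ), 0, by positivity, by rw [Real.rpow_neg_one]; norm_num, fun f hf => ?_⟩
      rw [← rpow_natCast, ← rpow_mul (by norm_num)]
      refine rpow_le_rpow_of_exponent_le (by norm_num) ?_
      have : (3 * (C ∩ f).card : ℝ) ≤ C.card := by exact_mod_cast hA f hf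
      linarith
    · refine ⟨2 ^ (1 : ℝ), 1, by positivity, by norm_num, fun f hf => ?_⟩
      rw [← rpow_natCast, ← rpow_mul (by norm_num)]
      refine rpow_le_rpow_of_exponent_le (by norm_num) ?_
      have h1 : (3 * (C \ f).card : ℝ) ≤ C.card := by exact_mod_cast hA f hf
      have h2 : (((C ∩ f).card + (C \ f).card : ℕ) : ℝ) = C.card := by rw [Finset.card_inter_add_card_sdiff]
      push_cast at h2
      linarith
  have h1 := chern0 A (fun p => w p * (if p ∈ C then b else 1)) (fun p => mul_nonneg (hw p) (by split_ifs <;> positivity))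
    (θ * 2 ^ (C.card * (y - 1 / 3))) (by
      intro f hf
      rw [prod_mul_distrib]
      refine mul_le_mul (h f hf) ?_ (by positivity) (prod_nonneg fun p _ => hw p)
      rw [prod_ite_mem, prod_const, Finset.inter_comm]
      exact hbA f hf)
  have h2 : ∏ p, (1 + w p * (if p ∈ C then b else 1)) = (∏ p, (1 + w p)) * (3 / 4 * 2 ^ y) ^ C.card := by
    have : ∀ p, (1 + w p * (if p ∈ C then b else 1)) = (1 + w p) * (if p ∈ C then 3 / 4 * 2 ^ y else 1) := by
      intro p
      split_ifs with hp
      · rw [hC p hp, ← hby]; ring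
      · ring
    rw [prod_congr rfl (fun p _ => this p), prod_mul_distrib, prod_ite_mem, prod_const]
    simp
  rw [h2, mul_pow] at h1
  have h3 := half_gain C.card
  have hp : (0:ℝ) < 2 ^ (C.card * (y - 1 / 3)) := by positivity
  have hP : 0 ≤ ∏ p, (1 + w p) := prod_nonneg fun p _ => by have := hw p; linarith
  have h4 : ((2:ℝ) ^ y) ^ C.card = 2 ^ (C.card * (y - 1 / 3)) * 2 ^ ((C.card : ℝ) / 3) := by
    rw [← rpow_natCast, ← rpow_mul (by norm_num), ← rpow_add (by norm_num)]
    congr 1; ring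
  rw [h4] at h1
  refine le_of_mul_le_mul_right ?_ hp
  calc (A.card : ℝ) * θ * 2 ^ (C.card * (y - 1 / 3)) ≤
        (∏ p, (1 + w p)) * 2 ^ (C.card * (y - 1 / 3)) * ((3 / 4) ^ C.card * 2 ^ ((C.card : ℝ) / 3)) := by linarith
    _ ≤ (∏ p, (1 + w p)) * 2 ^ (C.card * (y - 1 / 3)) * 2 ^ (-((C.card : ℝ) / 20)) := by gcongr
    _ = _ := by ring

/-- The graph of a set of pairs. -/
def gr (f : Finset (Fin n × Fin n)) : SimpleGraph (Fin n) where
  Adj x y := x ≠ y ∧ (min x y, max x y) ∈ f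
  symm := ⟨fun x y h => ⟨h.1.symm, by rw [min_comm, max_comm]; exact h.2⟩⟩
  loopless := ⟨fun x h => h.1 rfl⟩

lemma gx_count {k K : ℕ} (c : Fin n → Fin k) (A : Finset (Finset (Fin n × Fin n))) (w : Fin n × Fin n → ℝ)
    (hw : ∀ p, 0 ≤ w p) (θ : ℝ) (hθ : 0 ≤ θ) (h : ∀ f ∈ A, θ ≤ ∏ p ∈ f, w p)
    (hw1 : ∀ x y, x < y → c x ≠ c y → w (x, y) = 1) (hA : ∀ f ∈ A, ¬ GenX (gr f) c K) :
    (A.card : ℝ) * θ ≤ (2 ^ n * 2 ^ n * 2) * ((∏ p, (1 + w p)) * 2 ^ (-((K:ℝ) ^ 2 / 20))) := by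
  have hP : 0 ≤ ∏ p, (1 + w p) := prod_nonneg fun p _ => by have := hw p; linarith
  rcases hθ.eq_or_lt with rfl | hθ'
  · rw [mul_zero]; positivity
  let mm : Fin n × Fin n → Fin n × Fin n := fun p => (min p.1 p.2, max p.1 p.2)
  have hmm : ∀ (B Z : Finset (Fin n)) j, (∀ b ∈ B, c b = j) → (∀ z ∈ Z, c z ≠ j) →
      Set.InjOn mm ((Z ×ˢ B : Finset _) : Set (Fin n × Fin n)) := by
    intro B Z j hB hZ
    rintro ⟨z, b⟩ h1 ⟨z', b'⟩ h2 he
    simp only [Finset.coe_product, Set.mem_prod, mem_coe] at h1 h2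
    have z1 := hZ z h1.1
    have z2 := hZ z' h2.1
    have b1 := hB b h1.2
    have b2 := hB b' h2.2
    simp only [mm, Prod.mk.injEq] at he
    rcases le_total z b with e1 | e1 <;> rcases le_total z' b' with e2 | e2 <;>
      simp only [min_eq_left, min_eq_right, max_eq_left, max_eq_right, e1, e2] at he
    · rw [he.1, he.2]
    · exact absurd (he.1 ▸ b2) z1
    · exact absurd (he.1 ▸ b1) z2
    · rw [he.1, he.2]
  have hcov := cover_card {D : Finset (Fin n) × Finset (Fin n) × Bool | (∃ j, (∀ b ∈ D.1, c b = j) ∧ (∀ z ∈ D.2.1, c z ≠ j)) ∧ K ≤ D.1.card ∧ K ≤ D.2.1.card}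
    (fun D => {f : Finset (Fin n × Fin n) | f ∈ A ∧ if D.2.2 then 3 * (((D.2.1 ×ˢ D.1).image mm) ∩ f).card ≤ ((D.2.1 ×ˢ D.1).image mm).card else
      3 * (((D.2.1 ×ˢ D.1).image mm) \ f).card ≤ ((D.2.1 ×ˢ D.1).image mm).card})
    (A := (A : Set (Finset (Fin n × Fin n)))) (X := ((∏ p, (1 + w p)) * 2 ^ (-((K:ℝ) ^ 2 / 20))) / θ) ?_ ?_
  · rw [ncard_coe_finset] at hcov
    rw [← le_div_iff₀ hθ', mul_div_assoc]
    refine hcov.trans ?_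
    gcongr
    refine (Nat.cast_le.2 (ncard_le_ncard (Set.subset_univ _))).trans ?_
    rw [ncard_univ]
    simp [mul_assoc]
  · intro f hf
    have hf' := hA f hf
    unfold GenX at hf'
    push Not at hf'
    obtain ⟨j, B, hB, hK, hcon⟩ := hf'
    have hsum : ∀ (Z : Finset (Fin n)) (g : Fin n × Fin n → Prop), (∀ z ∈ Z, 3 * (B.filter (fun b => g (mm (z, b)))).card ≤ B.card) →
        (∀ z ∈ Z, c z ≠ j) → 3 * (((Z ×ˢ B).image mm).filter g).card ≤ ((Z ×ˢ B).image mm).card := by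
      intro Z g hZ hZc
      have hinj := hmm B Z j hB hZc
      rw [Finset.card_image_of_injOn hinj, Finset.filter_image, Finset.card_image_of_injOn (hinj.mono (by intro p hp; exact mem_of_mem_filter p hp)),
        card_product]
      have e : ((Z ×ˢ B).filter (fun p => g (mm p))).card = ∑ z ∈ Z, (B.filter (fun b => g (mm (z, b)))).card := by
        rw [card_filter, Finset.sum_product]
        simp only [card_filter]
      rw [e, mul_sum]
      refine (sum_le_sum hZ).trans (by simp)
    have hadj : ∀ z b, c z ≠ j → b ∈ B → ((gr f).Adj z b ↔ mm (z, b) ∈ f) := by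
      intro z b hz hb
      have : z ≠ b := fun e => hz (e ▸ hB b hb)
      simp [gr, mm, this]
    obtain ⟨Z1, hZ1⟩ : ∃ Z, Z = univ.filter (fun v => c v ≠ j ∧ 3 * (B.filter (fun b => (gr f).Adj v b)).card < B.card) := ⟨_, rfl⟩
    obtain ⟨Z2, hZ2⟩ : ∃ Z, Z = univ.filter (fun v => c v ≠ j ∧ 3 * (B.filter (fun b => ¬ (gr f).Adj v b)).card < B.card) := ⟨_, rfl⟩
    rw [← hZ1, ← hZ2] at hcon
    have hm1 : ∀ z ∈ Z1, c z ≠ j ∧ 3 * (B.filter (fun b => mm (z, b) ∈ f)).card ≤ B.card := by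
      intro z hz
      rw [hZ1, mem_filter] at hz
      refine ⟨hz.2.1, le_trans (le_of_eq ?_) hz.2.2.le⟩
      congr 2
      exact Finset.filter_congr fun b hb => by rw [hadj z b hz.2.1 hb]
    have hm2 : ∀ z ∈ Z2, c z ≠ j ∧ 3 * (B.filter (fun b => mm (z, b) ∉ f)).card ≤ B.card := by
      intro z hz
      rw [hZ2, mem_filter] at hz
      refine ⟨hz.2.1, le_trans (le_of_eq ?_) hz.2.2.le⟩
      congr 2
      exact Finset.filter_congr fun b hb => by rw [hadj z b hz.2.1 hb]
    by_cases h1 : Z1.card < K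
    · refine ⟨⟨B, Z2, false⟩, ⟨⟨j, hB, fun z hz => (hm2 z hz).1⟩, hK, hcon h1⟩, hf, ?_⟩
      simp only [Bool.false_eq_true, if_false]
      rw [← Finset.filter_notMem_eq_sdiff]
      convert hsum Z2 (fun p => p ∉ f) (fun z hz => by convert (hm2 z hz).2) (fun z hz => (hm2 z hz).1)
    · refine ⟨⟨B, Z1, true⟩, ⟨⟨j, hB, fun z hz => (hm1 z hz).1⟩, hK, not_lt.1 h1⟩, hf, ?_⟩
      simp only [if_true]
      rw [← Finset.filter_mem_eq_inter]
      convert hsum Z1 (fun p => p ∈ f) (fun z hz => by convert (hm1 z hz).2) (fun z hz => (hm1 z hz).1)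
  · rintro ⟨B, Z, sg⟩ ⟨⟨j, hB, hZ⟩, hK1, hK2⟩
    simp only at hB hZ hK1 hK2
    have hcard : K ^ 2 ≤ ((Z ×ˢ B).image mm).card := by
      have hinj := hmm B Z j hB hZ
      rw [Finset.card_image_of_injOn hinj, card_product, sq]
      exact Nat.mul_le_mul hK2 hK1
    have hch := chern (A.filter (fun f => if sg then 3 * (((Z ×ˢ B).image mm) ∩ f).card ≤ ((Z ×ˢ B).image mm).card else
      3 * (((Z ×ˢ B).image mm) \ f).card ≤ ((Z ×ˢ B).image mm).card)) w hw θ (fun f hf => h f (mem_of_mem_filter f hf))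
      ((Z ×ˢ B).image mm) (by
        intro p hp
        obtain ⟨⟨z, b⟩, hzb, rfl⟩ := mem_image.1 hp
        rw [mem_product] at hzb
        have z1 := hZ z hzb.1
        have b1 := hB b hzb.2
        have hne : z ≠ b := fun e => z1 (e ▸ b1)
        refine hw1 _ _ (by simpa using hne.symm) ?_
        rcases le_total z b with e1 | e1 <;> simp only [min_eq_left, min_eq_right, max_eq_left, max_eq_right, e1, b1]
        · exact z1
        · exact z1.symm) (by
        cases sg
        · right; intro f hf; simpa using (mem_filter.1 hf).2
        · left; intro f hf; simpa using (mem_filter.1 hf).2)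
    rw [le_div_iff₀ hθ']
    refine le_trans (mul_le_mul_of_nonneg_right (Nat.cast_le.2 ?_) hθ) (hch.trans ?_)
    · refine le_trans (ncard_le_ncard ?_ (Finset.finite_toSet _)) (ncard_coe_finset _).le
      intro f hf
      simpa using hf
    · gcongr
      · norm_num
      · exact_mod_cast hcard

/-- Existence of generic patterns. -/
lemma patt (k : ℕ) {κ : ℝ} (hκ : 0 < κ) : ∀ᶠ w : ℕ in atTop, ∃ (Q : SimpleGraph (Fin (k * w))) (c : Fin (k * w) → Fin k),
    (∀ j, (part c j).card = w) ∧ GenX Q c ⌈κ * w⌉₊ := by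
  filter_upwards [ev_lin_ge (γ := κ ^ 2) (by positivity) (40 * k + 41), eventually_ge_atTop 1] with w hw hw1
  let c : Fin (k * w) → Fin k := fun x => (finProdFinEquiv.symm x).1
  have hw1' : (1:ℝ) ≤ w := by exact_mod_cast hw1
  obtain ⟨f, hf⟩ : ∃ f : Finset (Fin (k * w) × Fin (k * w)), GenX (gr f) c ⌈κ * w⌉₊ := by
    by_contra hcon
    push Not at hcon
    have h := gx_count c univ (fun _ => 1) (fun _ => zero_le_one) 1 zero_le_one (fun f _ => by simp) (fun _ _ _ _ => rfl)
      (fun f _ => hcon f)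
    have e : ((univ : Finset (Finset (Fin (k * w) × Fin (k * w)))).card : ℝ) = ∏ p : Fin (k * w) × Fin (k * w), (1 + (1:ℝ)) := by
      rw [prod_const, card_univ, Fintype.card_finset, card_univ]
      push_cast; norm_num
    rw [e, mul_one] at h
    have hpos : 0 < ∏ p : Fin (k * w) × Fin (k * w), (1 + (1:ℝ)) := Finset.prod_pos fun _ _ => by norm_num
    have hlt : (2 ^ (k * w) * 2 ^ (k * w) * 2) * (2:ℝ) ^ (-((⌈κ * w⌉₊:ℝ) ^ 2 / 20)) < 1 := by
      have e2 : (2 ^ (k * w) * 2 ^ (k * w) * 2 : ℝ) = 2 ^ (2 * (k * w) + 1 : ℝ) := by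
        rw [show (2 * (k * w) + 1 : ℝ) = ((2 * (k * w) + 1 : ℕ) : ℝ) by push_cast; ring, rpow_natCast]; ring
      rw [e2, ← rpow_add (by norm_num)]
      refine Real.rpow_lt_one_of_one_lt_of_neg (by norm_num) ?_
      have h1 : κ * w ≤ ⌈κ * w⌉₊ := Nat.le_ceil _
      have h2 : (κ * w) ^ 2 ≤ (⌈κ * w⌉₊ : ℝ) ^ 2 := by gcongr
      have h3 : (40 * k + 41) * (w:ℝ) ≤ κ ^ 2 * w * w := by gcongr
      nlinarith
    have h5 := mul_lt_mul_of_pos_left hlt hpos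
    linarith
  refine ⟨gr f, c, fun j => ?_, hf⟩
  have : part c j = ((univ : Finset (Fin w)).map ⟨fun a => finProdFinEquiv (j, a), fun a b h => by simpa using h⟩) := by
    ext x
    simp only [part, mem_filter, mem_univ, true_and, Finset.mem_map, Function.Embedding.coeFn_mk]
    constructor
    · rintro rfl
      exact ⟨(finProdFinEquiv.symm x).2, finProdFinEquiv.apply_symm_apply x⟩
    · rintro ⟨a, rfl⟩
      exact congrArg Prod.fst (finProdFinEquiv.symm_apply_apply (j, a))
  rw [this]; simp

lemma trace_count {s : ℕ} (q : Fin s → Fin n) (hq : Injective q) (H0 : SimpleGraph (Fin n)) (a b η : ℝ) (ha : 0 ≤ a) (hb : b ≤ a)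
    (A : Set (SimpleGraph (Fin n))) (hA : ∀ H ∈ A, AgreeOff q H0 H ∧ ∃ T D : Finset (Finset (Fin s)),
      (T.card : ℝ) ≤ 2 ^ a ∧ (D.card : ℝ) ≤ 2 ^ b ∧ (∀ v, (∀ x, q x ≠ v) → trc H q v ∈ T) ∧
      η * n ≤ (univ.filter (fun v => (∀ x, q x ≠ v) ∧ trc H q v ∈ D)).card) :
    (A.ncard : ℝ) ≤ Fintype.card (Finset (Finset (Fin s)) × Finset (Finset (Fin s))) * 2 ^ (s * s) * 2 ^ ((a + 1 - (a - b) * η) * n) := by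
  have hcov := cover_card {D : (Finset (Finset (Fin s)) × Finset (Finset (Fin s))) × Finset (Fin n) |
      (D.1.1.card : ℝ) ≤ 2 ^ a ∧ (D.1.2.card : ℝ) ≤ 2 ^ b ∧ (∀ v ∈ D.2, ∀ x, q x ≠ v) ∧ η * n ≤ D.2.card}
    (fun D => {H | H ∈ A ∧ ∀ v, trc H q v ∈ if ∃ x, q x = v then univ else if v ∈ D.2 then D.1.2 else D.1.1})
    (A := A) (X := 2 ^ (s * s) * 2 ^ ((a - (a - b) * η) * n)) ?_ ?_
  · refine hcov.trans ?_
    have h1 : ({D : (Finset (Finset (Fin s)) × Finset (Finset (Fin s))) × Finset (Fin n) |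
      (D.1.1.card : ℝ) ≤ 2 ^ a ∧ (D.1.2.card : ℝ) ≤ 2 ^ b ∧ (∀ v ∈ D.2, ∀ x, q x ≠ v) ∧ η * n ≤ D.2.card}.ncard : ℝ) ≤
        Fintype.card (Finset (Finset (Fin s)) × Finset (Finset (Fin s))) * 2 ^ n := by
      refine (Nat.cast_le.2 (ncard_le_ncard (Set.subset_univ _))).trans ?_
      rw [ncard_univ, Nat.card_eq_fintype_card, Fintype.card_prod (Finset (Finset (Fin s)) × Finset (Finset (Fin s)))]
      simp
    refine (mul_le_mul_of_nonneg_right h1 (by positivity)).trans (le_of_eq ?_)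
    rw [show (a + 1 - (a - b) * η) * n = (a - (a - b) * η) * n + n by ring, rpow_add (by norm_num), rpow_natCast]
    ring
  · intro H hH
    obtain ⟨-, T, D, hT, hD, hv, hη⟩ := hA H hH
    refine ⟨⟨⟨T, D⟩, _⟩, ⟨hT, hD, ?_, hη⟩, hH, ?_⟩
    · intro v h; exact (mem_filter.1 h).2.1
    · intro v
      split_ifs with h1 h2
      · simp
      · exact (mem_filter.1 h2).2.2
      · push Not at h1; exact hv v h1
  · rintro ⟨⟨T, D⟩, Z⟩ ⟨hT, hD, hZ, hη⟩
    simp only at hT hD hZ hη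
    have hle : {H | H ∈ A ∧ ∀ v, trc H q v ∈ if ∃ x, q x = v then univ else if v ∈ Z then D else T}.ncard ≤
        (Fintype.piFinset (fun v => if ∃ x, q x = v then univ else if v ∈ Z then D else T)).card := by
      rw [← ncard_coe_finset]
      refine Set.ncard_le_ncard_of_injOn (fun H => trc H q) (fun H hH => by simpa using hH.2) ?_ (Finset.finite_toSet _)
      intro H hH H' hH' he
      have h1 := (hA H hH.1).1
      have h2 := (hA H' hH'.1).1
      refine rows_eq (q := q) (fun x y hx hy => (h1 x y hx hy).symm.trans (h2 x y hx hy)) ?_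
      ext x i
      have := Finset.ext_iff.1 (congrFun he x) i
      simp only [mem_trc] at this
      simp [rows, this]
    refine (Nat.cast_le.2 hle).trans ?_
    rw [Fintype.card_piFinset]
    push_cast
    have h2a : (1:ℝ) ≤ 2 ^ a := Real.one_le_rpow (by norm_num) ha
    have hpt : ∀ v, (((if ∃ x, q x = v then univ else if v ∈ Z then D else T) : Finset (Finset (Fin s))).card : ℝ) ≤
        (if v ∈ univ.image q then 2 ^ s else 1) * ((if v ∈ Z then 2 ^ b else 2 ^ a)) := by
      intro v
      by_cases h1 : ∃ x, q x = v
      · have h2 : v ∉ Z := fun h => by obtain ⟨x, hx⟩ := h1; exact hZ v h x hx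
        rw [if_pos h1, if_pos (by simpa using h1), if_neg h2]
        simp only [card_univ, Fintype.card_finset, Fintype.card_fin]
        push_cast
        exact le_mul_of_one_le_right (by positivity) h2a
      · rw [if_neg h1, if_neg (show v ∉ univ.image q by simpa using h1), one_mul]
        split_ifs
        · exact hD
        · exact hT
    refine (Finset.prod_le_prod (fun v _ => by positivity) (fun v _ => hpt v)).trans ?_
    rw [prod_mul_distrib, prod_ite_mem, prod_const, univ_inter, Finset.card_image_of_injective _ hq]
    simp only [card_univ, Fintype.card_fin]
    rw [← pow_mul]
    gcongr
    have hZr : ((univ.filter (fun v => v ∈ Z)).card : ℝ) = Z.card := by simp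
    have hZn : ((univ.filter (fun v => v ∉ Z)).card : ℝ) = n - Z.card := by
      have := Finset.card_filter_add_card_filter_not (s := (univ : Finset (Fin n))) (fun v => v ∈ Z)
      rw [card_univ, Fintype.card_fin] at this
      rw [← hZr]
      have h3 : ((univ.filter (fun v => v ∈ Z)).card + (univ.filter (fun v => v ∉ Z)).card : ℝ) = n := by exact_mod_cast this
      linarith
    rw [prod_ite, prod_const, prod_const, ← rpow_natCast, ← rpow_natCast, ← rpow_mul (by norm_num),
      ← rpow_mul (by norm_num), ← rpow_add (by norm_num), hZr, hZn]
    refine rpow_le_rpow_of_exponent_le (by norm_num) ?_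
    have := mul_le_mul_of_nonneg_left hη (sub_nonneg.2 hb)
    linarith

lemma trace_gain (hr : 2 ≤ r) (s : ℕ) (hs : 1 ≤ s) (a b η : ℝ) (ha : 0 ≤ a) (hb : b ≤ a) (hlt : a + 1 - (a - b) * η < s * al r)
    (A : Fam) (h : ∀ᶠ n in atTop, ∀ H ∈ A n, ¬ HasC r H ∧ ∃ q : Fin s → Fin n, Injective q ∧ ∃ T D : Finset (Finset (Fin s)),
      (T.card : ℝ) ≤ 2 ^ a ∧ (D.card : ℝ) ≤ 2 ^ b ∧ (∀ v, (∀ x, q x ≠ v) → trc H q v ∈ T) ∧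
      η * n ≤ (univ.filter (fun v => (∀ x, q x ≠ v) ∧ trc H q v ∈ D)).card) : Small r A := by
  set C : ℝ := Fintype.card (Finset (Finset (Fin s)) × Finset (Finset (Fin s))) * 2 ^ (s * s) with hC
  refine small_of_removal hr s hs (fun n => n ^ s * (C * 2 ^ ((a + 1 - (a - b) * η) * n))) (fun n => by positivity) ?_ ?_
  · refine (poly_exp_zero s C (γ := s * al r - (a + 1 - (a - b) * η)) (by linarith)).congr fun n => ?_
    rw [mul_div_assoc, mul_div_assoc, ← rpow_sub (by norm_num), mul_assoc]
    congr 3; ring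
  · filter_upwards [h] with n hn
    refine removal (A n) (fun q H => ∃ T D : Finset (Finset (Fin s)),
      (T.card : ℝ) ≤ 2 ^ a ∧ (D.card : ℝ) ≤ 2 ^ b ∧ (∀ v, (∀ x, q x ≠ v) → trc H q v ∈ T) ∧
      η * n ≤ (univ.filter (fun v => (∀ x, q x ≠ v) ∧ trc H q v ∈ D)).card) _ (by positivity) hn ?_
    intro q hq H0 _ _
    exact trace_count q hq H0 a b η ha hb _ (fun H hH => ⟨hH.2.2, hH.1⟩)

/-- Few sets have a tiny intersection with a given set. -/
lemma few_count {ε : ℝ} (hε : 0 < ε) : ∃ ζ : ℝ, 0 < ζ ∧ ζ ≤ 1 ∧ ∀ (s : ℕ) (P C : Finset (Fin s)) (A : Finset (Finset (Fin s))),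
    (∀ x ∈ C, x ∉ P) → (∀ S ∈ A, ((P ∩ S).card : ℝ) ≤ ζ * P.card) → ((∀ S ∈ A, 3 * (C ∩ S).card ≤ C.card) ∨ (∀ S ∈ A, 3 * (C \ S).card ≤ C.card)) →
    (A.card : ℝ) ≤ 2 ^ (s - P.card + ε * P.card - C.card / 20) := by
  set lam : ℝ := min 1 (2 ^ (ε / 2) - 1) with hl
  have hlp : 0 < lam := by
    refine lt_min one_pos ?_
    have : (1:ℝ) < 2 ^ (ε / 2) := Real.one_lt_rpow (by norm_num) (by linarith)
    linarith
  have hl1 : lam ≤ 1 := min_le_left _ _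
  have hl2 : 1 + lam ≤ 2 ^ (ε / 2) := by have := min_le_right 1 ((2:ℝ) ^ (ε / 2) - 1); linarith
  set μ : ℝ := -logb 2 lam with hμ
  have hμ0 : 0 ≤ μ := by
    rw [hμ, neg_nonneg]; exact Real.logb_nonpos (by norm_num) hlp.le hl1
  have hlμ : lam = 2 ^ (-μ) := by rw [hμ, neg_neg, Real.rpow_logb (by norm_num) (by norm_num) hlp]
  refine ⟨min 1 (ε / (2 * (μ + 1))), by positivity, min_le_left _ _, fun s P C A hCP hA hCA => ?_⟩
  have hz : min 1 (ε / (2 * (μ + 1))) * μ ≤ ε / 2 := by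
    calc min 1 (ε / (2 * (μ + 1))) * μ ≤ ε / (2 * (μ + 1)) * (μ + 1) := by
          gcongr
          · exact min_le_right _ _
          · linarith
      _ = ε / 2 := by field_simp
  have h := chern A (fun p => if p ∈ P then lam else 1) (fun p => by split_ifs <;> linarith) (2 ^ (-(ε / 2 * P.card))) (by
    intro S hS
    rw [prod_ite_mem, prod_const, hlμ, ← rpow_natCast, ← rpow_mul (by norm_num)]
    refine rpow_le_rpow_of_exponent_le (by norm_num) ?_
    rw [Finset.inter_comm]
    have h1 := hA S hS
    have h2 := mul_le_mul_of_nonneg_right hz (Nat.cast_nonneg (α := ℝ) P.card)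
    nlinarith [mul_le_mul_of_nonneg_right h1 hμ0]) C (fun p hp => if_neg (hCP p hp)) hCA
  have h2 : ∏ p, (1 + if p ∈ P then lam else 1) ≤ (2:ℝ) ^ (s - P.card + ε / 2 * P.card) := by
    have : ∀ p, (1 + if p ∈ P then lam else 1) = 2 * (if p ∈ P then (1 + lam) / 2 else 1) := by
      intro p; split_ifs <;> ring
    rw [prod_congr rfl (fun p _ => this p), prod_mul_distrib, prod_ite_mem, prod_const, prod_const,
      univ_inter, card_univ, Fintype.card_fin, div_pow]
    calc (2:ℝ) ^ s * ((1 + lam) ^ P.card / 2 ^ P.card) ≤ (2:ℝ) ^ s * ((2 ^ (ε / 2)) ^ P.card / 2 ^ P.card) := by gcongr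
      _ = _ := by
        rw [← rpow_natCast, ← rpow_natCast, ← rpow_natCast, ← rpow_mul (by norm_num), ← rpow_sub (by norm_num),
          ← rpow_add (by norm_num)]
        congr 1; ring
  have h3 := h.trans (mul_le_mul_of_nonneg_right h2 (by positivity))
  rw [rpow_neg (by norm_num) (ε / 2 * _), ← div_eq_mul_inv, div_le_iff₀ (by positivity), ← rpow_add (by norm_num), ← rpow_add (by norm_num)] at h3
  refine h3.trans (le_of_eq ?_)
  congr 1; ring

/-- Large families shatter sets which are substantial on prescribed sets. -/
lemma pajor {ε : ℝ} (hε : 0 < ε) : ∃ ζ : ℝ, 0 < ζ ∧ ζ ≤ 1 ∧ ∀ (s : ℕ) (T : Finset (Finset (Fin s))) (Ps : Finset (Finset (Fin s))) (p : ℕ),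
    (∀ P ∈ Ps, P.card = p) → Ps.card * (2:ℝ) ^ (s - p + ε * p) < T.card → ∃ S, T.Shatters S ∧ ∀ P ∈ Ps, ζ * p < (P ∩ S).card := by
  obtain ⟨ζ, hζ, hζ1, h⟩ := few_count hε
  refine ⟨ζ, hζ, hζ1, fun s T Ps p hp hlt => ?_⟩
  by_contra hcon
  push Not at hcon
  have h1 : T.shatterer ⊆ Ps.biUnion (fun P => univ.filter (fun S => ((P ∩ S).card : ℝ) ≤ ζ * p)) := by
    intro S hS
    obtain ⟨P, hP, hle⟩ := hcon S (Finset.mem_shatterer.1 hS)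
    simp only [mem_biUnion, mem_filter, mem_univ, true_and]
    exact ⟨P, hP, hle⟩
  have h2 : ((Ps.biUnion (fun P => univ.filter (fun S => ((P ∩ S).card : ℝ) ≤ ζ * p))).card : ℝ) ≤ Ps.card * (2:ℝ) ^ (s - p + ε * p) := by
    refine (Nat.cast_le.2 card_biUnion_le).trans ?_
    push_cast
    rw [← nsmul_eq_mul]
    refine sum_le_card_nsmul _ _ _ fun P hP => ?_
    have := h s P ∅ (univ.filter (fun S => ((P ∩ S).card : ℝ) ≤ ζ * p)) (by simp) (fun S hS => by
      rw [hp P hP]; exact (mem_filter.1 hS).2) (by simp)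
    simpa [hp P hP] using this
  have h3 : (T.card : ℝ) ≤ T.shatterer.card := by exact_mod_cast Finset.card_le_card_shatterer T
  have h4 : (T.shatterer.card : ℝ) ≤ _ := Nat.cast_le.2 (card_le_card h1)
  linarith

lemma kap (M : ℕ) {ζ : ℝ} (hζ : 0 < ζ) : ∃ κ : ℝ, 0 < κ ∧ ∀ᶠ w : ℕ in atTop, ∃ W0, M * ⌈κ * w⌉₊ + 20 ≤ W0 ∧ ⌈κ * w⌉₊ ≤ W0 ∧
    ((5 ^ M * W0 : ℕ) : ℝ) ≤ ζ * w := by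
  set κ : ℝ := ζ / (2 * 5 ^ M * (M + 1)) with hκ
  have hκ0 : 0 < κ := by positivity
  refine ⟨κ, hκ0, ?_⟩
  filter_upwards [ev_lin_ge (γ := ζ / 2) (by linarith) (5 ^ M * (M + 1 + 20))] with w hw
  refine ⟨(M + 1) * ⌈κ * w⌉₊ + 20, by gcongr; omega, by nlinarith, ?_⟩
  have h1 : (⌈κ * w⌉₊ : ℝ) ≤ κ * w + 1 := (Nat.ceil_lt_add_one (by positivity)).le
  push_cast
  calc (5:ℝ) ^ M * ((M + 1) * ⌈κ * w⌉₊ + 20) ≤ (5:ℝ) ^ M * ((M + 1) * (κ * w + 1) + 20) := by gcongr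
    _ = (5 ^ M * (M + 1) * κ) * w + 5 ^ M * (M + 1 + 20) := by ring
    _ = ζ / 2 * w + 5 ^ M * (M + 1 + 20) := by rw [hκ]; field_simp
    _ ≤ ζ * w := by linarith

/-- The traces on a core. -/
def trs {s : ℕ} (H : SimpleGraph (Fin n)) (q : Fin s → Fin n) : Finset (Finset (Fin s)) :=
  (univ.filter (fun v => ∀ x, q x ≠ v)).image (trc H q)

lemma mem_trs {s : ℕ} {H : SimpleGraph (Fin n)} {q : Fin s → Fin n} {A : Finset (Fin s)} :
    A ∈ trs H q ↔ ∃ v, (∀ x, q x ≠ v) ∧ A = trc H q v := by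
  simp only [trs, mem_image, mem_filter, mem_univ, true_and]
  exact ⟨fun ⟨v, h1, h2⟩ => ⟨v, h1, h2.symm⟩, fun ⟨v, h1, h2⟩ => ⟨v, h1, h2.symm⟩⟩

/-- A large trace family shatters a set which is substantial on every part. -/
lemma pajor_parts {k w : ℕ} {ε ζ : ℝ} {c : Fin (k * w) → Fin k} (hcw : ∀ j, (part c j).card = w) {T : Finset (Finset (Fin (k * w)))}
    (hp : ∀ (s : ℕ) (T : Finset (Finset (Fin s))) (Ps : Finset (Finset (Fin s))) (p : ℕ),
      (∀ P ∈ Ps, P.card = p) → Ps.card * (2:ℝ) ^ (s - p + ε * p) < T.card → ∃ S, T.Shatters S ∧ ∀ P ∈ Ps, ζ * p < (P ∩ S).card)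
    (hk : (k : ℝ) ≤ 2 ^ (ε * w)) (hT : (2:ℝ) ^ ((k - 1) * w + 2 * ε * w : ℝ) < T.card) :
    ∃ S, T.Shatters S ∧ ∀ j, ζ * w < (part c j ∩ S).card := by
  obtain ⟨S, hS, h⟩ := hp (k * w) T (univ.image (part c)) w (by
    intro P hP; obtain ⟨j, -, rfl⟩ := mem_image.1 hP; exact hcw j) (by
      refine lt_of_le_of_lt ?_ hT
      have h1 : ((univ.image (part c)).card : ℝ) ≤ k := by
        have := card_image_le (s := (univ : Finset (Fin k))) (f := part c)
        rw [card_univ, Fintype.card_fin] at this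
        exact_mod_cast this
      calc ((univ.image (part c)).card : ℝ) * (2:ℝ) ^ (((k * w : ℕ) : ℝ) - w + ε * w)
          ≤ 2 ^ (ε * w) * (2:ℝ) ^ (((k * w : ℕ) : ℝ) - w + ε * w) := by gcongr; exact h1.trans hk
        _ = _ := by rw [← rpow_add (by norm_num)]; congr 1; push_cast; ring)
  exact ⟨S, hS, fun j => h _ (Finset.mem_image_of_mem _ (mem_univ _))⟩

/-- All `k`-part cores with `k ≤ r` are unavoidable. -/
lemma U_all (hr : 2 ≤ r) : ∀ k, k + 1 ≤ r → ∀ s (c0 : Fin s → Fin (k + 1)) (Q : SimpleGraph (Fin s)),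
    Small r (fun n => {H | ¬ HasC r H ∧ ∀ q τ, ¬ Core c0 Q H q τ}) := by
  intro k
  induction k with
  | zero =>
    intro _ s c0 Q
    refine Small.mono (B := fun _ => ∅) (small_of_direct (fun _ => 0) tendsto_const_nhds (fun _ => le_rfl) (by simp)) ?_
    filter_upwards [eventually_ge_atTop (2 ^ (s + s))] with n hn
    rintro H ⟨-, hH⟩
    exfalso
    obtain ⟨f, hf, t, ht⟩ := ramsey s (fun a b => H.Adj (Fin.castLE hn a) (Fin.castLE hn b)) (fun _ _ h => h.symm)
    refine hH (fun x => Fin.castLE hn (f x)) (fun _ => t = true) ⟨?_, ?_⟩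
    · exact (Fin.castLE_injective hn).comp hf
    · intro x y hxy
      rw [if_pos (Fin.ext (by omega))]
      exact ht x y hxy
  | succ k ih =>
    intro hk s c0 Q
    have hr0 : (0:ℝ) < r := by positivity
    obtain ⟨ζ, hζ, -, hp⟩ := pajor (ε := 1 / (4 * r)) (by positivity)
    obtain ⟨M, hM⟩ : ∃ M, M = 2 * (s * (2 ^ (s + s)) ^ s) + 2 ^ (s + s) := ⟨_, rfl⟩
    obtain ⟨κ, hκ, hkap⟩ := kap M hζ
    obtain ⟨w, ⟨Qp, cp, hcw, hgen⟩, ⟨W0, hW1, hW2, hW3⟩, hkw, hw1, hw2⟩ := ((patt (k + 1) hκ).and (hkap.and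
      ((ev_const_le (γ := 1 / (4 * r)) (by positivity) ((k + 1 : ℕ) : ℝ)).and
      ((ev_lin_ge (γ := 1 / (2 * r)) (by positivity) 2).and (eventually_ge_atTop 1))))).exists
    refine ((ih (by omega) _ cp Qp).union (B := fun n => {H | ¬ HasC r H ∧ (∀ q τ, ¬ Core c0 Q H q τ) ∧ ∃ q τ, Core cp Qp H q τ}) ?_).mono ?_
    swap
    · filter_upwards with n H hH
      by_cases h : ∃ q τ, Core cp Qp H q τ
      · exact Or.inr ⟨hH.1, hH.2, h⟩
      · push Not at h; exact Or.inl ⟨hH.1, h⟩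
    have hkr : ((k:ℝ) + 2) ≤ r := by exact_mod_cast hk
    refine trace_gain hr ((k + 1) * w) (Nat.mul_pos (by omega) hw2) (((k + 1 : ℕ) - 1) * w + 2 * (1 / (4 * r)) * w) (((k + 1 : ℕ) - 1) * w + 2 * (1 / (4 * r)) * w) 0
      ?_ le_rfl ?_ _ ?_
    · push_cast
      have : (0:ℝ) ≤ (k + 1 - 1) * w := by rw [add_sub_cancel_right]; positivity
      positivity
    · unfold al
      push_cast
      have e1 : (k + 1) * (w:ℝ) * (1 - 1 / r) = (k+1) * w - (k + 1) * (w / r) := by field_simp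
      have e2 : 2 * (1 / (4 * r)) * (w:ℝ) = (w / r) / 2 := by field_simp; norm_num
      have e3 : 1 / (2 * r) * (w:ℝ) = (w / r) / 2 := by field_simp
      have e4 : (k + 2) * ((w:ℝ) / r) ≤ w := by
        calc (k + 2) * ((w:ℝ) / r) ≤ r * (w / r) := by gcongr
          _ = w := by field_simp
      rw [e1, e2]
      rw [e3] at hw1
      linarith
    · filter_upwards with n
      rintro H ⟨hC, hno, q, τ, hcore⟩
      refine ⟨hC, q, hcore.1, trs H q, ∅, ?_, by simp; positivity, fun v hv => mem_trs.2 ⟨v, hv, rfl⟩, by simp⟩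
      by_contra hcon
      push Not at hcon
      obtain ⟨S, hS, hSj⟩ := pajor_parts hcw hp hkw hcon
      obtain ⟨t, q', hq', hadj⟩ := extract hgen hcore (ramsey s) hM hW1 hW2 (S := S) (Y := ∅) (T := trs H q)
        (fun A hA => ⟨by simp, mem_trs.1 hA⟩) hS (fun _ x => finSuccEquivLast (c0 x)) (fun _ => Q) (fun j => part cp j ∩ S)
        (fun i x hx => by simpa [part] using (mem_inter.1 hx).1) (fun i => by exact_mod_cast hW3.trans (hSj i).le)
        (fun i => Or.inl inter_subset_right) 0 inter_subset_right
      refine hno q' (fun i => Option.elim (finSuccEquivLast i) (t = true) τ) ⟨hq', fun x y hxy => ?_⟩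
      rw [hadj x y hxy]
      simp only [EmbeddingLike.apply_eq_iff_eq]

/-- In a large generic `r`-core all parts are independent. -/
lemma core_indep {s K M W0 : ℕ} (hr : 5 ≤ r) {Q : SimpleGraph (Fin s)} {c : Fin s → Fin r} (hg : GenX Q c K)
    {H : SimpleGraph (Fin n)} {q : Fin s → Fin n} {τ : Fin r → Prop} (hc : Core c Q H q τ)
    (hM : M = 2 * r + 2) (hW : M * K + 20 ≤ W0) (hKW : K ≤ W0) (v0 : Fin s)
    (hZc : ∀ i, 5 ^ M * W0 ≤ (part c i).card) (hC : ¬ HasC r H) (i : Fin r) : ¬ τ i := by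
  intro hi
  by_cases h : ∃ j, j ≠ i ∧ τ j
  · obtain ⟨j, hj, hτ⟩ := h
    refine hC (core_hasC hg hc hM hW hKW v0 hZc (fun x => if x.val % 2 = 0 then i else j) ?_)
    intro x y hxy hd
    have hx : τ (if x.val % 2 = 0 then i else j) := by split_ifs <;> assumption
    have hpar : x.val % 2 = y.val % 2 := by
      split_ifs at hd with h1 h2 h2
      · omega
      · exact absurd hd.symm hj
      · exact absurd hd hj
      · omega
    simp only [hx, true_iff]
    rintro (h | h | h | h) <;> omega
  · push Not at h
    let f : ℕ → ℕ := fun p => if p = 0 ∨ p = 3 ∨ p = 6 ∨ p = 9 then 0 else if p < 10 then p / 3 + 1 else (p - 4) / 2 + 1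
    have hf : ∀ x : Fin (2 * r + 2), f x < r := by
      intro x; simp only [f]; split_ifs <;> omega
    let d : Fin (2 * r + 2) → Fin r := fun x => Equiv.swap ⟨0, by omega⟩ i ⟨f x, hf x⟩
    have hd0 : ∀ x : Fin (2 * r + 2), f x = 0 → d x = i := by
      intro x hx; simp only [d, hx]; exact Equiv.swap_apply_left _ _
    refine hC (core_hasC hg hc hM hW hKW v0 hZc d ?_)
    intro x y hxy hd
    have hfe : f x = f y := by simpa [d] using hd
    have hxy' : x.val ≠ y.val := fun h => hxy (Fin.ext h)
    by_cases h0 : f x = 0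
    · rw [hd0 x h0]
      have h0' := hfe ▸ h0
      simp only [hi, true_iff]
      simp only [f] at h0 h0'
      rintro (h | h | h | h) <;> split_ifs at h0 h0' <;> omega
    · have hne : d x ≠ i := by
        intro h
        have h9 := h.trans (hd0 ⟨0, by omega⟩ (by simp [f])).symm
        simp only [d, EmbeddingLike.apply_eq_iff_eq, Fin.mk.injEq] at h9
        exact h0 h9
      simp only [h _ hne, false_iff, not_not]
      simp only [f] at h0 hfe
      unfold cyc
      split_ifs at h0 hfe <;> omega

def cgr (L : ℕ) : SimpleGraph (Fin L) where
  Adj x y := x ≠ y ∧ ¬ cyc L x y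
  symm := ⟨fun x y h => ⟨h.1.symm, by rw [cyc_comm]; exact h.2⟩⟩
  loopless := ⟨fun x h => h.1 rfl⟩

/-- No shattered set is substantial on all parts (one part may be replaced by a fixed set of common neighbours). -/
lemma exc {s' K M W0 : ℕ} (hr : 5 ≤ r) {Q : SimpleGraph (Fin s')} {c : Fin s' → Fin r} (hg : GenX Q c K)
    {H : SimpleGraph (Fin n)} {q : Fin s' → Fin n} {τ : Fin r → Prop} (hc : Core c Q H q τ) (hτ : ∀ i, ¬ τ i)
    (hM : M = 2 * ((2 * r + 2) * (2 ^ ((2 * r + 2) + (2 * r + 2))) ^ (2 * r + 2)) + 2 ^ ((2 * r + 2) + (2 * r + 2)))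
    (hW : M * K + 20 ≤ W0) (hKW : K ≤ W0) {S Y : Finset (Fin s')} {T : Finset (Finset (Fin s'))}
    (hT : ∀ A ∈ T, Y ⊆ A ∧ A ∈ trs H q) (hS : T.Shatters S) (j : Fin r)
    (h1 : ∀ i, i ≠ j → 5 ^ M * W0 ≤ (part c i ∩ S).card)
    (h2 : 5 ^ M * W0 ≤ (part c j ∩ S).card ∨ 5 ^ M * W0 ≤ (part c j ∩ Y).card) : HasC r H := by
  let f : Bool → ℕ → ℕ := fun t p => if t then (if p < 4 then p / 2 else if p < 8 then 2 else p / 2 - 1) else p / 2 - 1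
  have hf : ∀ t (x : Fin (2 * r + 2)), f t x < r := by
    intro t x; simp only [f]; split_ifs <;> omega
  let jj : Bool → Fin r := fun t => ⟨if t then 0 else 1, by split_ifs <;> omega⟩
  let nn : Bool → ℕ → Prop := fun t p => if t then p = 4 ∨ p = 7 else p = 0 ∨ p = 1
  let c0 : Bool → Fin (2 * r + 2) → Option (Fin r) := fun t x => if nn t x then none else some (Equiv.swap (jj t) j ⟨f t x, hf t x⟩)
  obtain ⟨i0, hi0⟩ : ∃ i0, i0 ≠ j := by
    by_cases h : j = ⟨0, by omega⟩
    · exact ⟨⟨1, by omega⟩, by rw [h]; simp⟩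
    · exact ⟨_, Ne.symm h⟩
  obtain ⟨Z, hZj, hZn⟩ : ∃ Z : Fin r → Finset (Fin s'), ((Z j = part c j ∩ S ∨ Z j = part c j ∩ Y) ∧ 5 ^ M * W0 ≤ (Z j).card) ∧
      ∀ i, i ≠ j → Z i = part c i ∩ S := by
    rcases h2 with h2 | h2
    · exact ⟨fun i => part c i ∩ S, ⟨Or.inl rfl, h2⟩, fun _ _ => rfl⟩
    · exact ⟨fun i => if i = j then part c j ∩ Y else part c i ∩ S, ⟨Or.inr (by simp), by simpa using h2⟩, fun i hi => by simp [hi]⟩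
  have hext := extract hg hc (ramsey (2 * r + 2)) hM hW hKW (S := S) (Y := Y) (T := T)
    (fun A hA => ⟨(hT A hA).1, mem_trs.1 (hT A hA).2⟩) hS c0 (fun _ => cgr (2 * r + 2)) Z ?_ ?_ ?_ i0 (by rw [hZn _ hi0]; exact inter_subset_right)
  · obtain ⟨t, q', hq', hadj⟩ := hext
    refine ⟨fun p => if h : p < 2 * r + 2 then q' ⟨p, h⟩ else q' ⟨0, by omega⟩, ?_⟩
    intro x y hx hy hxy
    simp only [hx, hy, dif_pos]
    have hne : (⟨x, hx⟩ : Fin (2 * r + 2)) ≠ ⟨y, hy⟩ := by simpa using hxy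
    refine ⟨hq'.ne hne, ?_⟩
    rw [hadj _ _ hne]
    simp only [c0]
    by_cases n1 : nn t x <;> by_cases n2 : nn t y
    · simp only [n1, n2, if_true, Option.elim, eq_self]
      simp only [nn] at n1 n2
      unfold cyc
      rcases t with _ | _
      · simp only [Bool.false_eq_true, if_false] at n1 n2 ⊢
        simp only [false_iff, true_iff, not_not]
        omega
      · simp only [if_true] at n1 n2 ⊢
        simp only [false_iff, true_iff, not_not]
        omega
    · simp [n1, n2, cgr, hxy]
    · simp [n1, n2, cgr, hxy]
    · simp only [n1, n2, if_false, Option.some.injEq, EmbeddingLike.apply_eq_iff_eq, Fin.mk.injEq, Option.elim, hτ]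
      split_ifs with hff
      · simp only [nn] at n1 n2
        simp only [f] at hff
        simp only [false_iff, not_not]
        unfold cyc
        rcases t with _ | _
        · simp only [Bool.false_eq_true, if_false] at n1 n2 hff; omega
        · simp only [if_true] at n1 n2 hff; split_ifs at hff <;> omega
      · simp [cgr, hxy]
  · intro i x hx
    have : x ∈ part c i := by
      by_cases h : i = j
      · subst h
        rcases hZj.1 with e | e <;> rw [e] at hx <;> exact (mem_inter.1 hx).1
      · rw [hZn i h] at hx; exact (mem_inter.1 hx).1
    simpa [part] using this
  · intro i
    by_cases h : i = j
    · subst h; exact hZj.2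
    · rw [hZn i h]; exact h1 i h
  · intro i
    by_cases h : i = j
    · subst h
      rcases hZj.1 with e | e <;> rw [e]
      · exact Or.inl inter_subset_right
      · refine Or.inr ⟨inter_subset_right, fun t x b hx hb => ?_⟩
        have nb : nn t b := by by_contra hn; simp [c0, hn] at hb
        have nx : ¬ nn t x := by intro hn; simp [c0, hn] at hx
        have hfx : f t x = (jj t).val := by
          simp only [c0, nx, if_false, Option.some.injEq] at hx
          have := (Equiv.swap (jj t) i).injective (hx.trans (Equiv.swap_apply_left (jj t) i).symm)
          exact congrArg Fin.val this
        have hne : x ≠ b := fun h => nx (h ▸ nb)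
        refine ⟨hne, ?_⟩
        simp only [nn, jj, f] at nb nx hfx
        unfold cyc
        rcases t with _ | _
        · simp only [Bool.false_eq_true, if_false] at nb nx hfx; omega
        · simp only [if_true] at nb nx hfx; split_ifs at hfx <;> omega
    · rw [hZn i h]; exact Or.inl inter_subset_right

/-- Bound on the number of traces. -/
lemma trs_le {s' K M W0 w : ℕ} (hr : 5 ≤ r) {Q : SimpleGraph (Fin s')} {c : Fin s' → Fin r} (hg : GenX Q c K)
    {H : SimpleGraph (Fin n)} {q : Fin s' → Fin n} {τ : Fin r → Prop} (hc : Core c Q H q τ) (hτ : ∀ i, ¬ τ i)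
    (hM : M = 2 * ((2 * r + 2) * (2 ^ ((2 * r + 2) + (2 * r + 2))) ^ (2 * r + 2)) + 2 ^ ((2 * r + 2) + (2 * r + 2)))
    (hW : M * K + 20 ≤ W0) (hKW : K ≤ W0) (hC : ¬ HasC r H) {X : ℝ} {ζ : ℝ} (hWζ : ((5 ^ M * W0 : ℕ) : ℝ) ≤ ζ * w)
    (hp : X < (trs H q).card → ∃ S, (trs H q).Shatters S ∧ ∀ j, ζ * w < ((part c j ∩ S).card : ℝ)) :
    ((trs H q).card : ℝ) ≤ X := by
  by_contra! hlt
  obtain ⟨S, hS, hS2⟩ := hp hlt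
  have h9 : ∀ i, 5 ^ M * W0 ≤ (part c i ∩ S).card := fun i => by exact_mod_cast hWζ.trans (hS2 i).le
  exact hC (exc hr hg hc hτ hM hW hKW (T := trs H q) (Y := ∅) (fun A hA => ⟨by simp, hA⟩) hS ⟨0, by omega⟩
    (fun i _ => h9 i) (Or.inl (h9 _)))

/-- Bound on the number of traces meeting all parts substantially. -/
lemma R_le {s' K M W0 w P : ℕ} (hr : 5 ≤ r) {Q : SimpleGraph (Fin s')} {c : Fin s' → Fin r} (hg : GenX Q c K)
    {H : SimpleGraph (Fin n)} {q : Fin s' → Fin n} {τ : Fin r → Prop} (hc : Core c Q H q τ) (hτ : ∀ i, ¬ τ i)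
    (hM : M = 2 * ((2 * r + 2) * (2 ^ ((2 * r + 2) + (2 * r + 2))) ^ (2 * r + 2)) + 2 ^ ((2 * r + 2) + (2 * r + 2)))
    (hW : M * K + 20 ≤ W0) (hKW : K ≤ W0) (hC : ¬ HasC r H) (hs : s' = r * w) (hcw : ∀ j, (part c j).card = w)
    {ζ1 ζ2 : ℝ} (hp : ∀ (s : ℕ) (T : Finset (Finset (Fin s))) (Ps : Finset (Finset (Fin s))) (p : ℕ), (∀ P ∈ Ps, P.card = p) →
      (Ps.card : ℝ) * (2:ℝ) ^ ((s:ℝ) - p + 1 / 16 * p) < T.card → ∃ S, T.Shatters S ∧ ∀ P ∈ Ps, ζ1 * p < ((P ∩ S).card : ℝ))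
    (hf : ∀ (s : ℕ) (P C : Finset (Fin s)) (A : Finset (Finset (Fin s))), (∀ x ∈ C, x ∉ P) →
      (∀ S ∈ A, ((P ∩ S).card : ℝ) ≤ ζ2 * P.card) →
      ((∀ S ∈ A, 3 * (C ∩ S).card ≤ C.card) ∨ (∀ S ∈ A, 3 * (C \ S).card ≤ C.card)) →
      (A.card : ℝ) ≤ 2 ^ ((s:ℝ) - P.card + 1 / (8 * r) * P.card - C.card / 20))
    (hWζ : ((5 ^ M * W0 : ℕ) : ℝ) ≤ ζ1 * w) (hP : 5 ^ M * W0 ≤ P) (hP2 : (P : ℝ) ≤ ζ2 * w) (hw : (r:ℝ) * r ≤ 2 ^ (1 / 4 * (w:ℝ))) :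
    (((trs H q).filter (fun A => ∀ j, P ≤ (part c j ∩ A).card)).card : ℝ) ≤ 2 ^ (((r:ℝ) - 1) * w - 1 / 2 * w) := by
  have hr0 : (0:ℝ) < r := by exact_mod_cast (by omega : 0 < r)
  obtain ⟨R, hR⟩ : ∃ R, R = (trs H q).filter (fun A => ∀ j, P ≤ (part c j ∩ A).card) := ⟨_, rfl⟩
  rw [← hR]
  have hY : ∀ A ∈ R, ∃ Y, Y ⊆ A ∧ ∀ j, (part c j ∩ Y).card = P := by
    intro A hA
    rw [hR, mem_filter] at hA
    choose Y hY1 hY2 using fun j => Finset.exists_subset_card_eq (hA.2 j)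
    have hYc : ∀ j x, x ∈ Y j → c x = j := fun j x hx => by
      have := (mem_inter.1 (hY1 j hx)).1; simpa [part] using this
    refine ⟨univ.biUnion Y, fun x hx => ?_, fun j => ?_⟩
    · obtain ⟨j, -, hj⟩ := mem_biUnion.1 hx
      exact (mem_inter.1 (hY1 j hj)).2
    · rw [← hY2 j]
      congr 1
      ext x
      simp only [mem_inter, part, mem_filter, mem_univ, true_and, mem_biUnion]
      constructor
      · rintro ⟨h1, i, hi⟩
        rw [← h1, hYc i x hi]; exact hi
      · exact fun h => ⟨hYc j x h, j, h⟩
  obtain ⟨𝒴, h𝒴⟩ : ∃ 𝒴, 𝒴 = (univ : Finset (Finset (Fin s'))).filter (fun Y => ∀ j, (part c j ∩ Y).card = P) := ⟨_, rfl⟩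
  have h𝒴c : (𝒴.card : ℝ) ≤ 2 ^ (1 / 8 * (w:ℝ)) := by
    have h := hf s' univ ∅ 𝒴 (by simp) ?_ (Or.inl (by simp))
    · refine h.trans (le_of_eq ?_)
      congr 1
      simp [hs]; field_simp
    · intro S hS
      rw [h𝒴, mem_filter] at hS
      have : (univ ∩ S).card = r * P := by
        rw [univ_inter, Finset.card_eq_sum_card_fiberwise (t := univ) (f := c) (by simp)]
        rw [sum_congr rfl (fun j _ => (?_ : _ = P))]
        · simp
        · rw [← hS.2 j]
          congr 1
          ext x; simp [part, and_comm]
      rw [this, card_univ, Fintype.card_fin, hs]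
      push_cast
      nlinarith
  obtain ⟨Ps, hPs⟩ : ∃ Ps, Ps = ((univ : Finset (Fin r × Fin r)).filter (fun p => p.1 ≠ p.2)).image (fun p => part c p.1 ∪ part c p.2) := ⟨_, rfl⟩
  have hPsc : (Ps.card : ℝ) ≤ r * r := by
    have : Ps.card ≤ r * r := by
      rw [hPs]
      refine card_image_le.trans ((Finset.card_filter_le _ _).trans ?_)
      simp
    exact_mod_cast this
  have hPw : ∀ B ∈ Ps, B.card = 2 * w := by
    intro B hB
    rw [hPs] at hB
    obtain ⟨p, hp1, rfl⟩ := mem_image.1 hB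
    rw [Finset.card_union_of_disjoint, hcw, hcw, two_mul]
    rw [Finset.disjoint_left]
    intro x hx hx'
    simp only [part, mem_filter, mem_univ, true_and] at hx hx' hp1
    exact hp1 (hx.symm.trans hx')
  have hRY : ∀ Y ∈ 𝒴, ((R.filter (fun A => Y ⊆ A)).card : ℝ) ≤ r * r * 2 ^ ((s':ℝ) - (2 * w : ℕ) + 1 / 16 * (2 * w : ℕ)) := by
    intro Y hY
    rw [h𝒴, mem_filter] at hY
    by_contra! hlt
    obtain ⟨S, hS, hS2⟩ := hp s' _ Ps (2 * w) hPw (lt_of_le_of_lt (mul_le_mul_of_nonneg_right hPsc (by positivity)) hlt)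
    have hor : ∃ j, ∀ i, i ≠ j → 5 ^ M * W0 ≤ (part c i ∩ S).card := by
      by_contra! hno
      obtain ⟨i, -, hi⟩ := hno ⟨0, by omega⟩
      obtain ⟨i', hne, hi'⟩ := hno i
      have h := hS2 (part c i' ∪ part c i) (by rw [hPs]; exact mem_image.2 ⟨(i', i), by simpa using hne, rfl⟩)
      have h3 : ((part c i' ∪ part c i) ∩ S).card ≤ (part c i' ∩ S).card + (part c i ∩ S).card := by
        rw [Finset.union_inter_distrib_right]; exact card_union_le _ _
      have h4 : (((part c i' ∪ part c i) ∩ S).card : ℝ) ≤ 2 * (5 ^ M * W0 : ℕ) := by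
        exact_mod_cast (by omega : _ ≤ 2 * (5 ^ M * W0))
      push_cast at h h4 hWζ
      nlinarith
    obtain ⟨j, hj⟩ := hor
    exact hC (exc hr hg hc hτ hM hW hKW (Y := Y) (fun A hA => ⟨(mem_filter.1 hA).2, by
      have := (mem_filter.1 hA).1; rw [hR] at this; exact (mem_filter.1 this).1⟩) hS j hj
      (Or.inr (by rw [hY.2 j]; exact hP)))
  have hcov : R ⊆ 𝒴.biUnion (fun Y => R.filter (fun A => Y ⊆ A)) := by
    intro A hA
    obtain ⟨Y, h1, h2⟩ := hY A hA
    exact mem_biUnion.2 ⟨Y, by rw [h𝒴]; simpa using h2, mem_filter.2 ⟨hA, h1⟩⟩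
  calc (R.card : ℝ) ≤ ∑ Y ∈ 𝒴, ((R.filter (fun A => Y ⊆ A)).card : ℝ) := by
        exact_mod_cast (card_le_card hcov).trans card_biUnion_le
    _ ≤ 𝒴.card * (r * r * 2 ^ ((s':ℝ) - (2 * w : ℕ) + 1 / 16 * (2 * w : ℕ))) := by
        rw [← nsmul_eq_mul]; exact sum_le_card_nsmul _ _ _ hRY
    _ ≤ 2 ^ (1 / 8 * (w:ℝ)) * (2 ^ (1 / 4 * (w:ℝ)) * 2 ^ ((s':ℝ) - (2 * w : ℕ) + 1 / 16 * (2 * w : ℕ))) := by gcongr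
    _ = _ := by
        rw [← rpow_add (by norm_num), ← rpow_add (by norm_num)]
        congr 1
        rw [hs]; push_cast; ring

lemma find_path {n β : ℕ} (E : Fin n → Fin n → Prop) (hs : ∀ x y, E x y → E y x)
    (B2 : Fin n → Finset (Fin n)) (B3 : Fin n → Fin n → Finset (Fin n)) (B4 : Fin n → Fin n → Fin n → Finset (Fin n))
    (h2 : ∀ b, (B2 b).card ≤ β) (h3 : ∀ b c, (B3 b c).card ≤ β) (h4 : ∀ b c a, (B4 b c a).card ≤ β)
    (h : (3 * β + 6) * n < (univ.filter (fun p : Fin n × Fin n => E p.1 p.2)).card) :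
    ∃ a b c d, a ≠ c ∧ a ≠ d ∧ b ≠ d ∧ E a b ∧ E b c ∧ E c d ∧ c ∉ B2 b ∧ a ∉ B3 b c ∧ d ∉ B4 b c a := by
  let N : Fin n → Finset (Fin n) := fun x => univ.filter (fun y => E x y)
  have hsum : ∀ (S : Fin n → Finset (Fin n)) k, (∀ x, (S x).card ≤ k) →
      (univ.filter (fun p : Fin n × Fin n => p.2 ∈ S p.1)).card ≤ k * n ∧
      (univ.filter (fun p : Fin n × Fin n => p.1 ∈ S p.2)).card ≤ k * n := by
    intro S k hS
    have h0 : ∑ x, (S x).card ≤ k * n := (sum_le_card_nsmul _ _ k (fun x _ => hS x)).trans (by simp [mul_comm])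
    have h1 : (univ.sigma S).card ≤ k * n := by rw [card_sigma]; exact h0
    constructor
    · refine le_trans (Finset.card_le_card_of_injOn (fun p => (⟨p.1, p.2⟩ : Σ _ : Fin n, Fin n)) ?_ ?_) h1
      · intro p hp; simpa using hp
      · rintro ⟨a, b⟩ _ ⟨c, d⟩ _ h; simpa using h
    · refine le_trans (Finset.card_le_card_of_injOn (fun p => (⟨p.2, p.1⟩ : Σ _ : Fin n, Fin n)) ?_ ?_) h1
      · intro p hp; simpa using hp
      · rintro ⟨a, b⟩ _ ⟨c, d⟩ _ h; simp at h ⊢; exact ⟨h.2, h.1⟩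
  let S : Fin n → Finset (Fin n) := fun x => if (N x).card ≤ β + 2 then N x else ∅
  have hS : ∀ x, (S x).card ≤ β + 2 := by intro x; simp only [S]; split_ifs <;> simp_all
  have hB := (hsum B2 β h2).1
  obtain ⟨hS1, hS2⟩ := hsum S _ hS
  obtain ⟨⟨b, c⟩, hbc, hno⟩ : ∃ p ∈ univ.filter (fun p : Fin n × Fin n => E p.1 p.2), p ∉
      (univ.filter (fun p : Fin n × Fin n => p.2 ∈ B2 p.1)) ∪ ((univ.filter (fun p : Fin n × Fin n => p.2 ∈ S p.1)) ∪
      (univ.filter (fun p : Fin n × Fin n => p.1 ∈ S p.2))) := by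
    by_contra! hall
    have hle := card_le_card (fun p hp => hall p hp)
    have hu := card_union_le (univ.filter (fun p : Fin n × Fin n => p.2 ∈ B2 p.1)) ((univ.filter (fun p : Fin n × Fin n => p.2 ∈ S p.1)) ∪
      (univ.filter (fun p : Fin n × Fin n => p.1 ∈ S p.2)))
    have hu2 := card_union_le (univ.filter (fun p : Fin n × Fin n => p.2 ∈ S p.1)) (univ.filter (fun p : Fin n × Fin n => p.1 ∈ S p.2))
    nlinarith
  simp only [mem_union, mem_filter, mem_univ, true_and, not_or] at hbc hno
  obtain ⟨n2, n3, n4⟩ := hno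
  have hdb : β + 2 < (N b).card := by
    by_contra hle
    exact n3 (by simp only [S]; rw [if_pos (by omega)]; simpa [N] using hbc)
  have hdc : β + 2 < (N c).card := by
    by_contra hle
    exact n4 (by simp only [S]; rw [if_pos (by omega)]; simpa [N] using hs _ _ hbc)
  have pick : ∀ (X B : Finset (Fin n)) (x y : Fin n), β + 2 < X.card → B.card ≤ β → ∃ z ∈ X, z ∉ B ∧ z ≠ x ∧ z ≠ y := by
    intro X B x y hX hB
    obtain ⟨z, hz, hz'⟩ := Finset.exists_mem_notMem_of_card_lt_card (s := insert x (insert y B)) (t := X)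
      (by have := card_insert_le x (insert y B); have := card_insert_le y B; omega)
    simp only [mem_insert, not_or] at hz'
    exact ⟨z, hz, hz'.2.2, hz'.1, hz'.2.1⟩
  obtain ⟨a, ha, ha1, ha2, -⟩ := pick (N b) (B3 b c) c c hdb (h3 b c)
  obtain ⟨d, hd, hd1, hd2, hd3⟩ := pick (N c) (B4 b c a) a b hdc (h4 b c a)
  simp only [N, mem_filter, mem_univ, true_and] at ha hd
  exact ⟨a, b, c, d, ha2, hd2.symm, hd3.symm, hs _ _ ha, hbc, hd, n2, ha1, hd1⟩

/-- An induced-free path inside a would-be part produces the cycle. -/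
lemma four {s K W : ℕ} (hr : 5 ≤ r) {Q : SimpleGraph (Fin s)} {c : Fin s → Fin r} (hg : GenX Q c K)
    {H : SimpleGraph (Fin n)} {q : Fin s → Fin n} {τ : Fin r → Prop} (hc : Core c Q H q τ) (hτ : ∀ i, ¬ τ i)
    (hW : WW r (K + 20) ≤ W) (p : Fin 4 → Fin n) (hp : Injective p) (hpq : ∀ k x, q x ≠ p k) (j : Fin r)
    (hR : ∀ i, ∀ t : Fin 4 → Prop, (i = j → ∀ k, ¬ t k) →
      W ≤ (univ.filter (fun u => c u = i ∧ ∀ k, (H.Adj (q u) (p k) ↔ t k))).card)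
    (h01 : H.Adj (p 0) (p 1)) (h12 : H.Adj (p 1) (p 2)) (h23 : H.Adj (p 2) (p 3)) : HasC r H := by
  by_contra hC
  have hinj : Injective (Fin.append q p) := by
    intro x y
    induction x using Fin.addCases <;> induction y using Fin.addCases <;> simp only [Fin.append_left, Fin.append_right] <;> intro h
    · rw [hc.1 h]
    · exact absurd h (hpq _ _)
    · exact absurd h.symm (hpq _ _)
    · rw [hp h]
  let c1 : Fin (s + 4) → Fin r := Fin.append c (fun _ => j)
  let H1 := H.comap (Fin.append q p)
  have hC1 : ¬ HasC r H1 := fun h => hC (hasC_comap ⟨_, hinj⟩ h)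
  have key : ∀ (R : Fin (s + 4) → Prop) (R' : Fin s → Prop) [DecidablePred R] [DecidablePred R'], (∀ x, R (Fin.castAdd 4 x) ↔ R' x) →
      (univ.filter R').card ≤ (univ.filter R).card ∧ (univ.filter R).card ≤ (univ.filter R').card + 4 := by
    intro R R' _ _ h
    constructor
    · exact Finset.card_le_card_of_injOn (Fin.castAdd 4) (fun x hx => by simpa [h] using hx) (fun x _ y _ h => by simpa using h)
    · have : univ.filter R ⊆ (univ.filter R').image (Fin.castAdd 4) ∪ univ.image (Fin.natAdd s) := by
        intro x hx
        simp only [mem_union, mem_image, mem_filter, mem_univ, true_and] at hx ⊢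
        induction x using Fin.addCases with
        | left x => exact Or.inl ⟨x, (h x).1 hx, rfl⟩
        | right x => exact Or.inr ⟨x, rfl⟩
      refine (card_le_card this).trans ((card_union_le _ _).trans (Nat.add_le_add card_image_le ?_))
      exact card_image_le.trans (by simp)
  have hadj : ∀ x y : Fin s, c x ≠ c y → (H.Adj (q x) (q y) ↔ Q.Adj x y) := by
    intro x y hxy
    rw [hc.2 x y (fun h => hxy (by rw [h])), if_neg hxy]
  have hgen : Gen H1 c1 (K + 20) := by
    intro i B hB hBK
    obtain ⟨B0, hB0⟩ : ∃ B0, B0 = univ.filter (fun x : Fin s => Fin.castAdd 4 x ∈ B) := ⟨_, rfl⟩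
    have hBc : B.card ≤ B0.card + 4 := by
      have := (key (fun x => x ∈ B) _ (fun x => Iff.rfl)).2
      rw [hB0]; simpa using this
    have hB0c : ∀ b ∈ B0, c b = i := by
      intro b hb
      rw [hB0, mem_filter] at hb
      simpa [c1] using hB _ hb.2
    have hsub : ∀ (R : Fin (s + 4) → Prop) (R' : Fin s → Prop) [DecidablePred R] [DecidablePred R'], (∀ x ∈ B0, R (Fin.castAdd 4 x) ↔ R' x) →
        (B0.filter R').card ≤ (B.filter R).card := by
      intro R R' _ _ h
      refine Finset.card_le_card_of_injOn (Fin.castAdd 4) (fun x hx => ?_) (fun x _ y _ h => by simpa using h)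
      simp only [coe_filter, mem_ofPred_eq] at hx ⊢
      exact ⟨by have := hx.1; rw [hB0, mem_filter] at this; exact this.2, (h x hx.1).2 hx.2⟩
    obtain ⟨g1, g2⟩ := hg i B0 hB0c (by omega)
    constructor
    · have h := (key (fun v => c1 v ≠ i ∧ 4 * (B.filter (fun b => H1.Adj v b)).card < B.card) _ (fun x => Iff.rfl)).2
      refine lt_of_le_of_lt (h.trans (Nat.add_le_add_right (card_le_card ?_) 4)) (Nat.lt_of_lt_of_le (Nat.add_lt_add_right g1 4) (by omega))
      intro v hv
      simp only [mem_filter, mem_univ, true_and] at hv ⊢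
      have hvi : c v ≠ i := by simpa [c1] using hv.1
      have := hsub (fun b => H1.Adj (Fin.castAdd 4 v) b) (fun b => Q.Adj v b) (by
        intro x hx
        simp only [H1, SimpleGraph.comap_adj, Fin.append_left]
        exact hadj v x (by rw [hB0c x hx]; exact hvi))
      exact ⟨hvi, by omega⟩
    · have h := (key (fun v => 4 * (B.filter (fun b => ¬ H1.Adj v b)).card < B.card) _ (fun x => Iff.rfl)).2
      refine lt_of_le_of_lt (h.trans (Nat.add_le_add_right (card_le_card ?_) 4)) (Nat.lt_of_lt_of_le (Nat.add_lt_add_right g2 4) (by omega))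
      intro v hv
      simp only [mem_filter, mem_univ, true_and] at hv ⊢
      by_cases hvi : c v = i
      · exfalso
        have := hsub (fun b => ¬ H1.Adj (Fin.castAdd 4 v) b) (fun _ => True) (by
          intro x hx
          simp only [H1, SimpleGraph.comap_adj, Fin.append_left, iff_true]
          intro ha
          have hne : v ≠ x := fun h => (h ▸ ha).ne rfl
          rw [hc.2 v x hne, if_pos (by rw [hvi, hB0c x hx])] at ha
          exact hτ _ ha)
        simp only [Finset.filter_true] at this
        omega
      · have := hsub (fun b => ¬ H1.Adj (Fin.castAdd 4 v) b) (fun b => ¬ Q.Adj v b) (by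
          intro x hx
          simp only [H1, SimpleGraph.comap_adj, Fin.append_left]
          exact not_congr (hadj v x (by rw [hB0c x hx]; exact hvi)))
        exact ⟨hvi, by omega⟩
  have hrich : RichP H1 c1 (fun x => s ≤ x.val) W := by
    intro Qs hQ hlw i t ht
    have hm : ∀ k, ∃ m : Fin 4, Qs k = Fin.natAdd s m := by
      intro k
      have h1 := (Qs k).isLt
      have h2 := hlw k
      exact ⟨⟨(Qs k).val - s, by omega⟩, Fin.ext (by simp; omega)⟩
    choose m hm using hm
    have hmi : Injective m := fun a b h => hQ (by rw [hm, hm, h])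
    refine (hR i (fun k => ∃ k', m k' = k ∧ t k') ?_).trans ((card_le_card ?_).trans (key _ (fun u => c1 (Fin.castAdd 4 u) = i ∧ ∀ k, (H1.Adj (Fin.castAdd 4 u) (Qs k) ↔ t k)) (fun _ => Iff.rfl)).1)
    · rintro rfl k ⟨k', -, hk⟩
      exact ht k' (by rw [hm]; simp [c1]) hk
    · intro u hu
      simp only [mem_filter, mem_univ, true_and] at hu ⊢
      refine ⟨by simpa [c1] using hu.1, fun k => ?_⟩
      rw [hm]
      simp only [H1, SimpleGraph.comap_adj, Fin.append_left, Fin.append_right]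
      rw [hu.2 (m k)]
      exact ⟨fun ⟨k', h1, h2⟩ => hmi h1 ▸ h2, fun h => ⟨k, rfl, h⟩⟩
  have hno := noP4_P hr hgen hrich hW hC1 j
  have hl : ∀ k : Fin 4, c1 (Fin.natAdd s k) = j ∧ s ≤ (Fin.natAdd s k).val := fun k => ⟨by simp [c1], by simp⟩
  refine hno (Fin.natAdd s 0) (Fin.natAdd s 1) (Fin.natAdd s 2) (Fin.natAdd s 3) (hl _) (hl _) (hl _) (hl _) ?_ ?_ ?_ ?_ ?_ ?_
  · simp
  · simp
  · simp
  · simpa [H1] using h01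
  · simpa [H1] using h12
  · simpa [H1] using h23

def ref {s : ℕ} (𝒞 : Finset (Finset (Fin s))) (A : Finset (Fin s)) : Finset (Finset (Fin s)) :=
  𝒞.image (· ∩ A) ∪ 𝒞.image (· \ A)

lemma ref_card {s : ℕ} (𝒞 : Finset (Finset (Fin s))) (A : Finset (Fin s)) : (ref 𝒞 A).card ≤ 2 * 𝒞.card := by
  have h1 := card_union_le (𝒞.image (· ∩ A)) (𝒞.image (· \ A))
  have h2 : (𝒞.image (· ∩ A)).card ≤ 𝒞.card := card_image_le
  have h3 : (𝒞.image (· \ A)).card ≤ 𝒞.card := card_image_le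
  unfold ref; omega

lemma ref_mem {s : ℕ} {𝒞 : Finset (Finset (Fin s))} {A C : Finset (Fin s)} (h : C ∈ 𝒞) (t : Prop) :
    C.filter (fun u => u ∈ A ↔ t) ∈ ref 𝒞 A := by
  by_cases ht : t
  · refine mem_union_left _ (mem_image.2 ⟨C, h, ?_⟩)
    ext; simp [ht]
  · refine mem_union_right _ (mem_image.2 ⟨C, h, ?_⟩)
    ext; simp [ht]

/-- `v` has few neighbours in part `j` of the core. -/
def Lo {s : ℕ} (H : SimpleGraph (Fin n)) (q : Fin s → Fin n) (c : Fin s → Fin r) (P : ℕ) (j : Fin r) (v : Fin n) : Prop :=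
  (∀ x, q x ≠ v) ∧ (part c j ∩ trc H q v).card < P

def bad {s : ℕ} (H : SimpleGraph (Fin n)) (q : Fin s → Fin n) (c : Fin s → Fin r) (P w : ℕ) (j : Fin r)
    (𝒞 : Finset (Finset (Fin s))) : Finset (Fin n) :=
  univ.filter (fun v => Lo H q c P j v ∧ ∃ C ∈ 𝒞, (w ≤ 27 * C.card ∧ Disjoint C (part c j)) ∧
    (3 * (C ∩ trc H q v).card ≤ C.card ∨ 3 * (C \ trc H q v).card ≤ C.card))

lemma bad_le {s P w : ℕ} {H : SimpleGraph (Fin n)} {q : Fin s → Fin n} {c : Fin s → Fin r} {X y : ℝ} (hy : 0 ≤ y)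
    (hD : ∀ (j : Fin r) (C : Finset (Fin s)) (A : Finset (Finset (Fin s))), w ≤ 27 * C.card → Disjoint C (part c j) →
      (∀ S ∈ A, (part c j ∩ S).card < P) → ((∀ S ∈ A, 3 * (C ∩ S).card ≤ C.card) ∨ (∀ S ∈ A, 3 * (C \ S).card ≤ C.card)) →
      (A.card : ℝ) ≤ X)
    (hfew : ∀ D : Finset (Finset (Fin s)), (D.card : ℝ) ≤ X →
      ((univ.filter (fun v => (∀ x, q x ≠ v) ∧ trc H q v ∈ D)).card : ℝ) ≤ y)
    (j : Fin r) (𝒞 : Finset (Finset (Fin s))) : ((bad H q c P w j 𝒞).card : ℝ) ≤ 𝒞.card * (2 * y) := by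
  let F : Finset (Fin s) → Finset (Fin n) := fun C => bad H q c P w j {C}
  have hF : ∀ C ∈ 𝒞, ((F C).card : ℝ) ≤ 2 * y := by
    intro C _
    by_cases hC : w ≤ 27 * C.card ∧ Disjoint C (part c j)
    · have e1 := hfew _ (hD j C (univ.filter (fun S => (part c j ∩ S).card < P ∧ 3 * (C ∩ S).card ≤ C.card)) hC.1 hC.2
        (fun S hS => (mem_filter.1 hS).2.1) (Or.inl (fun S hS => (mem_filter.1 hS).2.2)))
      have e2 := hfew _ (hD j C (univ.filter (fun S => (part c j ∩ S).card < P ∧ 3 * (C \ S).card ≤ C.card)) hC.1 hC.2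
        (fun S hS => (mem_filter.1 hS).2.1) (Or.inr (fun S hS => (mem_filter.1 hS).2.2)))
      refine le_trans (Nat.cast_le.2 (card_le_card (t := univ.filter (fun v => (∀ x, q x ≠ v) ∧ trc H q v ∈
        univ.filter (fun S => (part c j ∩ S).card < P ∧ 3 * (C ∩ S).card ≤ C.card)) ∪ univ.filter (fun v => (∀ x, q x ≠ v) ∧ trc H q v ∈
        univ.filter (fun S => (part c j ∩ S).card < P ∧ 3 * (C \ S).card ≤ C.card))) fun v hv => ?_)) ?_
      swap
      · refine (Nat.cast_le.2 (card_union_le _ _)).trans ?_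
        push_cast; linarith
      · simp only [F, bad, mem_filter, mem_univ, true_and, mem_singleton, exists_eq_left] at hv
        rcases hv.2.2 with h | h
        · exact mem_union_left _ (mem_filter.2 ⟨mem_univ v, hv.1.1, mem_filter.2 ⟨mem_univ _, hv.1.2, h⟩⟩)
        · exact mem_union_right _ (mem_filter.2 ⟨mem_univ v, hv.1.1, mem_filter.2 ⟨mem_univ _, hv.1.2, h⟩⟩)
    · have : F C = ∅ := by
        simp only [F, bad, mem_singleton, exists_eq_left, hC, false_and, and_false, Finset.filter_false]
      rw [this]; simpa using hy
  have hsub : bad H q c P w j 𝒞 ⊆ 𝒞.biUnion F := by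
    intro v hv
    simp only [bad, mem_filter, mem_univ, true_and] at hv
    obtain ⟨h1, C, hC, h2⟩ := hv
    exact mem_biUnion.2 ⟨C, hC, mem_filter.2 ⟨mem_univ _, h1, C, by simp, h2⟩⟩
  calc ((bad H q c P w j 𝒞).card : ℝ) ≤ ∑ C ∈ 𝒞, ((F C).card : ℝ) := by
        exact_mod_cast (card_le_card hsub).trans card_biUnion_le
    _ ≤ _ := by rw [← nsmul_eq_mul]; exact sum_le_card_nsmul _ _ _ hF

lemma inj4 {α : Type} {a b d e : α} (h1 : a ≠ b) (h2 : a ≠ d) (h3 : a ≠ e) (h4 : b ≠ d) (h5 : b ≠ e) (h6 : d ≠ e) :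
    Injective ![a, b, d, e] := by
  intro x y hxy
  fin_cases x <;> fin_cases y <;> simp [h1, h2, h3, h4, h5, h6, h1.symm, h2.symm, h3.symm, h4.symm, h5.symm, h6.symm] at hxy ⊢

set_option maxHeartbeats 1000000 in
/-- If few vertices have exceptional traces then the graph has few inner edges. -/
lemma inner_le {s K W P w : ℕ} (hr : 5 ≤ r) {Q : SimpleGraph (Fin s)} {c : Fin s → Fin r} (hg : GenX Q c K)
    {H : SimpleGraph (Fin n)} {q : Fin s → Fin n} {τ : Fin r → Prop} (hc : Core c Q H q τ) (hτ : ∀ i, ¬ τ i)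
    (hW : WW r (K + 20) ≤ W) (hC : ¬ HasC r H) (hcw : ∀ j, (part c j).card = w) (h81 : 81 * W ≤ w) (hP : 8 * P ≤ w)
    {X y : ℝ} (hy : 0 ≤ y)
    (hD : ∀ (j : Fin r) (C : Finset (Fin s)) (A : Finset (Finset (Fin s))), w ≤ 27 * C.card → Disjoint C (part c j) →
      (∀ S ∈ A, (part c j ∩ S).card < P) → ((∀ S ∈ A, 3 * (C ∩ S).card ≤ C.card) ∨ (∀ S ∈ A, 3 * (C \ S).card ≤ C.card)) →
      (A.card : ℝ) ≤ X)
    (hfew : ∀ D : Finset (Finset (Fin s)), (D.card : ℝ) ≤ X →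
      ((univ.filter (fun v => (∀ x, q x ≠ v) ∧ trc H q v ∈ D)).card : ℝ) ≤ y)
    (hRX : (((trs H q).filter (fun A => ∀ j, P ≤ (part c j ∩ A).card)).card : ℝ) ≤ X) (hr0 : 0 < r) :
    (inner H (opt hr0 H) : ℝ) ≤ (2 * (s + (1 + 2 * r ^ 2) * y) + r * (48 * r * y + 6)) * n := by
  let 𝒞 : Fin r → Finset (Finset (Fin s)) := fun j => (univ.filter (fun i => i ≠ j)).image (part c)
  have h𝒞 : ∀ j, (𝒞 j).card ≤ r := fun j => card_image_le.trans ((Finset.card_filter_le _ _).trans (by simp))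
  let tr := trc H q
  let E : Fin r → Fin n → Fin n → Prop := fun j x y => H.Adj x y ∧ Lo H q c P j x ∧ Lo H q c P j y ∧
    x ∉ bad H q c P w j (𝒞 j) ∧ y ∉ bad H q c P w j (𝒞 j)
  obtain ⟨β, hβ⟩ : ∃ β, β = ⌊16 * r * y⌋₊ := ⟨_, rfl⟩
  have hbad : ∀ j 𝒟, 𝒟.card ≤ 8 * r → (bad H q c P w j 𝒟).card ≤ β := by
    intro j 𝒟 h𝒟
    rw [hβ]
    refine Nat.le_floor ((bad_le hy hD hfew j 𝒟).trans ?_)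
    have : (𝒟.card : ℝ) ≤ 8 * r := by exact_mod_cast h𝒟
    nlinarith
  have hE : ∀ j, (univ.filter (fun p : Fin n × Fin n => E j p.1 p.2)).card ≤ (3 * β + 6) * n := by
    intro j
    by_contra! hlt
    have hc1 : ∀ b, (ref (𝒞 j) (tr b)).card ≤ 2 * r := fun b => (ref_card _ _).trans (by have := h𝒞 j; omega)
    have hc2 : ∀ b d, (ref (ref (𝒞 j) (tr b)) (tr d)).card ≤ 4 * r := fun b d => (ref_card _ _).trans (by have := hc1 b; omega)
    have hc3 : ∀ b d a, (ref (ref (ref (𝒞 j) (tr b)) (tr d)) (tr a)).card ≤ 8 * r := fun b d a => (ref_card _ _).trans (by have := hc2 b d; omega)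
    obtain ⟨a, b, d, e, n1, n2, n3, E1, E2, E3, hd, ha, he⟩ := find_path (E j) (fun x y h => ⟨h.1.symm, h.2.2.1, h.2.1, h.2.2.2.2, h.2.2.2.1⟩)
      (fun b => bad H q c P w j (ref (𝒞 j) (tr b))) (fun b d => bad H q c P w j (ref (ref (𝒞 j) (tr b)) (tr d)))
      (fun b d a => bad H q c P w j (ref (ref (ref (𝒞 j) (tr b)) (tr d)) (tr a)))
      (fun b => hbad _ _ (by have := hc1 b; omega)) (fun b d => hbad _ _ (by have := hc2 b d; omega)) (fun b d a => hbad _ _ (hc3 b d a)) (lt_of_lt_of_eq hlt (by congr))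
    have step : ∀ (m : ℕ) (𝒟 : Finset (Finset (Fin s))) v, m ≤ 27 → Lo H q c P j v → v ∉ bad H q c P w j 𝒟 →
        (∀ C ∈ 𝒟, w ≤ m * C.card ∧ Disjoint C (part c j)) → ∀ C ∈ ref 𝒟 (tr v), w ≤ (3 * m) * C.card ∧ Disjoint C (part c j) := by
      intro m 𝒟 v hm hL hv h𝒟 C hC
      have hgood : ∀ C ∈ 𝒟, C.card < 3 * (C ∩ tr v).card ∧ C.card < 3 * (C \ tr v).card := by
        intro C hC
        by_contra hno
        refine hv (mem_filter.2 ⟨mem_univ _, hL, C, hC, ⟨(h𝒟 C hC).1.trans (Nat.mul_le_mul_right _ hm), (h𝒟 C hC).2⟩, ?_⟩)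
        rcases not_and_or.1 hno with h | h
        · exact Or.inl (not_lt.1 h)
        · exact Or.inr (not_lt.1 h)
      rcases mem_union.1 hC with h | h <;> obtain ⟨C', hC', rfl⟩ := mem_image.1 h
      · exact ⟨by nlinarith [(h𝒟 C' hC').1, (hgood C' hC').1], (h𝒟 C' hC').2.mono_left Finset.inter_subset_left⟩
      · exact ⟨by nlinarith [(h𝒟 C' hC').1, (hgood C' hC').2], (h𝒟 C' hC').2.mono_left Finset.sdiff_subset⟩
    have b0 : ∀ C ∈ 𝒞 j, w ≤ 1 * C.card ∧ Disjoint C (part c j) := by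
      intro C hC
      obtain ⟨i, hi, rfl⟩ := mem_image.1 hC
      refine ⟨by rw [hcw, one_mul], Finset.disjoint_left.2 fun x h1 h2 => ?_⟩
      simp only [part, mem_filter, mem_univ, true_and] at h1 h2 hi
      exact hi (h1.symm.trans h2)
    have b1 := step _ _ b (by norm_num) E1.2.2.1 E1.2.2.2.2 b0
    have b2 := step _ _ d (by norm_num) E2.2.2.1 hd b1
    have b3 := step _ _ a (by norm_num) E1.2.1 ha b2
    have b4 := step _ _ e (by norm_num) E3.2.2.1 he b3
    have hLo : ∀ k, Lo H q c P j (![a, b, d, e] k) := by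
      intro k; fin_cases k
      exacts [E1.2.1, E1.2.2.1, E2.2.2.1, E3.2.2.1]
    refine hC (four hr hg hc hτ hW ![a, b, d, e] ?_ (fun k x => (hLo k).1 x) j ?_ E1.1 E2.1 E3.1)
    · exact inj4 E1.1.ne n1 n2 E2.1.ne n3 E3.1.ne
    · intro i t ht
      by_cases hij : i = j
      · subst hij
        have hsub : part c i ⊆ (univ.filter (fun u => c u = i ∧ ∀ k : Fin 4, (H.Adj (q u) (![a, b, d, e] k) ↔ t k))) ∪
            univ.biUnion (fun k : Fin 4 => part c i ∩ trc H q (![a, b, d, e] k)) := by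
          intro u hu
          by_cases hk : ∃ k, u ∈ trc H q (![a, b, d, e] k)
          · obtain ⟨k, hk⟩ := hk
            exact mem_union_right _ (mem_biUnion.2 ⟨k, mem_univ _, mem_inter.2 ⟨hu, hk⟩⟩)
          · push Not at hk
            refine mem_union_left _ (mem_filter.2 ⟨mem_univ _, by simpa [part] using hu, fun k => ?_⟩)
            exact iff_of_false (fun h => hk k (mem_trc.2 h.symm)) (ht rfl k)
        have h1 := (card_le_card hsub).trans (card_union_le _ _)
        have h2 : (univ.biUnion (fun k : Fin 4 => part c i ∩ trc H q (![a, b, d, e] k))).card ≤ 4 * P :=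
          card_biUnion_le.trans ((sum_le_card_nsmul _ _ P (fun k _ => (hLo k).2.le)).trans (by simp))
        rw [hcw] at h1
        omega
      · have hm := (b4 _ (ref_mem (ref_mem (ref_mem (ref_mem (show part c i ∈ 𝒞 j from mem_image.2 ⟨i, by simpa using hij, rfl⟩) (t 1)) (t 2)) (t 0)) (t 3))).1
        have hle : 81 * W ≤ 81 * _ := h81.trans hm
        refine (Nat.le_of_mul_le_mul_left hle (by norm_num)).trans (card_le_card ?_)
        intro u hu
        simp only [tr, mem_filter, mem_trc, part, mem_univ, true_and] at hu ⊢
        obtain ⟨⟨⟨⟨h0, h1⟩, h2⟩, h3⟩, h4⟩ := hu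
        refine ⟨h0, fun k => ?_⟩
        rw [H.adj_comm]
        fin_cases k
        exacts [h3, h1, h2, h4]
  obtain ⟨R, hR⟩ : ∃ R, R = (trs H q).filter (fun A => ∀ j, P ≤ (part c j ∩ A).card) := ⟨_, rfl⟩
  rw [← hR] at hRX
  let c' : Fin n → Fin r := fun v => if h : ∃ j, (part c j ∩ tr v).card < P then h.choose else ⟨0, hr0⟩
  obtain ⟨B0, hB0⟩ : ∃ B0, B0 = univ.image q ∪ ((univ.filter (fun v => (∀ x, q x ≠ v) ∧ trc H q v ∈ R)) ∪
    univ.biUnion (fun j => bad H q c P w j (𝒞 j))) := ⟨_, rfl⟩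
  have hB0c : (B0.card : ℝ) ≤ s + (1 + 2 * r ^ 2) * y := by
    have h1 : (B0.card : ℝ) ≤ (univ.image q).card + ((univ.filter (fun v => (∀ x, q x ≠ v) ∧ trc H q v ∈ R)).card +
        ∑ j, ((bad H q c P w j (𝒞 j)).card : ℝ)) := by
      rw [hB0]
      exact_mod_cast (card_union_le _ _).trans (Nat.add_le_add_left ((card_union_le _ _).trans (Nat.add_le_add_left card_biUnion_le _)) _)
    have h2 : ((univ.image q).card : ℝ) ≤ s := by exact_mod_cast card_image_le.trans (by simp)
    have h3 := hfew R hRX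
    have h4 : ∑ j, ((bad H q c P w j (𝒞 j)).card : ℝ) ≤ r * (r * (2 * y)) := by
      refine (sum_le_card_nsmul _ _ (r * (2 * y)) (fun j _ => (bad_le hy hD hfew j (𝒞 j)).trans ?_)).trans (by simp)
      have : ((𝒞 j).card : ℝ) ≤ r := by exact_mod_cast h𝒞 j
      gcongr
    nlinarith
  have hout : ∀ v, v ∉ B0 → Lo H q c P (c' v) v ∧ ∀ j, v ∉ bad H q c P w j (𝒞 j) := by
    intro v hv
    rw [hB0] at hv
    simp only [mem_union, mem_image, mem_univ, true_and, not_or, mem_filter, mem_biUnion, not_exists] at hv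
    obtain ⟨v1, v2, v3⟩ := hv
    refine ⟨⟨v1, ?_⟩, v3⟩
    have hex : ∃ j, (part c j ∩ tr v).card < P := by
      by_contra! hno
      exact v2 ⟨v1, by rw [hR]; exact mem_filter.2 ⟨mem_trs.2 ⟨v, v1, rfl⟩, hno⟩⟩
    simp only [c', dif_pos hex]
    exact hex.choose_spec
  have hin : inner H c' ≤ B0.card * n + B0.card * n + r * ((3 * β + 6) * n) := by
    have e1 : inner H c' = (univ.sigma (fun v => nbs H c' v (c' v))).card := by rw [card_sigma]; rfl
    have hsub : ((univ.sigma (fun v => nbs H c' v (c' v))).image (fun p => (p.1, p.2))) ⊆ (B0 ×ˢ univ ∪ univ ×ˢ B0) ∪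
        univ.biUnion (fun j => univ.filter (fun p : Fin n × Fin n => E j p.1 p.2)) := by
      intro p hp
      obtain ⟨⟨x, z⟩, hp', rfl⟩ := mem_image.1 hp
      simp only [Finset.mem_sigma, mem_univ, true_and, nbs, mem_filter] at hp'
      by_cases hx : x ∈ B0
      · exact mem_union_left _ (mem_union_left _ (by simp [hx]))
      by_cases hz : z ∈ B0
      · exact mem_union_left _ (mem_union_right _ (by simp [hz]))
      refine mem_union_right _ (mem_biUnion.2 ⟨c' x, mem_univ _, mem_filter.2 ⟨mem_univ _, hp'.2, (hout x hx).1, ?_, (hout x hx).2 _, (hout z hz).2 _⟩⟩)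
      have := (hout z hz).1
      rwa [hp'.1] at this
    have h1 := card_le_card hsub
    rw [Finset.card_image_of_injective _ (by rintro ⟨a, b⟩ ⟨c, d⟩ h; simpa using h), ← e1] at h1
    refine h1.trans ((card_union_le _ _).trans (Nat.add_le_add ((card_union_le _ _).trans (by simp [mul_comm])) ?_))
    exact card_biUnion_le.trans ((sum_le_card_nsmul _ _ _ (fun j _ => hE j)).trans (by simp))
  have hopt : (inner H (opt hr0 H) : ℝ) ≤ B0.card * n + B0.card * n + r * ((3 * β + 6) * n) := by
    exact_mod_cast (opt_isOpt hr0 H c').trans hin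
  have hβr : (β : ℝ) ≤ 16 * r * y := by rw [hβ]; exact Nat.floor_le (by positivity)
  refine hopt.trans ?_
  have : (B0.card * n + B0.card * n + r * ((3 * β + 6) * n) : ℝ) = (2 * B0.card + r * (3 * β + 6)) * n := by ring
  rw [this]
  have hr1 : (0:ℝ) ≤ r := by positivity
  refine mul_le_mul_of_nonneg_right (add_le_add (by linarith) (mul_le_mul_of_nonneg_left (by linarith) hr1)) (by positivity)

lemma WW_le {m M K W0 w : ℕ} (hm : 2 ≤ m) (h81 : 4 ≤ m) (hM : 3 * m ≤ M) (hW : M * K + 20 ≤ W0) (hw : 5 ^ M * W0 ≤ w) :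
    81 * (5 ^ m * (m * (K + 20) + 20) + m) ≤ w := by
  have e1 : 81 ≤ 5 ^ m := le_trans (by norm_num) (Nat.pow_le_pow_right (by norm_num) h81)
  have e2 : 2 * m ≤ 5 ^ m := by
    obtain ⟨k, rfl⟩ : ∃ k, m = k + 1 := ⟨m - 1, by omega⟩
    have := Nat.lt_pow_self (n := k) (by norm_num : 1 < 5)
    rw [pow_succ]; omega
  have e3 : 5 ^ m * (5 ^ m * 5 ^ m) ≤ 5 ^ M := by
    rw [← pow_add, ← pow_add]; exact Nat.pow_le_pow_right (by norm_num) (by omega)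
  have e4 : m * K + 20 ≤ W0 := le_trans (by gcongr; omega) hW
  have e5 : m * (K + 20) + 20 + m ≤ 2 * m * (m * K + 20) := by nlinarith [Nat.zero_le (m * K)]
  have e6 : 1 ≤ 5 ^ m := by omega
  calc 81 * (5 ^ m * (m * (K + 20) + 20) + m) ≤ 81 * (5 ^ m * (m * (K + 20) + 20 + m)) := by nlinarith
    _ ≤ 5 ^ m * (5 ^ m * (5 ^ m * W0)) := Nat.mul_le_mul e1 (Nat.mul_le_mul_left _ (e5.trans (Nat.mul_le_mul e2 e4)))
    _ = 5 ^ m * (5 ^ m * 5 ^ m) * W0 := by ring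
    _ ≤ w := (Nat.mul_le_mul_right _ e3).trans hw

/-- Graphs with many inner edges are negligible. -/
lemma far_small (hr : 5 ≤ r) (hr0 : 0 < r) {η : ℝ} (hη : 0 < η) :
    Small r (fun n => {H | ¬ HasC r H ∧ η * n ^ 2 < inner H (opt hr0 H)}) := by
  have hrp : (0:ℝ) < r := by exact_mod_cast hr0
  have hr1 : (1:ℝ) ≤ r := by exact_mod_cast hr0
  have hU : ∀ s (c0 : Fin s → Fin r) (Q : SimpleGraph (Fin s)), Small r (fun n => {H | ¬ HasC r H ∧ ∀ q τ, ¬ Core c0 Q H q τ}) := by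
    obtain ⟨k, rfl⟩ : ∃ k, r = k + 1 := ⟨r - 1, by omega⟩
    exact U_all (by omega) k le_rfl
  obtain ⟨η', hη'⟩ : ∃ η' : ℝ, η' = η / (400 * r ^ 2) := ⟨_, rfl⟩
  have hη0 : 0 < η' := by rw [hη']; positivity
  obtain ⟨ε, hε⟩ : ∃ ε : ℝ, ε = η' / 8640 := ⟨_, rfl⟩
  have hε0 : 0 < ε := by rw [hε]; positivity
  obtain ⟨ζ0, hζ0, -, hp0⟩ := pajor hε0
  obtain ⟨ζ1, hζ1, -, hp1⟩ := pajor (ε := 1 / 16) (by norm_num)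
  obtain ⟨ζ2, hζ2, -, hf2⟩ := few_count (ε := 1 / (8 * r)) (by positivity)
  obtain ⟨ζ3, hζ3, -, hf3⟩ := few_count (ε := 1 / 1080) (by norm_num)
  obtain ⟨ζ, hζ, l0, l1, l2, l3, l4⟩ : ∃ ζ : ℝ, 0 < ζ ∧ ζ ≤ ζ0 ∧ ζ ≤ ζ1 ∧ ζ ≤ ζ2 ∧ ζ ≤ ζ3 ∧ ζ ≤ 1 / 8 :=
    ⟨min ζ0 (min ζ1 (min ζ2 (min ζ3 (1 / 8)))), by positivity, by simp, by simp, by simp, by simp, by simp⟩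
  obtain ⟨M, hM⟩ : ∃ M, M = 2 * ((2 * r + 2) * (2 ^ ((2 * r + 2) + (2 * r + 2))) ^ (2 * r + 2)) + 2 ^ ((2 * r + 2) + (2 * r + 2)) := ⟨_, rfl⟩
  have hM3 : 3 * (2 * r + 2) ≤ M := by
    have h1 : 1 ≤ (2 ^ ((2 * r + 2) + (2 * r + 2))) ^ (2 * r + 2) := Nat.one_le_pow _ _ (by positivity)
    have h2 := Nat.lt_pow_self (n := (2 * r + 2) + (2 * r + 2)) (by norm_num : 1 < 2)
    nlinarith
  obtain ⟨κ, hκ, hkap⟩ := kap M hζ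
  obtain ⟨w, ⟨Q, c, hcw, hg⟩, ⟨W0, hW1, hW2, hW3⟩, hk1, hk2, hw1, hw2⟩ := ((patt r hκ).and (hkap.and
      ((ev_const_le hε0 (r : ℝ)).and ((ev_const_le (γ := 1 / 4) (by norm_num) ((r : ℝ) * r)).and
      ((ev_lin_ge (γ := η' / 2160) (by positivity) 1).and (eventually_ge_atTop 1)))))).exists
  obtain ⟨K, hK⟩ : ∃ K, K = ⌈κ * (w:ℝ)⌉₊ := ⟨_, rfl⟩
  rw [← hK] at hg hW1 hW2
  have hw0 : (0:ℝ) ≤ w := by positivity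
  have hmul : ∀ {x : ℝ}, ζ ≤ x → ζ * w ≤ x * w := fun h => mul_le_mul_of_nonneg_right h hw0
  have hWw : 5 ^ M * W0 ≤ w := by
    have : ((5 ^ M * W0 : ℕ) : ℝ) ≤ w := hW3.trans ((hmul l4).trans (by linarith))
    exact_mod_cast this
  obtain ⟨P, hP⟩ : ∃ P, P = ⌊ζ * w⌋₊ := ⟨_, rfl⟩
  have hP1 : 5 ^ M * W0 ≤ P := by rw [hP]; exact Nat.le_floor hW3
  have hP2 : (P : ℝ) ≤ ζ * w := by rw [hP]; exact Nat.floor_le (by positivity)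
  have hP8 : 8 * P ≤ w := by
    have : (8 * P : ℝ) ≤ w := by linarith [hmul l4]
    exact_mod_cast this
  obtain ⟨b, hb⟩ : ∃ b : ℝ, b = (r - 1) * w - 1 / 1080 * w := ⟨_, rfl⟩
  refine ((hU _ c Q).union (B := fun n => {H | ¬ HasC r H ∧ ∃ q : Fin (r * w) → Fin n, Injective q ∧ ∃ T D : Finset (Finset (Fin (r * w))),
      (T.card : ℝ) ≤ 2 ^ ((r - 1) * w + 2 * ε * w : ℝ) ∧ (D.card : ℝ) ≤ 2 ^ b ∧ (∀ v, (∀ x, q x ≠ v) → trc H q v ∈ T) ∧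
      η' * n ≤ (univ.filter (fun v => (∀ x, q x ≠ v) ∧ trc H q v ∈ D)).card}) ?_).mono ?_
  · refine trace_gain (by omega) (r * w) (Nat.mul_pos hr0 hw2) ((r - 1) * w + 2 * ε * w) b η' ?_ ?_ ?_ _ (by filter_upwards with n H hH; exact hH)
    · have : (0:ℝ) ≤ (r - 1) * w := mul_nonneg (by linarith) hw0
      positivity
    · rw [hb]; nlinarith
    · rw [hb]
      unfold al
      have e1 : ((r * w : ℕ) : ℝ) * (1 - 1 / r) = (r - 1) * w := by push_cast; field_simp
      rw [e1, hε]
      nlinarith [mul_nonneg (mul_nonneg hη0.le hη0.le) hw0]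
  · filter_upwards [ev_lin_ge (γ := η / 2) (by positivity) (2 * (r * w : ℕ) + 6 * r), eventually_ge_atTop 1] with n hn hn1
    rintro H ⟨hC, hin⟩
    by_contra hcon
    simp only [Set.mem_union, mem_ofPred_eq, not_or, not_and] at hcon
    obtain ⟨h1, h2⟩ := hcon
    have h1 := h1 hC
    have h2 := h2 hC
    push Not at h1
    obtain ⟨q, τ, hc⟩ := h1
    have hτ := core_indep hr hg hc (M := 2 * r + 2) rfl (W0 := W0) (le_trans (by gcongr; omega) hW1) hW2 ⟨0, Nat.mul_pos hr0 hw2⟩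
      (fun i => by rw [hcw]; exact le_trans (Nat.mul_le_mul_right _ (Nat.pow_le_pow_right (by norm_num) (by omega))) hWw) hC
    have hT := trs_le hr hg hc hτ hM hW1 hW2 hC (hW3.trans (hmul l0)) (pajor_parts hcw hp0 hk1)
    have hR := R_le hr hg hc hτ hM hW1 hW2 hC rfl hcw hp1 hf2 (hW3.trans (hmul l1)) hP1 (hP2.trans (hmul l2)) hk2
    have hfew : ∀ D : Finset (Finset (Fin (r * w))), (D.card : ℝ) ≤ 2 ^ b →
        ((univ.filter (fun v => (∀ x, q x ≠ v) ∧ trc H q v ∈ D)).card : ℝ) ≤ η' * n := by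
      intro D hD
      by_contra! hlt
      exact h2 ⟨q, hc.1, trs H q, D, hT, hD, fun v hv => mem_trs.2 ⟨v, hv, rfl⟩, hlt.le⟩
    have hres := inner_le hr hg hc hτ (W := WW r (K + 20)) le_rfl hC hcw (WW_le (by omega) (by omega) hM3 hW1 hWw) hP8 (X := 2 ^ b) (y := η' * n) (by positivity) ?_ hfew
      (hR.trans (rpow_le_rpow_of_exponent_le (by norm_num) (by rw [hb]; linarith))) hr0
    · refine absurd (hin.trans_le hres) (not_lt.2 ?_)
      have e1 : (2 * ((r * w : ℕ) + (1 + 2 * r ^ 2) * (η' * n)) + r * (48 * r * (η' * n) + 6) : ℝ) ≤ η * n := by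
        have e2 : η * n = 400 * r ^ 2 * (η' * n) := by rw [hη']; field_simp
        have e3 : 0 ≤ η' * n := by positivity
        nlinarith [mul_nonneg (sub_nonneg.2 (one_le_pow₀ hr1 (n := 2))) e3]
      calc _ ≤ η * n * n := mul_le_mul_of_nonneg_right e1 (by positivity)
        _ = _ := by ring
    · intro j C A hC1 hC2 hA hor
      have h := hf3 _ (part c j) C A (fun x hx => Finset.disjoint_left.1 hC2 hx) (fun S hS => ?_) hor
      · refine h.trans (rpow_le_rpow_of_exponent_le (by norm_num) ?_)
        have : (w:ℝ) ≤ 27 * C.card := by exact_mod_cast hC1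
        rw [hcw, hb]; push_cast; linarith
      · rw [hcw]
        exact (Nat.cast_le.2 (hA S hS).le).trans (hP2.trans (hmul l3))

/-! ### Nearly partite graphs are generic and balanced -/

lemma gen_of {ν η : ℝ} (hν : 0 < ν) (hη : 16 * η ≤ 3 * ν ^ 2) {H : SimpleGraph (Fin n)} {c : Fin n → Fin r}
    (hin : (inner H c : ℝ) ≤ η * n ^ 2) (hn : 0 < n) (hg : GenX H c ⌈ν * n / 2⌉₊) : Gen H c ⌈ν * n⌉₊ := by
  have hνn : 0 < ν * n := by positivity
  have hle : ⌈ν * n / 2⌉₊ ≤ ⌈ν * n⌉₊ := Nat.ceil_mono (by linarith)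
  intro j B hB hK
  obtain ⟨g1, g2⟩ := hg j B hB (hle.trans hK)
  refine ⟨((card_le_card ?_).trans_lt g1).trans_le hle, ?_⟩
  · intro v hv
    simp only [mem_filter, mem_univ, true_and] at hv ⊢
    exact ⟨hv.1, by omega⟩
  obtain ⟨S, hS⟩ : ∃ S, S = univ.filter (fun v => c v = j ∧ 4 * (B.filter (fun b => ¬ H.Adj v b)).card < B.card) := ⟨_, rfl⟩
  have h1 : S.card * (3 * B.card) ≤ 4 * inner H c := by
    rw [inner, mul_sum, ← smul_eq_mul]
    refine (card_nsmul_le_sum S (fun v => 4 * (nbs H c v (c v)).card) _ fun v hv => ?_).trans (Finset.sum_le_sum_of_subset (Finset.subset_univ _))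
    simp only [hS, mem_filter, mem_univ, true_and] at hv
    have e1 := Finset.card_filter_add_card_filter_not (s := B) (fun b => H.Adj v b)
    have e2 : (B.filter (fun b => H.Adj v b)).card ≤ (nbs H c v (c v)).card := by
      refine card_le_card fun b hb => ?_
      simp only [nbs, mem_filter, mem_univ, true_and] at hb ⊢
      exact ⟨(hB b hb.1).trans hv.1.symm, hb.2⟩
    have := hv.2
    omega
  have h2 : (S.card : ℝ) ≤ ν * n / 4 := by
    have e1 : (S.card * (3 * B.card) : ℝ) ≤ 4 * inner H c := by exact_mod_cast h1
    have e2 : ν * n ≤ B.card := (Nat.le_ceil _).trans (by exact_mod_cast hK)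
    have e3 : (S.card : ℝ) * (3 * (ν * n)) ≤ S.card * (3 * B.card) := by gcongr
    have e4 : 16 * η * n ^ 2 ≤ 3 * ν ^ 2 * n ^ 2 := by gcongr
    refine le_of_mul_le_mul_right ?_ hνn
    nlinarith
  have h3 : (univ.filter (fun v => 4 * (B.filter (fun b => ¬ H.Adj v b)).card < B.card)).card ≤
      (univ.filter (fun v => c v ≠ j ∧ 3 * (B.filter (fun b => ¬ H.Adj v b)).card < B.card)).card + S.card := by
    refine (card_le_card ?_).trans (card_union_le _ _)
    intro v hv
    simp only [hS, mem_union, mem_filter, mem_univ, true_and] at hv ⊢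
    by_cases h : c v = j
    · exact Or.inr ⟨h, hv⟩
    · exact Or.inl ⟨h, by omega⟩
  refine lt_of_le_of_lt h3 (Nat.lt_ceil.2 ?_)
  have h4 := Nat.lt_ceil.1 g2
  push_cast
  linarith

lemma cross_unbal (hr : 0 < r) (c : Fin n → Fin r) {ν : ℝ} (hν : 0 ≤ ν) {j : Fin r} (hj : ν * n < |((part c j).card : ℝ) - n / r|) :
    ((prs (fun x y => c x ≠ c y)).card : ℝ) ≤ al r * n ^ 2 / 2 - ν ^ 2 * n ^ 2 / 2 := by
  have hr' : (0:ℝ) < r := by exact_mod_cast hr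
  have h1 : ∑ i, (((part c i).card : ℝ) - n / r) ^ 2 = ∑ i, ((part c i).card : ℝ) ^ 2 - n ^ 2 / r := by
    have hs : ∑ i, ((part c i).card : ℝ) = n := by exact_mod_cast part_sum c
    have : ∀ i, (((part c i).card : ℝ) - n / r) ^ 2 = ((part c i).card : ℝ) ^ 2 - 2 * (n / r) * (part c i).card + (n / r) ^ 2 := fun i => by ring
    simp only [this, sum_add_distrib, Finset.sum_sub_distrib, ← mul_sum, hs, sum_const, card_univ, Fintype.card_fin, nsmul_eq_mul]
    field_simp; ring
  have h2 := Finset.single_le_sum (f := fun i => (((part c i).card : ℝ) - n / r) ^ 2) (fun i _ => sq_nonneg _) (mem_univ j)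
  have h3 : (ν * n) ^ 2 ≤ (((part c j).card : ℝ) - n / r) ^ 2 := by
    rw [← sq_abs (_ - _)]; gcongr
  have h4 := cross_eq c
  have e : al r * n ^ 2 / 2 = (n ^ 2 - n ^ 2 / r) / 2 := by unfold al; ring
  rw [e]; nlinarith

lemma a1_count {K : ℕ} (hr : 0 < r) (c : Fin n → Fin r) {t ξ ν : ℝ} (ht : 0 ≤ t) (hν : 0 ≤ ν) (A : Finset (SimpleGraph (Fin n)))
    (hin : ∀ H ∈ A, (inner H c : ℝ) ≤ ξ) (hK : ν * n / 2 ≤ K)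
    (hA : (∀ H ∈ A, ¬ GenX H c K) ∨ ∃ j, ν * n < |((part c j).card : ℝ) - n / r|) :
    (A.card : ℝ) ≤ 2 ^ (t * ξ + (2 * n + 1) + (al r * n ^ 2 / 2 + 2 * 2 ^ (-t) * n ^ 2) - ν ^ 2 * n ^ 2 / 80) := by
  obtain ⟨a, ha⟩ : ∃ a : ℝ, a = 2 ^ (-t) := ⟨_, rfl⟩
  have ha0 : 0 < a := by rw [ha]; positivity
  have hgr : ∀ H : SimpleGraph (Fin n), gr (prs H.Adj) = H := by
    intro H; ext x y
    simp only [gr, prs, mem_filter, mem_univ, true_and]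
    constructor
    · rintro ⟨hne, _, h⟩
      rcases le_total x y with e | e
      · rwa [min_eq_left e, max_eq_right e] at h
      · rw [min_eq_right e, max_eq_left e] at h; exact h.symm
    · intro h
      refine ⟨h.ne, by simp [h.ne'], ?_⟩
      rcases le_total x y with e | e
      · rwa [min_eq_left e, max_eq_right e]
      · rw [min_eq_right e, max_eq_left e]; exact h.symm
  obtain ⟨w, hw⟩ : ∃ w : Fin n × Fin n → ℝ, w = fun p => if p.1 < p.2 then (if c p.1 = c p.2 then a else 1) else 0 := ⟨_, rfl⟩
  have hw0 : ∀ p, 0 ≤ w p := by intro p; rw [hw]; dsimp only; split_ifs <;> positivity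
  obtain ⟨A', hA'⟩ : ∃ A', A' = A.image (fun H => prs H.Adj) := ⟨_, rfl⟩
  have hcard : A'.card = A.card := by
    rw [hA']
    exact Finset.card_image_of_injective _ (Function.LeftInverse.injective (g := gr) hgr)
  have hθ : ∀ f ∈ A', (2:ℝ) ^ (-(t * ξ)) ≤ ∏ p ∈ f, w p := by
    intro f hf
    rw [hA', mem_image] at hf
    obtain ⟨H, hH, rfl⟩ := hf
    have e1 : ∏ p ∈ prs H.Adj, w p = ∏ p ∈ prs H.Adj, (if c p.1 = c p.2 then a else 1) := by
      refine prod_congr rfl fun p hp => ?_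
      simp only [prs, mem_filter, mem_univ, true_and] at hp
      rw [hw]; simp only [hp.1, if_true]
    have e2 : ((prs H.Adj).filter (fun p => c p.1 = c p.2)).card ≤ inner H c := by
      rw [inner, ← card_sigma]
      refine le_trans (card_le_card ?_) (card_image_le (f := fun s : (_ : Fin n) × Fin n => (s.1, s.2)))
      rintro ⟨x, y⟩ hp
      simp only [prs, mem_filter, mem_univ, true_and] at hp
      exact mem_image.2 ⟨⟨x, y⟩, by simp [nbs, hp.2, hp.1.2], rfl⟩
    rw [e1, prod_ite, prod_const, Finset.prod_const_one, mul_one, ha, ← rpow_natCast, ← rpow_mul (by norm_num)]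
    refine rpow_le_rpow_of_exponent_le (by norm_num) ?_
    have e3 := (Nat.cast_le (α := ℝ).2 e2).trans (hin H hH)
    nlinarith
  have hprod : ∏ p, (1 + w p) ≤ 2 ^ ((prs (fun x y => c x ≠ c y)).card + 2 * a * n ^ 2 : ℝ) := by
    have e1 : ∀ p ∈ (univ : Finset (Fin n × Fin n)), 1 + w p ≤ (if p ∈ prs (fun x y => c x ≠ c y) then 2 else 1) * (2:ℝ) ^ (2 * a) := by
      intro p _
      have e2 : 1 + a ≤ (2:ℝ) ^ (2 * a) := by
        rw [Real.rpow_def_of_pos (by norm_num)]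
        refine (add_comm 1 a).le.trans ((Real.add_one_le_exp a).trans (Real.exp_le_exp.2 ?_))
        have := Real.log_two_gt_d9
        nlinarith
      rw [hw]; dsimp only
      simp only [prs, mem_filter, mem_univ, true_and]
      by_cases h1 : p.1 < p.2 <;> by_cases h2 : c p.1 = c p.2 <;> simp [h1, h2] <;> linarith
    refine (Finset.prod_le_prod (fun p _ => by have := hw0 p; linarith) e1).trans ?_
    rw [prod_mul_distrib, prod_ite_mem, univ_inter, prod_const, prod_const, rpow_add (by norm_num), rpow_natCast,
      rpow_mul (by norm_num : (0:ℝ) ≤ 2) (2 * a), ← Nat.cast_pow, rpow_natCast]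
    simp [sq]
  have hP0 : 0 ≤ ∏ p, (1 + w p) := prod_nonneg fun p _ => by have := hw0 p; linarith
  have hcl := cross_le hr c
  have key : (A'.card : ℝ) * 2 ^ (-(t * ξ)) ≤ 2 ^ ((2 * n + 1) + (al r * n ^ 2 / 2 + 2 * a * n ^ 2) - ν ^ 2 * n ^ 2 / 80) := by
    have hnn : 0 ≤ ν ^ 2 * (n:ℝ) ^ 2 := by positivity
    rcases hA with hA | ⟨j, hj⟩
    · refine (gx_count c A' w hw0 _ (by positivity) hθ ?_ (K := K) ?_).trans ?_
      · intro x y hxy hc; rw [hw]; simp [hxy, hc]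
      · intro f hf
        rw [hA', mem_image] at hf
        obtain ⟨H, hH, rfl⟩ := hf
        rw [hgr]; exact hA H hH
      · have e1 : (2:ℝ) ^ n * 2 ^ n * 2 = 2 ^ (2 * n + 1 : ℝ) := by
          rw [rpow_add (by norm_num), two_mul, rpow_add (by norm_num)]; simp
        rw [e1]
        refine (mul_le_mul_of_nonneg_left (mul_le_mul_of_nonneg_right hprod (by positivity)) (by positivity)).trans ?_
        rw [← rpow_add (by norm_num), ← rpow_add (by norm_num)]
        refine rpow_le_rpow_of_exponent_le (by norm_num) ?_
        have e2 : (ν * n / 2) ^ 2 ≤ (K:ℝ) ^ 2 := by gcongr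
        nlinarith
    · refine (chern0 A' w hw0 _ hθ).trans (hprod.trans (rpow_le_rpow_of_exponent_le (by norm_num) ?_))
      have := cross_unbal hr c hν hj
      have : (0:ℝ) ≤ n := by positivity
      linarith
  rw [hcard, ← le_div_iff₀ (by positivity), ← rpow_sub (by norm_num)] at key
  refine key.trans (rpow_le_rpow_of_exponent_le (by norm_num) ?_)
  rw [← ha]; linarith

lemma a1_small (hr : 2 ≤ r) (hr0 : 0 < r) {ν : ℝ} (hν : 0 < ν) : ∃ η : ℝ, 0 < η ∧ 2 * η < ν ^ 2 ∧
    Small r (fun n => {H | (inner H (opt hr0 H) : ℝ) ≤ η * n ^ 2 ∧ ¬ Near hr0 ν η H}) := by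
  obtain ⟨t0, ht0⟩ := ((ev_const_le (γ := 1) one_pos (640 / ν ^ 2)).and (eventually_ge_atTop 1)).exists
  obtain ⟨t, ht⟩ : ∃ t : ℝ, t = t0 := ⟨_, rfl⟩
  rw [one_mul, ← ht] at ht0
  have ht1 : 1 ≤ t := by rw [ht]; exact_mod_cast ht0.2
  have hν2 : 0 < ν ^ 2 := by positivity
  have hsm : (2:ℝ) ^ (-t) ≤ ν ^ 2 / 640 := by
    rw [rpow_neg (by norm_num), inv_le_comm₀ (by positivity) (by positivity), inv_div]; exact ht0.1
  obtain ⟨η, hη⟩ : ∃ η : ℝ, η = ν ^ 2 / (320 * t) := ⟨_, rfl⟩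
  have hη0 : 0 < η := by rw [hη]; positivity
  have htη : t * η = ν ^ 2 / 320 := by rw [hη]; field_simp
  have hη1 : 320 * η ≤ ν ^ 2 := by nlinarith
  refine ⟨η, hη0, by linarith, small_of_direct (fun n => (1 / 2) ^ n) (tendsto_pow_atTop_nhds_zero_of_lt_one (by norm_num) (by norm_num)) (fun n => by positivity) ?_⟩
  filter_upwards [ev_lin_ge (γ := ν ^ 2 / 160) (by positivity) (r + 5), eventually_ge_atTop 1] with n hn hn1
  have hn1' : (1:ℝ) ≤ n := by exact_mod_cast hn1
  have hcov := cover_card_univ (K := Fin n → Fin r) (fun c => {H : SimpleGraph (Fin n) | (inner H c : ℝ) ≤ η * n ^ 2 ∧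
      (¬ GenX H c ⌈ν * n / 2⌉₊ ∨ ∃ j, ν * n < |((part c j).card : ℝ) - n / r|)})
    (A := {H | (inner H (opt hr0 H) : ℝ) ≤ η * n ^ 2 ∧ ¬ Near hr0 ν η H})
    (X := 2 ^ (t * (η * n ^ 2) + (2 * n + 1) + (al r * n ^ 2 / 2 + 2 * 2 ^ (-t) * n ^ 2) - ν ^ 2 * n ^ 2 / 80)) ?_ ?_
  · refine hcov.trans ((?_ : _ ≤ (1 / 2 : ℝ) ^ n * 2 ^ (al r * (n * (n - 1) / 2))).trans (mul_le_mul_of_nonneg_left (TN_lower hr n) (by positivity)))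
    have e1 : (Fintype.card (Fin n → Fin r) : ℝ) ≤ 2 ^ (r * n : ℝ) := by
      rw [rpow_mul (by norm_num), rpow_natCast, rpow_natCast]
      simp only [Fintype.card_fun, Fintype.card_fin, Nat.cast_pow]
      gcongr
      exact_mod_cast Nat.lt_two_pow_self.le
    have e2 : (1 / 2 : ℝ) ^ n = 2 ^ (-(n:ℝ)) := by
      rw [rpow_neg (by norm_num), rpow_natCast]; simp
    rw [e2, ← rpow_add (by norm_num)]
    refine (mul_le_mul_of_nonneg_right e1 (by positivity)).trans ?_
    rw [← rpow_add (by norm_num)]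
    refine rpow_le_rpow_of_exponent_le (by norm_num) ?_
    have e3 : 2 * 2 ^ (-t) * (n:ℝ) ^ 2 ≤ 2 * (ν ^ 2 / 640) * n ^ 2 := by gcongr
    have e4 : t * (η * n ^ 2) = ν ^ 2 / 320 * n ^ 2 := by rw [← htη]; ring
    have e5 : (r + 5) * (n:ℝ) ≤ ν ^ 2 / 160 * n * n := by gcongr
    have e6 : al r * n ≤ n := by nlinarith [al_le r]
    rw [e4]
    nlinarith
  · rintro H ⟨h1, h2⟩
    refine ⟨opt hr0 H, h1, ?_⟩
    by_contra hcon
    push Not at hcon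
    exact h2 ⟨h1, gen_of hν (by linarith) h1 hn1 hcon.1, hcon.2⟩
  · intro c
    rw [Set.ncard_eq_toFinset_card']
    refine a1_count hr0 c (by linarith) hν.le _ (fun H hH => (Set.mem_toFinset.1 hH).1) (Nat.le_ceil _) ?_
    by_cases hc : ∃ j, ν * n < |((part c j).card : ℝ) - n / r|
    · exact Or.inr hc
    · exact Or.inl fun H hH => (Set.mem_toFinset.1 hH).2.resolve_right hc

lemma final (hr : 5 ≤ r) : Small r (fun n => FF r n \ TT r n) := by
  have hr0 : 0 < r := by omega
  obtain ⟨ν, hν, hmain⟩ := near_main hr hr0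
  obtain ⟨η, hη, hην, hs⟩ := a1_small (by omega) hr0 hν
  refine (((far_small hr hr0 hη).union hs).union (hmain ν η hν le_rfl hην)).mono ?_
  filter_upwards with n H hH
  by_cases h1 : η * n ^ 2 < inner H (opt hr0 H)
  · exact Or.inl (Or.inl ⟨hH.1, h1⟩)
  · by_cases h2 : Near hr0 ν η H
    · exact Or.inr ⟨hH.1, h2, hH.2⟩
    · exact Or.inl (Or.inr ⟨not_lt.1 h1, h2⟩)

end
end CF

/-- For `l > 5`, almost every `C_{2l}`-free graph can be partitioned into `l-2` cliques
and a set `T` such that the complement of `G[T]` is a disjoint union of stars and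
triangles. -/
theorem stmt_1 (l : ℕ) (hl : 5 < l) :
    Tendsto
      (fun n : ℕ =>
        (({G : SimpleGraph (Fin n) |
              IndFree (cycleGraph (2 * l)) G ∧
              ∃ f : Fin n → Option (Fin (l - 2)),
                (∀ i : Fin (l - 2), G.IsClique {v | f v = some i}) ∧
                StarsAndTriangles (G.induce {v | f v = none})ᶜ}.ncard : ℝ) /
          ({G : SimpleGraph (Fin n) | IndFree (cycleGraph (2 * l)) G}.ncard : ℝ)))
      atTop (nhds 1) := by
  obtain ⟨m, rfl⟩ : ∃ m, l = m + 2 := ⟨l - 2, by omega⟩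
  exact CF.reduction (CF.small_main (by omega) (CF.final (by omega))) (by omega)
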